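/- (Maximal cross-cut lemma, plane case.) Let f : ℝ² → ℝ² be a homeomorphism and U ⊆ ℝ² an open simply connected f-invariant set such that ℝ²∖U has more than one point, and suppose some extension F of f|_U to c_E(U,ℝ²) has no fixed point in b_E(U,ℝ²) (i.e. ρ(f,U) ≠ 0). Let N ≥ 2 and let γ be an N-translation arc for f whose two endpoints lie in ∂U and which intersects U, and set Γ = ⋃_{k=0}^{N} f^k(γ). Then: (1) every connected component σ of U ∩ Γ is a cross-cut of U satisfying f(σ) ∩ σ = ∅, and exactly one of the two connected components of U∖σ, denoted D_σ, satisfies f(D_σ) ∩ D_σ = ∅; (2) there is exactly one connected component U₀ of U∖Γ with f(U₀) ∩ U₀ ≠ ∅; moreover U₀ is open and simply connected and U∖U₀ = ⋃_σ (σ ∪ D_σ), the union taken over all components σ of U ∩ Γ; (3) the boundary of U₀ in U is a union of members of a subfamily F* of the family of components of U ∩ Γ, and every point of this boundary is an endpoint of an end-cut of U₀; (4) if in addition Γ ⊆ V for some neighborhood V of ∂U such that U∖V is connected and f(U∖V) ∩ (U∖V) ≠ ∅, and no cross-section D of U with f^k(D) ∩ D = ∅ for all k ≠ 0 has all its forward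 iterates f^k(D) (k ≥ 0), or all its backward iterates (k ≤ 0), contained in V, then there is a sub-arc σ ⊆ γ such that f^k(σ) ∈ F* for all 0 ≤ k ≤ N. -/

import Mathlib

open Set Topology Filter

noncomputable section

universe u

variable {X : Type u} [TopologicalSpace X]

/-- A homeomorphism is *orientation preserving* if it is isotopic to the identity. -/
def IsOrientationPreserving (f : X ≃ₜ X) : Prop :=
  ∃ H : unitInterval × X → X,
    Continuous H ∧ (∀ x, H (0, x) = x) ∧ (∀ x, H (1, x) = f x) ∧
      ∀ t : unitInterval, IsHomeomorph fun x => H (t, x)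

/-- `D` is a connected component of `A`. -/
def IsCompOf (A D : Set X) : Prop := ∃ x ∈ A, D = connectedComponentIn A x

/-- `A` has exactly two connected components, the distinct sets `D₁` and `D₂`. -/
def HasTwoComps (A D₁ D₂ : Set X) : Prop :=
  IsCompOf A D₁ ∧ IsCompOf A D₂ ∧ D₁ ≠ D₂ ∧
    ∀ x ∈ A, connectedComponentIn A x = D₁ ∨ connectedComponentIn A x = D₂

/-- A *cross-cut* of the open set `U`: the image of an arc `g` on `(0,1)`, where `g` is
continuous and injective on `[0,1]`'s interior, runs inside `U`, has endpoints on `∂U`, and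
separates `U` into exactly two components, each with a boundary point on `∂U` away from the
closed arc. -/
def IsCrossCut (U γ : Set X) : Prop :=
  ∃ g : ℝ → X,
    ContinuousOn g (Icc 0 1) ∧ InjOn g (Ioo 0 1) ∧ (∀ t ∈ Ioo (0:ℝ) 1, g t ∈ U) ∧
      g 0 ∈ frontier U ∧ g 1 ∈ frontier U ∧ γ = g '' Ioo 0 1 ∧
      ∃ D₁ D₂ : Set X, HasTwoComps (U \ γ) D₁ D₂ ∧
        (frontier D₁ ∩ (frontier U \ g '' Icc 0 1)).Nonempty ∧
        (frontier D₂ ∩ (frontier U \ g '' Icc 0 1)).Nonempty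

/-- A *cross-section* of `U`: a connected component of `U ∖ γ` for a cross-cut `γ`. -/
def IsCrossSection (U D : Set X) : Prop := ∃ γ : Set X, IsCrossCut U γ ∧ IsCompOf (U \ γ) D

/-- The image of a set under the `k`-th integer iterate of a homeomorphism. -/
def iterZ (f : X ≃ₜ X) (k : ℤ) (A : Set X) : Set X := ⇑(f.toEquiv ^ k) '' A

/-- A cross-section of `U` which is wandering for `f^n`. -/
def IsWanderingSection (f : X ≃ₜ X) (U : Set X) (n : ℕ) (D : Set X) : Prop :=
  IsCrossSection U D ∧ ∀ k : ℤ, k ≠ 0 → iterZ f ((n : ℤ) * k) D ∩ D = ∅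

/-- `f` is ∂-nonwandering in `U`. -/
def BdNonwandering (f : X ≃ₜ X) (U : Set X) : Prop :=
  ∀ n : ℕ, 1 ≤ n → ∃ K : Set X, IsCompact K ∧ K ⊆ U ∧
    ∀ D : Set X, IsWanderingSection f U n D →
      (∃ k : ℤ, 0 < k ∧ (iterZ f ((n : ℤ) * k) D ∩ K).Nonempty) ∧
      (∃ k : ℤ, k < 0 ∧ (iterZ f ((n : ℤ) * k) D ∩ K).Nonempty)

/-- The boundary of `D` inside `U` (for `D` open in `U`). -/
def bdIn (U D : Set X) : Set X := (closure D \ D) ∩ U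

/-- A chain of cross-sections of `U`. -/
def IsPEChain (U : Set X) (D : ℕ → Set X) : Prop :=
  (∀ i, IsCrossSection U (D i)) ∧ (∀ i j : ℕ, j ≤ i → D i ⊆ D j) ∧
    ∀ i j : ℕ, i ≠ j → closure (bdIn U (D i)) ∩ closure (bdIn U (D j)) = ∅

/-- The chain `D` divides the cross-section `E`. -/
def ChainDividesSection (D : ℕ → Set X) (E : Set X) : Prop := ∃ N : ℕ, ∀ i, N ≤ i → D i ⊆ E

/-- The chain `D` divides the chain `D'`. -/
def ChainDivides (D D' : ℕ → Set X) : Prop := ∀ n : ℕ, ∃ m : ℕ, D m ⊆ D' n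

/-- A prime chain: a chain dividing every chain that divides it. -/
def IsPrimeChain (U : Set X) (D : ℕ → Set X) : Prop :=
  IsPEChain U D ∧ ∀ D' : ℕ → Set X, IsPEChain U D' → ChainDivides D' D → ChainDivides D D'

/-- The type of prime chains of `U`. -/
def PrimeChain (U : Set X) : Type u := {D : ℕ → Set X // IsPrimeChain U D}

/-- A prime end of `U`: an equivalence class of prime chains. -/
def PrimeEnd (U : Set X) : Type u :=
  Quot fun C C' : PrimeChain U => ChainDivides C.1 C'.1 ∧ ChainDivides C'.1 C.1

/-- The prime end `p` divides the cross-section `E`. -/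
def PrimeEndDivides {U : Set X} (p : PrimeEnd U) (E : Set X) : Prop :=
  ∃ C : PrimeChain U, Quot.mk _ C = p ∧ ChainDividesSection C.1 E

/-- The prime ends compactification of `U` (as a set: `U ⊔ (prime ends)`). -/
def PrimeEndComp (U : Set X) : Type u := ↥U ⊕ PrimeEnd U

/-- A point of `U`, as an element of the prime ends compactification. -/
def pePt (U : Set X) (x : ↥U) : PrimeEndComp U := Sum.inl x

/-- A prime end, as an element of the prime ends compactification. -/
def peEnd (U : Set X) (p : PrimeEnd U) : PrimeEndComp U := Sum.inr p

/-- The copy of a subset `V ⊆ U` inside the prime ends compactification. -/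
def peOpen (U V : Set X) : Set (PrimeEndComp U) := {z | ∃ x : ↥U, z = pePt U x ∧ (x : X) ∈ V}

/-- The basic set `E ∪ i_E(E)` of the prime ends compactification, for a cross-section `E`. -/
def peSection (U E : Set X) : Set (PrimeEndComp U) :=
  peOpen U E ∪ {z | ∃ p : PrimeEnd U, z = peEnd U p ∧ PrimeEndDivides p E}

/-- The topology of the prime ends compactification. -/
instance primeEndCompTopology (U : Set X) : TopologicalSpace (PrimeEndComp U) :=
  TopologicalSpace.generateFrom
    ({s | ∃ V : Set X, IsOpen V ∧ V ⊆ U ∧ s = peOpen U V} ∪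
      {s | ∃ E : Set X, IsCrossSection U E ∧ s = peSection U E})

/-- The circle of prime ends, as a subset of the prime ends compactification. -/
def PrimeEndCircle (U : Set X) : Set (PrimeEndComp U) := Set.range (peEnd U)

/-- `F` is an extension of `f|_U` to the prime ends compactification of `U`. -/
def IsPEExtension (f : X ≃ₜ X) (U : Set X) (F : PrimeEndComp U ≃ₜ PrimeEndComp U) : Prop :=
  ∀ (x : X) (hx : x ∈ U) (hfx : f x ∈ U), F (pePt U ⟨x, hx⟩) = pePt U ⟨f x, hfx⟩

/-- An end-cut of `U`: an injective arc in `U` defined on `[0,1)` converging in the ambient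
space as `t → 1⁻`. -/
def IsEndCut (U : Set X) (γ : ℝ → X) : Prop :=
  ContinuousOn γ (Ico 0 1) ∧ InjOn γ (Ico 0 1) ∧ (∀ t ∈ Ico (0:ℝ) 1, γ t ∈ U) ∧
    ∃ z : X, Tendsto γ (𝓝[<] (1:ℝ)) (𝓝 z)

/-- `z` is an accessible point of `∂U`. -/
def IsAccessiblePoint (U : Set X) (z : X) : Prop :=
  ∃ γ : ℝ → X, IsEndCut U γ ∧ Tendsto γ (𝓝[<] (1:ℝ)) (𝓝 z)

/-- `p` is an accessible prime end of `U`. -/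
def IsAccessiblePrimeEnd (U : Set X) (p : PrimeEnd U) : Prop :=
  ∃ (γ : ℝ → X) (hγ : ∀ t ∈ Ico (0:ℝ) 1, γ t ∈ U), IsEndCut U γ ∧
    Tendsto (fun t : ↥(Ico (0:ℝ) 1) => pePt U ⟨γ ↑t, hγ ↑t t.2⟩)
      (comap Subtype.val (𝓝[<] (1:ℝ))) (𝓝 (peEnd U p))

/-- A translation arc for `f` based at `x`: a simple arc from `x` to `f x` meeting its image
only as allowed. -/
def IsTranslationArc (f : X ≃ₜ X) (γ : Set X) (x : X) : Prop :=
  f x ≠ x ∧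
    ∃ g : ℝ → X, ContinuousOn g (Icc 0 1) ∧ InjOn g (Icc 0 1) ∧
      g 0 = x ∧ g 1 = f x ∧ γ = g '' Icc 0 1 ∧
      ((⇑f '' γ) ∩ γ = {f x} ∨ ((⇑f '' γ) ∩ γ = {x, f x} ∧ f (f x) = x))

/-- An `N`-translation arc for `f` based at `x` (for `N = 1` this is just a translation arc). -/
def IsNTranslationArc (f : X ≃ₜ X) (N : ℕ) (γ : Set X) (x : X) : Prop :=
  IsTranslationArc f γ x ∧
    (2 ≤ N →
      (∀ k : ℕ, 2 ≤ k → k ≤ N - 1 → (⇑f)^[k] '' γ ∩ γ = ∅) ∧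
        ((⇑f)^[N] '' γ ∩ γ = ∅ ∨ ((⇑f)^[N] '' γ ∩ γ = {x} ∧ (⇑f)^[N + 1] x = x)))

/-- An ∞-translation arc: an `N`-translation arc for every `N ≥ 1`. -/
def IsInfTranslationArc (f : X ≃ₜ X) (γ : Set X) (x : X) : Prop :=
  ∀ N : ℕ, 1 ≤ N → IsNTranslationArc f N γ x

/-- A nonwandering homeomorphism. -/
def IsNonwanderingMap (f : X → X) : Prop :=
  ∀ V : Set X, IsOpen V → V.Nonempty → ∃ n : ℕ, 1 ≤ n ∧ (f^[n] '' V ∩ V).Nonempty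

/-- A loop contained in `A` which is not null-homotopic in `V`. -/
def IsEssentialLoopIn (V A : Set X) : Prop :=
  ∃ (z : ↥V) (δ : Path z z), (∀ t : unitInterval, (↑(δ t) : X) ∈ A) ∧
    ¬ δ.Homotopic (Path.refl z)

/-- An annular continuum: a continuum with an open annular neighborhood `V` such that `V ∖ K`
has exactly two components, each essential in `V`. -/
def IsAnnularContinuum (K : Set X) : Prop :=
  IsCompact K ∧ IsConnected K ∧ K.Nontrivial ∧
    ∃ V : Set X, IsOpen V ∧ K ⊆ V ∧
      Nonempty (↥V ≃ₜ AddCircle (1 : ℝ) × ↥(Ioo (0 : ℝ) 1)) ∧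
      ∃ D₁ D₂ : Set X, HasTwoComps (V \ K) D₁ D₂ ∧
        IsEssentialLoopIn V D₁ ∧ IsEssentialLoopIn V D₂

/-- A set contractible in the ambient surface: it has an open neighborhood homeomorphic to the
plane. -/
def ContractibleInSurface (K : Set X) : Prop :=
  ∃ W : Set X, IsOpen W ∧ K ⊆ W ∧ Nonempty (↥W ≃ₜ (ℝ × ℝ))

/-- `α ∈ ℝ/ℤ` is rational. -/
def IsRationalAC (α : AddCircle (1 : ℝ)) : Prop := ∃ r : ℚ, α = ((r : ℝ) : AddCircle (1 : ℝ))

/-- The constant `q(α,g)`: the smallest positive integer `q` with `‖qα‖ = 0` if `α` is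
rational, and `(2g+1)‖qα‖ < ‖α‖` if `α` is irrational. -/
def qConst (α : AddCircle (1 : ℝ)) (g : ℕ) : ℕ :=
  sInf {q : ℕ | 0 < q ∧
    ((IsRationalAC α ∧ ‖q • α‖ = 0) ∨
      (¬IsRationalAC α ∧ ((2 * g + 1 : ℕ) : ℝ) * ‖q • α‖ < ‖α‖))}

/-- `u` has a continuous logarithm on `O`. -/
def HasLog (O : Set ℂ) (u : ℂ → ℂ) : Prop :=
  ∃ L : ℂ → ℂ, ContinuousOn L O ∧ ∀ z ∈ O, Complex.exp (L z) = u z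

theorem HasLog.mono {O O' : Set ℂ} {u : ℂ → ℂ} (h : HasLog O u) (hO : O' ⊆ O) : HasLog O' u := by
  obtain ⟨L, hc, hL⟩ := h
  exact ⟨L, hc.mono hO, fun z hz => hL z (hO hz)⟩

theorem HasLog.congr {O : Set ℂ} {u v : ℂ → ℂ} (h : HasLog O u) (huv : ∀ z ∈ O, u z = v z) :
    HasLog O v := by
  obtain ⟨L, hc, hL⟩ := h
  exact ⟨L, hc, fun z hz => (hL z hz).trans (huv z hz)⟩

theorem HasLog.mul {O : Set ℂ} {u v : ℂ → ℂ} (h : HasLog O u) (h' : HasLog O v) :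
    HasLog O (fun z => u z * v z) := by
  obtain ⟨L, hc, hL⟩ := h
  obtain ⟨L', hc', hL'⟩ := h'
  exact ⟨fun z => L z + L' z, hc.add hc', fun z hz => by rw [Complex.exp_add, hL z hz, hL' z hz]⟩

theorem HasLog.div {O : Set ℂ} {u v : ℂ → ℂ} (h : HasLog O u) (h' : HasLog O v) :
    HasLog O (fun z => u z / v z) := by
  obtain ⟨L, hc, hL⟩ := h
  obtain ⟨L', hc', hL'⟩ := h'
  exact ⟨fun z => L z - L' z, hc.sub hc', fun z hz => by rw [Complex.exp_sub, hL z hz, hL' z hz]⟩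

theorem hasLog_const (O : Set ℂ) {c : ℂ} (hc : c ≠ 0) : HasLog O (fun _ => c) :=
  ⟨fun _ => Complex.log c, continuousOn_const, fun _ _ => Complex.exp_log hc⟩

theorem hasLog_of_isSimplyConnected {U : Set ℂ} (hU : IsSimplyConnected U) (hUo : IsOpen U)
    {u : ℂ → ℂ} (hu : ContinuousOn u U) (h0 : ∀ z ∈ U, u z ≠ 0) : HasLog U u := by
  obtain ⟨L, hc, hL⟩ := Complex.exists_continuousOn_eqOn_exp_comp hU hUo hu
    (by rintro ⟨z, hz, h⟩; exact h0 z hz h)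
  exact ⟨L, hc, fun z hz => hL hz⟩

theorem isSimplyConnected_of_convex {C : Set ℂ} (hC : Convex ℝ C) (hne : C.Nonempty) :
    IsSimplyConnected C := by
  have : ContractibleSpace C := hC.contractibleSpace hne
  exact (inferInstance : SimplyConnectedSpace C)

theorem isSimplyConnected_univ_complex : IsSimplyConnected (univ : Set ℂ) :=
  isSimplyConnected_of_convex convex_univ univ_nonempty

theorem exp_one_const {α : Type*} [TopologicalSpace α] {S : Set α} (hS : IsPreconnected S)
    {h : α → ℂ} (hc : ContinuousOn h S) (he : ∀ z ∈ S, Complex.exp (h z) = 1)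
    {z w : α} (hz : z ∈ S) (hw : w ∈ S) : h z = h w := by
  have hT : DiscreteTopology (range ((↑) : ℤ → ℝ)) :=
    (Int.isClosedEmbedding_coe_real.isEmbedding.toHomeomorph).symm.isEmbedding.discreteTopology
  have h2 : (2 * Real.pi : ℂ) * Complex.I ≠ 0 := Complex.two_pi_I_ne_zero
  have key : ∀ z ∈ S, ∃ n : ℤ, h z = n * (2 * Real.pi * Complex.I) := fun z hz =>
    Complex.exp_eq_one_iff.1 (he z hz)
  have hm : MapsTo (fun z => (h z / (2 * Real.pi * Complex.I)).re) S (range ((↑) : ℤ → ℝ)) := by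
    intro z hz
    obtain ⟨n, hn⟩ := key z hz
    exact ⟨n, by simp only [hn]; rw [mul_div_cancel_right₀ _ h2]; simp⟩
  have := hS.constant_of_mapsTo (T := range ((↑) : ℤ → ℝ)) ⟨hT⟩ (f := fun z => (h z / (2 * Real.pi * Complex.I)).re)
    (Complex.continuous_re.comp_continuousOn (hc.div_const _)) hm hz hw
  obtain ⟨n, hn⟩ := key z hz
  obtain ⟨m, hm⟩ := key w hw
  simp only [hn, hm, mul_div_cancel_right₀ _ h2, Complex.intCast_re] at this ⊢
  have : n = m := by exact_mod_cast this
  rw [this]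

theorem exists_pos_fun {α : Type*} [PseudoMetricSpace α] {O : Set α} (hO : IsOpen O) :
    ∃ d : α → ℝ, Continuous d ∧ (∀ z, 0 ≤ d z) ∧ ∀ z, 0 < d z ↔ z ∈ O := by
  by_cases h : Oᶜ.Nonempty
  · refine ⟨fun z => Metric.infDist z Oᶜ, Metric.continuous_infDist_pt _,
      fun z => Metric.infDist_nonneg, fun z => ?_⟩
    rw [← hO.isClosed_compl.notMem_iff_infDist_pos h]; simp
  · rw [not_nonempty_iff_eq_empty, compl_empty_iff] at h
    exact ⟨fun _ => 1, continuous_const, fun _ => zero_le_one, fun z => by simp [h]⟩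

/-- A cocycle for the cover of `O₁ ∪ O₂` jumping on the clopen part `P` of `O₁ ∩ O₂`. -/
theorem exists_cocycle {O₁ O₂ P Q : Set ℂ} (h1 : IsOpen O₁) (h2 : IsOpen O₂) (hP : IsOpen P)
    (hQ : IsOpen Q) (hd : Disjoint P Q) (hPQ : O₁ ∩ O₂ = P ∪ Q) :
    ∃ u a b : ℂ → ℂ, ContinuousOn u (O₁ ∪ O₂) ∧ (∀ z ∈ O₁ ∪ O₂, u z ≠ 0) ∧
      ContinuousOn a O₁ ∧ ContinuousOn b O₂ ∧ (∀ z ∈ O₁, Complex.exp (a z) = u z) ∧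
      (∀ z ∈ O₂, Complex.exp (b z) = u z) ∧
      (∀ z ∈ P, a z - b z = 2 * Real.pi * Complex.I) ∧ (∀ z ∈ Q, a z - b z = 0) := by
  classical
  obtain ⟨d1, hd1c, hd1n, hd1⟩ := exists_pos_fun h1
  obtain ⟨d2, hd2c, hd2n, hd2⟩ := exists_pos_fun h2
  let ρ : ℂ → ℝ := fun z => d2 z / (d1 z + d2 z)
  have hpos : ∀ z ∈ O₁ ∪ O₂, d1 z + d2 z ≠ 0 := by
    grind
  have hρ : ∀ z ∈ O₁ ∪ O₂, ContinuousAt ρ z := fun z hz =>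
    hd2c.continuousAt.div (hd1c.add hd2c).continuousAt (hpos z hz)
  let T : ℂ := 2 * Real.pi * Complex.I
  let a : ℂ → ℂ := fun z => if z ∈ P then T * (ρ z : ℂ) else 0
  let b : ℂ → ℂ := fun z => if z ∈ P then T * ((ρ z - 1 : ℝ) : ℂ) else 0
  have hgen : ∀ (r : ℂ → ℝ) (z : ℂ), ContinuousAt r z → (z ∈ P ∨ z ∈ Q ∨ r z = 0) →
      ContinuousAt (fun z => if z ∈ P then T * (r z : ℂ) else 0) z := by
    rintro r z hr (hz | hz | hz)
    · have : ContinuousAt (fun z => T * (r z : ℂ)) z :=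
        continuousAt_const.mul (Complex.continuous_ofReal.continuousAt.comp hr)
      refine this.congr ?_
      filter_upwards [hP.mem_nhds hz] with w hw
      simp [hw]
    · have : ContinuousAt (fun _ : ℂ => (0:ℂ)) z := continuousAt_const
      refine this.congr ?_
      filter_upwards [hQ.mem_nhds hz] with w hw
      rw [if_neg (fun h => hd.ne_of_mem h hw rfl)]
    · have h0 : (if z ∈ P then T * (r z : ℂ) else 0) = 0 := by simp [hz]
      rw [ContinuousAt, h0]
      have : Tendsto (fun z => T * (r z : ℂ)) (𝓝 z) (𝓝 0) := by
        have : ContinuousAt (fun z => T * (r z : ℂ)) z :=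
          continuousAt_const.mul (Complex.continuous_ofReal.continuousAt.comp hr)
        simpa [ContinuousAt, hz] using this
      refine squeeze_zero_norm (fun w => ?_) (tendsto_norm_zero.comp this)
      dsimp
      split_ifs
      · exact le_rfl
      · rw [norm_zero]; positivity
  have hsplit : ∀ z ∈ O₁, z ∈ O₂ → z ∈ P ∨ z ∈ Q := fun z hz hz' => by
    have : z ∈ P ∪ Q := hPQ ▸ ⟨hz, hz'⟩
    exact this
  have hac : ∀ z ∈ O₁, ContinuousAt a z := fun z hz => by
    grind
  have hbc : ∀ z ∈ O₂, ContinuousAt b z := fun z hz => by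
    refine hgen (fun z => ρ z - 1) z ((hρ z (Or.inr hz)).sub continuousAt_const) ?_
    grind
  have hPa : ∀ z ∈ P, a z - b z = T := fun z hz => by
    simp only [a, b, hz, if_true]; push_cast; ring
  have hQa : ∀ z ∈ Q, a z - b z = 0 := fun z hz => by
    grind
  have hee : ∀ z, z ∈ O₁ → z ∈ O₂ → Complex.exp (a z) = Complex.exp (b z) := by
    intro z hz hz'
    have : a z = b z + (a z - b z) := by ring
    rw [this, Complex.exp_add]
    rcases hsplit z hz hz' with h | h
    · rw [hPa z h, Complex.exp_two_pi_mul_I, mul_one]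
    · rw [hQa z h, Complex.exp_zero, mul_one]
  let u : ℂ → ℂ := fun z => if z ∈ O₁ then Complex.exp (a z) else Complex.exp (b z)
  have hu1 : ∀ z ∈ O₁, Complex.exp (a z) = u z := fun z hz => by simp [u, hz]
  have hu2 : ∀ z ∈ O₂, Complex.exp (b z) = u z := fun z hz => by
    grind
  refine ⟨u, a, b, ?_, ?_, fun z hz => (hac z hz).continuousWithinAt,
    fun z hz => (hbc z hz).continuousWithinAt, hu1, hu2, hPa, hQa⟩
  · rintro z (hz | hz)
    · refine ((Complex.continuous_exp.continuousAt.comp (hac z hz)).congr ?_).continuousWithinAt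
      filter_upwards [h1.mem_nhds hz] with w hw using hu1 w hw
    · refine ((Complex.continuous_exp.continuousAt.comp (hbc z hz)).congr ?_).continuousWithinAt
      filter_upwards [h2.mem_nhds hz] with w hw using hu2 w hw
  · intro z _
    simp only [u]
    split_ifs <;> exact Complex.exp_ne_zero _

theorem isOpen_ccIn {O : Set ℂ} (hO : IsOpen O) (w : ℂ) : IsOpen (connectedComponentIn O w) :=
  hO.connectedComponentIn

/-- If all functions with logarithms on `O₁` and on `O₂` have logarithms on the union, then points
joined in `O₁` and in `O₂` are joined in `O₁ ∩ O₂`. -/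
theorem joined_inter {O₁ O₂ : Set ℂ} (h1 : IsOpen O₁) (h2 : IsOpen O₂)
    (hlog : ∀ u : ℂ → ℂ, ContinuousOn u (O₁ ∪ O₂) → (∀ z ∈ O₁ ∪ O₂, u z ≠ 0) → HasLog O₁ u →
      HasLog O₂ u → HasLog (O₁ ∪ O₂) u)
    {w z : ℂ} (hw : w ∈ O₁ ∩ O₂)
    (hj1 : z ∈ connectedComponentIn O₁ w) (hj2 : z ∈ connectedComponentIn O₂ w) :
    z ∈ connectedComponentIn (O₁ ∩ O₂) w := by
  by_contra hz
  have ho := h1.inter h2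
  set P := connectedComponentIn (O₁ ∩ O₂) w with hPdef
  have hPo : IsOpen P := isOpen_ccIn ho w
  have hPs : P ⊆ O₁ ∩ O₂ := connectedComponentIn_subset _ _
  have hQo : IsOpen ((O₁ ∩ O₂) \ P) := by
    rw [isOpen_iff_mem_nhds]
    rintro y ⟨hy, hyP⟩
    filter_upwards [(isOpen_ccIn ho y).mem_nhds (mem_connectedComponentIn hy)] with v hv
    refine ⟨connectedComponentIn_subset _ _ hv, fun hvP => hyP ?_⟩
    rw [hPdef, connectedComponentIn_eq hvP, ← connectedComponentIn_eq hv]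
    exact mem_connectedComponentIn hy
  obtain ⟨u, a, b, huc, hu0, hac, hbc, hau, hbu, hP, hQ⟩ :=
    exists_cocycle h1 h2 hPo hQo disjoint_sdiff_right (union_sdiff_cancel hPs).symm
  obtain ⟨L, hLc, hL⟩ := hlog u huc hu0 ⟨a, hac, hau⟩ ⟨b, hbc, hbu⟩
  have e1 : L w - a w = L z - a z :=
    exp_one_const isPreconnected_connectedComponentIn (S := connectedComponentIn O₁ w)
      (h := fun z => L z - a z)
      ((hLc.mono ((connectedComponentIn_subset _ _).trans subset_union_left)).sub
        (hac.mono (connectedComponentIn_subset _ _)))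
      (fun v hv => by
        have hv' := connectedComponentIn_subset _ _ hv
        rw [Complex.exp_sub, hL v (Or.inl hv'), hau v hv', div_self (hu0 v (Or.inl hv'))])
      (mem_connectedComponentIn hw.1) hj1
  have e2 : L w - b w = L z - b z :=
    exp_one_const isPreconnected_connectedComponentIn (S := connectedComponentIn O₂ w)
      (h := fun z => L z - b z)
      ((hLc.mono ((connectedComponentIn_subset _ _).trans subset_union_right)).sub
        (hbc.mono (connectedComponentIn_subset _ _)))
      (fun v hv => by
        have hv' := connectedComponentIn_subset _ _ hv
        rw [Complex.exp_sub, hL v (Or.inr hv'), hbu v hv', div_self (hu0 v (Or.inr hv'))])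
      (mem_connectedComponentIn hw.2) hj2
  have e3 := hP w (mem_connectedComponentIn hw)
  have e4 := hQ z ⟨⟨connectedComponentIn_subset _ _ hj1, connectedComponentIn_subset _ _ hj2⟩, hz⟩
  apply Complex.two_pi_I_ne_zero
  linear_combination e4 - e3 - e1 + e2

theorem continuousOn_comp_log {Λ : ℂ → ℂ} (hc : Continuous Λ)
    (hp : ∀ s, Λ (s + 2 * Real.pi * Complex.I) = Λ s) :
    ContinuousOn (fun w => Λ (Complex.log w)) {0}ᶜ := by
  intro w hw
  have hw0 : w ≠ 0 := hw
  apply ContinuousAt.continuousWithinAt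
  by_cases hs : w ∈ Complex.slitPlane
  · exact hc.continuousAt.comp (continuousAt_clog hs)
  · have hs' : -w ∈ Complex.slitPlane := by
      rw [Complex.mem_slitPlane_iff] at hs ⊢
      push Not at hs
      left
      have : w.re ≠ 0 := fun h => hw0 (Complex.ext h hs.2)
      simpa using lt_of_le_of_ne hs.1 this
    have hper : ∀ (n : ℤ) (s : ℂ), Λ (s + n * (2 * Real.pi * Complex.I)) = Λ s := by
      have : Function.Periodic Λ (2 * Real.pi * Complex.I) := hp
      exact fun n s => this.int_mul n s
    have hev : ContinuousAt (fun w => Λ (Complex.log (-w) + Real.pi * Complex.I)) w := by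
      refine hc.continuousAt.comp (ContinuousAt.add ?_ continuousAt_const)
      exact (continuousAt_clog hs').comp continuousAt_neg
    refine hev.congr ?_
    filter_upwards [isOpen_compl_singleton.mem_nhds hw0] with v hv
    have hv0 : v ≠ 0 := hv
    have : Complex.exp (Complex.log (-v) + Real.pi * Complex.I) = Complex.exp (Complex.log v) := by
      rw [Complex.exp_add, Complex.exp_log (neg_ne_zero.2 hv0), Complex.exp_pi_mul_I,
        Complex.exp_log hv0]
      ring
    obtain ⟨n, hn⟩ := Complex.exp_eq_exp_iff_exists_int.1 this
    rw [hn, hper]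

/-- A function on a once punctured plane with a logarithm near infinity has a logarithm. -/
theorem hasLog_punctured {p : ℂ} {u : ℂ → ℂ} (hu : ContinuousOn u {p}ᶜ) (h0 : ∀ z ∈ ({p}ᶜ : Set ℂ), u z ≠ 0)
    {R : ℝ} (hR : HasLog (Metric.closedBall 0 R)ᶜ u) : HasLog {p}ᶜ u := by
  have hne : ∀ s : ℂ, p + Complex.exp s ∈ ({p}ᶜ : Set ℂ) := fun s => by
    simp [Complex.exp_ne_zero]
  obtain ⟨Λ, hΛc, hΛ⟩ := hasLog_of_isSimplyConnected isSimplyConnected_univ_complex isOpen_univ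
    (u := fun s => u (p + Complex.exp s))
    (hu.comp (by fun_prop) (fun s _ => hne s)) (fun s _ => h0 _ (hne s))
  rw [continuousOn_univ] at hΛc
  obtain ⟨L, hLc, hL⟩ := hR
  let r : ℝ := Real.log (|R| + ‖p‖ + 1)
  have hr : ∀ s ∈ {s : ℂ | r < s.re}, p + Complex.exp s ∈ (Metric.closedBall (0:ℂ) R)ᶜ := by
    intro s hs
    have hs' : r < s.re := hs
    have h1 : |R| + ‖p‖ + 1 < ‖Complex.exp s‖ := by
      rw [Complex.norm_exp]
      exact (Real.log_lt_iff_lt_exp (by positivity)).1 hs'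
    have h2 : ‖Complex.exp s‖ ≤ ‖p + Complex.exp s‖ + ‖p‖ := by
      have := norm_sub_le (p + Complex.exp s) p
      simpa using this
    simp only [mem_compl_iff, Metric.mem_closedBall, dist_zero_right, not_le]
    have := le_abs_self R
    linarith
  have hconv : IsPreconnected {s : ℂ | r < s.re} := (convex_halfSpace_re_gt r).isPreconnected
  have hshift : ∀ s, Complex.exp (s + 2 * Real.pi * Complex.I) = Complex.exp s := fun s => by
    rw [Complex.exp_add, Complex.exp_two_pi_mul_I, mul_one]
  let s0 : ℂ := ((r + 1 : ℝ) : ℂ)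
  have hs0 : s0 ∈ {s : ℂ | r < s.re} := by simp [s0]
  have hs1 : s0 + 2 * Real.pi * Complex.I ∈ {s : ℂ | r < s.re} := by simp [s0]
  have e1 : Λ s0 - L (p + Complex.exp s0) = Λ (s0 + 2 * Real.pi * Complex.I) -
      L (p + Complex.exp (s0 + 2 * Real.pi * Complex.I)) :=
    exp_one_const hconv (h := fun s => Λ s - L (p + Complex.exp s))
      (hΛc.continuousOn.sub (hLc.comp (by fun_prop) hr)) (fun s hs => by
        rw [Complex.exp_sub, hΛ s (mem_univ _), hL _ (hr s hs), div_self (h0 _ (hne s))]) hs0 hs1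
  rw [hshift] at e1
  have hper : ∀ s, Λ (s + 2 * Real.pi * Complex.I) = Λ s := by
    intro s
    have := exp_one_const (S := univ) isPreconnected_univ
      (h := fun s => Λ (s + 2 * Real.pi * Complex.I) - Λ s) (by fun_prop) (fun s _ => by
        rw [Complex.exp_sub, hΛ _ (mem_univ _), hΛ _ (mem_univ _)]
        simp only [hshift]
        rw [div_self (h0 _ (hne s))]) (mem_univ s) (mem_univ s0)
    linear_combination this - e1
  refine ⟨fun z => Λ (Complex.log (z - p)), (continuousOn_comp_log hΛc hper).comp (by fun_prop)
    (fun z hz => by simpa [sub_eq_zero] using hz), fun z hz => ?_⟩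
  have hz' : z - p ≠ 0 := sub_ne_zero.2 hz
  rw [hΛ _ (mem_univ _)]
  simp [Complex.exp_log hz']

/-- On a twice punctured plane, a function with a logarithm near infinity is, up to a power of
`(z - p) / (z - q)`, an exponential. -/
theorem hasLog_two_punctured {p q : ℂ} (hpq : p ≠ q) {u : ℂ → ℂ} (hu : ContinuousOn u {p, q}ᶜ)
    (h0 : ∀ z ∈ ({p, q}ᶜ : Set ℂ), u z ≠ 0)
    {R : ℝ} (hR : HasLog (Metric.closedBall 0 R)ᶜ u) :
    ∃ n : ℤ, HasLog {p, q}ᶜ (fun z => u z * ((z - p) / (z - q)) ^ n) := by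
  obtain ⟨L, hLc, hL⟩ := hR
  have hfar : ∀ z : ℂ, R < ‖z‖ → z ∈ (Metric.closedBall (0:ℂ) R)ᶜ := fun z hz => by simpa using hz
  -- cut off
  let χ : ℂ → ℝ := fun z => max 0 (min 1 (‖z‖ - (R + 1)))
  have hχ0 : ∀ z, ‖z‖ ≤ R + 1 → χ z = 0 := fun z hz => by
    simp only [χ]; exact max_eq_left ((min_le_right _ _).trans (by linarith))
  have hχ1 : ∀ z, R + 2 ≤ ‖z‖ → χ z = 1 := fun z hz => by
    simp only [χ]; rw [min_eq_left (by linarith)]; norm_num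
  have hχc : Continuous χ := by fun_prop
  let Lt : ℂ → ℂ := fun z => χ z * L z
  have hLt : Continuous Lt := by
    rw [continuous_iff_continuousAt]
    intro z
    by_cases hz : ‖z‖ < R + 1
    · have : ContinuousAt (fun _ : ℂ => (0:ℂ)) z := continuousAt_const
      refine this.congr ?_
      filter_upwards [(isOpen_lt continuous_norm continuous_const).mem_nhds hz] with w hw
      simp [Lt, hχ0 w (le_of_lt hw)]
    · refine (Complex.continuous_ofReal.continuousAt.comp hχc.continuousAt).mul
        (hLc.continuousAt (Metric.isClosed_closedBall.isOpen_compl.mem_nhds (hfar z (by linarith))))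
  let v : ℂ → ℂ := fun z => u z * Complex.exp (- Lt z)
  have hv1 : ∀ z, R + 2 ≤ ‖z‖ → v z = 1 := fun z hz => by
    have := hL z (hfar z (by linarith))
    simp only [v, Lt, hχ1 z hz, Complex.ofReal_one, one_mul, ← this, ← Complex.exp_add]
    simp
  have hvc : ContinuousOn v {p, q}ᶜ := hu.mul (by fun_prop)
  have hv0 : ∀ z ∈ ({p, q}ᶜ : Set ℂ), v z ≠ 0 := fun z hz => mul_ne_zero (h0 z hz) (Complex.exp_ne_zero _)
  -- pull back
  let ζ : ℂ → ℂ := fun s => (p - q * Complex.exp s) / (1 - Complex.exp s)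
  have hζ : ∀ s, Complex.exp s ≠ 1 → ζ s ∈ ({p, q}ᶜ : Set ℂ) := fun s hs => by
    have h1 : 1 - Complex.exp s ≠ 0 := sub_ne_zero.2 hs.symm
    have h2 := Complex.exp_ne_zero s
    simp only [ζ, mem_compl_iff, mem_insert_iff, mem_singleton_iff, div_eq_iff h1, not_or]
    constructor
    · intro h
      have : (p - q) * Complex.exp s = 0 := by linear_combination h
      exact (mul_ne_zero (sub_ne_zero.2 hpq) h2) this
    · intro h
      exact hpq (by linear_combination h)
  have hζc : ∀ s, Complex.exp s ≠ 1 → ContinuousAt ζ s := fun s hs => by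
    have h1 : 1 - Complex.exp s ≠ 0 := sub_ne_zero.2 hs.symm
    exact ContinuousAt.div (by fun_prop) (by fun_prop) h1
  classical
  let h : ℂ → ℂ := fun s => if Complex.exp s = 1 then 1 else v (ζ s)
  have hhc : Continuous h := by
    rw [continuous_iff_continuousAt]
    intro s
    by_cases hs : Complex.exp s = 1
    · have : ContinuousAt (fun _ : ℂ => (1:ℂ)) s := continuousAt_const
      refine this.congr ?_
      have hlim : ContinuousAt (fun s => ‖p - q * Complex.exp s‖ - (|R| + 2) * ‖1 - Complex.exp s‖) s := by
        fun_prop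
      have hpos : 0 < ‖p - q * Complex.exp s‖ - (|R| + 2) * ‖1 - Complex.exp s‖ := by
        simp [hs, sub_eq_zero, hpq]
      filter_upwards [hlim.eventually (lt_mem_nhds hpos)] with w hw
      simp only [h]
      split_ifs with hw1
      · rfl
      · rw [hv1]
        have h1 : 0 < ‖1 - Complex.exp w‖ := norm_pos_iff.2 (sub_ne_zero.2 (Ne.symm hw1))
        simp only [ζ, norm_div]
        rw [le_div_iff₀ h1]
        have := mul_le_mul_of_nonneg_right (le_abs_self R) h1.le
        linarith
    · have hc : ContinuousAt (fun s => v (ζ s)) s :=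
        (hvc.continuousAt ((toFinite {p, q}).isClosed.isOpen_compl.mem_nhds (hζ s hs))).comp (hζc s hs)
      refine hc.congr ?_
      have : {s : ℂ | Complex.exp s ≠ 1} ∈ 𝓝 s :=
        (isOpen_ne_fun Complex.continuous_exp continuous_const).mem_nhds hs
      filter_upwards [this] with w hw
      have : Complex.exp w ≠ 1 := hw
      simp [h, this]
  have hh0 : ∀ s, h s ≠ 0 := fun s => by
    simp only [h]; split_ifs with hs
    exacts [one_ne_zero, hv0 _ (hζ s hs)]
  obtain ⟨Λ, hΛc, hΛ⟩ := hasLog_of_isSimplyConnected isSimplyConnected_univ_complex isOpen_univ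
    (u := h) hhc.continuousOn (fun s _ => hh0 s)
  rw [continuousOn_univ] at hΛc
  have hshift : ∀ s, Complex.exp (s + 2 * Real.pi * Complex.I) = Complex.exp s := fun s => by
    rw [Complex.exp_add, Complex.exp_two_pi_mul_I, mul_one]
  have hhs : ∀ s, h (s + 2 * Real.pi * Complex.I) = h s := fun s => by
    simp only [h, ζ, hshift]
  have hone : ∀ s, Complex.exp (Λ (s + 2 * Real.pi * Complex.I) - Λ s) = 1 := fun s => by
    rw [Complex.exp_sub, hΛ _ (mem_univ _), hΛ _ (mem_univ _), hhs, div_self (hh0 s)]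
  obtain ⟨n, hn⟩ := Complex.exp_eq_one_iff.1 (hone 0)
  have hconst : ∀ s, Λ (s + 2 * Real.pi * Complex.I) - Λ s = n * (2 * Real.pi * Complex.I) := by
    intro s
    rw [← hn]
    exact exp_one_const (S := univ) isPreconnected_univ
      (h := fun s => Λ (s + 2 * Real.pi * Complex.I) - Λ s) (by fun_prop) (fun s _ => hone s)
      (mem_univ s) (mem_univ 0)
  let Λ' : ℂ → ℂ := fun s => Λ s - n * s
  have hΛ'c : Continuous Λ' := by fun_prop
  have hΛ'p : ∀ s, Λ' (s + 2 * Real.pi * Complex.I) = Λ' s := fun s => by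
    simp only [Λ']; linear_combination hconst s
  have hden : ∀ z ∈ ({p, q}ᶜ : Set ℂ), z - p ≠ 0 ∧ z - q ≠ 0 := fun z hz => by
    simp only [mem_compl_iff, mem_insert_iff, mem_singleton_iff, not_or] at hz
    exact ⟨sub_ne_zero.2 hz.1, sub_ne_zero.2 hz.2⟩
  refine ⟨-n, fun z => Λ' (Complex.log ((z - p) / (z - q))) + Lt z, ?_, fun z hz => ?_⟩
  · refine ContinuousOn.add ((continuousOn_comp_log hΛ'c hΛ'p).comp ?_ ?_) hLt.continuousOn
    · exact ContinuousOn.div (by fun_prop) (by fun_prop) (fun z hz => (hden z hz).2)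
    · intro z hz
      exact div_ne_zero (hden z hz).1 (hden z hz).2
  · obtain ⟨hz1, hz2⟩ := hden z hz
    have hM : (z - p) / (z - q) ≠ 0 := div_ne_zero hz1 hz2
    set s := Complex.log ((z - p) / (z - q)) with hs
    have hexp : Complex.exp s = (z - p) / (z - q) := Complex.exp_log hM
    have hne1 : Complex.exp s ≠ 1 := by
      rw [hexp, Ne, div_eq_one_iff_eq hz2]
      intro h; exact hpq (by linear_combination -h)
    have hζz : ζ s = z := by
      simp only [ζ]
      rw [div_eq_iff (sub_ne_zero.2 hne1.symm), hexp]
      field_simp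
      ring
    rw [Complex.exp_add]
    have hΛs : Complex.exp (Λ s) = u z * Complex.exp (-Lt z) := by
      rw [hΛ s (mem_univ _)]
      simp only [h, if_neg hne1, hζz, v]
    simp only [← hs, Λ', Complex.exp_sub, hΛs]
    rw [Complex.exp_int_mul, hexp, zpow_neg, Complex.exp_neg]
    have := Complex.exp_ne_zero (Lt z)
    field_simp

theorem isConnected_compl_closedBall (c : ℂ) {r : ℝ} (hr : 0 < r) :
    IsConnected (Metric.closedBall c r)ᶜ := by
  have : (Metric.closedBall c r)ᶜ = (fun s => c + Complex.exp s) '' {s : ℂ | Real.log r < s.re} := by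
    ext z
    simp only [mem_compl_iff, Metric.mem_closedBall, not_le, mem_image, mem_ofPred_eq]
    constructor
    · intro hz
      have h0 : z - c ≠ 0 := by
        rw [← norm_pos_iff, ← dist_eq_norm]; linarith
      refine ⟨Complex.log (z - c), ?_, by rw [Complex.exp_log h0]; ring⟩
      rw [Complex.log_re, ← dist_eq_norm]
      exact Real.log_lt_log hr hz
    · rintro ⟨s, hs, rfl⟩
      rw [dist_eq_norm, add_sub_cancel_left, Complex.norm_exp]
      exact (Real.log_lt_iff_lt_exp hr).1 hs
  rw [this]
  refine ⟨⟨_, mem_image_of_mem _ (show ((Real.log r + 1 : ℝ) : ℂ) ∈ _ by simp)⟩, ?_⟩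
  exact (convex_halfSpace_re_gt _).isPreconnected.image _ (by fun_prop)

theorem mem_ccIn_of_isPreconnected {α : Type*} [TopologicalSpace α] {O T : Set α}
    (hT : IsPreconnected T) (hTO : T ⊆ O) {w z : α}
    (hw : w ∈ T) (hz : z ∈ T) : z ∈ connectedComponentIn O w :=
  hT.subset_connectedComponentIn hw hTO hz

theorem compl_closedBall_subset_compl {C : Set ℂ} (hC : IsCompact C) :
    ∃ R : ℝ, (Metric.closedBall (0:ℂ) R)ᶜ ⊆ Cᶜ := by
  obtain ⟨R, hR⟩ := hC.isBounded.subset_closedBall 0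
  exact ⟨R, compl_subset_compl.2 hR⟩

/-- A weak form of Janiszewski's theorem. -/
theorem joined_compl_union {C₁ C₂ : Set ℂ} (h1 : IsCompact C₁) (h2 : IsCompact C₂) {m : ℂ}
    (h12 : C₁ ∩ C₂ ⊆ {m}) {w z : ℂ} (hw : w ∉ C₁ ∪ C₂)
    (hj1 : z ∈ connectedComponentIn C₁ᶜ w) (hj2 : z ∈ connectedComponentIn C₂ᶜ w) :
    z ∈ connectedComponentIn (C₁ ∪ C₂)ᶜ w := by
  rw [compl_union]
  refine joined_inter h1.isClosed.isOpen_compl h2.isClosed.isOpen_compl ?_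
    (by rwa [← compl_union]) hj1 hj2
  intro u hu h0 hl1 _
  obtain ⟨R, hR⟩ := compl_closedBall_subset_compl h1
  rw [← compl_inter] at hu h0 ⊢
  rcases subset_singleton_iff_eq.1 h12 with h | h
  · rw [h, compl_empty] at hu h0 ⊢
    exact hasLog_of_isSimplyConnected isSimplyConnected_univ_complex isOpen_univ hu h0
  · rw [h] at hu h0 ⊢
    exact hasLog_punctured hu h0 (hl1.mono hR)

theorem joined_compl_arc {g : ℝ → ℂ} {a b : ℝ} (hab : a ≤ b) (hg : ContinuousOn g (Icc a b))
    (hi : InjOn g (Icc a b)) {w z : ℂ} (hw : w ∉ g '' Icc a b) (hz : z ∉ g '' Icc a b) :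
    z ∈ connectedComponentIn (g '' Icc a b)ᶜ w := by
  have hcomp : IsCompact (g '' Icc a b) := isCompact_Icc.image_of_continuousOn hg
  obtain ⟨e1, he1, hb1⟩ := Metric.isOpen_iff.1 hcomp.isClosed.isOpen_compl w hw
  obtain ⟨e2, he2, hb2⟩ := Metric.isOpen_iff.1 hcomp.isClosed.isOpen_compl z hz
  set e := min e1 e2 with he
  have hepos : 0 < e := lt_min he1 he2
  have hdist : ∀ t ∈ Icc a b, e ≤ dist w (g t) ∧ e ≤ dist z (g t) := by
    intro t ht
    constructor
    · by_contra! h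
      have : g t ∈ Metric.ball w e1 := by
        rw [Metric.mem_ball, dist_comm]; exact h.trans_le (min_le_left _ _)
      exact hb1 this (mem_image_of_mem _ ht)
    · by_contra! h
      have : g t ∈ Metric.ball z e2 := by
        rw [Metric.mem_ball, dist_comm]; exact h.trans_le (min_le_right _ _)
      exact hb2 this (mem_image_of_mem _ ht)
  have huc := isCompact_Icc.uniformContinuousOn_of_continuous hg
  obtain ⟨d, hd, hd'⟩ := Metric.uniformContinuousOn_iff.1 huc (e / 2) (by positivity)
  obtain ⟨N, hN⟩ := exists_nat_gt ((b - a) / d)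
  have hNpos : (0:ℝ) < N := lt_of_le_of_lt (div_nonneg (by linarith) hd.le) hN
  let t : ℕ → ℝ := fun k => a + k * ((b - a) / N)
  have hstep : (b - a) / N < d := by
    rw [div_lt_iff₀ hNpos]; rw [div_lt_iff₀ hd] at hN; linarith
  have hs0 : 0 ≤ (b - a) / N := div_nonneg (by linarith) hNpos.le
  have ht0 : ∀ k, a ≤ t k := fun k => by simp only [t]; nlinarith [(Nat.cast_nonneg k : (0:ℝ) ≤ k)]
  have htN : ∀ k : ℕ, k ≤ N → t k ≤ b := fun k hk => by
    have : (k:ℝ) ≤ N := by exact_mod_cast hk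
    have h2 : (N:ℝ) * ((b - a) / N) = b - a := by field_simp
    simp only [t]; nlinarith
  have htstep : ∀ k, t (k + 1) = t k + (b - a) / N := fun k => by simp only [t]; push_cast; ring
  have hout : ∀ s ⊆ Icc a b, w ∉ g '' s ∧ z ∉ g '' s := fun s hs =>
    ⟨fun h => hw (image_mono hs h), fun h => hz (image_mono hs h)⟩
  have key : ∀ k : ℕ, k ≤ N → z ∈ connectedComponentIn (g '' Icc a (t k))ᶜ w := by
    intro k
    induction k with
    | zero =>
      intro _
      have : t 0 = a := by simp [t]
      rw [this, Icc_self, image_singleton]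
      have hsub : ({a} : Set ℝ) ⊆ Icc a b := by simpa using hab
      obtain ⟨q1, q2⟩ := hout _ hsub
      rw [image_singleton] at q1 q2
      exact mem_ccIn_of_isPreconnected (isConnected_compl_singleton_of_one_lt_rank (by simp) _).isPreconnected
        subset_rfl q1 q2
    | succ k ih =>
      intro hk
      have hk' : k ≤ N := by omega
      have hle : t k ≤ t (k + 1) := by rw [htstep]; linarith
      have hU : g '' Icc a (t (k + 1)) = g '' Icc a (t k) ∪ g '' Icc (t k) (t (k + 1)) := by
        grind
      have hsub1 : Icc a (t k) ⊆ Icc a b := Icc_subset_Icc_right (htN k hk')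
      have hsub2 : Icc (t k) (t (k + 1)) ⊆ Icc a b := Icc_subset_Icc (ht0 k) (htN _ hk)
      rw [hU]
      refine joined_compl_union (m := g (t k)) (isCompact_Icc.image_of_continuousOn (hg.mono hsub1))
        (isCompact_Icc.image_of_continuousOn (hg.mono hsub2)) ?_ ?_ (ih hk') ?_
      · rintro _ ⟨⟨x, hx, rfl⟩, ⟨y, hy, hxy⟩⟩
        have := hi (hsub2 hy) (hsub1 hx) hxy
        subst this
        rw [le_antisymm hx.2 hy.1]; rfl
      · grind
      · have hb : g '' Icc (t k) (t (k + 1)) ⊆ Metric.closedBall (g (t k)) (e / 2) := by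
          rintro _ ⟨y, hy, rfl⟩
          refine (hd' y (hsub2 hy) (t k) (hsub2 ⟨le_rfl, hle⟩) ?_).le
          rw [Real.dist_eq, abs_of_nonneg (by linarith [hy.1])]
          have := hy.2; rw [htstep] at this; linarith
        obtain ⟨q1, q2⟩ := hdist (t k) ⟨ht0 k, htN k hk'⟩
        refine mem_ccIn_of_isPreconnected (isConnected_compl_closedBall (g (t k)) (r := e / 2) (by positivity)).isPreconnected
          (compl_subset_compl.2 hb) ?_ ?_ <;>
        · simp only [mem_compl_iff, Metric.mem_closedBall, not_le]; linarith
  grind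

/-- The complement of an arc is connected. -/
theorem isConnected_compl_arc {g : ℝ → ℂ} {a b : ℝ} (hab : a ≤ b) (hg : ContinuousOn g (Icc a b))
    (hi : InjOn g (Icc a b)) : IsConnected (g '' Icc a b)ᶜ := by
  obtain ⟨R, hR⟩ := compl_closedBall_subset_compl (isCompact_Icc.image_of_continuousOn hg)
  have hw : (((|R| + 1 : ℝ) : ℂ)) ∈ (g '' Icc a b)ᶜ := hR (by
    simp only [mem_compl_iff, Metric.mem_closedBall, dist_zero_right, Complex.norm_real, not_le]
    rw [Real.norm_of_nonneg (by positivity)]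
    linarith [le_abs_self R])
  have : (g '' Icc a b)ᶜ = connectedComponentIn (g '' Icc a b)ᶜ ((|R| + 1 : ℝ) : ℂ) :=
    subset_antisymm (fun z hz => joined_compl_arc hab hg hi hw hz) (connectedComponentIn_subset _ _)
  rw [this]
  exact isConnected_connectedComponentIn_iff.2 hw

theorem not_hasLog_sphere (a : ℂ) {r : ℝ} (hr : 0 < r) : ¬ HasLog (Metric.sphere a r) (fun z => z - a) := by
  rintro ⟨L, hc, hL⟩
  have hm : ∀ θ : ℝ, a + r * Complex.exp (θ * Complex.I) ∈ Metric.sphere a r := fun θ => by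
    simp [Complex.norm_exp_ofReal_mul_I, abs_of_pos hr]
  have hr' : (r:ℂ) ≠ 0 := by exact_mod_cast hr.ne'
  have := exp_one_const (S := (univ : Set ℝ)) isPreconnected_univ
    (h := fun θ : ℝ => L (a + r * Complex.exp (θ * Complex.I)) - θ * Complex.I - Complex.log r)
    ((((hc.comp (by fun_prop) (fun θ _ => hm θ)).sub (by fun_prop))).sub (by fun_prop)) (fun θ _ => by
      rw [Complex.exp_sub, Complex.exp_sub, hL _ (hm θ), Complex.exp_log hr']
      have := Complex.exp_ne_zero (θ * Complex.I)
      grind) (mem_univ 0) (mem_univ (2 * Real.pi))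
  have h2 : Complex.exp (((2 * Real.pi : ℝ) : ℂ) * Complex.I) = Complex.exp (((0:ℝ):ℂ) * Complex.I) := by
    push_cast; rw [Complex.exp_two_pi_mul_I]; simp
  simp only [h2] at this
  apply Complex.two_pi_I_ne_zero
  push_cast at this
  linear_combination this

theorem not_hasLog_two_punctured {p q : ℂ} (hpq : p ≠ q) :
    ¬ HasLog {p, q}ᶜ (fun z => (z - p) / (z - q)) := by
  intro h
  have hd : 0 < dist p q := dist_pos.2 hpq
  have hs : ∀ z ∈ Metric.sphere p (dist p q / 2), z ∈ ({p, q}ᶜ : Set ℂ) ∧ z ∈ Metric.ball p (dist p q) := by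
    intro z hz
    rw [Metric.mem_sphere] at hz
    constructor
    · simp only [mem_compl_iff, mem_insert_iff, mem_singleton_iff, not_or]
      constructor
      · rintro rfl; rw [dist_self] at hz; linarith
      · rintro rfl; rw [dist_comm] at hz; linarith
    · rw [Metric.mem_ball]; linarith
  have hq : HasLog (Metric.ball p (dist p q)) (fun z => z - q) :=
    hasLog_of_isSimplyConnected (isSimplyConnected_of_convex (convex_ball _ _) ⟨p, Metric.mem_ball_self hd⟩)
      Metric.isOpen_ball (by fun_prop) (fun z hz => by
        rw [sub_ne_zero]; rintro rfl; rw [Metric.mem_ball, dist_comm] at hz; exact lt_irrefl _ hz)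
  apply not_hasLog_sphere p (r := dist p q / 2) (by positivity)
  refine ((h.mono fun z hz => (hs z hz).1).mul (hq.mono fun z hz => (hs z hz).2)).congr fun z hz => ?_
  grind

open unitInterval in
/-- Off a path from `p` to `q`, the function `(z - p) / (z - q)` has a logarithm. -/
theorem hasLog_compl_path {g : ℝ → ℂ} (hg : ContinuousOn g (Icc 0 1)) :
    HasLog (g '' Icc 0 1)ᶜ (fun z => (z - g 0) / (z - g 1)) := by
  set O : Set ℂ := (g '' Icc 0 1)ᶜ with hO
  have hne : ∀ (t : I) (z : O), (z : ℂ) - g t ≠ 0 := fun t z h =>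
    z.2 ⟨t, t.2, (sub_eq_zero.1 h).symm⟩
  have hgI : Continuous fun t : I => g t := hg.domRestrict
  let H : C(I × O, {z : ℂ // z ≠ 0}) :=
    ⟨fun x => ⟨((x.2 : ℂ) - g 0) / ((x.2 : ℂ) - g x.1), div_ne_zero (hne 0 x.2) (hne x.1 x.2)⟩, by
      refine Continuous.subtype_mk (Continuous.div
        ((continuous_subtype_val.comp continuous_snd).sub continuous_const) ?_ (fun x => hne x.1 x.2)) _
      exact (continuous_subtype_val.comp continuous_snd).sub (hgI.comp continuous_fst)⟩
  let f : C(O, ℂ) := ⟨fun _ => 0, continuous_const⟩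
  have hf : ∀ a, H (0, a) = (fun z : ℂ ↦ (⟨_, z.exp_ne_zero⟩ : {z : ℂ // z ≠ 0})) (f a) := by
    intro a
    apply Subtype.ext
    simp only [H, f, ContinuousMap.coe_mk, Complex.exp_zero]
    exact div_self (hne 0 a)
  let Λ := Complex.isCoveringMap_exp.liftHomotopy H f hf
  have hΛ := Complex.isCoveringMap_exp.liftHomotopy_lifts H f hf
  classical
  refine ⟨fun z => if h : z ∈ O then Λ (1, ⟨z, h⟩) else 0, ?_, ?_⟩
  · rw [continuousOn_iff_continuous_domRestrict]
    have : O.domRestrict (fun z => if h : z ∈ O then Λ (1, ⟨z, h⟩) else 0) = fun z : O => Λ (1, z) := by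
      funext z; simp [domRestrict_apply]
    rw [this]
    fun_prop
  · intro z hz
    simp only [hz, dif_pos]
    have := congrArg Subtype.val (congrFun hΛ (1, ⟨z, hz⟩))
    exact this.trans (by simp [H])

theorem IsCompOf.subset {A D : Set X} (h : IsCompOf A D) : D ⊆ A := by
  obtain ⟨x, _, rfl⟩ := h; exact connectedComponentIn_subset _ _

theorem IsCompOf.isConnected {A D : Set X} (h : IsCompOf A D) : IsConnected D := by
  obtain ⟨x, hx, rfl⟩ := h; exact isConnected_connectedComponentIn_iff.2 hx

theorem IsCompOf.isPreconnected {A D : Set X} (h : IsCompOf A D) : IsPreconnected D :=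
  h.isConnected.isPreconnected

theorem IsCompOf.nonempty {A D : Set X} (h : IsCompOf A D) : D.Nonempty := h.isConnected.nonempty

theorem IsCompOf.eq_cc {A D : Set X} (h : IsCompOf A D) {y : X} (hy : y ∈ D) :
    D = connectedComponentIn A y := by
  obtain ⟨x, hx, rfl⟩ := h; exact connectedComponentIn_eq hy

theorem isCompOf_cc {A : Set X} {x : X} (hx : x ∈ A) : IsCompOf A (connectedComponentIn A x) :=
  ⟨x, hx, rfl⟩

theorem IsCompOf.eq_of_mem {A D D' : Set X} (h : IsCompOf A D) (h' : IsCompOf A D') {y : X}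
    (hy : y ∈ D) (hy' : y ∈ D') : D = D' := (h.eq_cc hy).trans (h'.eq_cc hy').symm

theorem IsCompOf.disjoint {A D D' : Set X} (h : IsCompOf A D) (h' : IsCompOf A D') (hne : D ≠ D') :
    Disjoint D D' :=
  Set.disjoint_left.2 fun _ hy hy' => hne (h.eq_of_mem h' hy hy')

theorem IsCompOf.subset_of_isPreconnected {A D T : Set X} (h : IsCompOf A D) (hT : IsPreconnected T)
    (hTA : T ⊆ A) (hne : (D ∩ T).Nonempty) : T ⊆ D := by
  obtain ⟨y, hy, hyT⟩ := hne
  rw [h.eq_cc hy]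
  exact hT.subset_connectedComponentIn hyT hTA

theorem IsCompOf.isOpen [LocallyConnectedSpace X] {A D : Set X} (h : IsCompOf A D) (hA : IsOpen A) :
    IsOpen D := by
  obtain ⟨x, _, rfl⟩ := h; exact hA.connectedComponentIn

theorem IsCompOf.mem_of_mem_closure {A D : Set X} (h : IsCompOf A D) {y : X}
    (hy : y ∈ A) (hyD : y ∈ closure D) : y ∈ D := by
  have hc : IsPreconnected (insert y D) := by
    refine h.isPreconnected.subset_closure (subset_insert _ _) ?_
    exact insert_subset hyD subset_closure
  exact h.subset_of_isPreconnected hc (insert_subset hy h.subset)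
    (h.nonempty.mono fun z hz => ⟨hz, Or.inr hz⟩) (mem_insert _ _)

theorem IsPreconnected.subset_of_clopenIn {A S F V : Set X} (hS : IsPreconnected S)
    (hF : IsClosed F) (hV : IsOpen V) (hSA : S ⊆ A) (hFV : A ∩ F = A ∩ V)
    (hne : (S ∩ V).Nonempty) : S ⊆ V := by
  have hSF : S ⊆ F := by
    by_contra hcon
    obtain ⟨y, hyS, hyF⟩ := not_subset.1 hcon
    obtain ⟨v, hvS, hvV, hvF⟩ := hS V Fᶜ hV hF.isOpen_compl (fun v hv => by
      by_cases hvF : v ∈ F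
      · exact Or.inl (hFV ▸ ⟨hSA hv, hvF⟩ : v ∈ A ∩ V).2
      · exact Or.inr hvF) hne ⟨y, hyS, hyF⟩
    exact hvF (hFV ▸ ⟨hSA hvS, hvV⟩ : v ∈ A ∩ F).2
  exact fun y hy => (hFV ▸ ⟨hSA hy, hSF hy⟩ : y ∈ A ∩ V).2

theorem isCompOf_of_clopen {A C F V : Set X} (hC : IsConnected C) (hF : IsClosed F) (hV : IsOpen V)
    (hCF : C = A ∩ F) (hCV : C = A ∩ V) : IsCompOf A C := by
  obtain ⟨x, hx⟩ := hC.nonempty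
  have hCA : C ⊆ A := by rw [hCF]; exact inter_subset_left
  have hs : connectedComponentIn A x ⊆ A := connectedComponentIn_subset _ _
  refine ⟨x, hCA hx, subset_antisymm (hC.isPreconnected.subset_connectedComponentIn hx hCA) ?_⟩
  have := isPreconnected_connectedComponentIn.subset_of_clopenIn (S := connectedComponentIn A x)
    hF hV hs (hCF ▸ hCV) ⟨x, mem_connectedComponentIn (hCA hx), (hCV ▸ hx : x ∈ A ∩ V).2⟩
  rw [hCV]
  exact subset_inter hs this

theorem HasLog.glue {O₁ O₂ : Set ℂ} (h1 : IsOpen O₁) (h2 : IsOpen O₂) {u μ ν : ℂ → ℂ}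
    (hμ : ContinuousOn μ O₁) (hν : ContinuousOn ν O₂) (hμu : ∀ z ∈ O₁, Complex.exp (μ z) = u z)
    (hνu : ∀ z ∈ O₂, Complex.exp (ν z) = u z) (h : ∀ z ∈ O₁ ∩ O₂, μ z = ν z) :
    HasLog (O₁ ∪ O₂) u := by
  classical
  have e1 : ∀ z ∈ O₁, (if z ∈ O₁ then μ z else ν z) = μ z := fun z hz => by simp [hz]
  have e2 : ∀ z ∈ O₂, (if z ∈ O₁ then μ z else ν z) = ν z := fun z hz => by
    grind
  refine ⟨fun z => if z ∈ O₁ then μ z else ν z, ?_, ?_⟩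
  · rintro z (hz | hz)
    · refine ((hμ.continuousAt (h1.mem_nhds hz)).congr ?_).continuousWithinAt
      filter_upwards [h1.mem_nhds hz] with w hw using (e1 w hw).symm
    · refine ((hν.continuousAt (h2.mem_nhds hz)).congr ?_).continuousWithinAt
      filter_upwards [h2.mem_nhds hz] with w hw using (e2 w hw).symm
  · grind

theorem isOpen_diff_cc {O : Set ℂ} (hO : IsOpen O) (w : ℂ) :
    IsOpen (O \ connectedComponentIn O w) := by
  rw [isOpen_iff_mem_nhds]
  rintro y ⟨hy, hyP⟩
  filter_upwards [(isOpen_ccIn hO y).mem_nhds (mem_connectedComponentIn hy)] with v hv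
  refine ⟨connectedComponentIn_subset _ _ hv, fun hvP => hyP ?_⟩
  rw [connectedComponentIn_eq hvP, ← connectedComponentIn_eq hv]
  exact mem_connectedComponentIn hy

theorem not_mem_of_frontier {U : Set X} (hU : IsOpen U) {x : X} (hx : x ∈ frontier U) : x ∉ U := by
  rw [hU.frontier_eq] at hx; exact hx.2

section Arc

variable {U : Set ℂ} (hUo : IsOpen U) (hUs : IsSimplyConnected U) {g : ℝ → ℂ}
  (hg : ContinuousOn g (Icc 0 1)) (hi : InjOn g (Icc 0 1)) (hgU : ∀ t ∈ Ioo (0:ℝ) 1, g t ∈ U)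
  (h0 : g 0 ∉ U) (h1 : g 1 ∉ U)
include h0 h1

theorem diff_arc_eq : U \ g '' Ioo 0 1 = (g '' Icc 0 1)ᶜ ∩ U := by
  grind

include hUo hg in
theorem isOpen_diff_arc : IsOpen (U \ g '' Ioo 0 1) := by
  rw [diff_arc_eq h0 h1]
  exact (isCompact_Icc.image_of_continuousOn hg).isClosed.isOpen_compl.inter hUo

include hgU

theorem arc_union_eq : (g '' Icc 0 1)ᶜ ∪ U = {g 0, g 1}ᶜ := by
  grind

include hUo hUs hg hi

theorem hasTwoComps_of_arc : ∃ D₁ D₂, HasTwoComps (U \ g '' Ioo 0 1) D₁ D₂ := by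
  have hpq : g 0 ≠ g 1 := fun h => zero_ne_one (hi (by simp) (by simp) h)
  have hΛ : IsCompact (g '' Icc 0 1) := isCompact_Icc.image_of_continuousOn hg
  have hO1 := hΛ.isClosed.isOpen_compl
  have hun := arc_union_eq hgU h0 h1
  have hin := diff_arc_eq h0 h1
  set O₁ := (g '' Icc 0 1)ᶜ with hO1def
  set W := U \ g '' Ioo 0 1 with hW
  have hWo : IsOpen W := isOpen_diff_arc hUo hg h0 h1
  have hO1c : IsPreconnected O₁ := (isConnected_compl_arc zero_le_one hg hi).isPreconnected
  have hUc : IsPreconnected U := hUs.isPathConnected.isConnected.isPreconnected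
  let M : ℂ → ℂ := fun z => (z - g 0) / (z - g 1)
  have hM0 : ∀ z ∈ O₁ ∪ U, M z ≠ 0 := fun z hz => by
    grind
  have hMc : ContinuousOn M (O₁ ∪ U) := by
    refine ContinuousOn.div (by fun_prop) (by fun_prop) (fun z hz => ?_)
    grind
  obtain ⟨μ, hμc, hμ⟩ : HasLog O₁ M := hasLog_compl_path hg
  obtain ⟨ν, hνc, hν⟩ : HasLog U M := hasLog_of_isSimplyConnected hUs hUo
    (hMc.mono subset_union_right) (fun z hz => hM0 z (Or.inr hz))
  let κ : ℂ → ℂ := fun z => μ z - ν z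
  have hκc : ContinuousOn κ W := by
    rw [hin]; exact (hμc.mono inter_subset_left).sub (hνc.mono inter_subset_right)
  have hκ1 : ∀ z ∈ W, Complex.exp (κ z) = 1 := fun z hz => by
    rw [hin] at hz
    simp only [κ]
    rw [Complex.exp_sub, hμ z hz.1, hν z hz.2, div_self (hM0 z (Or.inl hz.1))]
  have hκ : ∀ w ∈ W, ∀ z ∈ connectedComponentIn W w, κ z = κ w := fun w hw z hz =>
    exp_one_const isPreconnected_connectedComponentIn (hκc.mono (connectedComponentIn_subset _ _))
      (fun v hv => hκ1 v (connectedComponentIn_subset _ _ hv)) hz (mem_connectedComponentIn hw)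
  -- indicators of components are affine functions of `κ`
  have hind : ∀ w ∈ W, ∃ (n : ℤ) (m : ℂ), (∀ z ∈ connectedComponentIn W w,
      n * κ z + m = 2 * Real.pi * Complex.I) ∧ ∀ z ∈ W \ connectedComponentIn W w, n * κ z + m = 0 := by
    intro w hw
    obtain ⟨u, a, b, huc, hu0, hac, hbc, hau, hbu, hP, hQ⟩ :=
      exists_cocycle hO1 hUo (isOpen_ccIn hWo w) (isOpen_diff_cc hWo w) disjoint_sdiff_right
        (hin ▸ (union_sdiff_cancel (connectedComponentIn_subset W w)).symm)
    obtain ⟨R, hR⟩ := compl_closedBall_subset_compl hΛ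
    obtain ⟨n, L, hLc, hL⟩ := hasLog_two_punctured hpq (hun ▸ huc) (hun ▸ hu0)
      (HasLog.mono ⟨a, hac, hau⟩ hR)
    rw [← hun] at hLc hL
    have hexp : ∀ (S : Set ℂ) (hS : S ⊆ O₁ ∪ U) (c l : ℂ → ℂ), (∀ z ∈ S, Complex.exp (c z) = u z) →
        (∀ z ∈ S, Complex.exp (l z) = M z) → ∀ z ∈ S, Complex.exp (c z + n * l z - L z) = 1 := by
      intro S hS c l hc hl z hz
      have hM' : M z ≠ 0 := hM0 z (hS hz)
      rw [Complex.exp_sub, Complex.exp_add, Complex.exp_int_mul, hc z hz, hl z hz, hL z (hS hz)]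
      exact div_self (mul_ne_zero (hu0 z (hS hz)) (zpow_ne_zero _ hM'))
    have hwW := hin ▸ hw
    have c1 : ∀ z ∈ O₁, a z + n * μ z - L z = a w + n * μ w - L w := fun z hz =>
      exp_one_const hO1c (h := fun z => a z + n * μ z - L z)
        ((hac.add (continuousOn_const.mul hμc)).sub (hLc.mono subset_union_left))
        (hexp O₁ subset_union_left a μ hau hμ) hz hwW.1
    have c2 : ∀ z ∈ U, b z + n * ν z - L z = b w + n * ν w - L w := fun z hz =>
      exp_one_const hUc (h := fun z => b z + n * ν z - L z)
        ((hbc.add (continuousOn_const.mul hνc)).sub (hLc.mono subset_union_right))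
        (hexp U subset_union_right b ν hbu hν) hz hwW.2
    have hPw := hP w (mem_connectedComponentIn hw)
    refine ⟨-n, 2 * Real.pi * Complex.I + n * κ w, fun z hz => ?_, fun z hz => ?_⟩
    · rw [hκ w hw z hz]; push_cast; ring
    · grind
  have hnc : ∃ w₁ ∈ W, ∃ w₂ ∈ W, κ w₁ ≠ κ w₂ := by
    by_contra! hcon
    obtain ⟨c, hc1, hc⟩ : ∃ c : ℂ, Complex.exp c = 1 ∧ ∀ z ∈ W, κ z = c := by
      by_cases hne : W.Nonempty
      · obtain ⟨w, hw⟩ := hne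
        grind
      · exact ⟨0, Complex.exp_zero, fun z hz => (hne ⟨z, hz⟩).elim⟩
    apply not_hasLog_two_punctured hpq
    rw [← hun]
    refine HasLog.glue hO1 hUo hμc (hνc.add (continuousOn_const (c := c))) hμ (fun z hz => ?_) (fun z hz => ?_)
    · simp only [Pi.add_apply]; rw [Complex.exp_add, hc1, mul_one]; exact hν z hz
    · have := hc z (hin ▸ hz)
      simp only [κ] at this
      simp only [Pi.add_apply]
      linear_combination this
  obtain ⟨w₁, hw₁, w₂, hw₂, hne⟩ := hnc
  have h12 : w₂ ∉ connectedComponentIn W w₁ := fun h => hne (hκ w₁ hw₁ w₂ h).symm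
  refine ⟨connectedComponentIn W w₁, connectedComponentIn W w₂, isCompOf_cc hw₁, isCompOf_cc hw₂,
    fun h => h12 (h ▸ mem_connectedComponentIn hw₂), fun w₃ hw₃ => ?_⟩
  by_contra! hcon
  have h31 : w₃ ∉ connectedComponentIn W w₁ := fun h => hcon.1 (connectedComponentIn_eq h).symm
  have h32 : w₃ ∉ connectedComponentIn W w₂ := fun h => hcon.2 (connectedComponentIn_eq h).symm
  obtain ⟨n, m, hn1, hn2⟩ := hind w₁ hw₁
  obtain ⟨n', m', hn1', hn2'⟩ := hind w₂ hw₂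
  have a1 := hn1 w₁ (mem_connectedComponentIn hw₁)
  have a2 := hn2 w₂ ⟨hw₂, h12⟩
  have a3 := hn2 w₃ ⟨hw₃, h31⟩
  have b2 := hn1' w₂ (mem_connectedComponentIn hw₂)
  have b3 := hn2' w₃ ⟨hw₃, h32⟩
  have hn0 : (n:ℂ) ≠ 0 := fun h => by
    rw [h] at a1 a2
    exact Complex.two_pi_I_ne_zero (by linear_combination a2 - a1)
  grind

/-- An arc in `U` between distinct boundary points is a cross-cut. -/
theorem isCrossCut_of_arc (h0f : g 0 ∈ frontier U) (h1f : g 1 ∈ frontier U) :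
    IsCrossCut U (g '' Ioo 0 1) := by
  obtain ⟨D₁, D₂, hD⟩ := hasTwoComps_of_arc hUo hUs hg hi hgU h0 h1
  have hpq : g 0 ≠ g 1 := fun h => zero_ne_one (hi (by simp) (by simp) h)
  have key : ∀ D, IsCompOf (U \ g '' Ioo 0 1) D →
      (frontier D ∩ (frontier U \ g '' Icc 0 1)).Nonempty := by
    intro D hD
    by_contra hcon
    have hWo := isOpen_diff_arc hUo hg h0 h1
    have hDo := hD.isOpen hWo
    have hDU : D ⊆ U := hD.subset.trans sdiff_subset
    have hcl : closure D ∩ (g '' Icc 0 1)ᶜ ⊆ D := by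
      rintro y ⟨hyD, hyΛ⟩
      by_contra hyn
      by_cases hyU : y ∈ U
      · exact hyn (hD.mem_of_mem_closure ⟨hyU, fun h => hyΛ (image_mono Ioo_subset_Icc_self h)⟩ hyD)
      · refine hcon ⟨y, ?_, ?_, hyΛ⟩
        · rw [hDo.frontier_eq]; exact ⟨hyD, hyn⟩
        · rw [hUo.frontier_eq]; exact ⟨closure_mono hDU hyD, hyU⟩
    have hsub := (isConnected_compl_arc zero_le_one hg hi).isPreconnected.subset_of_closure_inter_subset
      hDo (by
        obtain ⟨y, hy⟩ := hD.nonempty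
        exact ⟨y, (diff_arc_eq h0 h1 ▸ hD.subset hy).1, hy⟩) hcl
    have hU : U = {g 0, g 1}ᶜ := by
      grind
    apply not_hasLog_two_punctured hpq
    rw [← hU]
    refine hasLog_of_isSimplyConnected hUs hUo (ContinuousOn.div (by fun_prop) (by fun_prop) ?_) ?_
    · grind
    · grind
  exact ⟨g, hg, hi.mono Ioo_subset_Icc_self, hgU, h0f, h1f, rfl, D₁, D₂, hD, key D₁ hD.1, key D₂ hD.2.1⟩

end Arc

/-- Removing a closed half line keeps a simply connected plane domain connected. -/
theorem joined_diff_halfline {U C : Set ℂ} (hUo : IsOpen U) (hUs : IsSimplyConnected U)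
    (hC : IsCompact C) (hCc : IsPreconnected Cᶜ) {p : ℂ} (hCU : C ∩ Uᶜ = {p}) :
    IsPreconnected (U \ C) := by
  have hO : IsOpen Cᶜ := hC.isClosed.isOpen_compl
  have hun : U ∪ Cᶜ = {p}ᶜ := by
    grind
  have hUc := hUs.isPathConnected.isConnected.isPreconnected
  rw [show U \ C = U ∩ Cᶜ from rfl]
  refine isPreconnected_of_forall_pair fun w hw z hz => ?_
  obtain ⟨R, hR⟩ := compl_closedBall_subset_compl hC
  refine ⟨connectedComponentIn (U ∩ Cᶜ) w, connectedComponentIn_subset _ _,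
    mem_connectedComponentIn hw, ?_, isPreconnected_connectedComponentIn⟩
  refine joined_inter hUo hO (fun u hu h0 _ h2 => ?_) hw
    (mem_ccIn_of_isPreconnected hUc subset_rfl hw.1 hz.1)
    (mem_ccIn_of_isPreconnected hCc subset_rfl hw.2 hz.2)
  rw [hun] at hu h0 ⊢
  exact hasLog_punctured hu h0 (h2.mono hR)

theorem isPreconnected_inter_of_simplyConnected {O₁ O₂ U : Set ℂ} (hUo : IsOpen U)
    (hUs : IsSimplyConnected U) (h1 : IsOpen O₁) (h2 : IsOpen O₂) (hU : O₁ ∪ O₂ = U)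
    (hc1 : IsPreconnected O₁) (hc2 : IsPreconnected O₂) : IsPreconnected (O₁ ∩ O₂) := by
  refine isPreconnected_of_forall_pair fun w hw z hz => ?_
  refine ⟨connectedComponentIn (O₁ ∩ O₂) w, connectedComponentIn_subset _ _,
    mem_connectedComponentIn hw, ?_, isPreconnected_connectedComponentIn⟩
  refine joined_inter h1 h2 (fun u hu h0 _ _ => ?_) hw
    (mem_ccIn_of_isPreconnected hc1 subset_rfl hw.1 hz.1)
    (mem_ccIn_of_isPreconnected hc2 subset_rfl hw.2 hz.2)
  rw [hU] at hu h0 ⊢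
  exact hasLog_of_isSimplyConnected hUs hUo hu h0

section Ends

variable {U : Set ℂ} (hUo : IsOpen U) (hUs : IsSimplyConnected U) {g : ℝ → ℂ}
  (hg : ContinuousOn g (Icc 0 1)) (hi : InjOn g (Ioo 0 1)) (hgU : ∀ t ∈ Ioo (0:ℝ) 1, g t ∈ U)
  (h0 : g 0 ∉ U) (h1 : g 1 ∉ U)
include hUo hUs hg hi hgU h0 h1

/-- Opening a gap in a cross-cut reconnects the domain. -/
theorem isPreconnected_diff_ends {t₁ t₂ : ℝ} (ht₁ : 0 < t₁) (h12 : t₁ < t₂) (ht₂ : t₂ < 1) :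
    IsPreconnected (U \ (g '' Icc 0 t₁ ∪ g '' Icc t₂ 1)) := by
  have key : ∀ a b : ℝ, a ≤ b → Icc a b ⊆ Icc 0 1 → ∀ p ∈ Icc a b, g p ∉ U →
      (∀ t ∈ Icc a b, t ≠ p → t ∈ Ioo (0:ℝ) 1) → IsOpen (U \ g '' Icc a b) ∧
      IsPreconnected (U \ g '' Icc a b) := by
    intro a b hab hsub p hp hpU hin
    have hcomp : IsCompact (g '' Icc a b) := isCompact_Icc.image_of_continuousOn (hg.mono hsub)
    refine ⟨hUo.sdiff hcomp.isClosed, joined_diff_halfline hUo hUs hcomp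
      (isConnected_compl_arc hab (hg.mono hsub) ?_).isPreconnected (p := g p) ?_⟩
    · intro s hs t ht hst
      by_cases hsp : s = p <;> by_cases htp : t = p
      · rw [hsp, htp]
      · grind
      · grind
      · exact hi (hin s hs hsp) (hin t ht htp) hst
    · grind
  obtain ⟨o1, c1⟩ := key 0 t₁ ht₁.le (Icc_subset_Icc le_rfl (by linarith)) 0 (by simp [ht₁.le]) h0
    (fun t ht h => ⟨lt_of_le_of_ne ht.1 (Ne.symm h), by linarith [ht.2]⟩)
  obtain ⟨o2, c2⟩ := key t₂ 1 ht₂.le (Icc_subset_Icc (by linarith) le_rfl) 1 (by simp [ht₂.le]) h1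
    (fun t ht h => ⟨by linarith [ht.1], lt_of_le_of_ne ht.2 h⟩)
  rw [show U \ (g '' Icc 0 t₁ ∪ g '' Icc t₂ 1) = (U \ g '' Icc 0 t₁) ∩ (U \ g '' Icc t₂ 1) by
    grind]
  refine isPreconnected_inter_of_simplyConnected hUo hUs o1 o2 ?_ c1 c2
  ext z
  simp only [mem_union, Set.mem_sdiff]
  refine ⟨fun h => h.elim And.left And.left, fun hz => ?_⟩
  by_contra! hcon
  obtain ⟨s, hs, hsz⟩ := hcon.1 hz
  obtain ⟨t, ht, htz⟩ := hcon.2 hz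
  have hs' : s ∈ Ioo (0:ℝ) 1 :=
    ⟨lt_of_le_of_ne hs.1 (by rintro rfl; exact h0 (hsz ▸ hz)), by linarith [hs.2]⟩
  have ht' : t ∈ Ioo (0:ℝ) 1 :=
    ⟨by linarith [ht.1], lt_of_le_of_ne ht.2 (by rintro rfl; exact h1 (htz ▸ hz))⟩
  have := hi hs' ht' (hsz.trans htz.symm)
  linarith [hs.2, ht.1]

end Ends

theorem IsCrossCut.subset {U σ : Set X} (h : IsCrossCut U σ) : σ ⊆ U := by
  obtain ⟨g, _, _, hgU, _, _, rfl, _⟩ := h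
  exact image_subset_iff.2 hgU

theorem IsCrossCut.isConnected {U σ : Set X} (h : IsCrossCut U σ) : IsConnected σ := by
  obtain ⟨g, hg, _, _, _, _, rfl, _⟩ := h
  exact (isConnected_Ioo zero_lt_one).image g (hg.mono Ioo_subset_Icc_self)

theorem IsCrossCut.isOpen_diff [T2Space X] {U σ : Set X} (hUo : IsOpen U) (h : IsCrossCut U σ) :
    IsOpen (U \ σ) := by
  obtain ⟨g, hg, _, _, h0, h1, rfl, _⟩ := h
  have h0 := not_mem_of_frontier hUo h0
  have h1 := not_mem_of_frontier hUo h1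
  have : U \ g '' Ioo 0 1 = U \ g '' Icc 0 1 := by
    grind
  rw [this]
  exact hUo.sdiff (isCompact_Icc.image_of_continuousOn hg).isClosed

theorem IsCrossCut.subset_closure {U σ D : Set ℂ} (hUo : IsOpen U) (hUs : IsSimplyConnected U)
    (h : IsCrossCut U σ) (hD : IsCompOf (U \ σ) D) : σ ⊆ closure D := by
  have hWo := h.isOpen_diff hUo
  obtain ⟨g, hg, hi, hgU, h0, h1, rfl, D₁, D₂, hD12, -, -⟩ := h
  have h0 := not_mem_of_frontier hUo h0
  have h1 := not_mem_of_frontier hUo h1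
  rintro y ⟨t, ht, rfl⟩
  by_contra hy
  have hca : ContinuousAt g t := hg.continuousAt (Icc_mem_nhds ht.1 ht.2)
  have hnear : ∀ᶠ s in 𝓝 t, g s ∉ closure D ∧ s ∈ Ioo (0:ℝ) 1 :=
    (hca.eventually (isClosed_closure.isOpen_compl.mem_nhds hy)).and (Ioo_mem_nhds ht.1 ht.2)
  obtain ⟨a, b, hab, hsub⟩ := mem_nhds_iff_exists_Ioo_subset.1 hnear
  obtain ⟨t₁, ha1, h1t⟩ := exists_between hab.1
  obtain ⟨t₂, ht2, h2b⟩ := exists_between hab.2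
  have m1 := hsub ⟨ha1, h1t.trans hab.2⟩
  have m2 := hsub ⟨hab.1.trans ht2, h2b⟩
  have hV := isPreconnected_diff_ends hUo hUs hg hi hgU h0 h1 m1.2.1 (h1t.trans ht2) m2.2.2
  set V := U \ (g '' Icc 0 t₁ ∪ g '' Icc t₂ 1) with hVdef
  have hσV : U \ g '' Ioo 0 1 ⊆ V := by
    grind
  have hDV : V ⊆ D := by
    refine hV.subset_of_closure_inter_subset (hD.isOpen hWo) ?_ ?_
    · obtain ⟨z, hz⟩ := hD.nonempty
      exact ⟨z, hσV (hD.subset hz), hz⟩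
    · rintro z ⟨hz, hzV⟩
      refine hD.mem_of_mem_closure ⟨hzV.1, ?_⟩ hz
      rintro ⟨s, hs, rfl⟩
      have hs1 : t₁ < s := by
        grind
      have hs2 : s < t₂ := by
        grind
      exact (hsub ⟨ha1.trans hs1, hs2.trans h2b⟩).1 hz
  have e1 : D₁ = D := by
    obtain ⟨z, hz⟩ := hD12.1.nonempty
    exact hD12.1.eq_of_mem hD hz (hDV (hσV (hD12.1.subset hz)))
  have e2 : D₂ = D := by
    obtain ⟨z, hz⟩ := hD12.2.1.nonempty
    exact hD12.2.1.eq_of_mem hD hz (hDV (hσV (hD12.2.1.subset hz)))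
  exact hD12.2.2.1 (e1.trans e2.symm)

theorem IsCrossCut.bdIn_eq {U σ D : Set ℂ} (hUo : IsOpen U) (hUs : IsSimplyConnected U)
    (h : IsCrossCut U σ) (hD : IsCompOf (U \ σ) D) : bdIn U D = σ := by
  ext y
  constructor
  · rintro ⟨⟨hy, hn⟩, hU⟩
    by_contra hσ
    exact hn (hD.mem_of_mem_closure ⟨hU, hσ⟩ hy)
  · intro hy
    exact ⟨⟨h.subset_closure hUo hUs hD hy, fun hyD => (hD.subset hyD).2 hy⟩, h.subset hy⟩

/-- If a relatively closed set separates two points of a simply connected domain, then so does one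
of its components. -/
theorem exists_comp_separating {U Y : Set ℂ} (hUo : IsOpen U) (hUs : IsSimplyConnected U)
    (hYo : IsOpen (U \ Y)) {w z : ℂ} (hw : w ∈ U \ Y) (hz : z ∈ U \ Y)
    (hwz : z ∉ connectedComponentIn (U \ Y) w) :
    ∃ c ⊆ Y, IsPreconnected c ∧ c ⊆ U ∧ c.Nonempty ∧ z ∉ connectedComponentIn (U \ c) w := by
  have hUc := hUs.isPathConnected.isConnected.isPreconnected
  set P := connectedComponentIn (U \ Y) w with hP
  have hPo : IsOpen P := isOpen_ccIn hYo w
  have hPc : IsPreconnected P := isPreconnected_connectedComponentIn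
  have hPU : P ⊆ U := (connectedComponentIn_subset _ _).trans sdiff_subset
  have hwP : w ∈ P := mem_connectedComponentIn hw
  have hcomp : IsCompOf (U \ Y) P := isCompOf_cc hw
  have hzcl : z ∈ U \ closure P := ⟨hz.1, fun h => hwz (hcomp.mem_of_mem_closure hz h)⟩
  have hWo : IsOpen (U \ closure P) := hUo.sdiff isClosed_closure
  set Q := connectedComponentIn (U \ closure P) z with hQ
  have hQo : IsOpen Q := isOpen_ccIn hWo z
  have hQcomp : IsCompOf (U \ closure P) Q := isCompOf_cc hzcl
  have hzQ : z ∈ Q := mem_connectedComponentIn hzcl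
  have hQU : Q ⊆ U := hQcomp.subset.trans sdiff_subset
  -- frontier of Q inside U
  have hFP : ∀ y ∈ closure Q ∩ U, y ∉ Q → y ∈ closure P ∧ y ∈ Y ∧ y ∉ P := by
    rintro y ⟨hyQ, hyU⟩ hyn
    have hycl : y ∈ closure P := by
      by_contra hy
      exact hyn (hQcomp.mem_of_mem_closure ⟨hyU, hy⟩ hyQ)
    have hyP : y ∉ P := fun hyP => by
      obtain ⟨v, hvP, hvQ⟩ := mem_closure_iff.1 hyQ P hPo hyP
      exact (hQcomp.subset hvQ).2 (subset_closure hvP)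
    refine ⟨hycl, ?_, hyP⟩
    by_contra hyY
    exact hyP (hcomp.mem_of_mem_closure ⟨hyU, hyY⟩ hycl)
  set Fr := (closure Q \ Q) ∩ U with hFr
  have hFrw : ∀ c : Set ℂ, Fr ⊆ c → c ⊆ Y → z ∉ connectedComponentIn (U \ c) w := by
    intro c hc hcY hcon
    have hsub : connectedComponentIn (U \ c) w ⊆ Q := by
      refine isPreconnected_connectedComponentIn.subset_of_closure_inter_subset hQo ⟨z, hcon, hzQ⟩ ?_
      rintro y ⟨hy, hy'⟩
      by_contra hyn
      have := connectedComponentIn_subset _ _ hy'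
      grind
    have := hsub (mem_connectedComponentIn ⟨hw.1, fun h => hw.2 (hcY h)⟩)
    exact (hQcomp.subset this).2 (subset_closure hwP)
  have hFrY : Fr ⊆ Y := fun y hy => (hFP y ⟨hy.1.1, hy.2⟩ hy.1.2).2.1
  refine ⟨Fr, hFrY, ?_, inter_subset_right, ?_, hFrw Fr subset_rfl hFrY⟩
  · -- connectedness
    rw [isPreconnected_iff_subset_of_disjoint_closed]
    by_contra! hcon
    obtain ⟨F₁, F₂, hF1, hF2, hsub, hdisj, hn1, hn2⟩ := hcon
    have hO : ∀ F : Set ℂ, IsClosed F → IsOpen (U \ (Fr ∩ F)) := by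
      intro F hF
      have : U \ (Fr ∩ F) = U \ ((closure Q ∩ Qᶜ) ∩ F) := by
        grind
      rw [this]
      exact hUo.sdiff ((isClosed_closure.inter hQo.isClosed_compl).inter hF)
    have hun : (U \ (Fr ∩ F₁)) ∪ (U \ (Fr ∩ F₂)) = U := by
      ext y
      simp only [mem_union, Set.mem_sdiff, mem_inter_iff]
      grind
    have hinter : (U \ (Fr ∩ F₁)) ∩ (U \ (Fr ∩ F₂)) = U \ Fr := by
      grind
    have hj : ∀ F : Set ℂ, (∃ y ∈ Fr, y ∉ F) → z ∈ connectedComponentIn (U \ (Fr ∩ F)) w := by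
      rintro F ⟨y, hy, hyF⟩
      have hyP := hFP y ⟨hy.1.1, hy.2⟩ hy.1.2
      have c1 : IsPreconnected (insert y P) :=
        hPc.subset_closure (subset_insert _ _) (insert_subset hyP.1 subset_closure)
      have c2 : IsPreconnected (insert y Q) :=
        hQcomp.isPreconnected.subset_closure (subset_insert _ _) (insert_subset hy.1.1 subset_closure)
      refine mem_ccIn_of_isPreconnected (c1.union y (mem_insert _ _) (mem_insert _ _) c2) ?_
        (Or.inl (Or.inr hwP)) (Or.inr (Or.inr hzQ))
      have hyU : y ∈ U \ (Fr ∩ F) := ⟨hy.2, fun h => hyF h.2⟩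
      refine union_subset (insert_subset hyU ?_) (insert_subset hyU ?_)
      · grind
      · grind
    refine hFrw Fr subset_rfl hFrY ?_
    rw [← hinter]
    refine joined_inter (hO F₁ hF1) (hO F₂ hF2) (fun u hu h0 _ _ => ?_) ?_
      (hj F₁ (not_subset.1 hn1)) (hj F₂ (not_subset.1 hn2))
    · rw [hun] at hu h0 ⊢
      exact hasLog_of_isSimplyConnected hUs hUo hu h0
    · grind
  · by_contra hne
    rw [not_nonempty_iff_eq_empty] at hne
    refine hFrw ∅ (by rw [hne]) (empty_subset _) ?_
    rw [sdiff_empty]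
    exact mem_ccIn_of_isPreconnected hUc subset_rfl hw.1 hz.1

theorem exists_isCompOf_separating {U Y : Set ℂ} (hUo : IsOpen U) (hUs : IsSimplyConnected U)
    (hYo : IsOpen (U \ Y)) {w z : ℂ} (hw : w ∈ U \ Y) (hz : z ∈ U \ Y)
    (hwz : z ∉ connectedComponentIn (U \ Y) w) :
    ∃ c, IsCompOf Y c ∧ z ∉ connectedComponentIn (U \ c) w := by
  obtain ⟨c, hcY, hcc, hcU, ⟨y, hy⟩, hsep⟩ := exists_comp_separating hUo hUs hYo hw hz hwz
  refine ⟨connectedComponentIn Y y, isCompOf_cc (hcY hy), fun h => hsep ?_⟩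
  exact connectedComponentIn_mono w
    (sdiff_subset_sdiff_right (hcc.subset_connectedComponentIn hy hcY)) h

/-- The maximal open interval of parameters around `θ₀` mapped into an open set. -/
theorem exists_maximal_interval {U : Set X} (hUo : IsOpen U) {e : ℝ → X} (he : Continuous e)
    {θ₁ θ₀ θ₂ : ℝ} (h10 : θ₁ < θ₀) (h02 : θ₀ < θ₂) (h1 : e θ₁ ∉ U) (h0 : e θ₀ ∈ U) (h2 : e θ₂ ∉ U) :
    ∃ α β, θ₁ ≤ α ∧ α < θ₀ ∧ θ₀ < β ∧ β ≤ θ₂ ∧ (∀ t ∈ Ioo α β, e t ∈ U) ∧ e α ∈ frontier U ∧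
      e β ∈ frontier U := by
  have hcl : IsClosed (e ⁻¹' Uᶜ) := hUo.isClosed_compl.preimage he
  have k1 : IsCompact (e ⁻¹' Uᶜ ∩ Icc θ₁ θ₀) := isCompact_Icc.inter_left hcl
  have k2 : IsCompact (e ⁻¹' Uᶜ ∩ Icc θ₀ θ₂) := isCompact_Icc.inter_left hcl
  obtain ⟨α, ⟨hαU, hα⟩, hαmax⟩ := k1.exists_isGreatest ⟨θ₁, h1, le_rfl, h10.le⟩
  obtain ⟨β, ⟨hβU, hβ⟩, hβmin⟩ := k2.exists_isLeast ⟨θ₂, h2, h02.le, le_rfl⟩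
  have hα0 : α < θ₀ := lt_of_le_of_ne hα.2 (by rintro rfl; exact hαU h0)
  have hβ0 : θ₀ < β := lt_of_le_of_ne hβ.1 (by rintro rfl; exact hβU h0)
  have hin : ∀ t ∈ Ioo α β, e t ∈ U := by
    intro t ht
    by_contra hcon
    rcases le_total t θ₀ with h | h
    · exact absurd (hαmax ⟨hcon, hα.1.trans ht.1.le, h⟩) (not_le.2 ht.1)
    · exact absurd (hβmin ⟨hcon, h, ht.2.le.trans hβ.2⟩) (not_le.2 ht.2)
  have hcl : ∀ t ∈ Icc α β, e t ∈ closure U := by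
    intro t ht
    rw [← closure_Ioo (hα0.trans hβ0).ne] at ht
    exact map_mem_closure he ht hin
  refine ⟨α, β, hα.1, hα0, hβ0, hβ.2, hin, ?_, ?_⟩
  · rw [hUo.frontier_eq]; grind
  · rw [hUo.frontier_eq]; grind

theorem IsPreconnected.subset_ball {M : Type*} [PseudoMetricSpace M] {T : Set M} (hT : IsPreconnected T) {a : M} {R : ℝ}
    (hS : Disjoint T (Metric.sphere a R)) (h : (T ∩ Metric.ball a R).Nonempty) :
    T ⊆ Metric.ball a R := by
  refine hT.subset_of_closure_inter_subset Metric.isOpen_ball h ?_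
  rintro y ⟨hy, hyT⟩
  have h1 : dist y a ≤ R := Metric.closure_ball_subset_closedBall hy
  exact lt_of_le_of_ne h1 fun h => Set.disjoint_left.1 hS hyT h

theorem IsPreconnected.subset_compl_closedBall {M : Type*} [PseudoMetricSpace M] {T : Set M}
    (hT : IsPreconnected T) {a : M} {R : ℝ}
    (hS : Disjoint T (Metric.sphere a R)) (h : (T ∩ (Metric.closedBall a R)ᶜ).Nonempty) :
    T ⊆ (Metric.closedBall a R)ᶜ := by
  obtain ⟨y, hyT, hy⟩ := h
  intro x hx hxb
  have hxb' : dist x a ≤ R := hxb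
  have : x ∈ Metric.ball a R := lt_of_le_of_ne hxb' fun h => Set.disjoint_left.1 hS hx h
  exact hy (Metric.ball_subset_closedBall (hT.subset_ball hS ⟨x, hx, this⟩ hyT))

theorem exists_mem_frontier_of_isPreconnected {T U : Set X} (hT : IsPreconnected T)
    (h1 : (T ∩ U).Nonempty) (h2 : (T \ U).Nonempty) : (T ∩ frontier U).Nonempty := by
  by_contra hcon
  rw [not_nonempty_iff_eq_empty] at hcon
  have hsub : T ⊆ interior U ∪ (closure U)ᶜ := by
    intro x hx
    by_contra h
    simp only [mem_union, mem_compl_iff, not_or, not_not] at h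
    exact (hcon ▸ (⟨hx, h.2, h.1⟩ : x ∈ T ∩ frontier U) : x ∈ (∅ : Set X))
  obtain ⟨x, hx, hxU⟩ := h1
  obtain ⟨y, hy, hyU⟩ := h2
  obtain ⟨v, _, hv1, hv2⟩ := hT _ _ isOpen_interior isClosed_closure.isOpen_compl hsub
    ⟨x, hx, (hsub hx).resolve_right fun h => h (subset_closure hxU)⟩
    ⟨y, hy, (hsub hy).resolve_left fun h => hyU (interior_subset h)⟩
  exact hv2 (subset_closure (interior_subset hv1))

theorem IsSimplyConnected.exists_sphere_not_mem {U : Set ℂ} (hUo : IsOpen U)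
    (hUs : IsSimplyConnected U) {a : ℂ} (ha : a ∉ U) {r : ℝ} (hr : 0 < r) :
    ∃ z ∈ Metric.sphere a r, z ∉ U := by
  by_contra! h
  refine not_hasLog_sphere a hr (HasLog.mono (hasLog_of_isSimplyConnected hUs hUo (by fun_prop)
    fun z hz => ?_) h)
  exact sub_ne_zero.2 fun h => ha (h ▸ hz)

theorem circleMap_inj_of_lt {a : ℂ} {R : ℝ} (hR : R ≠ 0) {s t : ℝ} (h : |s - t| < 2 * Real.pi)
    (hst : circleMap a R s = circleMap a R t) : s = t := by
  obtain ⟨n, hn⟩ := (circleMap_eq_circleMap_iff a hR).1 hst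
  have h2 : s = t + n * (2 * Real.pi) := by
    have := congrArg Complex.im hn
    simpa using this
  have hpi := Real.pi_pos
  have : |(n:ℝ)| < 1 := by
    rw [h2, add_sub_cancel_left, abs_mul, abs_of_pos (by positivity : 0 < 2 * Real.pi)] at h
    nlinarith
  have : n = 0 := by
    have := abs_lt.1 this
    have h3 : (-1:ℤ) < n := by exact_mod_cast this.1
    have h4 : n < (1:ℤ) := by exact_mod_cast this.2
    omega
  rw [h2, this]; simp

theorem exists_circleMap_eq_Ico {a : ℂ} {R : ℝ} (hR : 0 < R) {z : ℂ} (hz : z ∈ Metric.sphere a R) (α : ℝ) :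
    ∃ θ ∈ Ico α (α + 2 * Real.pi), circleMap a R θ = z := by
  rw [← abs_of_pos hR, ← range_circleMap] at hz
  obtain ⟨θ, rfl⟩ := hz
  obtain ⟨y, hy, h⟩ := (periodic_circleMap a R).exists_mem_Ico (by positivity : 0 < 2 * Real.pi) θ α
  exact ⟨y, hy, h.symm⟩

/-- Components of the trace of a simply connected domain on a circle are open circular arcs. -/
theorem exists_arc_of_isCompOf_sphere {U : Set ℂ} (hUo : IsOpen U) (hUs : IsSimplyConnected U)
    {a : ℂ} (ha : a ∉ U) {R : ℝ} (hR : 0 < R) {c : Set ℂ} (hc : IsCompOf (Metric.sphere a R ∩ U) c) :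
    ∃ α β, α < β ∧ β ≤ α + 2 * Real.pi ∧ (∀ t ∈ Ioo α β, circleMap a R t ∈ U) ∧
      circleMap a R α ∈ frontier U ∧ circleMap a R β ∈ frontier U ∧
      c = circleMap a R '' Ioo α β := by
  obtain ⟨q, hqS, hqU⟩ := hUs.exists_sphere_not_mem hUo ha hR
  obtain ⟨p, hp⟩ := hc.nonempty
  have hpSU := hc.subset hp
  obtain ⟨θ₁, -, h1⟩ := exists_circleMap_eq_Ico hR hqS 0
  obtain ⟨θ₀, h0, h0p⟩ := exists_circleMap_eq_Ico hR hpSU.1 θ₁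
  have hne : θ₁ ≠ θ₀ := by rintro rfl; exact hqU (h1 ▸ h0p ▸ hpSU.2)
  have h2 : circleMap a R (θ₁ + 2 * Real.pi) = circleMap a R θ₁ := periodic_circleMap a R θ₁
  obtain ⟨α, β, hα1, hα, hβ, hβ2, hin, hαf, hβf⟩ := exists_maximal_interval hUo (continuous_circleMap a R)
    (lt_of_le_of_ne h0.1 hne) h0.2 (h1 ▸ hqU) (h0p ▸ hpSU.2) (by rw [h2, h1]; exact hqU)
  have hαβ : α < β := hα.trans hβ
  have hβ3 : β ≤ α + 2 * Real.pi := by linarith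
  refine ⟨α, β, hαβ, hβ3, hin, hαf, hβf, ?_⟩
  have hαU := not_mem_of_frontier hUo hαf
  have hβU := not_mem_of_frontier hUo hβf
  have hmS : ∀ t, circleMap a R t ∈ Metric.sphere a R := fun t => circleMap_mem_sphere a hR.le t
  have hcomp : IsCompOf (Metric.sphere a R ∩ U) (circleMap a R '' Ioo α β) := by
    refine isCompOf_of_clopen ((isConnected_Ioo hαβ).image _ (continuous_circleMap a R).continuousOn)
      (isCompact_Icc.image (continuous_circleMap a R)).isClosed (F := circleMap a R '' Icc α β)
      (isCompact_Icc.image (continuous_circleMap a R)).isClosed.isOpen_compl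
      (V := (circleMap a R '' Icc β (α + 2 * Real.pi))ᶜ) ?_ ?_
    · ext z
      constructor
      · rintro ⟨t, ht, rfl⟩
        exact ⟨⟨hmS t, hin t ht⟩, t, Ioo_subset_Icc_self ht, rfl⟩
      · rintro ⟨⟨_, hz⟩, t, ht, rfl⟩
        refine ⟨t, ⟨lt_of_le_of_ne ht.1 ?_, lt_of_le_of_ne ht.2 ?_⟩, rfl⟩
        · rintro rfl; exact hαU hz
        · rintro rfl; exact hβU hz
    · ext z
      constructor
      · rintro ⟨t, ht, rfl⟩
        refine ⟨⟨hmS t, hin t ht⟩, ?_⟩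
        rintro ⟨s, hs, hst⟩
        have := circleMap_inj_of_lt hR.ne' (abs_lt.2 ⟨by linarith [hs.1, ht.2, ht.1, hs.2, Real.pi_pos],
          by linarith [hs.1, ht.2, ht.1, hs.2]⟩) hst
        linarith [hs.1, ht.2]
      · rintro ⟨⟨hzS, hz⟩, hzn⟩
        obtain ⟨t, ht, rfl⟩ := exists_circleMap_eq_Ico hR hzS α
        refine ⟨t, ⟨lt_of_le_of_ne ht.1 ?_, ?_⟩, rfl⟩
        · rintro rfl; exact hαU hz
        · by_contra! h
          exact hzn ⟨t, ⟨h, ht.2.le⟩, rfl⟩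
  exact hc.eq_of_mem hcomp hp ⟨θ₀, ⟨hα, hβ⟩, h0p⟩

theorem isCrossCut_of_arc_Icc {U : Set ℂ} (hUo : IsOpen U) (hUs : IsSimplyConnected U) {g : ℝ → ℂ}
    {s t : ℝ} (hst : s < t) (hg : ContinuousOn g (Icc s t)) (hi : InjOn g (Icc s t))
    (hgU : ∀ x ∈ Ioo s t, g x ∈ U) (h0f : g s ∈ frontier U) (h1f : g t ∈ frontier U) :
    IsCrossCut U (g '' Ioo s t) := by
  have hd : 0 < t - s := sub_pos.2 hst
  set φ : ℝ → ℝ := fun x => s + x * (t - s) with hφ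
  have hφc : Continuous φ := by fun_prop
  have hφi : Function.Injective φ := fun x y h => by
    simp only [hφ, add_right_inj] at h; exact mul_right_cancel₀ hd.ne' h
  have hφI : φ '' Ioo 0 1 = Ioo s t := by
    ext x
    constructor
    · rintro ⟨y, hy, rfl⟩
      constructor <;> simp only [hφ] <;> nlinarith [hy.1, hy.2]
    · intro hx
      refine ⟨(x - s) / (t - s), ⟨div_pos (by linarith [hx.1]) hd, (div_lt_one hd).2 (by linarith [hx.2])⟩, ?_⟩
      simp only [hφ]; field_simp; ring
  have hφm : MapsTo φ (Icc 0 1) (Icc s t) := fun y hy => by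
    constructor <;> simp only [hφ] <;> nlinarith [hy.1, hy.2]
  have e0 : φ 0 = s := by simp [hφ]
  have e1 : φ 1 = t := by simp [hφ]
  have := isCrossCut_of_arc hUo hUs (g := g ∘ φ) (hg.comp hφc.continuousOn hφm)
    (hi.comp hφi.injOn hφm) (fun x hx => hgU _ (hφI ▸ mem_image_of_mem φ hx))
    (by simpa [e0] using not_mem_of_frontier hUo h0f) (by simpa [e1] using not_mem_of_frontier hUo h1f)
    (by simpa [e0] using h0f) (by simpa [e1] using h1f)
  rwa [image_comp, hφI] at this

/-- Components of the trace of a simply connected domain on a circle centred off the domain are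
cross-cuts. -/
theorem isCrossCut_of_isCompOf_sphere {U : Set ℂ} (hUo : IsOpen U) (hUs : IsSimplyConnected U)
    {a : ℂ} (ha : a ∉ U) {R : ℝ} (hR : 0 < R) {c : Set ℂ} (hc : IsCompOf (Metric.sphere a R ∩ U) c) :
    IsCrossCut U c := by
  obtain ⟨α, β, hαβ, hβ, hin, hαf, hβf, rfl⟩ := exists_arc_of_isCompOf_sphere hUo hUs ha hR hc
  rcases hβ.lt_or_eq with hβ | rfl
  · refine isCrossCut_of_arc_Icc hUo hUs hαβ (continuous_circleMap a R).continuousOn ?_ hin hαf hβf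
    intro s hs t ht h
    exact circleMap_inj_of_lt hR.ne' (abs_lt.2 ⟨by linarith [hs.1, ht.2], by linarith [hs.2, ht.1]⟩) h
  have hmS : ∀ t, circleMap a R t ∈ Metric.sphere a R := fun t => circleMap_mem_sphere a hR.le t
  have hαU := not_mem_of_frontier hUo hαf
  set e := circleMap a R with he
  have hUc := hUs.isPathConnected.isConnected.isPreconnected
  have hcS : e '' Ioo α (α + 2 * Real.pi) = Metric.sphere a R ∩ U := by
    refine subset_antisymm hc.subset ?_
    rintro z ⟨hzS, hzU⟩
    obtain ⟨t, ht, rfl⟩ := exists_circleMap_eq_Ico hR hzS α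
    exact ⟨t, ⟨lt_of_le_of_ne ht.1 (by rintro rfl; exact hαU hzU), ht.2⟩, rfl⟩
  have hSU : Metric.sphere a R ∩ Uᶜ = {e α} := by
    ext z
    constructor
    · rintro ⟨hzS, hzU⟩
      obtain ⟨t, ht, rfl⟩ := exists_circleMap_eq_Ico hR hzS α
      rcases eq_or_lt_of_le ht.1 with h | h
      · rw [← h]; rfl
      · exact (hzU (hin t ⟨h, ht.2⟩)).elim
    · rintro rfl; exact ⟨hmS α, hαU⟩
  have hSc : IsCompact (Metric.sphere a R) := isCompact_sphere a R
  have hW : U \ e '' Ioo α (α + 2 * Real.pi) = (Metric.sphere a R)ᶜ ∩ U := by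
    rw [hcS]; ext z; simp only [Set.mem_sdiff, mem_inter_iff, mem_compl_iff]; tauto
  have hun : (Metric.sphere a R)ᶜ ∪ U = {e α}ᶜ := by
    rw [← hSU, compl_inter, compl_compl]
  have hjoin : ∀ T : Set ℂ, IsPreconnected T → T ⊆ (Metric.sphere a R)ᶜ → ∀ w ∈ T ∩ U, ∀ z ∈ T ∩ U,
      z ∈ connectedComponentIn ((Metric.sphere a R)ᶜ ∩ U) w := by
    intro T hT hTS w hw z hz
    refine joined_inter hSc.isClosed.isOpen_compl hUo (fun u hu h0 h1 _ => ?_) ⟨hTS hw.1, hw.2⟩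
      (mem_ccIn_of_isPreconnected hT hTS hw.1 hz.1)
      (mem_ccIn_of_isPreconnected hUc subset_rfl hw.2 hz.2)
    obtain ⟨R', hR'⟩ := compl_closedBall_subset_compl hSc
    rw [hun] at hu h0 ⊢
    exact hasLog_punctured hu h0 (h1.mono hR')
  have hb : Metric.ball a R ⊆ (Metric.sphere a R)ᶜ := fun z hz hzS => by
    have h1 : dist z a < R := hz
    have h2 : dist z a = R := hzS
    exact h1.ne h2
  have hb' : (Metric.closedBall a R)ᶜ ⊆ (Metric.sphere a R)ᶜ :=
    compl_subset_compl.2 Metric.sphere_subset_closedBall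
  have hbc : IsPreconnected (Metric.ball a R) := (convex_ball a R).isPreconnected
  have hbc' : IsPreconnected (Metric.closedBall a R)ᶜ := (isConnected_compl_closedBall a hR).isPreconnected
  -- points on both sides
  obtain ⟨p, hp⟩ := hc.nonempty
  obtain ⟨t, ht, rfl⟩ := hp
  have hscale : ContinuousAt (fun ρ : ℝ => circleMap a ρ t) R := by
    unfold circleMap; fun_prop
  have hev : ∀ᶠ ρ in 𝓝 R, circleMap a ρ t ∈ U ∧ 0 < ρ :=
    (hscale.eventually (hUo.mem_nhds (hin t ht))).and (lt_mem_nhds hR)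
  have hdist : ∀ ρ : ℝ, 0 < ρ → dist (circleMap a ρ t) a = ρ := fun ρ hρ =>
    circleMap_mem_sphere a hρ.le t
  obtain ⟨x, y, hxy, hsub⟩ := mem_nhds_iff_exists_Ioo_subset.1 hev
  obtain ⟨ρ₁, hx1, h1R⟩ := exists_between hxy.1
  obtain ⟨ρ₂, hR2, h2y⟩ := exists_between hxy.2
  have m1 := hsub ⟨hx1, h1R.trans hxy.2⟩
  have m2 := hsub ⟨hxy.1.trans hR2, h2y⟩
  set w₁ := circleMap a ρ₁ t
  set w₂ := circleMap a ρ₂ t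
  have hw1 : w₁ ∈ Metric.ball a R := by rw [Metric.mem_ball, hdist _ m1.2]; exact h1R
  have hw2 : w₂ ∈ (Metric.closedBall a R)ᶜ := by
    rw [mem_compl_iff, Metric.mem_closedBall, hdist _ m2.2, not_le]; exact hR2
  set W := (Metric.sphere a R)ᶜ ∩ U with hWdef
  have hw1W : w₁ ∈ W := ⟨hb hw1, m1.1⟩
  have hw2W : w₂ ∈ W := ⟨hb' hw2, m2.1⟩
  have hdis : ∀ w, Disjoint (connectedComponentIn W w) (Metric.sphere a R) := fun w =>
    disjoint_left.2 fun z hz hzS => (connectedComponentIn_subset _ _ hz).1 hzS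
  have hC1 : connectedComponentIn W w₁ = Metric.ball a R ∩ U :=
    subset_antisymm (subset_inter (isPreconnected_connectedComponentIn.subset_ball (hdis _)
      ⟨w₁, mem_connectedComponentIn hw1W, hw1⟩) ((connectedComponentIn_subset _ _).trans inter_subset_right))
      fun z hz => hjoin _ hbc hb _ ⟨hw1, m1.1⟩ _ hz
  have hC2 : connectedComponentIn W w₂ = (Metric.closedBall a R)ᶜ ∩ U :=
    subset_antisymm (subset_inter (isPreconnected_connectedComponentIn.subset_compl_closedBall (hdis _)
      ⟨w₂, mem_connectedComponentIn hw2W, hw2⟩) ((connectedComponentIn_subset _ _).trans inter_subset_right))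
      fun z hz => hjoin _ hbc' hb' _ ⟨hw2, m2.1⟩ _ hz
  have hpi : 0 < 2 * Real.pi := by positivity
  set φ : ℝ → ℝ := fun x => α + x * (2 * Real.pi) with hφ
  have hφI : φ '' Ioo 0 1 = Ioo α (α + 2 * Real.pi) := by
    ext x
    constructor
    · rintro ⟨y, hy, rfl⟩
      constructor <;> simp only [hφ] <;> nlinarith [hy.1, hy.2]
    · intro hx
      refine ⟨(x - α) / (2 * Real.pi), ⟨div_pos (by linarith [hx.1]) hpi, (div_lt_one hpi).2 (by linarith [hx.2])⟩, ?_⟩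
      simp only [hφ]; field_simp; ring
  have hgS : (e ∘ φ) '' Icc 0 1 ⊆ Metric.sphere a R := by rintro _ ⟨x, -, rfl⟩; exact hmS _
  have hfr : ∀ T : Set ℂ, IsOpen T → IsPreconnected T → T ⊆ (Metric.sphere a R)ᶜ → (T ∩ U).Nonempty →
      (T \ U).Nonempty → (frontier (T ∩ U) ∩ (frontier U \ (e ∘ φ) '' Icc 0 1)).Nonempty := by
    intro T hTo hT hTS h1 h2
    obtain ⟨z, hzT, hz⟩ := exists_mem_frontier_of_isPreconnected hT h1 h2
    refine ⟨z, ?_, hz, fun h => hTS hzT (hgS h)⟩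
    rw [(hTo.inter hUo).frontier_eq]
    refine ⟨?_, fun h => not_mem_of_frontier hUo hz h.2⟩
    exact hTo.inter_closure ⟨hzT, hz.1⟩
  obtain ⟨q, hqS, hqU⟩ := hUs.exists_sphere_not_mem hUo ha (r := R + 1) (by linarith)
  refine ⟨e ∘ φ, ((continuous_circleMap a R).comp (by fun_prop)).continuousOn, ?_, ?_, ?_, ?_, ?_,
    connectedComponentIn W w₁, connectedComponentIn W w₂, ⟨?_, ?_, ?_, ?_⟩, ?_, ?_⟩
  · intro x hx y hy h
    have := circleMap_inj_of_lt hR.ne' (abs_lt.2 ⟨?_, ?_⟩) h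
    · simp only [hφ, add_right_inj] at this; exact mul_right_cancel₀ hpi.ne' this
    · simp only [hφ]; nlinarith [hx.1, hx.2, hy.1, hy.2]
    · simp only [hφ]; nlinarith [hx.1, hx.2, hy.1, hy.2]
  · intro x hx
    exact hin _ (hφI ▸ mem_image_of_mem φ hx)
  · simpa [hφ] using hαf
  · simpa [hφ] using hβf
  · rw [image_comp, hφI]
  · rw [hW]; exact isCompOf_cc hw1W
  · rw [hW]; exact isCompOf_cc hw2W
  · rw [hC1, hC2]
    intro h
    have : w₁ ∈ (Metric.closedBall a R)ᶜ ∩ U := h ▸ ⟨hw1, m1.1⟩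
    exact this.1 (Metric.ball_subset_closedBall hw1)
  · intro x hx
    rw [hW] at hx ⊢
    rcases lt_or_ge (dist x a) R with h | h
    · left
      exact (connectedComponentIn_eq (hjoin _ hbc hb _ ⟨hw1, m1.1⟩ x ⟨h, hx.2⟩)).symm
    · right
      have : x ∈ (Metric.closedBall a R)ᶜ := by
        rw [mem_compl_iff, Metric.mem_closedBall, not_le]
        exact lt_of_le_of_ne h fun h' => hx.1 h'.symm
      exact (connectedComponentIn_eq (hjoin _ hbc' hb' _ ⟨hw2, m2.1⟩ x ⟨this, hx.2⟩)).symm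
  · rw [hC1]
    exact hfr _ Metric.isOpen_ball hbc hb ⟨w₁, hw1, m1.1⟩ ⟨a, Metric.mem_ball_self hR, ha⟩
  · rw [hC2]
    refine hfr _ Metric.isClosed_closedBall.isOpen_compl hbc' hb' ⟨w₂, hw2, m2.1⟩ ⟨q, ?_, hqU⟩
    have : dist q a = R + 1 := hqS
    rw [mem_compl_iff, Metric.mem_closedBall, this]; linarith

/-- A circle centred off a simply connected domain, meeting a connected subset on both sides, contains
a cross-cut separating the two points. -/
theorem exists_circular_crossCut {U : Set ℂ} (hUo : IsOpen U) (hUs : IsSimplyConnected U)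
    {a : ℂ} (ha : a ∉ U) {R : ℝ} (hR : 0 < R) {x y : ℂ} (hx : x ∈ U) (hy : y ∈ U)
    (hxy : (dist x a < R ∧ R < dist y a) ∨ (dist y a < R ∧ R < dist x a)) :
    ∃ c, IsCompOf (Metric.sphere a R ∩ U) c ∧ IsCrossCut U c ∧ y ∉ connectedComponentIn (U \ c) x := by
  have hnot : ∀ v, v ∈ U → dist v a ≠ R → v ∈ U \ (Metric.sphere a R ∩ U) :=
    fun v hv h => ⟨hv, fun h' => h h'.1⟩
  have hxR : dist x a ≠ R := by rcases hxy with h | h; exacts [h.1.ne, h.2.ne']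
  have hyR : dist y a ≠ R := by rcases hxy with h | h; exacts [h.2.ne', h.1.ne]
  have h1 : IsOpen (U \ (Metric.sphere a R ∩ U)) := by
    rw [show U \ (Metric.sphere a R ∩ U) = U \ Metric.sphere a R by
      ext; simp only [Set.mem_sdiff, mem_inter_iff]; tauto]
    exact hUo.sdiff Metric.isClosed_sphere
  have h2 : y ∉ connectedComponentIn (U \ (Metric.sphere a R ∩ U)) x := by
    intro hcon
    have hmem := mem_connectedComponentIn (hnot x hx hxR)
    have hdis : Disjoint (connectedComponentIn (U \ (Metric.sphere a R ∩ U)) x) (Metric.sphere a R) :=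
      disjoint_left.2 fun z hz hzS => by
        have := connectedComponentIn_subset _ _ hz
        exact this.2 ⟨hzS, this.1⟩
    rcases hxy with h | h
    · have := isPreconnected_connectedComponentIn.subset_ball hdis ⟨x, hmem, h.1⟩ hcon
      exact absurd this (not_lt.2 h.2.le)
    · have := isPreconnected_connectedComponentIn.subset_ball hdis ⟨y, hcon, h.1⟩ hmem
      exact absurd this (not_lt.2 h.2.le)
  obtain ⟨c, hc, hsep⟩ := exists_isCompOf_separating hUo hUs h1 (hnot x hx hxR) (hnot y hy hyR) h2
  exact ⟨c, hc, isCrossCut_of_isCompOf_sphere hUo hUs ha hR hc, hsep⟩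

section Transport

variable {Y : Type u} [TopologicalSpace Y] (e : X ≃ₜ Y)

theorem IsCompOf.image {A D : Set X} (h : IsCompOf A D) : IsCompOf (e '' A) (e '' D) := by
  obtain ⟨x, hx, rfl⟩ := h
  exact ⟨e x, mem_image_of_mem _ hx, e.image_connectedComponentIn hx⟩

theorem Homeomorph.symm_image_image' (A : Set X) : e.symm '' (e '' A) = A := by
  simp [image_image]

theorem Homeomorph.image_symm_image' (A : Set Y) : e '' (e.symm '' A) = A := by
  simp [image_image]

theorem isCompOf_image_iff {A D : Set X} : IsCompOf (e '' A) (e '' D) ↔ IsCompOf A D :=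
  ⟨fun h => by simpa only [e.symm_image_image'] using h.image e.symm, fun h => h.image e⟩

theorem HasTwoComps.image {A D₁ D₂ : Set X} (h : HasTwoComps A D₁ D₂) :
    HasTwoComps (e '' A) (e '' D₁) (e '' D₂) := by
  obtain ⟨h1, h2, hne, h3⟩ := h
  refine ⟨h1.image e, h2.image e, fun h => hne (e.injective.image_injective h), ?_⟩
  rintro _ ⟨x, hx, rfl⟩
  rw [← e.image_connectedComponentIn hx]
  grind

theorem IsCrossCut.image {U σ : Set X} (h : IsCrossCut U σ) : IsCrossCut (e '' U) (e '' σ) := by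
  obtain ⟨g, hg, hi, hgU, h0, h1, rfl, D₁, D₂, hD, hf1, hf2⟩ := h
  have key : ∀ D : Set X, (frontier D ∩ (frontier U \ g '' Icc 0 1)).Nonempty →
      (frontier (e '' D) ∩ (frontier (e '' U) \ (e ∘ g) '' Icc 0 1)).Nonempty := by
    rintro D ⟨z, hz⟩
    rw [image_comp, ← e.image_frontier, ← e.image_frontier, ← image_sdiff e.injective,
      ← image_inter e.injective]
    exact ⟨e z, mem_image_of_mem _ hz⟩
  refine ⟨e ∘ g, e.continuous.comp_continuousOn hg, e.injective.comp_injOn hi,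
    fun t ht => mem_image_of_mem _ (hgU t ht), ?_, ?_, (image_comp _ _ _).symm, e '' D₁, e '' D₂,
    ?_, key D₁ hf1, key D₂ hf2⟩
  · rw [← e.image_frontier]; exact mem_image_of_mem _ h0
  · rw [← e.image_frontier]; exact mem_image_of_mem _ h1
  · rw [← image_sdiff e.injective]; exact hD.image e

theorem IsCrossSection.image {U D : Set X} (h : IsCrossSection U D) :
    IsCrossSection (e '' U) (e '' D) := by
  obtain ⟨σ, hσ, hD⟩ := h
  exact ⟨e '' σ, hσ.image e, image_sdiff e.injective U σ ▸ hD.image e⟩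

theorem bdIn_image (U D : Set X) : bdIn (e '' U) (e '' D) = e '' bdIn U D := by
  simp only [bdIn]
  rw [image_inter e.injective, image_sdiff e.injective, e.image_closure]

theorem IsPEChain.image {U : Set X} {D : ℕ → Set X} (h : IsPEChain U D) :
    IsPEChain (e '' U) (fun i => e '' D i) := by
  refine ⟨fun i => (h.1 i).image e, fun i j hij => image_mono (h.2.1 i j hij), fun i j hij => ?_⟩
  rw [bdIn_image, bdIn_image, ← e.image_closure, ← e.image_closure, ← image_inter e.injective,
    h.2.2 i j hij, image_empty]

theorem ChainDivides.image {D D' : ℕ → Set X} (h : ChainDivides D D') :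
    ChainDivides (fun i => e '' D i) (fun i => e '' D' i) :=
  fun n => (h n).imp fun _ hm => image_mono hm

theorem IsPrimeChain.image {U : Set X} {D : ℕ → Set X} (h : IsPrimeChain U D) :
    IsPrimeChain (e '' U) (fun i => e '' D i) := by
  refine ⟨h.1.image e, fun D' hD' hdiv => ?_⟩
  have := h.2 (fun i => e.symm '' D' i) (by simpa only [e.symm_image_image'] using hD'.image e.symm)
    (by simpa only [e.symm_image_image'] using hdiv.image e.symm)
  simpa only [e.image_symm_image'] using this.image e

end Transport

theorem IsCrossSection.subset {U D : Set X} (h : IsCrossSection U D) : D ⊆ U := by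
  obtain ⟨σ, _, hD⟩ := h
  exact hD.subset.trans sdiff_subset

omit [TopologicalSpace X] in
theorem ChainDivides.trans {A B C : ℕ → Set X} (h : ChainDivides A B) (h' : ChainDivides B C) :
    ChainDivides A C := fun n => by
  obtain ⟨m, hm⟩ := h' n
  obtain ⟨k, hk⟩ := h m
  exact ⟨k, hk.trans hm⟩

/-- The prime chain is not divided by its image: the prime end it defines is not fixed. -/
def NoFixedPrimeEnd (f : X ≃ₜ X) (U : Set X) : Prop :=
  ∀ D : ℕ → Set X, IsPrimeChain U D → ¬ ChainDivides (fun i => f '' D i) D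

theorem primeEnd_mk_eq {U : Set X} {C D : PrimeChain U}
    (h : (Quot.mk _ C : PrimeEnd U) = Quot.mk _ D) : ChainDivides C.1 D.1 ∧ ChainDivides D.1 C.1 := by
  have key := Quot.eqvGen_exact h
  clear h
  induction key with
  | rel _ _ h => exact h
  | refl x => exact ⟨fun n => ⟨n, subset_rfl⟩, fun n => ⟨n, subset_rfl⟩⟩
  | symm _ _ _ ih => exact ih.symm
  | trans _ _ _ _ _ ih1 ih2 => exact ⟨ih1.1.trans ih2.1, ih2.2.trans ih1.2⟩

theorem PrimeEnd.eventually_mem {U : Set X} (D : PrimeChain U) {O : Set (PrimeEndComp U)} (hO : IsOpen O)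
    (hp : peEnd U (Quot.mk _ D) ∈ O) : ∃ k, ∀ y (hy : y ∈ U), y ∈ D.1 k → pePt U ⟨y, hy⟩ ∈ O := by
  induction hO with
  | basic s hs =>
    rcases hs with ⟨V, _, _, rfl⟩ | ⟨E, _, rfl⟩
    · obtain ⟨x, hx, _⟩ := hp
      cases hx
    · rcases hp with ⟨x, hx, _⟩ | ⟨q, hq, C, hC, n, hn⟩
      · cases hx
      · cases hq
        obtain ⟨m, hm⟩ := (primeEnd_mk_eq hC).2 n
        exact ⟨m, fun y hy hyD => Or.inl ⟨⟨y, hy⟩, rfl, hn n le_rfl (hm hyD)⟩⟩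
  | univ => exact ⟨0, fun _ _ _ => trivial⟩
  | inter s t _ _ ihs iht =>
    obtain ⟨k, hk⟩ := ihs hp.1
    obtain ⟨l, hl⟩ := iht hp.2
    exact ⟨max k l, fun y hy h => ⟨hk y hy (D.2.1.2.1 _ _ (le_max_left _ _) h),
      hl y hy (D.2.1.2.1 _ _ (le_max_right _ _) h)⟩⟩
  | sUnion S _ ih =>
    obtain ⟨s, hs, hps⟩ := hp
    obtain ⟨k, hk⟩ := ih s hs hps
    exact ⟨k, fun y hy h => ⟨s, hs, hk y hy h⟩⟩

theorem noFixedPrimeEnd_of_extension {f : X ≃ₜ X} {U : Set X} (hU : f '' U = U)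
    {F : PrimeEndComp U ≃ₜ PrimeEndComp U} (hF : IsPEExtension f U F)
    (hfix : ∀ p : PrimeEnd U, F (peEnd U p) ≠ peEnd U p) : NoFixedPrimeEnd f U := by
  intro D hD hdiv
  have hfU : ∀ y ∈ U, f y ∈ U := fun y hy => hU ▸ mem_image_of_mem f hy
  set p : PrimeEnd U := Quot.mk _ ⟨D, hD⟩ with hp
  rcases hFp : F (peEnd U p) with x | q
  · obtain ⟨y, hy, hyx⟩ : (x : X) ∈ f '' U := by rw [hU]; exact x.2
    have h1 : F (pePt U ⟨y, hy⟩) = F (peEnd U p) := by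
      rw [hF y hy (hfU y hy), hFp]
      exact congrArg Sum.inl (Subtype.ext hyx)
    cases F.injective h1
  · obtain ⟨⟨E, hE⟩, rfl⟩ := Quot.exists_rep q
    have hfD : ChainDivides (fun i => f '' D i) E := by
      intro j
      have hopen : IsOpen (F ⁻¹' peSection U (E j)) :=
        (TopologicalSpace.isOpen_generateFrom_of_mem (Or.inr ⟨E j, hE.1.1 j, rfl⟩)).preimage F.continuous
      obtain ⟨k, hk⟩ := PrimeEnd.eventually_mem ⟨D, hD⟩ hopen (by
        rw [mem_preimage]
        erw [hFp]
        exact Or.inr ⟨_, rfl, ⟨E, hE⟩, rfl, j, fun i hi => hE.1.2.1 i j hi⟩)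
      refine ⟨k, ?_⟩
      rintro _ ⟨y, hy, rfl⟩
      have hyU := (hD.1.1 k).subset hy
      have := hk y hyU hy
      rw [mem_preimage, hF y hyU (hfU y hyU)] at this
      rcases this with ⟨z, hz, hzE⟩ | ⟨q, hq, _⟩
      · have : f y = z := congrArg Subtype.val (Sum.inl.inj hz)
        rwa [this]
      · cases hq
    have hfDc : IsPEChain U (fun i => f '' D i) := by simpa only [hU] using hD.1.image f
    have hED := (hE.2 _ hfDc hfD).trans hdiv
    refine hfix p (hFp.trans ?_)
    exact congrArg (peEnd U) (Quot.sound ⟨hED, hD.2 E hE.1 hED⟩)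

theorem NoFixedPrimeEnd.image {Y : Type u} [TopologicalSpace Y] (e : X ≃ₜ Y) {f : X ≃ₜ X} {U : Set X}
    (h : NoFixedPrimeEnd f U) : NoFixedPrimeEnd ((e.symm.trans f).trans e) (e '' U) := by
  intro D hD hdiv
  refine h (fun i => e.symm '' D i) ?_ ?_
  · simpa only [e.symm_image_image'] using hD.image e.symm
  · have := hdiv.image e.symm
    refine fun n => (this n).imp fun m hm => ?_
    refine subset_trans ?_ hm
    simp only [image_image]
    rintro _ ⟨y, hy, rfl⟩
    exact ⟨y, hy, by simp⟩

theorem IsPathConnected.exists_compact_connected {U : Set X} (hU : IsPathConnected U) {x y : X}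
    (hx : x ∈ U) (hy : y ∈ U) :
    ∃ C ⊆ U, IsCompact C ∧ IsConnected C ∧ x ∈ C ∧ y ∈ C := by
  obtain ⟨p, hp⟩ := hU.joinedIn x hx y hy
  exact ⟨range p, range_subset_iff.2 hp, isCompact_range p.continuous, isConnected_range p.continuous,
    ⟨0, p.source⟩, ⟨1, p.target⟩⟩

theorem IsCrossSection.nonempty {U D : Set X} (h : IsCrossSection U D) : D.Nonempty := by
  obtain ⟨_, _, h⟩ := h
  exact h.nonempty

/-- A preconnected subset of `U` that meets a subset without being contained in it meets its
boundary in `U`. -/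
theorem IsPreconnected.inter_bdIn_nonempty {U T E : Set X} (hT : IsPreconnected T) (hTU : T ⊆ U)
    (hE : IsOpen E) (h1 : (T ∩ E).Nonempty) (h2 : ¬ T ⊆ E) : (T ∩ bdIn U E).Nonempty := by
  by_contra hcon
  refine h2 (hT.subset_of_closure_inter_subset hE h1 ?_)
  rintro y ⟨hy, hyT⟩
  by_contra hyE
  exact hcon ⟨y, hyT, ⟨hy, hyE⟩, hTU hyT⟩

/-- An end of the domain `U` described by caps `S n` with edges `δ n` shrinking with respect to a
gauge `h` whose level sets contain separating cross-cuts. -/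
structure ShrinkingCaps (U : Set ℂ) (h : ℂ → ℝ) (S δ : ℕ → Set ℂ) : Prop where
  subset : ∀ n, S n ∪ δ n ⊆ U
  anti : ∀ m n, m ≤ n → S n ⊆ S m
  nonempty : ∀ n, (S n).Nonempty
  edge_nonempty : ∀ n, (δ n).Nonempty
  disj : ∀ n, Disjoint (S n) (δ n)
  cross : ∀ n (T : Set ℂ), IsPreconnected T → T ⊆ U → (T ∩ S n).Nonempty → ¬ T ⊆ S n →
    (T ∩ δ n).Nonempty
  escape : ∀ y ∈ U, ∃ N, ∀ n, N ≤ n → y ∉ S n ∪ δ n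
  conn : ∀ n, IsPreconnected (S n ∪ δ n)
  coconn : ∀ n, IsPreconnected (U \ S n)
  small : ∀ r > 0, ∃ N, ∀ n, N ≤ n → ∀ v ∈ δ n, h v < r
  pos : ∀ v ∈ U, 0 < h v
  cont : ContinuousOn h U
  sep : ∀ r > 0, ∀ x ∈ U, ∀ y ∈ U, h x < r → r < h y →
    ∃ c, IsCrossCut U c ∧ closure c ⊆ {v | h v = r} ∧ y ∉ connectedComponentIn (U \ c) x
  away : ∀ c c', IsCrossCut U c → IsCrossCut U c' → closure c ∩ closure c' = ∅ →
    ∃ ε > 0, (∀ v ∈ c, ε ≤ h v) ∨ ∀ v ∈ c', ε ≤ h v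

namespace ShrinkingCaps

variable {U : Set ℂ} {h : ℂ → ℝ} {S δ : ℕ → Set ℂ} (hS : ShrinkingCaps U h S δ)
include hS

theorem exists_section {y : ℂ} (hy : y ∈ U) {r : ℝ} (hr : 0 < r) (hry : r < h y) :
    ∃ c D, IsCrossCut U c ∧ closure c ⊆ {v | h v = r} ∧ IsCompOf (U \ c) D ∧ y ∉ D ∧
      ∃ N, ∀ n, N ≤ n → S n ⊆ D := by
  obtain ⟨N₁, hN₁⟩ := hS.escape y hy
  obtain ⟨N₂, hN₂⟩ := hS.small r hr
  set m := max N₁ N₂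
  have hym := hN₁ m (le_max_left _ _)
  have hδm := hN₂ m (le_max_right _ _)
  obtain ⟨x, hx⟩ := hS.edge_nonempty m
  have hxU := hS.subset m (Or.inr hx)
  obtain ⟨c, hc, hcl, hsep⟩ := hS.sep r hr x hxU y hy (hδm x hx) hry
  have hcδ : Disjoint c (δ m) := disjoint_left.2 fun v hv hvδ =>
    (hδm v hvδ).ne (hcl (subset_closure hv))
  have hyc : y ∉ c := fun h => hry.ne' (hcl (subset_closure h))
  have hcS : Disjoint c (S m) := by
    by_contra hcon
    have hcsub : c ⊆ S m := by
      by_contra hn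
      obtain ⟨v, hv, hvδ⟩ := hS.cross m c hc.isConnected.isPreconnected hc.subset
        (not_disjoint_iff_nonempty_inter.1 hcon) hn
      exact disjoint_left.1 hcδ hv hvδ
    exact hsep (mem_ccIn_of_isPreconnected (hS.coconn m) (sdiff_subset_sdiff_right hcsub)
      ⟨hxU, fun h => disjoint_left.1 (hS.disj m) h hx⟩ ⟨hy, fun h => hym (Or.inl h)⟩)
  have hxc : x ∈ U \ c := ⟨hxU, fun h => disjoint_left.1 hcδ h hx⟩
  refine ⟨c, connectedComponentIn (U \ c) x, hc, hcl, isCompOf_cc hxc, hsep, m, fun n hn => ?_⟩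
  refine (hS.anti m n hn).trans (subset_union_left.trans ((hS.conn m).subset_connectedComponentIn
    (Or.inr hx) (subset_sdiff.2 ⟨hS.subset m, ?_⟩)))
  grind

theorem exists_chain (hUs : IsSimplyConnected U) :
    ∃ (r : ℕ → ℝ) (c D : ℕ → Set ℂ), (∀ j, 0 < r j) ∧ (∀ i j, i < j → r j < r i) ∧
      Tendsto r atTop (𝓝 0) ∧ (∀ j, IsCrossCut U (c j)) ∧ (∀ j, closure (c j) ⊆ {v | h v = r j}) ∧
      (∀ j, IsCompOf (U \ c j) (D j)) ∧ (∀ i j, i ≤ j → D j ⊆ D i) ∧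
      (∀ j, ∃ N, ∀ n, N ≤ n → S n ⊆ D j) ∧ ∀ v, ∃ j, v ∉ D j := by
  obtain ⟨z₀, hz₀⟩ := hUs.isPathConnected.isConnected.nonempty
  let P : ℝ × Set ℂ × Set ℂ → Prop := fun p => 0 < p.1 ∧ IsCrossCut U p.2.1 ∧
    closure p.2.1 ⊆ {v | h v = p.1} ∧ IsCompOf (U \ p.2.1) p.2.2 ∧ z₀ ∉ p.2.2 ∧
      ∃ N, ∀ n, N ≤ n → S n ⊆ p.2.2
  have hstep : ∀ p : {p // P p}, ∃ q : {p // P p}, q.1.1 = p.1.1 / 2 ∧ q.1.2.2 ⊆ p.1.2.2 := by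
    rintro ⟨⟨r, c, D⟩, hr, hc, hcl, hD, hz, N, hN⟩
    dsimp only at hr hc hcl hD hz hN ⊢
    obtain ⟨y, hy⟩ := hc.isConnected.nonempty
    have hyr : h y = r := hcl (subset_closure hy)
    obtain ⟨c', D', hc', hcl', hD', hy', N', hN'⟩ := hS.exists_section (hc.subset hy) (half_pos hr)
      (by rw [hyr]; exact half_lt_self hr)
    have hcc : Disjoint c c' := disjoint_left.2 fun v hv hv' => by
      have h1 : h v = r := hcl (subset_closure hv)
      have h2 : h v = r / 2 := hcl' (subset_closure hv')
      linarith
    have hcD : Disjoint D' c := by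
      rw [disjoint_iff_inter_eq_empty, ← not_nonempty_iff_eq_empty]
      intro hne
      exact hy' (hD'.subset_of_isPreconnected hc.isConnected.isPreconnected
        (subset_sdiff.2 ⟨hc.subset, hcc⟩) hne hy)
    have hDD : D' ⊆ D := by
      refine hD.subset_of_isPreconnected hD'.isPreconnected
        (subset_sdiff.2 ⟨hD'.subset.trans sdiff_subset, hcD⟩) ?_
      obtain ⟨v, hv⟩ := hS.nonempty (max N N')
      exact ⟨v, hN _ (le_max_left _ _) hv, hN' _ (le_max_right _ _) hv⟩
    exact ⟨⟨⟨r / 2, c', D'⟩, half_pos hr, hc', hcl', hD', fun h => hz (hDD h), N', hN'⟩, rfl, hDD⟩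
  obtain ⟨c₀, D₀, hc₀, hcl₀, hD₀, hy₀, hN₀⟩ := hS.exists_section hz₀ (half_pos (hS.pos z₀ hz₀))
    (half_lt_self (hS.pos z₀ hz₀))
  choose nxt hn1 hn2 using hstep
  let s : ℕ → {p // P p} := fun n => Nat.rec
    ⟨⟨h z₀ / 2, c₀, D₀⟩, half_pos (hS.pos z₀ hz₀), hc₀, hcl₀, hD₀, hy₀, hN₀⟩ (fun _ p => nxt p) n
  have hr : ∀ n, (s n).1.1 = h z₀ / 2 * (1 / 2) ^ n := by
    intro n
    induction n with
    | zero => simp [s]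
    | succ n ih =>
      grind
  have hlim : Tendsto (fun j => (s j).1.1) atTop (𝓝 0) := by
    simp only [hr]
    simpa using (tendsto_pow_atTop_nhds_zero_of_lt_one (by norm_num : (0:ℝ) ≤ 1/2) (by norm_num)).const_mul (h z₀ / 2)
  have hz := half_pos (hS.pos z₀ hz₀)
  refine ⟨fun j => (s j).1.1, fun j => (s j).1.2.1, fun j => (s j).1.2.2, fun j => (s j).2.1, ?_, hlim,
    fun j => (s j).2.2.1, fun j => (s j).2.2.2.1, fun j => (s j).2.2.2.2.1, ?_,
    fun j => (s j).2.2.2.2.2.2, ?_⟩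
  · intro i j hij
    dsimp only
    rw [hr, hr]
    exact mul_lt_mul_of_pos_left (pow_lt_pow_right_of_lt_one₀ (by norm_num) (by norm_num) hij) hz
  · exact fun i j hij => antitone_nat_of_succ_le (f := fun j => (s j).1.2.2) (fun n => hn2 (s n)) hij
  · intro v
    by_contra! hv
    have hvU : v ∈ U := ((s 0).2.2.2.2.1.subset (hv 0)).1
    obtain ⟨C, hCU, hC, hCc, hzC, hvC⟩ := hUs.isPathConnected.exists_compact_connected hz₀ hvU
    obtain ⟨w, hwC, hw⟩ := hC.exists_isMinOn ⟨z₀, hzC⟩ (hS.cont.mono hCU)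
    obtain ⟨j, hj⟩ := (hlim.eventually (gt_mem_nhds (hS.pos w (hCU hwC)))).exists
    refine (s j).2.2.2.2.2.1 ((s j).2.2.2.2.1.subset_of_isPreconnected hCc.isPreconnected
      (subset_sdiff.2 ⟨hCU, disjoint_left.2 fun x hx hxc => ?_⟩) ⟨v, hv j, hvC⟩ hzC)
    have h1 : h x = (s j).1.1 := (s j).2.2.2.1 (subset_closure hxc)
    have h2 : h w ≤ h x := hw hx
    linarith

theorem false_of_noFixedPrimeEnd (hUo : IsOpen U) (hUs : IsSimplyConnected U) {f : ℂ ≃ₜ ℂ}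
    (hfU : f '' U = U) (hf : NoFixedPrimeEnd f U) (hmeas : ∀ m k, (f '' S m ∩ S k).Nonempty) : False := by
  obtain ⟨r, c, D, hr0, hr, hlim, hc, hcl, hD, hanti, hSD, hempty⟩ := hS.exists_chain hUs
  have hbd : ∀ j, bdIn U (D j) = c j := fun j => (hc j).bdIn_eq hUo hUs (hD j)
  have hDo : ∀ j, IsOpen (D j) := fun j => (hD j).isOpen ((hc j).isOpen_diff hUo)
  have hDU : ∀ j, D j ⊆ U := fun j => (hD j).subset.trans sdiff_subset
  have hchain : IsPEChain U D := by
    refine ⟨fun i => ⟨c i, hc i, hD i⟩, fun i j hij => hanti j i hij, fun i j hij => ?_⟩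
    rw [hbd, hbd, eq_empty_iff_forall_notMem]
    rintro v ⟨h1, h2⟩
    have e1 : h v = r i := hcl i h1
    have e2 : h v = r j := hcl j h2
    rcases lt_or_gt_of_ne hij with hlt | hlt
    · exact (hr _ _ hlt).ne (e2.symm.trans e1)
    · exact (hr _ _ hlt).ne (e1.symm.trans e2)
  -- a chain whose members meet all `D m` is divided by `D`
  have key : ∀ E, IsPEChain U E → (∀ n m, (E n ∩ D m).Nonempty) → ChainDivides D E := by
    intro E hE hED
    by_contra hcon
    simp only [ChainDivides, not_forall, not_exists] at hcon
    obtain ⟨n₀, hn₀⟩ := hcon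
    choose τ hτ hτE using hE.1
    have hEb : ∀ n, bdIn U (E n) = τ n := fun n => (hτ n).bdIn_eq hUo hUs (hτE n)
    have hmeet : ∀ n, n₀ ≤ n → ∀ m, (D m ∩ τ n).Nonempty := by
      intro n hn m
      rw [← hEb]
      refine (hD m).isPreconnected.inter_bdIn_nonempty (hDU m)
        ((hτE n).isOpen ((hτ n).isOpen_diff hUo)) ?_ fun h => hn₀ m (h.trans (hE.2.1 _ _ hn))
      rw [inter_comm]; exact hED n m
    have hd := hE.2.2 n₀ (n₀ + 1) (by omega)
    rw [hEb, hEb] at hd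
    have hfin : ∀ n, n₀ ≤ n → ∀ ε > 0, ¬ ∀ v ∈ τ n, ε ≤ h v := by
      intro n hn ε hε hv
      obtain ⟨M, hM⟩ := (hlim.eventually (gt_mem_nhds hε)).exists
      have hsub : ∀ m, M ≤ m → τ n ⊆ D m := by
        intro m hm
        refine (hD m).subset_of_isPreconnected (hτ n).isConnected.isPreconnected
          (subset_sdiff.2 ⟨(hτ n).subset, disjoint_left.2 fun v h1 h2 => ?_⟩) (hmeet n hn m)
        have e : h v = r m := hcl m (subset_closure h2)
        have : r m ≤ r M := by
          rcases hm.eq_or_lt with rfl | h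
          exacts [le_rfl, (hr _ _ h).le]
        linarith [hv v h1]
      obtain ⟨v, hvτ⟩ := (hτ n).isConnected.nonempty
      obtain ⟨j, hj⟩ := hempty v
      exact hj (hanti j (max M j) (le_max_right _ _) (hsub _ (le_max_left _ _) hvτ))
    obtain ⟨ε, hε, h1 | h1⟩ := hS.away _ _ (hτ n₀) (hτ (n₀ + 1)) hd
    · exact hfin _ le_rfl ε hε h1
    · exact hfin _ (Nat.le_succ _) ε hε h1
  have hprime : IsPrimeChain U D := by
    refine ⟨hchain, fun E hE hdiv => key E hE fun n m => ?_⟩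
    obtain ⟨k, hk⟩ := hdiv m
    obtain ⟨v, hv⟩ := (hE.1 (max n k)).nonempty
    exact ⟨v, hE.2.1 _ _ (le_max_left _ _) hv, hk (hE.2.1 _ _ (le_max_right _ _) hv)⟩
  have hfU' : f.symm '' U = U :=
    calc f.symm '' U = f.symm '' (f '' U) := by rw [hfU]
      _ = U := f.symm_image_image' U
  have hfD := key (fun i => f.symm '' D i) (hfU' ▸ hchain.image f.symm) fun n m => by
    obtain ⟨N₁, h1⟩ := hSD m
    obtain ⟨N₂, h2⟩ := hSD n
    obtain ⟨_, ⟨v, hv, rfl⟩, hv2⟩ := hmeas N₁ N₂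
    exact ⟨v, ⟨f v, h2 _ le_rfl hv2, by simp⟩, h1 _ le_rfl hv⟩
  refine hf D hprime ?_
  simpa only [f.image_symm_image'] using hfD.image f

end ShrinkingCaps

/-- The gauge measuring the distance to a point outside the domain. -/
theorem gauge_dist {U : Set ℂ} (hUo : IsOpen U) (hUs : IsSimplyConnected U) {a : ℂ} (ha : a ∉ U) :
    (∀ r > 0, ∀ x ∈ U, ∀ y ∈ U, dist x a < r → r < dist y a →
      ∃ c, IsCrossCut U c ∧ closure c ⊆ {v | dist v a = r} ∧ y ∉ connectedComponentIn (U \ c) x) ∧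
    ∀ c c', IsCrossCut U c → IsCrossCut U c' → closure c ∩ closure c' = ∅ →
      ∃ ε > 0, (∀ v ∈ c, ε ≤ dist v a) ∨ ∀ v ∈ c', ε ≤ dist v a := by
  refine ⟨fun r hr x hx y hy h1 h2 => ?_, fun c c' _ _ hcc => ?_⟩
  · obtain ⟨c, hc, hcut, hsep⟩ := exists_circular_crossCut hUo hUs ha hr hx hy (Or.inl ⟨h1, h2⟩)
    exact ⟨c, hcut, closure_minimal (hc.subset.trans inter_subset_left) Metric.isClosed_sphere, hsep⟩
  · have key : ∀ c : Set ℂ, a ∉ closure c → ∃ ε > 0, ∀ v ∈ c, ε ≤ dist v a := fun c hc => by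
      obtain ⟨ε, hε, h⟩ := Metric.isOpen_iff.1 isClosed_closure.isOpen_compl a hc
      refine ⟨ε, hε, fun v hv => ?_⟩
      by_contra! hlt
      exact h hlt (subset_closure hv)
    by_cases hac : a ∈ closure c
    · obtain ⟨ε, hε, h⟩ := key c' fun h => (hcc ▸ ⟨hac, h⟩ : a ∈ (∅ : Set ℂ))
      exact ⟨ε, hε, Or.inr h⟩
    · obtain ⟨ε, hε, h⟩ := key c hac
      exact ⟨ε, hε, Or.inl h⟩

theorem IsCrossCut.isBounded {U c : Set ℂ} (h : IsCrossCut U c) : Bornology.IsBounded c := by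
  obtain ⟨g, hg, _, _, _, _, rfl, _⟩ := h
  exact (isCompact_Icc.image_of_continuousOn hg).isBounded.subset (image_mono Ioo_subset_Icc_self)

/-- The gauge measuring the distance to infinity. -/
theorem gauge_inv_dist {U : Set ℂ} (hUo : IsOpen U) (hUs : IsSimplyConnected U) {a : ℂ} (ha : a ∉ U) :
    (∀ r > 0, ∀ x ∈ U, ∀ y ∈ U, (dist x a)⁻¹ < r → r < (dist y a)⁻¹ →
      ∃ c, IsCrossCut U c ∧ closure c ⊆ {v | (dist v a)⁻¹ = r} ∧ y ∉ connectedComponentIn (U \ c) x) ∧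
    ∀ c c', IsCrossCut U c → IsCrossCut U c' → closure c ∩ closure c' = ∅ →
      ∃ ε > 0, (∀ v ∈ c, ε ≤ (dist v a)⁻¹) ∨ ∀ v ∈ c', ε ≤ (dist v a)⁻¹ := by
  have hpos : ∀ v ∈ U, 0 < dist v a := fun v hv => dist_pos.2 fun h => ha (h ▸ hv)
  refine ⟨fun r hr x hx y hy h1 h2 => ?_, fun c c' hc _ _ => ?_⟩
  · obtain ⟨c, hc, hcut, hsep⟩ := exists_circular_crossCut hUo hUs ha (inv_pos.2 hr) hx hy
      (Or.inr ⟨(lt_inv_comm₀ (hr) (hpos y hy)).1 h2, (inv_lt_comm₀ (hpos x hx) hr).1 h1⟩)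
    refine ⟨c, hcut, ?_, hsep⟩
    have := closure_minimal (hc.subset.trans inter_subset_left) Metric.isClosed_sphere
    intro v hv
    have hv' : dist v a = r⁻¹ := this hv
    simp [hv']
  · obtain ⟨R, hR⟩ := hc.isBounded.subset_closedBall a
    refine ⟨(max R 1)⁻¹, inv_pos.2 (by positivity), Or.inl fun v hv => ?_⟩
    exact inv_anti₀ (hpos v (hc.subset hv)) ((hR hv : dist v a ≤ R).trans (le_max_left _ _))

theorem hasDerivAt_of_sq_eq {s k : ℂ → ℂ} {k' z : ℂ} (hs : ContinuousAt s z)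
    (hk : HasDerivAt k k' z) (h : ∀ᶠ w in 𝓝 z, s w ^ 2 = k w) (h0 : s z ≠ 0) :
    HasDerivAt s (k' / (2 * s z)) z := by
  rw [hasDerivAt_iff_tendsto_slope] at hk ⊢
  have h1 : Tendsto (fun w => s w + s z) (𝓝[≠] z) (𝓝 (2 * s z)) := by
    rw [two_mul]
    exact (hs.tendsto.mono_left nhdsWithin_le_nhds).add_const _
  have h2 : ∀ᶠ w in 𝓝[≠] z, s w + s z ≠ 0 := h1.eventually_ne (by simp [h0])
  refine (hk.div h1 (by simp [h0])).congr' ?_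
  filter_upwards [h2, h.filter_mono nhdsWithin_le_nhds] with w hw hw2
  simp only [slope_def_field, Pi.div_apply]
  rw [← hw2, ← h.self_of_nhds]
  field_simp
  ring

/-- On a simply connected proper domain, a univalent map to the disc with explicit inverse. -/
theorem exists_univalent_bounded {U : Set ℂ} (hUo : IsOpen U) (hUs : IsSimplyConnected U) {a : ℂ}
    (ha : a ∉ U) : ∃ (χ : ℂ → ℂ) (x : ℂ) (ε : ℝ), 0 < ε ∧ DifferentiableOn ℂ χ U ∧
      MapsTo χ U (Metric.ball 0 1) ∧ (∀ z ∈ U, χ z ≠ 0) ∧ (∀ z ∈ U, z = a + (x + ε / χ z) ^ 2) := by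
  obtain ⟨s, hsc, hs⟩ := Complex.exists_continuousOn_pow_eq hUs hUo (g := fun z => z - a)
    (by fun_prop) (by grind) two_ne_zero
  have hs0 : ∀ z ∈ U, s z ≠ 0 := fun z hz h => ha <| by
    grind
  have hd : ∀ z ∈ U, HasDerivAt s (1 / (2 * s z)) z := fun z hz =>
    hasDerivAt_of_sq_eq (hsc.continuousAt (hUo.mem_nhds hz)) ((hasDerivAt_id z).sub_const a)
      (Eventually.of_forall hs) (hs0 z hz)
  obtain ⟨z₀, hz₀⟩ := hUs.isPathConnected.nonempty
  have hsinj : InjOn s U := fun z _ w _ h => by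
    grind
  have hopen : s '' U ∈ 𝓝 (s z₀) := by
    have hst : HasStrictDerivAt s (deriv s z₀) z₀ :=
      ((show DifferentiableOn ℂ s U from fun z hz =>
        (hd z hz).differentiableAt.differentiableWithinAt).analyticAt
          (hUo.mem_nhds hz₀)).hasStrictDerivAt
    rw [← hst.map_nhds_eq (by rw [(hd z₀ hz₀).deriv]; simp [hs0 z₀ hz₀])]
    exact image_mem_map (hUo.mem_nhds hz₀)
  obtain ⟨ε, hε, hball⟩ := Metric.mem_nhds_iff.1 hopen
  have hfar : ∀ z ∈ U, ε ≤ ‖s z + s z₀‖ := by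
    intro z hz
    by_contra! hlt
    have : -s z ∈ Metric.ball (s z₀) ε := by
      rwa [mem_ball_iff_norm, ← norm_neg, show -(-s z - s z₀) = s z + s z₀ by ring]
    grind
  have hne : ∀ z ∈ U, s z + s z₀ ≠ 0 := fun z hz h => by
    grind
  have hε2 : ((ε / 2 : ℝ) : ℂ) ≠ 0 := by
    exact_mod_cast (half_pos hε).ne'
  refine ⟨fun z => (ε / 2 : ℝ) / (s z + s z₀), -s z₀, ε / 2, half_pos hε, fun z hz => ?_, fun z hz => ?_,
    fun z hz => div_ne_zero hε2 (hne z hz), fun z hz => ?_⟩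
  · exact ((differentiableAt_const _).div ((hd z hz).differentiableAt.add_const _)
      (hne z hz)).differentiableWithinAt
  · rw [mem_ball_zero_iff, norm_div, Complex.norm_real, Real.norm_of_nonneg (half_pos hε).le,
      div_lt_one (hε.trans_le (hfar z hz))]
    linarith [hfar z hz]
  · rw [div_div_cancel₀ hε2]
    grind

/-- The univalent maps from `U` to the unit disc. -/
structure IsUnivDisc (U : Set ℂ) (h : ℂ → ℂ) : Prop where
  diff : DifferentiableOn ℂ h U
  maps : MapsTo h U (Metric.ball 0 1)
  inj : InjOn h U
  deriv_ne : ∀ z ∈ U, deriv h z ≠ 0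

theorem exists_isUnivDisc {U : Set ℂ} (hUo : IsOpen U) (hUs : IsSimplyConnected U) {a : ℂ}
    (ha : a ∉ U) : ∃ χ, IsUnivDisc U χ := by
  obtain ⟨χ, x, ε, hε, hd, hm, h0, hinv⟩ := exists_univalent_bounded hUo hUs ha
  refine ⟨χ, hd, hm, fun z hz w hw h => by rw [hinv z hz, hinv w hw, h], fun z hz h => ?_⟩
  have h1 : HasDerivAt χ 0 z := h ▸ (hd.differentiableAt (hUo.mem_nhds hz)).hasDerivAt
  have h2 : HasDerivAt (fun z => a + (x + ε / χ z) ^ 2) 0 z := by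
    have := ((((hasDerivAt_const z (ε : ℂ)).fun_div h1 (h0 z hz)).const_add x).pow 2).const_add a
    simpa using this
  have h3 : HasDerivAt (fun z : ℂ => z) 0 z := by
    refine h2.congr_of_eventuallyEq ?_
    filter_upwards [hUo.mem_nhds hz] with w hw using hinv w hw
  exact zero_ne_one (h3.unique (hasDerivAt_id z))

theorem norm_mobius_lt {c w : ℂ} (hc : ‖c‖ < 1) (hw : ‖w‖ < 1) :
    1 - (starRingEnd ℂ) c * w ≠ 0 ∧ ‖(w - c) / (1 - (starRingEnd ℂ) c * w)‖ < 1 := by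
  have h1 : 1 - (starRingEnd ℂ) c * w ≠ 0 := fun h => by
    have h2 : ‖(starRingEnd ℂ) c * w‖ = 1 := by rw [← sub_eq_zero.1 h]; simp
    rw [norm_mul, Complex.norm_conj] at h2
    nlinarith [norm_nonneg c, norm_nonneg w]
  refine ⟨h1, ?_⟩
  rw [norm_div, div_lt_one (norm_pos_iff.2 h1), ← sq_lt_sq₀ (norm_nonneg _) (norm_nonneg _)]
  have hc2 : ‖c‖ ^ 2 < 1 := by nlinarith [norm_nonneg c]
  have hw2 : ‖w‖ ^ 2 < 1 := by nlinarith [norm_nonneg w]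
  rw [Complex.sq_norm, Complex.normSq_apply] at hc2 hw2 ⊢
  rw [Complex.sq_norm, Complex.normSq_apply]
  simp only [Complex.sub_re, Complex.sub_im, Complex.mul_re, Complex.mul_im, Complex.conj_re,
    Complex.conj_im, Complex.one_re, Complex.one_im]
  nlinarith [mul_pos (sub_pos.2 hc2) (sub_pos.2 hw2)]

theorem IsUnivDisc.mobius {U : Set ℂ} {h : ℂ → ℂ} (hUo : IsOpen U) (hh : IsUnivDisc U h) {c : ℂ}
    (hc : ‖c‖ < 1) :
    IsUnivDisc U (fun z => (h z - c) / (1 - (starRingEnd ℂ) c * h z)) ∧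
    ∀ z ∈ U, deriv (fun z => (h z - c) / (1 - (starRingEnd ℂ) c * h z)) z =
      deriv h z * (1 - ‖c‖ ^ 2) / (1 - (starRingEnd ℂ) c * h z) ^ 2 := by
  have hne : ∀ z ∈ U, 1 - (starRingEnd ℂ) c * h z ≠ 0 := fun z hz =>
    (norm_mobius_lt hc (mem_ball_zero_iff.1 (hh.maps hz))).1
  have hccr : ‖c‖ ^ 2 < 1 := by nlinarith [norm_nonneg c]
  have hcc : (1 : ℂ) - ‖c‖ ^ 2 ≠ 0 := by
    exact_mod_cast (sub_pos.2 hccr).ne'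
  have hccc : (starRingEnd ℂ) c * c = ‖c‖ ^ 2 := Complex.conj_mul' c
  have hd : ∀ z ∈ U, HasDerivAt (fun z => (h z - c) / (1 - (starRingEnd ℂ) c * h z))
      (deriv h z * (1 - ‖c‖ ^ 2) / (1 - (starRingEnd ℂ) c * h z) ^ 2) z := fun z hz => by
    have h1 := (hh.diff.differentiableAt (hUo.mem_nhds hz)).hasDerivAt
    refine ((h1.sub_const c).fun_div ((h1.const_mul _).const_sub 1) (hne z hz)).congr_deriv ?_
    grind
  refine ⟨⟨fun z hz => (hd z hz).differentiableAt.differentiableWithinAt, fun z hz => ?_,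
    fun z hz w hw hzw => ?_, fun z hz => ?_⟩, fun z hz => (hd z hz).deriv⟩
  · exact mem_ball_zero_iff.2 (norm_mobius_lt hc (mem_ball_zero_iff.1 (hh.maps hz))).2
  · refine hh.inj hz hw ?_
    grind
  · rw [(hd z hz).deriv]
    exact div_ne_zero (mul_ne_zero (hh.deriv_ne z hz) hcc) (pow_ne_zero _ (hne z hz))

/-- Hurwitz: a limit of nonvanishing holomorphic functions has no isolated zeros. -/
theorem hurwitz_ne_zero {ι : Type*} {p : Filter ι} [p.NeBot] {U : Set ℂ} (hUo : IsOpen U)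
    {F : ι → ℂ → ℂ} {f : ℂ → ℂ} (hF : TendstoLocallyUniformlyOn F f p U)
    (hd : ∀ n, DifferentiableOn ℂ (F n) U) (hne : ∀ n, ∀ z ∈ U, F n z ≠ 0) {a : ℂ} (ha : a ∈ U)
    (hiso : ∀ᶠ z in 𝓝[≠] a, f z ≠ 0) : f a ≠ 0 := by
  intro hfa
  obtain ⟨r, hr, hball⟩ := Metric.mem_nhds_iff.1
    (Eventually.and (hUo.eventually_mem ha) (eventually_nhdsWithin_iff.1 hiso))
  have hsub : Metric.closedBall a (r / 2) ⊆ U := fun z hz =>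
    (hball (Metric.closedBall_subset_ball (half_lt_self hr) hz)).1
  have hfc : ContinuousOn f U :=
    (hF.differentiableOn (Eventually.of_forall hd) hUo).continuousOn
  have hS : IsCompact (Metric.sphere a (r / 2)) := isCompact_sphere _ _
  obtain ⟨z₁, hz₁, hmin⟩ := hS.exists_isMinOn (NormedSpace.sphere_nonempty.2 (half_pos hr).le)
    ((hfc.mono (Metric.sphere_subset_closedBall.trans hsub)).norm)
  have hm : 0 < ‖f z₁‖ := norm_pos_iff.2 ((hball (Metric.closedBall_subset_ball (half_lt_self hr)
    (Metric.sphere_subset_closedBall hz₁))).2 (Metric.ne_of_mem_sphere hz₁ (half_pos hr).ne'))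
  set m := ‖f z₁‖
  have hunif := (tendstoLocallyUniformlyOn_iff_tendstoUniformlyOn_of_compact hS).1
    (hF.mono (Metric.sphere_subset_closedBall.trans hsub))
  have h1 := Metric.tendstoUniformlyOn_iff.1 hunif (m / 2) (half_pos hm)
  have h2 : ∀ᶠ n in p, dist (f a) (F n a) < m / 2 :=
    Metric.tendsto_nhds.1 (hF.tendsto_at ha) (m / 2) (half_pos hm) |>.mono
      fun n hn => by rwa [dist_comm]
  obtain ⟨n, hn1, hn2⟩ := (h1.and h2).exists
  rw [hfa, dist_zero_left] at hn2
  have hinv : ‖(F n a)⁻¹‖ ≤ (m / 2)⁻¹ := by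
    refine Complex.norm_le_of_forall_mem_frontier_norm_le (f := fun z => (F n z)⁻¹)
      (U := Metric.ball a (r / 2)) Metric.isBounded_ball ?_ (fun z hz => ?_)
      (subset_closure (Metric.mem_ball_self (half_pos hr)))
    · refine DifferentiableOn.diffContOnCl_ball (U := U) (((hd n).fun_inv (hne n))) hsub
    · rw [frontier_ball _ (half_pos hr).ne'] at hz
      rw [norm_inv]
      refine inv_anti₀ (half_pos hm) ?_
      have := hn1 z hz
      have h3 : m ≤ ‖f z‖ := hmin hz
      rw [dist_eq_norm] at this
      have := norm_sub_norm_le (f z) (F n z)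
      linarith
  rw [norm_inv] at hinv
  have := (inv_le_inv₀ (norm_pos_iff.2 (hne n a ha)) (half_pos hm)).1 hinv
  linarith

theorem tendstoLocallyUniformlyOn_of_lipschitz {ι : Type*} {p : Filter ι} [p.NeBot] {U : Set ℂ}
    (hUo : IsOpen U) {F : ι → ℂ → ℂ} {f : ℂ → ℂ} (hd : ∀ n, DifferentiableOn ℂ (F n) U)
    (hm : ∀ n, MapsTo (F n) U (Metric.ball 0 1)) (hlim : ∀ z ∈ U, Tendsto (fun n => F n z) p (𝓝 (f z))) :
    TendstoLocallyUniformlyOn F f p U := by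
  rw [Metric.tendstoLocallyUniformlyOn_iff]
  intro ε hε x hx
  obtain ⟨R, hR, hball⟩ := Metric.isOpen_iff.1 hUo x hx
  have hlip : ∀ n, ∀ y ∈ Metric.ball x R, dist (F n y) (F n x) ≤ 2 / R * dist y x := fun n y hy => by
    refine Complex.dist_le_div_mul_dist_of_mapsTo_ball ((hd n).mono hball) ?_ hy
    intro w hw
    have h1 := mem_ball_zero_iff.1 (hm n (hball hw))
    have h2 := mem_ball_zero_iff.1 (hm n hx)
    rw [Metric.mem_closedBall, dist_eq_norm]
    have := norm_sub_le (F n w) (F n x)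
    linarith
  have hlim' : ∀ y ∈ Metric.ball x R, dist (f y) (f x) ≤ 2 / R * dist y x := fun y hy =>
    le_of_tendsto ((hlim y (hball hy)).dist (hlim x hx)) (Eventually.of_forall fun n => hlip n y hy)
  refine ⟨Metric.ball x (min R (ε * R / 8)), mem_nhdsWithin_of_mem_nhds
    (Metric.ball_mem_nhds _ (by positivity)), ?_⟩
  filter_upwards [Metric.tendsto_nhds.1 (hlim x hx) (ε / 4) (by positivity)] with n hn y hy
  rw [Metric.mem_ball, lt_min_iff] at hy
  have hyR : 2 / R * dist y x ≤ ε / 4 := by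
    calc 2 / R * dist y x ≤ 2 / R * (ε * R / 8) := by gcongr; exact hy.2.le
      _ = ε / 4 := by field_simp; norm_num
  have h1 := hlip n y hy.1
  have h2 := hlim' y hy.1
  have h3 := dist_triangle4 (f y) (f x) (F n x) (F n y)
  rw [dist_comm (F n x) (F n y), dist_comm (f x) (F n x)] at h3
  linarith

theorem exists_riemann_map {U : Set ℂ} (hUo : IsOpen U) (hUs : IsSimplyConnected U) {a : ℂ}
    (ha : a ∉ U) : ∃ ψ, IsUnivDisc U ψ ∧ ψ '' U = Metric.ball 0 1 := by
  obtain ⟨w₀, hw₀⟩ := hUs.isPathConnected.nonempty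
  have hUc := hUs.isPathConnected.isConnected
  obtain ⟨χ₀, hχ₀⟩ := exists_isUnivDisc hUo hUs ha
  obtain ⟨R, hR, hballR⟩ := Metric.isOpen_iff.1 hUo w₀ hw₀
  let A : Set ℝ := {t | ∃ h, IsUnivDisc U h ∧ ‖deriv h w₀‖ = t}
  have hAb : BddAbove A := by
    refine ⟨2 / R, ?_⟩
    rintro _ ⟨h, hh, rfl⟩
    refine Complex.norm_deriv_le_div_of_mapsTo_ball (hh.diff.mono hballR) (fun w hw => ?_) hR
    have h1 := mem_ball_zero_iff.1 (hh.maps (hballR hw))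
    have h2 := mem_ball_zero_iff.1 (hh.maps hw₀)
    rw [Metric.mem_closedBall, dist_eq_norm]
    have := norm_sub_le (h w) (h w₀)
    linarith
  have hAn : A.Nonempty := ⟨_, χ₀, hχ₀, rfl⟩
  obtain ⟨t, -, htt, htA⟩ := exists_seq_tendsto_sSup hAn hAb
  choose h hh ht using htA
  set M := sSup A
  have hM : 0 < M := (norm_pos_iff.2 (hχ₀.deriv_ne w₀ hw₀)).trans_le (le_csSup hAb ⟨_, hχ₀, rfl⟩)
  let p : Filter ℕ := (hyperfilter ℕ : Ultrafilter ℕ)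
  have hp : p ≤ atTop := Nat.hyperfilter_le_atTop
  have hlimex : ∀ z, ∃ y, z ∈ U → Tendsto (fun n => h n z) p (𝓝 y) := fun z => by
    by_cases hz : z ∈ U
    · obtain ⟨y, -, hy⟩ := (isCompact_closedBall (0 : ℂ) 1).ultrafilter_le_nhds
        ((hyperfilter ℕ).map fun n => h n z) (by
          rw [le_principal_iff]
          exact Filter.mem_map.2 (Filter.univ_mem' fun n => Metric.ball_subset_closedBall ((hh n).maps hz)))
      exact ⟨y, fun _ => hy⟩
    · exact ⟨0, fun h => absurd h hz⟩
  choose g hg using hlimex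
  have hunif : TendstoLocallyUniformlyOn h g p U :=
    tendstoLocallyUniformlyOn_of_lipschitz hUo (fun n => (hh n).diff) (fun n => (hh n).maps) hg
  have hgd : DifferentiableOn ℂ g U :=
    hunif.differentiableOn (Eventually.of_forall fun n => (hh n).diff) hUo
  have hderiv := hunif.deriv (Eventually.of_forall fun n => (hh n).diff) hUo
  have hgM : ‖deriv g w₀‖ = M := by
    refine tendsto_nhds_unique ((hderiv.tendsto_at hw₀).norm) ((htt.mono_left hp).congr fun n => ?_)
    exact (ht n).symm
  have hga : AnalyticOnNhd ℂ g U := hgd.analyticOnNhd hUo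
  have hgnc : ∀ c, ¬ EqOn g (fun _ => c) U := fun c hc => by
    have : deriv g w₀ = 0 := by
      rw [(hc.eventuallyEq_of_mem (hUo.mem_nhds hw₀)).deriv_eq]
      simp
    rw [this, norm_zero] at hgM
    exact hM.ne hgM
  have hgiso : ∀ c, ∀ z ∈ U, ∀ᶠ w in 𝓝[≠] z, g w - c ≠ 0 := fun c z hz => by
    rcases ((hga z hz).sub analyticAt_const).eventually_eq_zero_or_eventually_ne_zero with h1 | h1
    · refine absurd (hga.eqOn_of_preconnected_of_eventuallyEq (analyticOnNhd_const (v := c))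
        hUc.isPreconnected hz (h1.mono fun w hw => sub_eq_zero.1 hw)) (hgnc c)
    · exact h1
  have hginj : InjOn g U := by
    intro z hz w hw hzw
    by_contra hne
    have hUw : IsOpen (U \ {w}) := hUo.sdiff isClosed_singleton
    refine hurwitz_ne_zero (F := fun n v => h n v - h n w) (f := fun v => g v - g w) (p := p) hUw ?_
      (fun n => ((hh n).diff.mono sdiff_subset).sub_const _) (fun n v hv hvw => ?_)
      (a := z) ⟨hz, hne⟩ (hgiso _ z hz) (sub_eq_zero.2 hzw)
    · have h1 := hunif.mono (sdiff_subset (s := U) (t := {w}))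
      have h2 : TendstoLocallyUniformlyOn (fun n (_ : ℂ) => h n w) (fun _ => g w) p (U \ {w}) := by
        rw [Metric.tendstoLocallyUniformlyOn_iff]
        intro ε hε x _
        exact ⟨univ, univ_mem, (Metric.tendsto_nhds.1 (hg w hw) ε hε).mono fun n hn y _ => by
          rwa [dist_comm]⟩
      exact h1.sub h2
    · exact hv.2 ((hh n).inj hv.1 hw (sub_eq_zero.1 hvw))
  have hgderiv : ∀ z ∈ U, deriv g z ≠ 0 := fun z hz => by
    refine hurwitz_ne_zero hUo hderiv (fun n => (hh n).diff.deriv hUo)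
      (fun n => (hh n).deriv_ne) hz ?_
    rcases (hga z hz).deriv.eventually_eq_zero_or_eventually_ne_zero with h1 | h1
    · have := hga.deriv.eqOn_of_preconnected_of_eventuallyEq (analyticOnNhd_const (v := (0 : ℂ)))
        hUc.isPreconnected hz h1 hw₀
      rw [this, norm_zero] at hgM
      exact absurd hgM hM.ne
    · exact h1
  have hgmaps : MapsTo g U (Metric.ball 0 1) := by
    have hcl : g '' U ⊆ Metric.closedBall 0 1 := by
      rintro _ ⟨z, hz, rfl⟩
      exact Metric.isClosed_closedBall.mem_of_tendsto (hg z hz)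
        (Eventually.of_forall fun n => Metric.ball_subset_closedBall ((hh n).maps hz))
    have hopen : IsOpen (g '' U) := by
      rcases hga.is_constant_or_isOpen hUc.isPreconnected with ⟨c, hc⟩ | h1
      · exact absurd hc (hgnc c)
      · exact h1 U le_rfl hUo
    intro z hz
    have := interior_maximal hcl hopen (mem_image_of_mem g hz)
    rwa [interior_closedBall _ one_ne_zero] at this
  have hgU : IsUnivDisc U g := ⟨hgd, hgmaps, hginj, hgderiv⟩
  refine ⟨g, hgU, Subset.antisymm hgmaps.image_subset fun c hc => ?_⟩
  by_contra hcg
  have hc1 := mem_ball_zero_iff.1 hc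
  obtain ⟨hk, hkd⟩ := hgU.mobius hUo hc1
  set k := fun z => (g z - c) / (1 - (starRingEnd ℂ) c * g z) with hkdef
  have hne : ∀ z ∈ U, 1 - (starRingEnd ℂ) c * g z ≠ 0 := fun z hz =>
    (norm_mobius_lt hc1 (mem_ball_zero_iff.1 (hgmaps hz))).1
  have hk0 : ∀ z ∈ U, k z ≠ 0 := fun z hz =>
    div_ne_zero (fun h => hcg ⟨z, hz, sub_eq_zero.1 h⟩) (hne z hz)
  obtain ⟨s, hsc, hs⟩ := Complex.exists_continuousOn_pow_eq hUs hUo hk.diff.continuousOn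
    (by rintro ⟨z, hz, h⟩; exact hk0 z hz h) two_ne_zero
  have hs0 : ∀ z ∈ U, s z ≠ 0 := fun z hz h => hk0 z hz (by rw [← hs z, h]; simp)
  have hsd : ∀ z ∈ U, HasDerivAt s (deriv k z / (2 * s z)) z := fun z hz =>
    hasDerivAt_of_sq_eq (hsc.continuousAt (hUo.mem_nhds hz))
      (hk.diff.differentiableAt (hUo.mem_nhds hz)).hasDerivAt (Eventually.of_forall hs) (hs0 z hz)
  have hsn : ∀ z, ‖s z‖ ^ 2 = ‖k z‖ := fun z => by rw [← norm_pow, hs]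
  have hsU : IsUnivDisc U s := by
    refine ⟨fun z hz => (hsd z hz).differentiableAt.differentiableWithinAt, fun z hz => ?_,
      fun z hz w hw hzw => hk.inj hz hw (by rw [← hs, ← hs, hzw]), fun z hz => ?_⟩
    · have := mem_ball_zero_iff.1 (hk.maps hz)
      rw [← hsn] at this
      rw [mem_ball_zero_iff]
      nlinarith [norm_nonneg (s z)]
    · rw [(hsd z hz).deriv]
      exact div_ne_zero (hk.deriv_ne z hz) (mul_ne_zero two_ne_zero (hs0 z hz))
  have hkle : ∀ q, IsUnivDisc U q → ‖deriv q w₀‖ ≤ M := fun q hq => le_csSup hAb ⟨q, hq, rfl⟩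
  have hmob : ∀ q, IsUnivDisc U q → ‖deriv q w₀‖ ≤ M * (1 - ‖q w₀‖ ^ 2) := fun q hq => by
    have hq1 := mem_ball_zero_iff.1 (hq.maps hw₀)
    obtain ⟨h1, h2⟩ := hq.mobius hUo hq1
    have h3 := hkle _ h1
    have hpos : 0 < 1 - ‖q w₀‖ ^ 2 := by nlinarith [norm_nonneg (q w₀)]
    rw [h2 w₀ hw₀, Complex.conj_mul', norm_div, norm_mul, norm_pow,
      show (1 : ℂ) - (‖q w₀‖ : ℂ) ^ 2 = ((1 - ‖q w₀‖ ^ 2 : ℝ) : ℂ) by push_cast; ring,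
      Complex.norm_real, Real.norm_of_nonneg hpos.le, sq (1 - ‖q w₀‖ ^ 2),
      mul_div_mul_right _ _ hpos.ne', div_le_iff₀ hpos] at h3
    exact h3
  have hg0 : g w₀ = 0 := by
    have := hmob g hgU
    rw [hgM] at this
    have : ‖g w₀‖ ^ 2 ≤ 0 := by nlinarith
    simpa using this
  have hc0 : c ≠ 0 := fun h => hcg ⟨w₀, hw₀, by rw [hg0, h]⟩
  have h1 := hmob s hsU
  have hkw : k w₀ = -c := by simp [hkdef, hg0]
  have hsw : ‖s w₀‖ ^ 2 = ‖c‖ := by rw [hsn, hkw, norm_neg]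
  have hkdw : ‖deriv k w₀‖ = M * (1 - ‖c‖ ^ 2) := by
    have hpos : 0 < 1 - ‖c‖ ^ 2 := by nlinarith [norm_nonneg c]
    rw [hkd w₀ hw₀, hg0, mul_zero, sub_zero, one_pow, div_one, norm_mul, hgM,
      show (1 : ℂ) - (‖c‖ : ℂ) ^ 2 = ((1 - ‖c‖ ^ 2 : ℝ) : ℂ) by push_cast; ring,
      Complex.norm_real, Real.norm_of_nonneg hpos.le]
  set x := ‖s w₀‖
  have hx : 0 < x := norm_pos_iff.2 (hs0 w₀ hw₀)
  have hx1 : x < 1 := mem_ball_zero_iff.1 (hsU.maps hw₀)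
  rw [(hsd w₀ hw₀).deriv, norm_div, norm_mul, hkdw, ← hsw, Complex.norm_two,
    div_le_iff₀ (by positivity)] at h1
  have h2 : M * (1 - x ^ 2) * ((1 - x) ^ 2) ≤ 0 := by linear_combination h1
  have h3 : 0 < 1 - x ^ 2 := by nlinarith
  have h4 : 0 < (1 - x) ^ 2 := by
    have : 0 < 1 - x := by linarith
    positivity
  have := mul_pos (mul_pos hM h3) h4
  linarith

theorem lintegral_norm_deriv_sq_le {O : Set ℂ} {h : ℂ → ℂ} (hO : IsOpen O)
    (hd : DifferentiableOn ℂ h O) (hm : MapsTo h O (Metric.ball 0 1)) (hi : InjOn h O) :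
    ∫⁻ z in O, ENNReal.ofReal (‖deriv h z‖ ^ 2) ≤ ENNReal.ofReal Real.pi := by
  have h1 : ∀ z ∈ O, HasFDerivWithinAt h
      ((ContinuousLinearMap.toSpanSingleton ℂ (deriv h z)).restrictScalars ℝ) O z := fun z hz =>
    ((hd.differentiableAt (hO.mem_nhds hz)).hasDerivAt.hasFDerivAt.restrictScalars
      ℝ).hasFDerivWithinAt
  have h2 := MeasureTheory.lintegral_abs_det_fderiv_eq_addHaar_image MeasureTheory.volume
    hO.measurableSet h1 hi
  have h3 : ∀ w : ℂ, |((ContinuousLinearMap.toSpanSingleton ℂ w).restrictScalars ℝ).det| = ‖w‖ ^ 2 := by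
    intro w
    have : ((ContinuousLinearMap.toSpanSingleton ℂ w).restrictScalars ℝ).det = ‖w‖ ^ 2 := by
      have e : ((ContinuousLinearMap.toSpanSingleton ℂ w).restrictScalars ℝ).det =
        LinearMap.det ((ContinuousLinearMap.toSpanSingleton ℂ w : ℂ →ₗ[ℂ] ℂ).restrictScalars ℝ) := rfl
      rw [e, LinearMap.det_restrictScalars]
      simp [Algebra.norm_complex_apply, Complex.normSq_eq_norm_sq]
    rw [this, abs_of_nonneg (by positivity)]
  simp only [h3] at h2
  rw [h2]
  refine (MeasureTheory.measure_mono hm.image_subset).trans ?_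
  rw [Complex.volume_ball]
  simp only [ENNReal.ofReal, Real.toNNReal_one, ENNReal.coe_one, one_pow, one_mul]
  exact ENNReal.coe_le_coe.2 (NNReal.coe_le_coe.1 (by simp [Real.pi_pos.le]))

/-- The length-area principle. -/
theorem length_area {O : Set ℂ} {h : ℂ → ℂ} (hO : IsOpen O)
    (hd : DifferentiableOn ℂ h O) (hm : MapsTo h O (Metric.ball 0 1)) (hi : InjOn h O) (z : ℂ)
    {η ε R : ℝ} (hη : 0 < η) (hε : 0 < ε) (hεR : ε < R)
    (hR : 2 * Real.pi ^ 2 / η ^ 2 < Real.log (R / ε)) :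
    ∃ ρ ∈ Ioo ε R, ∀ s t, s ≤ t → -Real.pi ≤ s → t ≤ Real.pi →
      (∀ θ ∈ Icc s t, circleMap z ρ θ ∈ O) → ‖h (circleMap z ρ t) - h (circleMap z ρ s)‖ ≤ η := by
  by_contra! hcon
  have hpi := Real.pi_pos
  set F : ℂ → ENNReal := O.indicator fun z => ENNReal.ofReal (‖deriv h z‖ ^ 2) with hF
  have hFm : Measurable F := by
    refine Measurable.indicator ?_ hO.measurableSet
    exact ((measurable_deriv h).norm.pow_const 2).ennreal_ofReal
  have h1 : ∫⁻ w, F (z + w) ≤ ENNReal.ofReal Real.pi := by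
    rw [MeasureTheory.lintegral_add_left_eq_self F z, MeasureTheory.lintegral_indicator hO.measurableSet]
    exact lintegral_norm_deriv_sq_le hO hd hm hi
  rw [← Complex.lintegral_comp_polarCoord_symm] at h1
  have hmeas : Measurable fun p : ℝ × ℝ => ENNReal.ofReal p.1 • F (z + Complex.polarCoord.symm p) := by
    have : Measurable fun p : ℝ × ℝ => Complex.polarCoord.symm p := by
      simp only [Complex.polarCoord_symm_apply]
      fun_prop
    exact (measurable_fst.ennreal_ofReal).smul (hFm.comp (measurable_const.add this))
  rw [polarCoord_target, MeasureTheory.Measure.volume_eq_prod,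
    MeasureTheory.setLIntegral_prod _ hmeas.aemeasurable] at h1
  have key : ∀ ρ ∈ Ioo ε R, ENNReal.ofReal (η ^ 2 / (2 * Real.pi) * ρ⁻¹) ≤
      ∫⁻ θ in Ioo (-Real.pi) Real.pi, ENNReal.ofReal ρ • F (z + Complex.polarCoord.symm (ρ, θ)) := by
    intro ρ hρ
    have hρ0 : 0 < ρ := hε.trans hρ.1
    obtain ⟨s, t, hst, hs, ht, hin, hbig⟩ := hcon ρ hρ
    set g : ℝ → ℂ := fun θ => deriv h (circleMap z ρ θ) * (circleMap 0 ρ θ * Complex.I) with hg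
    have hder : ∀ θ ∈ Icc s t, HasDerivAt (fun θ => h (circleMap z ρ θ)) (g θ) θ := fun θ hθ =>
      HasDerivAt.comp_of_eq θ (hd.differentiableAt (hO.mem_nhds (hin θ hθ))).hasDerivAt
        (hasDerivAt_circleMap z ρ θ) rfl
    have hdc : ContinuousOn (fun θ => deriv h (circleMap z ρ θ)) (Icc s t) :=
      (hd.deriv hO).continuousOn.comp (continuous_circleMap z ρ).continuousOn hin
    have hgc : ContinuousOn g (Icc s t) := hdc.mul (by fun_prop)
    have hu : uIcc s t = Icc s t := uIcc_of_le hst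
    have hftc := intervalIntegral.integral_eq_sub_of_hasDerivAt (fun θ hθ => hder θ (hu ▸ hθ))
      ((hu ▸ hgc : ContinuousOn g (uIcc s t)).intervalIntegrable)
    rw [← hftc] at hbig
    have hgn : ∀ θ, ‖g θ‖ = ‖deriv h (circleMap z ρ θ)‖ * ρ := fun θ => by
      simp [hg, abs_of_pos hρ0]
    set I : ℝ := ∫ θ in s..t, ‖deriv h (circleMap z ρ θ)‖ ^ 2 with hI
    have hii : IntervalIntegrable (fun θ => ‖deriv h (circleMap z ρ θ)‖ ^ 2) MeasureTheory.volume s t :=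
      (hu ▸ hdc.norm.pow 2 : ContinuousOn _ (uIcc s t)).intervalIntegrable
    have h2 : ‖∫ θ in s..t, g θ‖ ≤ Real.pi / η * ρ ^ 2 * I + η / 2 := by
      calc ‖∫ θ in s..t, g θ‖ ≤ ∫ θ in s..t, ‖g θ‖ :=
            intervalIntegral.norm_integral_le_integral_norm hst
        _ ≤ ∫ θ in s..t, (Real.pi / η * ρ ^ 2 * ‖deriv h (circleMap z ρ θ)‖ ^ 2 + η / (4 * Real.pi)) := by
            refine intervalIntegral.integral_mono_on hst
              ((hu ▸ hgc.norm : ContinuousOn _ (uIcc s t)).intervalIntegrable)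
              ((hii.const_mul _).add (by simp)) fun θ _ => ?_
            rw [hgn]
            set y := ‖deriv h (circleMap z ρ θ)‖ * ρ
            have : Real.pi / η * ρ ^ 2 * ‖deriv h (circleMap z ρ θ)‖ ^ 2 + η / (4 * Real.pi) - y
              = Real.pi / η * (y - η / (2 * Real.pi)) ^ 2 := by
              grind
            have : 0 ≤ Real.pi / η * (y - η / (2 * Real.pi)) ^ 2 := by positivity
            linarith
        _ = Real.pi / η * ρ ^ 2 * I + (t - s) * (η / (4 * Real.pi)) := by
            rw [intervalIntegral.integral_add (hii.const_mul _) (by simp),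
              intervalIntegral.integral_const_mul, intervalIntegral.integral_const, smul_eq_mul]
        _ ≤ Real.pi / η * ρ ^ 2 * I + (2 * Real.pi) * (η / (4 * Real.pi)) := by
            gcongr; linarith
        _ = _ := by field_simp; ring
    have h3 : η ^ 2 / (2 * Real.pi) * ρ⁻¹ ≤ ρ * I := by
      have : η / 2 ≤ Real.pi / η * ρ ^ 2 * I := by linarith
      have h4 := mul_le_mul_of_nonneg_left this (by positivity : 0 ≤ η / (Real.pi * ρ))
      calc _ = η / (Real.pi * ρ) * (η / 2) := by field_simp
        _ ≤ _ := h4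
        _ = _ := by field_simp
    refine (ENNReal.ofReal_le_ofReal h3).trans ?_
    have h5 : ENNReal.ofReal (ρ * I) = ∫⁻ θ in Ioo s t, ENNReal.ofReal ρ • F (z + Complex.polarCoord.symm (ρ, θ)) := by
      rw [ENNReal.ofReal_mul hρ0.le, hI, intervalIntegral.integral_of_le hst,
        MeasureTheory.integral_Ioc_eq_integral_Ioo,
        MeasureTheory.ofReal_integral_eq_lintegral_ofReal
          ((intervalIntegrable_iff_integrableOn_Ioo_of_le hst).1 hii) (Eventually.of_forall fun θ => by positivity),
        ← MeasureTheory.lintegral_const_mul' _ _ ENNReal.ofReal_ne_top]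
      refine MeasureTheory.setLIntegral_congr_fun measurableSet_Ioo fun θ hθ => ?_
      have : z + Complex.polarCoord.symm (ρ, θ) = circleMap z ρ θ := by
        rw [Complex.polarCoord_symm_apply, circleMap, Complex.exp_mul_I]
        push_cast
        rfl
      rw [this, hF, indicator_of_mem (hin θ (Ioo_subset_Icc_self hθ)), smul_eq_mul]
    rw [h5]
    exact MeasureTheory.lintegral_mono_set (Ioo_subset_Ioo hs ht)
  have h6 : ENNReal.ofReal (η ^ 2 / (2 * Real.pi) * Real.log (R / ε)) ≤ ENNReal.ofReal Real.pi := by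
    refine le_trans ?_ h1
    refine le_trans ?_ (MeasureTheory.lintegral_mono_set (Ioo_subset_Ioi_self.trans (Ioi_subset_Ioi hε.le) : Ioo ε R ⊆ Ioi 0))
    refine le_trans ?_ (MeasureTheory.setLIntegral_mono' measurableSet_Ioo key)
    have hmeas : IntervalIntegrable (fun ρ : ℝ => η ^ 2 / (2 * Real.pi) * ρ⁻¹) MeasureTheory.volume ε R := by
      refine ContinuousOn.intervalIntegrable ?_
      refine continuousOn_const.mul (continuousOn_inv₀.mono fun x hx => ?_)
      rw [uIcc_of_le hεR.le] at hx
      exact (hε.trans_le hx.1).ne'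
    rw [← MeasureTheory.ofReal_integral_eq_lintegral_ofReal
      ((intervalIntegrable_iff_integrableOn_Ioo_of_le hεR.le).1 hmeas)
      ((MeasureTheory.ae_restrict_iff' measurableSet_Ioo).2 (Eventually.of_forall fun x hx => by
        have := hε.trans hx.1
        positivity)),
      ← MeasureTheory.integral_Ioc_eq_integral_Ioo, ← intervalIntegral.integral_of_le hεR.le,
      intervalIntegral.integral_const_mul, integral_inv_of_pos hε (hε.trans hεR)]
  rw [ENNReal.ofReal_le_ofReal_iff hpi.le] at h6
  have h7 : η ^ 2 / (2 * Real.pi) * (2 * Real.pi ^ 2 / η ^ 2) < η ^ 2 / (2 * Real.pi) * Real.log (R / ε) := by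
    gcongr
  have h8 : η ^ 2 / (2 * Real.pi) * (2 * Real.pi ^ 2 / η ^ 2) = Real.pi := by field_simp
  linarith

theorem norm_sub_le_of_arcs {O : Set ℂ} {h : ℂ → ℂ} {z : ℂ} {ρ η : ℝ}
    (hρ : ∀ s t, s ≤ t → -Real.pi ≤ s → t ≤ Real.pi →
      (∀ θ ∈ Icc s t, circleMap z ρ θ ∈ O) → ‖h (circleMap z ρ t) - h (circleMap z ρ s)‖ ≤ η)
    {s t : ℝ} (hst : s ≤ t) (hts : t ≤ s + 2 * Real.pi) (hO : ∀ θ ∈ Icc s t, circleMap z ρ θ ∈ O) :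
    ‖h (circleMap z ρ t) - h (circleMap z ρ s)‖ ≤ 2 * η := by
  have hpi := Real.pi_pos
  obtain ⟨n, hn⟩ : ∃ n : ℤ, s + n * (2 * Real.pi) ∈ Ico (-Real.pi) Real.pi := by
    obtain ⟨n, hn, -⟩ := existsUnique_add_zsmul_mem_Ico (by positivity : 0 < 2 * Real.pi) s (-Real.pi)
    grind
  have hper : ∀ (m : ℤ) θ, circleMap z ρ (θ + m * (2 * Real.pi)) = circleMap z ρ θ := fun m θ =>
    (periodic_circleMap z ρ).int_mul m θ
  have hO' : ∀ θ ∈ Icc (s + n * (2 * Real.pi)) (t + n * (2 * Real.pi)), circleMap z ρ θ ∈ O := fun θ hθ => by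
    have h1 := hper n (θ - n * (2 * Real.pi))
    grind
  rw [← hper n s, ← hper n t]
  set s' := s + n * (2 * Real.pi)
  set t' := t + n * (2 * Real.pi)
  have hst' : s' ≤ t' := by simp only [s', t']; linarith
  have hη : 0 ≤ η := by
    have := hρ s' s' le_rfl hn.1 hn.2.le fun θ hθ => hO' θ ⟨hθ.1, hθ.2.trans hst'⟩
    rwa [sub_self, norm_zero] at this
  rcases le_total t' Real.pi with h1 | h1
  · exact (hρ s' t' hst' hn.1 h1 hO').trans (by linarith)
  · have h2 := hρ s' Real.pi hn.2.le hn.1 le_rfl fun θ hθ => hO' θ ⟨hθ.1, hθ.2.trans h1⟩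
    have hback : ∀ θ, circleMap z ρ (θ - 2 * Real.pi) = circleMap z ρ θ := fun θ =>
      (periodic_circleMap z ρ).sub_eq θ
    have h3 := hρ (-Real.pi) (t' - 2 * Real.pi) (by linarith) le_rfl
      (by simp only [s', t'] at *; linarith [hn.2]) fun θ hθ => by
        have e := hback (θ + 2 * Real.pi)
        grind
    rw [hback, show -Real.pi = Real.pi - 2 * Real.pi by ring, hback] at h3
    have := norm_sub_le_norm_sub_add_norm_sub (h (circleMap z ρ t')) (h (circleMap z ρ Real.pi)) (h (circleMap z ρ s'))
    linarith

theorem exists_small_circle_aux {O : Set ℂ} {h : ℂ → ℂ} (hO : IsOpen O) (hOs : IsSimplyConnected O)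
    (hd : DifferentiableOn ℂ h O) (hm : MapsTo h O (Metric.ball 0 1)) (hi : InjOn h O) {a : ℂ}
    (ha : a ∉ O) {η ε R : ℝ} (hη : 0 < η) (hε : 0 < ε) (hεR : ε < R)
    (hR : 2 * Real.pi ^ 2 / (η / 2) ^ 2 < Real.log (R / ε)) :
    ∃ ρ ∈ Ioo ε R, ∀ c, IsCompOf (Metric.sphere a ρ ∩ O) c → ∀ u ∈ c, ∀ v ∈ c, ‖h u - h v‖ ≤ η := by
  obtain ⟨ρ, hρ, hlen⟩ := length_area hO hd hm hi a (half_pos hη) hε hεR hR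
  refine ⟨ρ, hρ, fun c hc => ?_⟩
  obtain ⟨α, β, hαβ, hβ, hin, -, -, rfl⟩ := exists_arc_of_isCompOf_sphere hO hOs ha (hε.trans hρ.1) hc
  have key : ∀ s ∈ Ioo α β, ∀ t ∈ Ioo α β, s ≤ t →
      ‖h (circleMap a ρ t) - h (circleMap a ρ s)‖ ≤ η := fun s hs t ht hst => by
    have := norm_sub_le_of_arcs hlen hst (by linarith [hs.1, ht.2]) fun θ hθ =>
      hin θ ⟨hs.1.trans_le hθ.1, hθ.2.trans_lt ht.2⟩
    linarith
  rintro _ ⟨s, hs, rfl⟩ _ ⟨t, ht, rfl⟩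
  rcases le_total s t with hst | hst
  · rw [norm_sub_rev]
    exact key s hs t ht hst
  · exact key t ht s hs hst

/-- Arbitrarily small circles on whose traces a bounded univalent map oscillates little. -/
theorem exists_small_circle {O : Set ℂ} {h : ℂ → ℂ} (hO : IsOpen O) (hOs : IsSimplyConnected O)
    (hd : DifferentiableOn ℂ h O) (hm : MapsTo h O (Metric.ball 0 1)) (hi : InjOn h O) {a : ℂ}
    (ha : a ∉ O) {η R : ℝ} (hη : 0 < η) (hR : 0 < R) :
    ∃ ρ ∈ Ioo 0 R, ∀ c, IsCompOf (Metric.sphere a ρ ∩ O) c → ∀ u ∈ c, ∀ v ∈ c, ‖h u - h v‖ ≤ η := by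
  set L := 2 * Real.pi ^ 2 / (η / 2) ^ 2 + 1 with hL
  have hL0 : 0 < L := by positivity
  obtain ⟨ρ, hρ, h⟩ := exists_small_circle_aux hO hOs hd hm hi ha hη (ε := R * Real.exp (-L)) (R := R)
    (by positivity) (mul_lt_of_lt_one_right hR (by simpa using hL0)) (by
      rw [div_mul_eq_div_div, div_self hR.ne', Real.exp_neg, one_div, inv_inv, Real.log_exp, hL]
      linarith)
  exact ⟨ρ, ⟨lt_trans (by positivity) hρ.1, hρ.2⟩, h⟩

/-- Arbitrarily large circles on whose traces a bounded univalent map oscillates little. -/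
theorem exists_large_circle {O : Set ℂ} {h : ℂ → ℂ} (hO : IsOpen O) (hOs : IsSimplyConnected O)
    (hd : DifferentiableOn ℂ h O) (hm : MapsTo h O (Metric.ball 0 1)) (hi : InjOn h O) {a : ℂ}
    (ha : a ∉ O) {η R : ℝ} (hη : 0 < η) (hR : 0 < R) :
    ∃ ρ, R < ρ ∧ ∀ c, IsCompOf (Metric.sphere a ρ ∩ O) c → ∀ u ∈ c, ∀ v ∈ c, ‖h u - h v‖ ≤ η := by
  set L := 2 * Real.pi ^ 2 / (η / 2) ^ 2 + 1 with hL
  have hL0 : 0 < L := by positivity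
  obtain ⟨ρ, hρ, h⟩ := exists_small_circle_aux hO hOs hd hm hi ha hη (ε := R) (R := R * Real.exp L)
    hR (lt_mul_of_one_lt_right hR (by simpa using hL0)) (by
      rw [mul_div_cancel_left₀ _ hR.ne', Real.log_exp, hL]
      linarith)
  exact ⟨ρ, hρ.1, h⟩

/-- `ψ` is a conformal map of `U` onto the unit disc, with inverse `φ`. -/
structure RMap (U : Set ℂ) (ψ φ : ℂ → ℂ) : Prop where
  mapsTo : MapsTo ψ U (Metric.ball 0 1)
  mapsTo_inv : MapsTo φ (Metric.ball 0 1) U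
  left_inv : ∀ z ∈ U, φ (ψ z) = z
  right_inv : ∀ w ∈ Metric.ball (0 : ℂ) 1, ψ (φ w) = w
  diff : DifferentiableOn ℂ ψ U
  diff_inv : DifferentiableOn ℂ φ (Metric.ball 0 1)

theorem exists_rMap {U : Set ℂ} (hUo : IsOpen U) (hUs : IsSimplyConnected U) {a : ℂ}
    (ha : a ∉ U) : ∃ ψ φ, RMap U ψ φ := by
  obtain ⟨ψ, hψ, hsurj⟩ := exists_riemann_map hUo hUs ha
  have hφ : ∀ w ∈ Metric.ball (0 : ℂ) 1, Function.invFunOn ψ U w ∈ U ∧ ψ (Function.invFunOn ψ U w) = w :=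
    fun w hw => by
      have : w ∈ ψ '' U := hsurj ▸ hw
      exact ⟨Function.invFunOn_mem this, Function.invFunOn_eq this⟩
  refine ⟨ψ, Function.invFunOn ψ U, hψ.maps, fun w hw => (hφ w hw).1,
    fun z hz => hψ.inj.leftInvOn_invFunOn hz, fun w hw => (hφ w hw).2, hψ.diff, fun w hw => ?_⟩
  obtain ⟨hz, hzw⟩ := hφ w hw
  set z := Function.invFunOn ψ U w with hzdef
  have hs : HasStrictDerivAt ψ (deriv ψ z) z :=
    ((hψ.diff.analyticOnNhd hUo z hz).contDiffAt (n := 1)).hasStrictDerivAt (by simp)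
  have h1 := (hs.to_localInverse (hψ.deriv_ne z hz)).hasDerivAt
  have h2 := hs.eventually_right_inverse (hψ.deriv_ne z hz)
  rw [hzw] at h1 h2
  have h3 : HasStrictDerivAt.localInverse ψ (deriv ψ z) z hs (hψ.deriv_ne z hz) w = z := by
    have := (hs.eventually_left_inverse (hψ.deriv_ne z hz)).self_of_nhds
    rwa [hzw] at this
  have h4 : ∀ᶠ y in 𝓝 w, HasStrictDerivAt.localInverse ψ (deriv ψ z) z hs (hψ.deriv_ne z hz) y ∈ U :=
    h1.continuousAt.eventually_mem (by rw [h3]; exact hUo.mem_nhds hz)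
  refine (h1.differentiableAt.congr_of_eventuallyEq ?_).differentiableWithinAt
  filter_upwards [h2, h4] with y hy hyU
  conv_lhs => rw [← hy]
  exact hψ.inj.leftInvOn_invFunOn hyU

/-- A set of small diameter near the unit circle controls every point it separates radially
from the origin. -/
theorem norm_sub_le_of_shadow {κ : Set ℂ} {η : ℝ} (hη : ∀ u ∈ κ, ∀ v ∈ κ, ‖u - v‖ ≤ η)
    (h1 : ∀ u ∈ κ, 1 - η ≤ ‖u‖) {w : ℂ} (hw : ‖w‖ < 1) (hwκ : (segment ℝ 0 w ∩ κ).Nonempty) {u : ℂ}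
    (hu : u ∈ κ) : ‖w - u‖ ≤ 2 * η := by
  obtain ⟨v, hv, hvκ⟩ := hwκ
  rw [segment_eq_image] at hv
  obtain ⟨t, ht, rfl⟩ := hv
  simp only [smul_zero, zero_add] at hvκ
  have h2 : ‖w - t • w‖ = ‖w‖ - ‖t • w‖ := by
    rw [show w - t • w = (1 - t) • w by rw [sub_smul, one_smul], norm_smul, norm_smul,
      Real.norm_of_nonneg ht.1, Real.norm_of_nonneg (sub_nonneg.2 ht.2)]
    ring
  have h3 := h1 _ hvκ
  have h4 := hη _ hvκ _ hu
  have := norm_sub_le_norm_sub_add_norm_sub w (t • w) u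
  linarith

theorem isSimplyConnected_unitBall : IsSimplyConnected (Metric.ball (0 : ℂ) 1) :=
  isSimplyConnected_of_convex (convex_ball 0 1) ⟨0, Metric.mem_ball_self one_pos⟩

namespace RMap

variable {U : Set ℂ} {ψ φ : ℂ → ℂ} (h : RMap U ψ φ)
include h

theorem injOn : InjOn ψ U := fun x hx y hy hxy => by
  rw [← h.left_inv x hx, ← h.left_inv y hy, hxy]

theorem injOn_inv : InjOn φ (Metric.ball 0 1) := fun x hx y hy hxy => by
  rw [← h.right_inv x hx, ← h.right_inv y hy, hxy]

theorem zero_mem : φ 0 ∈ U := h.mapsTo_inv (Metric.mem_ball_self one_pos)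

theorem isCompact_image_closedBall {t : ℝ} (ht : t < 1) : IsCompact (φ '' Metric.closedBall 0 t) :=
  (isCompact_closedBall _ _).image_of_continuousOn
    (h.diff_inv.continuousOn.mono (Metric.closedBall_subset_ball ht))

theorem image_closedBall_subset {t : ℝ} (ht : t < 1) : φ '' Metric.closedBall 0 t ⊆ U :=
  image_subset_iff.2 fun _ hw => h.mapsTo_inv (Metric.closedBall_subset_ball ht hw)

theorem mem_image_closedBall {z : ℂ} (hz : z ∈ U) {t : ℝ} (ht : ‖ψ z‖ ≤ t) :
    z ∈ φ '' Metric.closedBall 0 t :=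
  ⟨ψ z, mem_closedBall_zero_iff.2 ht, h.left_inv z hz⟩

/-- Near the boundary and near infinity, `ψ` is close to the unit circle. -/
theorem norm_lt_of_mem_nhds {z : ℂ} (hz : z ∉ U) {t : ℝ} (ht : t < 1) :
    ∀ᶠ w in 𝓝 z, w ∈ U → t < ‖ψ w‖ := by
  filter_upwards [(h.isCompact_image_closedBall ht).isClosed.isOpen_compl.mem_nhds
    fun hc => hz (h.image_closedBall_subset ht hc)] with w hw hwU
  by_contra hcon
  exact hw (h.mem_image_closedBall hwU (not_lt.1 hcon))

theorem norm_lt_cocompact {t : ℝ} (ht : t < 1) :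
    ∀ᶠ w in cocompact ℂ, w ∈ U → t < ‖ψ w‖ := by
  filter_upwards [(h.isCompact_image_closedBall ht).compl_mem_cocompact] with w hw hwU
  by_contra hcon
  exact hw (h.mem_image_closedBall hwU (not_lt.1 hcon))

theorem segment_inter_nonempty {c : Set ℂ} {x : ℂ} (hx : x ∈ U)
    (hc : φ 0 ∉ connectedComponentIn (U \ c) x) : (segment ℝ 0 (ψ x) ∩ ψ '' c).Nonempty := by
  by_contra hcon
  have hsub : segment ℝ 0 (ψ x) ⊆ Metric.ball 0 1 :=
    (convex_ball _ _).segment_subset (Metric.mem_ball_self one_pos) (h.mapsTo hx)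
  refine hc (mem_ccIn_of_isPreconnected (T := φ '' segment ℝ 0 (ψ x))
    ((convex_segment _ _).isPreconnected.image _ (h.diff_inv.continuousOn.mono hsub)) ?_
    ⟨ψ x, right_mem_segment _ _ _, h.left_inv x hx⟩ ⟨0, left_mem_segment _ _ _, rfl⟩)
  rintro _ ⟨w, hw, rfl⟩
  exact ⟨h.mapsTo_inv (hsub hw), fun hwc => hcon ⟨w, hw, φ w, hwc, h.right_inv w (hsub hw)⟩⟩

/-- A connected subset of `U` separated from `φ 0` by a circle on which `ψ` oscillates little has
a small image. -/
theorem norm_sub_le_of_sphere (hUo : IsOpen U) (hUs : IsSimplyConnected U) {a : ℂ} {ρ η : ℝ}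
    (hosc : ∀ c, IsCompOf (Metric.sphere a ρ ∩ U) c → ∀ u ∈ c, ∀ v ∈ c, ‖ψ u - ψ v‖ ≤ η)
    (hfar : ∀ u ∈ Metric.sphere a ρ ∩ U, 1 - η ≤ ‖ψ u‖) {κ : Set ℂ} (hκ : IsPreconnected κ) (hκU : κ ⊆ U)
    (hκS : Disjoint κ (Metric.sphere a ρ)) {x : ℂ} (hx : x ∈ κ) (h0 : φ 0 ∉ Metric.sphere a ρ)
    (hsep : φ 0 ∉ connectedComponentIn (U \ (Metric.sphere a ρ ∩ U)) x) :
    ∀ u ∈ κ, ∀ v ∈ κ, ‖ψ u - ψ v‖ ≤ 4 * η := by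
  have hYo : IsOpen (U \ (Metric.sphere a ρ ∩ U)) := by
    rw [sdiff_inter_self_eq_sdiff]
    exact hUo.sdiff Metric.isClosed_sphere
  obtain ⟨c, hc, hcsep⟩ := exists_isCompOf_separating hUo hUs hYo
    (w := x) (z := φ 0) ⟨hκU hx, fun hxs => hκS.le_bot ⟨hx, hxs.1⟩⟩ ⟨h.zero_mem, fun hxs => h0 hxs.1⟩ hsep
  obtain ⟨u₀, hu₀⟩ := hc.nonempty
  have hκc : κ ⊆ U \ c := fun y hy => ⟨hκU hy, fun hyc => hκS.le_bot ⟨hy, (hc.subset hyc).1⟩⟩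
  have key : ∀ u ∈ κ, ‖ψ u - ψ u₀‖ ≤ 2 * η := fun u hu => by
    refine norm_sub_le_of_shadow (κ := ψ '' c) ?_ ?_ (mem_ball_zero_iff.1 (h.mapsTo (hκU hu)))
      (h.segment_inter_nonempty (hκU hu) ?_) ⟨u₀, hu₀, rfl⟩
    · grind
    · rintro _ ⟨u, hu, rfl⟩
      exact hfar u (hc.subset hu)
    · rwa [← connectedComponentIn_eq (hκ.subset_connectedComponentIn hx hκc hu)]
  intro u hu v hv
  have h1 := key u hu
  have h2 := key v hv
  rw [norm_sub_rev] at h2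
  have := norm_sub_le_norm_sub_add_norm_sub (ψ u) (ψ u₀) (ψ v)
  linarith

theorem small_of_nhds (hUo : IsOpen U) (hUs : IsSimplyConnected U) {z : ℂ} (hz : z ∉ U) {η : ℝ}
    (hη : 0 < η) : ∃ V ∈ 𝓝 z, ∀ κ ⊆ U ∩ V, IsPreconnected κ → ∀ u ∈ κ, ∀ v ∈ κ, ‖ψ u - ψ v‖ ≤ η := by
  obtain ⟨R, hR, hball⟩ := Metric.eventually_nhds_iff_ball.1 ((h.norm_lt_of_mem_nhds hz
    (show 1 - η / 4 < 1 by linarith)).and (isOpen_ne.eventually_mem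
      (show z ≠ φ 0 from fun e => hz (e ▸ h.zero_mem))))
  obtain ⟨ρ, hρ, hosc⟩ := exists_small_circle hUo hUs h.diff h.mapsTo h.injOn hz
    (show 0 < η / 4 by linarith) hR
  refine ⟨Metric.ball z ρ, Metric.ball_mem_nhds _ hρ.1, fun κ hκU hκ u hu v hv => ?_⟩
  have h0 : φ 0 ∉ Metric.closedBall z ρ := fun h0 =>
    (hball (φ 0) (Metric.closedBall_subset_ball hρ.2 h0)).2 rfl
  have hsep : φ 0 ∉ connectedComponentIn (U \ (Metric.sphere z ρ ∩ U)) u := fun hc => h0 <| by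
    have hu' : u ∈ U \ (Metric.sphere z ρ ∩ U) :=
      ⟨(hκU hu).1, fun hs => (Metric.mem_ball.1 (hκU hu).2).ne (Metric.mem_sphere.1 hs.1)⟩
    refine Metric.ball_subset_closedBall (isPreconnected_connectedComponentIn.subset_ball ?_
      ⟨u, mem_connectedComponentIn hu', (hκU hu).2⟩ hc)
    exact Set.disjoint_left.2 fun y hy hys => by
      have := connectedComponentIn_subset _ _ hy
      exact this.2 ⟨hys, this.1⟩
  have := h.norm_sub_le_of_sphere hUo hUs hosc
    (fun u hu => ((hball u (Metric.closedBall_subset_ball hρ.2 (Metric.sphere_subset_closedBall hu.1))).1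
      hu.2).le) hκ (hκU.trans inter_subset_left)
    (Set.disjoint_left.2 fun y hy hys => (Metric.mem_ball.1 (hκU hy).2).ne (Metric.mem_sphere.1 hys)) hu
    (fun hs => h0 (Metric.sphere_subset_closedBall hs)) hsep u hu v hv
  linarith

theorem small_of_cocompact (hUo : IsOpen U) (hUs : IsSimplyConnected U) {a : ℂ} (ha : a ∉ U) {η : ℝ}
    (hη : 0 < η) :
    ∃ V ∈ cocompact ℂ, ∀ κ ⊆ U ∩ V, IsPreconnected κ → ∀ u ∈ κ, ∀ v ∈ κ, ‖ψ u - ψ v‖ ≤ η := by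
  obtain ⟨K, hK, hKsub⟩ := mem_cocompact.1 (h.norm_lt_cocompact (show 1 - η / 4 < 1 by linarith))
  obtain ⟨R, hR⟩ := (hK.insert (φ 0)).isBounded.subset_closedBall a
  obtain ⟨ρ, hρ, hosc⟩ := exists_large_circle hUo hUs h.diff h.mapsTo h.injOn ha
    (show 0 < η / 4 by linarith) (lt_max_of_lt_right one_pos : 0 < max R 1)
  have hρR : R < ρ := (le_max_left _ _).trans_lt hρ
  refine ⟨(Metric.closedBall a ρ)ᶜ, (isCompact_closedBall a ρ).compl_mem_cocompact,
    fun κ hκU hκ u hu v hv => ?_⟩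
  have h0 : φ 0 ∈ Metric.ball a ρ := Metric.closedBall_subset_ball hρR (hR (mem_insert _ _))
  have hsep : φ 0 ∉ connectedComponentIn (U \ (Metric.sphere a ρ ∩ U)) u := fun hc => by
    have hu' : u ∈ U \ (Metric.sphere a ρ ∩ U) :=
      ⟨(hκU hu).1, fun hs => (hκU hu).2 (Metric.sphere_subset_closedBall hs.1)⟩
    refine isPreconnected_connectedComponentIn.subset_compl_closedBall ?_
      ⟨u, mem_connectedComponentIn hu', (hκU hu).2⟩ hc (Metric.ball_subset_closedBall h0)
    exact Set.disjoint_left.2 fun y hy hys => by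
      have := connectedComponentIn_subset _ _ hy
      exact this.2 ⟨hys, this.1⟩
  have := h.norm_sub_le_of_sphere hUo hUs hosc
    (fun u hu => by
      refine le_of_lt (hKsub (fun huK => ?_) hu.2)
      exact (Metric.mem_ball.1 (Metric.closedBall_subset_ball hρR (hR (mem_insert_of_mem _ huK)))).ne
        (Metric.mem_sphere.1 hu.1)) hκ (hκU.trans inter_subset_left)
    (Set.disjoint_left.2 fun y hy hys => (hκU hy).2 (Metric.sphere_subset_closedBall hys)) hu
    (fun hs => (Metric.mem_ball.1 h0).ne (Metric.mem_sphere.1 hs)) hsep u hu v hv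
  linarith

end RMap

theorem isPreconnected_arc_re {R c : ℝ} (hc : 0 ≤ c) : IsPreconnected {y : ℂ | ‖y‖ = R ∧ c < y.re} := by
  have h1 : {y : ℂ | ‖y‖ = R ∧ c < y.re} =
      (fun t : ℝ => (⟨Real.sqrt (R ^ 2 - t ^ 2), t⟩ : ℂ)) '' {t : ℝ | 0 ≤ R ∧ t ^ 2 < R ^ 2 - c ^ 2} := by
    ext y
    constructor
    · rintro ⟨hy, hre⟩
      have h2 : y.re ^ 2 + y.im ^ 2 = R ^ 2 := by
        rw [← hy, Complex.sq_norm, Complex.normSq_apply]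
        ring
      refine ⟨y.im, ⟨hy ▸ norm_nonneg _, by nlinarith⟩, Complex.ext ?_ rfl⟩
      show Real.sqrt (R ^ 2 - y.im ^ 2) = y.re
      rw [show R ^ 2 - y.im ^ 2 = y.re ^ 2 by linarith, Real.sqrt_sq (by linarith)]
    · rintro ⟨t, ⟨hR, ht⟩, rfl⟩
      have h2 : Real.sqrt (R ^ 2 - t ^ 2) ^ 2 = R ^ 2 - t ^ 2 := Real.sq_sqrt (by nlinarith)
      refine ⟨?_, Real.lt_sqrt_of_sq_lt (by linarith)⟩
      rw [← sq_eq_sq₀ (norm_nonneg _) hR, Complex.sq_norm, Complex.normSq_apply]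
      grind
  rw [h1]
  refine IsPreconnected.image ?_ _ (Continuous.continuousOn ?_)
  · refine (OrdConnected.isPreconnected ⟨fun s hs t ht x hx => ⟨hs.1, ?_⟩⟩)
    have := hs.2
    have := ht.2
    rcases le_total 0 x with h0 | h0
    · nlinarith [hx.2]
    · nlinarith [hx.1]
  · have : (fun t : ℝ => (⟨Real.sqrt (R ^ 2 - t ^ 2), t⟩ : ℂ)) =
        fun t : ℝ => (Real.sqrt (R ^ 2 - t ^ 2) : ℂ) + t * Complex.I := by
      ext t
      apply Complex.ext <;> simp
    rw [this]
    exact (Complex.continuous_ofReal.comp (by fun_prop)).add (by fun_prop)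

section caps

variable {ζ : ℂ} {r : ℝ}

theorem isPreconnected_edge (hζ : ‖ζ‖ = 1) : IsPreconnected (Metric.ball (0 : ℂ) 1 ∩ Metric.sphere ζ r) := by
  have h1 : Metric.ball (0 : ℂ) 1 ∩ Metric.sphere ζ r =
      (fun y => ζ * (1 - y)) '' {y : ℂ | ‖y‖ = r ∧ r ^ 2 / 2 < y.re} := by
    have hζ0 : ζ ≠ 0 := norm_ne_zero_iff.1 (by rw [hζ]; exact one_ne_zero)
    have key : ∀ y : ℂ, ‖y‖ = r → (‖1 - y‖ < 1 ↔ r ^ 2 / 2 < y.re) := fun y hy => by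
      have e1 : ‖1 - y‖ ^ 2 = 1 - 2 * y.re + r ^ 2 := by
        rw [← hy, Complex.sq_norm, Complex.sq_norm, Complex.normSq_apply, Complex.normSq_apply]
        simp
        ring
      rw [← sq_lt_one_iff₀ (norm_nonneg _), e1]
      constructor <;> intro h <;> linarith
    ext w
    constructor
    · rintro ⟨hw, hws⟩
      rw [mem_ball_zero_iff] at hw
      rw [mem_sphere_iff_norm] at hws
      have h2 : ‖1 - w / ζ‖ = r := by
        rw [← hws, show 1 - w / ζ = -(w - ζ) / ζ by field_simp; ring, norm_div, hζ, norm_neg, div_one]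
      refine ⟨1 - w / ζ, ⟨h2, (key _ h2).1 ?_⟩, ?_⟩
      · rwa [sub_sub_cancel, norm_div, hζ, div_one]
      · field_simp
        ring
    · rintro ⟨y, ⟨hy, hre⟩, rfl⟩
      refine ⟨?_, ?_⟩
      · rw [mem_ball_zero_iff, norm_mul, hζ, one_mul]
        exact (key y hy).2 hre
      · rw [mem_sphere_iff_norm, show ζ * (1 - y) - ζ = -(ζ * y) by ring, norm_neg, norm_mul, hζ, one_mul, hy]
  rw [h1]
  exact (isPreconnected_arc_re (by positivity)).image _ (by fun_prop)

theorem isPreconnected_ball_diff_ball (hζ : ‖ζ‖ = 1) (hr : 0 < r) :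
    IsPreconnected (Metric.ball (0 : ℂ) 1 \ Metric.ball ζ r) := by
  have hζ0 : ζ ≠ 0 := norm_ne_zero_iff.1 (by rw [hζ]; exact one_ne_zero)
  have key : ∀ v : ℂ, v ≠ 0 → (‖1 - v⁻¹‖ < 1 ↔ 1 / 2 < v.re) := fun v hv => by
    have e0 : 1 - v⁻¹ = (v - 1) / v := by field_simp
    have e1 : ‖v - 1‖ ^ 2 = ‖v‖ ^ 2 - 2 * v.re + 1 := by
      rw [Complex.sq_norm, Complex.sq_norm, Complex.normSq_apply, Complex.normSq_apply]
      simp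
      ring
    rw [e0, norm_div, div_lt_one (norm_pos_iff.2 hv), ← sq_lt_sq₀ (norm_nonneg _) (norm_nonneg _), e1]
    constructor <;> intro h <;> linarith
  have h1 : Metric.ball (0 : ℂ) 1 \ Metric.ball ζ r =
      (fun v => ζ * (1 - v⁻¹)) '' ({v : ℂ | 1 / 2 < v.re} ∩ Metric.closedBall 0 r⁻¹) := by
    ext w
    constructor
    · rintro ⟨hw, hws⟩
      rw [mem_ball_zero_iff] at hw
      rw [mem_ball_iff_norm, not_lt] at hws
      have hwζ : w - ζ ≠ 0 := norm_pos_iff.1 (hr.trans_le hws)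
      have hv : -ζ / (w - ζ) ≠ 0 := div_ne_zero (neg_ne_zero.2 hζ0) hwζ
      have e : ζ * (1 - (-ζ / (w - ζ))⁻¹) = w := by
        field_simp
        ring
      refine ⟨-ζ / (w - ζ), ⟨(key _ hv).1 ?_, ?_⟩, e⟩
      · rwa [← e, norm_mul, hζ, one_mul] at hw
      · rw [mem_closedBall_zero_iff, norm_div, norm_neg, hζ, one_div]
        exact inv_anti₀ hr hws
    · rintro ⟨v, ⟨hv, hvr⟩, rfl⟩
      have hv0 : v ≠ 0 := fun h => by
        rw [h] at hv
        simp only [mem_ofPred_eq, Complex.zero_re] at hv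
        linarith
      refine ⟨?_, ?_⟩
      · rw [mem_ball_zero_iff, norm_mul, hζ, one_mul]
        exact (key v hv0).2 hv
      · rw [mem_ball_iff_norm, not_lt, show ζ * (1 - v⁻¹) - ζ = -(ζ * v⁻¹) by ring, norm_neg, norm_mul, hζ,
          one_mul, norm_inv]
        rw [mem_closedBall_zero_iff] at hvr
        exact (le_inv_comm₀ (norm_pos_iff.2 hv0) hr).1 hvr
  rw [h1]
  refine (((convex_halfSpace_re_gt _).inter (convex_closedBall _ _)).isPreconnected).image _ ?_
  refine continuousOn_const.mul (continuousOn_const.sub (continuousOn_id.inv₀ fun v hv h => ?_))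
  have := hv.1
  rw [show v = 0 from h] at this
  simp only [mem_ofPred_eq, Complex.zero_re] at this
  linarith

theorem mem_edge (hζ : ‖ζ‖ = 1) (hr : 0 < r) (hr1 : r < 1) :
    (1 - r : ℝ) • ζ ∈ Metric.ball (0 : ℂ) 1 ∩ Metric.sphere ζ r := by
  refine ⟨?_, ?_⟩
  · rw [mem_ball_zero_iff, norm_smul, hζ, Real.norm_of_nonneg (by linarith)]
    linarith
  · rw [mem_sphere_iff_norm, sub_smul, one_smul, sub_sub_cancel_left, norm_neg, norm_smul, hζ, mul_one,
      Real.norm_of_nonneg hr.le]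

theorem mem_cap (hζ : ‖ζ‖ = 1) {s : ℝ} (hs : 0 < s) (hs1 : s < 1) (hsr : s < r) :
    (1 - s : ℝ) • ζ ∈ Metric.ball (0 : ℂ) 1 ∩ Metric.ball ζ r :=
  ⟨(mem_edge hζ hs hs1).1, Metric.mem_ball.2 (by rw [Metric.mem_sphere.1 (mem_edge hζ hs hs1).2]; exact hsr)⟩

end caps

/-- The caps of the unit disc at a boundary point yield an end of the domain. -/
theorem RMap.shrinkingCaps {U : Set ℂ} {ψ φ : ℂ → ℂ} (h : RMap U ψ φ) {ζ : ℂ} (hζ : ‖ζ‖ = 1) {r : ℕ → ℝ}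
    (hr0 : ∀ n, 0 < r n) (hr1 : ∀ n, r n < 1) (hanti : Antitone r) (hlim : Tendsto r atTop (𝓝 0))
    {l : Filter ℂ} {H : ℂ → ℝ} (hH : Tendsto H l (𝓝 0))
    (hl : ∀ V ∈ l, ∃ N, ∀ n, N ≤ n → φ '' (Metric.ball 0 1 ∩ Metric.sphere ζ (r n)) ⊆ V)
    (hpos : ∀ v ∈ U, 0 < H v) (hcont : ContinuousOn H U)
    (hgauge : (∀ r > 0, ∀ x ∈ U, ∀ y ∈ U, H x < r → r < H y →
      ∃ c, IsCrossCut U c ∧ closure c ⊆ {v | H v = r} ∧ y ∉ connectedComponentIn (U \ c) x) ∧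
      ∀ c c', IsCrossCut U c → IsCrossCut U c' → closure c ∩ closure c' = ∅ →
        ∃ ε > 0, (∀ v ∈ c, ε ≤ H v) ∨ ∀ v ∈ c', ε ≤ H v) :
    ShrinkingCaps U H (fun n => φ '' (Metric.ball 0 1 ∩ Metric.ball ζ (r n)))
      (fun n => φ '' (Metric.ball 0 1 ∩ Metric.sphere ζ (r n))) := by
  have hun : ∀ n, Metric.ball (0 : ℂ) 1 ∩ Metric.ball ζ (r n) ∪ Metric.ball 0 1 ∩ Metric.sphere ζ (r n) =
      Metric.ball 0 1 ∩ Metric.closedBall ζ (r n) := fun n => by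
    rw [← inter_union_distrib_left, Metric.ball_union_sphere]
  constructor
  · intro n
    rw [← image_union, hun]
    exact image_subset_iff.2 fun w hw => h.mapsTo_inv hw.1
  · exact fun m n hmn => image_mono (inter_subset_inter_right _ (Metric.ball_subset_ball (hanti hmn)))
  · exact fun n => ⟨_, mem_image_of_mem _ (mem_cap hζ (half_pos (hr0 n)) (by linarith [hr0 n, hr1 n])
      (half_lt_self (hr0 n)))⟩
  · exact fun n => ⟨_, mem_image_of_mem _ (mem_edge hζ (hr0 n) (hr1 n))⟩
  · intro n
    rw [Set.disjoint_left]
    rintro _ ⟨w, hw, rfl⟩ ⟨w', hw', he⟩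
    rw [h.injOn_inv hw'.1 hw.1 he] at hw'
    exact (Metric.mem_ball.1 hw.2).ne (Metric.mem_sphere.1 hw'.2)
  · intro n T hT hTU hne hns
    by_contra hcon
    refine hns fun y hy => ⟨ψ y, ⟨h.mapsTo (hTU hy), ?_⟩, h.left_inv y (hTU hy)⟩
    refine (hT.image ψ (h.diff.continuousOn.mono hTU)).subset_ball ?_ ?_ ⟨y, hy, rfl⟩
    · rw [Set.disjoint_left]
      rintro _ ⟨x, hx, rfl⟩ hxs
      exact hcon ⟨x, hx, ψ x, ⟨h.mapsTo (hTU hx), hxs⟩, h.left_inv x (hTU hx)⟩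
    · obtain ⟨_, hx, w, hw, rfl⟩ := hne
      exact ⟨w, ⟨φ w, hx, h.right_inv w hw.1⟩, hw.2⟩
  · intro y hy
    have hyζ : 0 < dist (ψ y) ζ := dist_pos.2 fun e => by
      have := mem_ball_zero_iff.1 (h.mapsTo hy)
      rw [e, hζ] at this
      exact this.ne rfl
    obtain ⟨N, hN⟩ := eventually_atTop.1 (hlim.eventually (gt_mem_nhds hyζ))
    refine ⟨N, fun n hn => ?_⟩
    rw [← image_union, hun]
    rintro ⟨w, hw, rfl⟩
    rw [h.right_inv w hw.1] at hN
    exact (hN n hn).not_ge hw.2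
  · intro n
    rw [← image_union, hun]
    exact ((convex_ball _ _).inter (convex_closedBall _ _)).isPreconnected.image _
      (h.diff_inv.continuousOn.mono inter_subset_left)
  · intro n
    have : U \ φ '' (Metric.ball 0 1 ∩ Metric.ball ζ (r n)) = φ '' (Metric.ball 0 1 \ Metric.ball ζ (r n)) := by
      ext y
      constructor
      · rintro ⟨hy, hyn⟩
        exact ⟨ψ y, ⟨h.mapsTo hy, fun hc => hyn ⟨ψ y, ⟨h.mapsTo hy, hc⟩, h.left_inv y hy⟩⟩, h.left_inv y hy⟩
      · rintro ⟨w, hw, rfl⟩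
        refine ⟨h.mapsTo_inv hw.1, ?_⟩
        rintro ⟨w', hw', he⟩
        rw [h.injOn_inv hw'.1 hw.1 he] at hw'
        exact hw.2 hw'.2
    rw [this]
    exact (isPreconnected_ball_diff_ball hζ (hr0 n)).image _ (h.diff_inv.continuousOn.mono sdiff_subset)
  · intro ρ hρ
    obtain ⟨N, hN⟩ := hl _ (hH.eventually (gt_mem_nhds hρ))
    exact ⟨N, fun n hn v hv => hN n hn hv⟩
  · exact hpos
  · exact hcont
  · exact hgauge.1
  · exact hgauge.2

namespace RMap

variable {U : Set ℂ} {ψ φ : ℂ → ℂ} (h : RMap U ψ φ)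
include h

theorem exists_edges {χ : ℂ → ℂ} (hχd : DifferentiableOn ℂ χ U)
    (hχm : MapsTo χ U (Metric.ball 0 1)) (hχi : InjOn χ U) {ζ : ℂ} (hζ : ‖ζ‖ = 1) :
    ∃ (r : ℕ → ℝ) (ω : ℂ), (∀ n, 0 < r n) ∧ (∀ n, r n < 1) ∧ Antitone r ∧ Tendsto r atTop (𝓝 0) ∧
      ∀ W ∈ 𝓝 ω, ∃ N, ∀ n, N ≤ n → ∀ v ∈ φ '' (Metric.ball 0 1 ∩ Metric.sphere ζ (r n)), χ v ∈ W := by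
  have hζb : ζ ∉ Metric.ball (0 : ℂ) 1 := fun hc => (mem_ball_zero_iff.1 hc).ne hζ
  have hcomp : ∀ n : ℕ, ∀ R : ℝ, 0 < R → ∃ ρ, 0 < ρ ∧ ρ < R ∧
      ∀ u ∈ φ '' (Metric.ball 0 1 ∩ Metric.sphere ζ ρ), ∀ v ∈ φ '' (Metric.ball 0 1 ∩ Metric.sphere ζ ρ),
        ‖χ u - χ v‖ ≤ 1 / ((n : ℝ) + 1) := fun n R hR => by
    obtain ⟨ρ, hρ, hosc⟩ := exists_small_circle Metric.isOpen_ball isSimplyConnected_unitBall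
      (h := χ ∘ φ) (hχd.comp h.diff_inv h.mapsTo_inv) (hχm.comp h.mapsTo_inv)
      (hχi.comp h.injOn_inv h.mapsTo_inv) hζb (η := 1 / ((n : ℝ) + 1)) (by positivity) hR
    refine ⟨ρ, hρ.1, hρ.2, ?_⟩
    rintro _ ⟨u, hu, rfl⟩ _ ⟨v, hv, rfl⟩
    rw [inter_comm] at hu hv
    have hpre : IsPreconnected (Metric.sphere ζ ρ ∩ Metric.ball (0 : ℂ) 1) := by
      rw [inter_comm]
      exact isPreconnected_edge hζ
    refine hosc _ ⟨u, hu, rfl⟩ u (mem_connectedComponentIn hu) v ?_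
    rwa [hpre.connectedComponentIn hu]
  choose! F hF0 hFR hF using hcomp
  let r : ℕ → ℝ := fun n => Nat.rec (F 0 1) (fun n x => F (n + 1) (min x (1 / ((n : ℝ) + 2)))) n
  have hrs : ∀ n, r (n + 1) = F (n + 1) (min (r n) (1 / ((n : ℝ) + 2))) := fun n => rfl
  have hr0 : ∀ n, 0 < r n := fun n => by
    induction n with
    | zero => exact hF0 0 1 one_pos
    | succ n ih =>
      rw [hrs]
      exact hF0 _ _ (lt_min ih (by positivity))
  have hmin : ∀ n, 0 < min (r n) (1 / ((n : ℝ) + 2)) := fun n => lt_min (hr0 n) (by positivity)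
  have hanti : Antitone r := antitone_nat_of_succ_le fun n => by
    grind
  have hr1 : ∀ n, r n < 1 := fun n => (hanti (Nat.zero_le n)).trans_lt (hFR 0 1 one_pos)
  have hle : ∀ n, r n ≤ 1 / ((n : ℝ) + 1) := fun n => by
    cases n with
    | zero => simpa using (hr1 0).le
    | succ n =>
      grind
  have hosc : ∀ n, ∀ u ∈ φ '' (Metric.ball 0 1 ∩ Metric.sphere ζ (r n)),
      ∀ v ∈ φ '' (Metric.ball 0 1 ∩ Metric.sphere ζ (r n)), ‖χ u - χ v‖ ≤ 1 / ((n : ℝ) + 1) := fun n => by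
    cases n with
    | zero => exact hF 0 1 one_pos
    | succ n => exact hF (n + 1) _ (hmin n)
  have hlim : Tendsto r atTop (𝓝 0) := squeeze_zero (fun n => (hr0 n).le) hle
    tendsto_one_div_add_atTop_nhds_zero_nat
  have hmem : ∀ n, φ ((1 - r n : ℝ) • ζ) ∈ φ '' (Metric.ball 0 1 ∩ Metric.sphere ζ (r n)) := fun n =>
    mem_image_of_mem _ (mem_edge hζ (hr0 n) (hr1 n))
  obtain ⟨ω, -, k, hk, hω⟩ := (isCompact_closedBall (0 : ℂ) 1).tendsto_subseq
    (x := fun n => χ (φ ((1 - r n : ℝ) • ζ))) fun n =>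
      Metric.ball_subset_closedBall (hχm (h.mapsTo_inv (mem_edge hζ (hr0 n) (hr1 n)).1))
  refine ⟨r ∘ k, ω, fun n => hr0 _, fun n => hr1 _, hanti.comp_monotone hk.monotone,
    hlim.comp hk.tendsto_atTop, fun W hW => ?_⟩
  obtain ⟨ε, hε, hball⟩ := Metric.mem_nhds_iff.1 hW
  obtain ⟨N₁, hN₁⟩ := eventually_atTop.1 (hω.eventually (Metric.ball_mem_nhds ω (half_pos hε)))
  obtain ⟨N₂, hN₂⟩ := exists_nat_one_div_lt (half_pos hε)
  refine ⟨max N₁ N₂, fun n hn v hv => hball ?_⟩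
  have h1 := hN₁ n ((le_max_left _ _).trans hn)
  have h2 := hosc (k n) v hv _ (hmem (k n))
  rw [dist_eq_norm] at h1
  rw [Metric.mem_ball, dist_eq_norm]
  have h3 : 1 / ((k n : ℝ) + 1) ≤ 1 / ((N₂ : ℝ) + 1) := one_div_le_one_div_of_le (by positivity) (by
    have : (N₂ : ℝ) ≤ k n := by exact_mod_cast ((le_max_right _ _).trans hn).trans (hk.id_le n)
    linarith)
  have h4 := norm_sub_le_norm_sub_add_norm_sub (χ v) (χ (φ ((1 - r (k n) : ℝ) • ζ))) ω
  grind

/-- At every point of the unit circle there are arbitrarily small caps whose edges are mapped to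
cross-sections converging either to a boundary point or to infinity. -/
theorem exists_caps (hUo : IsOpen U) (hUs : IsSimplyConnected U) {a : ℂ} (ha : a ∉ U) {ζ : ℂ}
    (hζ : ‖ζ‖ = 1) : ∃ (H : ℂ → ℝ) (r : ℕ → ℝ) (l : Filter ℂ), (∀ n, 0 < r n) ∧ Tendsto r atTop (𝓝 0) ∧
      ShrinkingCaps U H (fun n => φ '' (Metric.ball 0 1 ∩ Metric.ball ζ (r n)))
        (fun n => φ '' (Metric.ball 0 1 ∩ Metric.sphere ζ (r n))) ∧
      (l = cocompact ℂ ∨ ∃ z ∉ U, l = 𝓝 z) ∧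
      ∀ V ∈ l, ∃ N, ∀ n, N ≤ n → φ '' (Metric.ball 0 1 ∩ Metric.sphere ζ (r n)) ⊆ V := by
  obtain ⟨χ, x, ε, hε, hχd, hχm, hχ0, hQ⟩ := exists_univalent_bounded hUo hUs ha
  have hχi : InjOn χ U := fun z hz w hw h => by rw [hQ z hz, hQ w hw, h]
  obtain ⟨r, ω, hr0, hr1, hanti, hlim, hW⟩ := h.exists_edges hχd hχm hχi hζ
  have hsubU : ∀ n, φ '' (Metric.ball 0 1 ∩ Metric.sphere ζ (r n)) ⊆ U := fun n =>
    image_subset_iff.2 fun w hw => h.mapsTo_inv hw.1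
  have hland : ∀ l : Filter ℂ, Tendsto (fun v : ℂ => a + (x + ε / v) ^ 2) (𝓝[{0}ᶜ] ω) l →
      ∀ V ∈ l, ∃ N, ∀ n, N ≤ n → φ '' (Metric.ball 0 1 ∩ Metric.sphere ζ (r n)) ⊆ V := fun l hl V hV => by
    obtain ⟨N, hN⟩ := hW _ (eventually_nhdsWithin_iff.1 (hl hV))
    refine ⟨N, fun n hn v hv => ?_⟩
    grind
  by_cases hω : ω = 0
  · have hl : Tendsto (fun v : ℂ => a + (x + ε / v) ^ 2) (𝓝[{0}ᶜ] ω) (cocompact ℂ) := by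
      have h1 : Tendsto (fun v : ℂ => ‖(x + ε / v) ^ 2‖) (𝓝[≠] 0) atTop := by
        have h2 : Tendsto (fun v : ℂ => ‖x + ε / v‖) (𝓝[≠] 0) atTop := by
          have h3 : Tendsto (fun v : ℂ => -‖x‖ + ε * ‖v⁻¹‖) (𝓝[≠] 0) atTop :=
            tendsto_atTop_add_const_left _ _
              ((tendsto_norm_cobounded_atTop.comp tendsto_inv₀_nhdsNE_zero).const_mul_atTop hε)
          refine tendsto_atTop_mono (fun v => ?_) h3
          have := norm_sub_le (x + ε / v) x
          rw [add_sub_cancel_left, div_eq_mul_inv, norm_mul, Complex.norm_real, Real.norm_of_nonneg hε.le]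
            at this
          rw [div_eq_mul_inv]
          linarith
        simp only [norm_pow]
        exact (tendsto_pow_atTop two_ne_zero).comp h2
      rw [hω, ← Metric.cobounded_eq_cocompact]
      refine tendsto_norm_atTop_iff_cobounded.1 ?_
      refine tendsto_atTop_mono (fun v => ?_) (tendsto_atTop_add_const_left _ (-‖a‖) h1)
      have := norm_sub_le (a + (x + ε / v) ^ 2) a
      grind
    have hpos : ∀ v ∈ U, 0 < dist v a := fun v hv => dist_pos.2 fun e => ha (e ▸ hv)
    refine ⟨fun v => (dist v a)⁻¹, r, cocompact ℂ, hr0, hlim, ?_, Or.inl rfl, hland _ hl⟩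
    exact h.shrinkingCaps hζ hr0 hr1 hanti hlim
      (tendsto_inv_atTop_zero.comp (tendsto_dist_right_cocompact_atTop a)) (hland _ hl)
      (fun v hv => inv_pos.2 (hpos v hv))
      ((continuous_id.dist continuous_const).continuousOn.inv₀ fun v hv => (hpos v hv).ne')
      (gauge_inv_dist hUo hUs ha)
  · have hl : Tendsto (fun v : ℂ => a + (x + ε / v) ^ 2) (𝓝[{0}ᶜ] ω) (𝓝 (a + (x + ε / ω) ^ 2)) :=
      Tendsto.mono_left (tendsto_const_nhds.add ((tendsto_const_nhds.add
        (tendsto_const_nhds.div tendsto_id hω)).pow 2)) nhdsWithin_le_nhds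
    set z := a + (x + ε / ω) ^ 2
    have hz : z ∉ U := fun hz => by
      have h1 : ‖ψ z‖ < 1 := mem_ball_zero_iff.1 (h.mapsTo hz)
      have hc : ContinuousAt (fun v => ‖ψ v‖) z := (h.diff.continuousOn.continuousAt (hUo.mem_nhds hz)).norm
      obtain ⟨N₁, hN₁⟩ := hland _ hl _ (hc.eventually
        (gt_mem_nhds (show ‖ψ z‖ < (1 + ‖ψ z‖) / 2 by linarith)))
      obtain ⟨N₂, hN₂⟩ := eventually_atTop.1 (hlim.eventually
        (gt_mem_nhds (show 0 < (1 - ‖ψ z‖) / 2 by linarith)))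
      set n := max N₁ N₂
      have hm := mem_edge hζ (hr0 n) (hr1 n)
      have h2 := hN₁ n (le_max_left _ _) (mem_image_of_mem _ hm)
      have h3 := hN₂ n (le_max_right _ _)
      rw [mem_ofPred_eq, h.right_inv _ hm.1, norm_smul, hζ, Real.norm_of_nonneg (by linarith [hr1 n])] at h2
      linarith
    refine ⟨fun v => dist v z, r, 𝓝 z, hr0, hlim, ?_, Or.inr ⟨z, hz, rfl⟩, hland _ hl⟩
    exact h.shrinkingCaps hζ hr0 hr1 hanti hlim
      (by simpa using (continuous_id.dist (continuous_const (y := z))).tendsto z) (hland _ hl)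
      (fun v hv => dist_pos.2 fun e => hz (e ▸ hv)) (continuous_id.dist continuous_const).continuousOn
      (gauge_dist hUo hUs hz)

end RMap

theorem exists_fixed_on_circle_arc {G : ℂ → ℂ} {α β : ℝ} (hαβ : α < β) (hβ : β < α + 2 * Real.pi)
    (hG : ContinuousOn G (circleMap 0 1 '' Icc α β))
    (hm : MapsTo G (circleMap 0 1 '' Icc α β) (circleMap 0 1 '' Icc α β)) :
    ∃ ζ ∈ circleMap 0 1 '' Icc α β, G ζ = ζ := by
  have hinj : InjOn (circleMap 0 1) (Icc α β) := fun s hs t ht hst =>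
    circleMap_inj_of_lt one_ne_zero (by grind) hst
  let e : Icc α β → ℂ := fun t => circleMap 0 1 t
  have hec : Continuous e := (continuous_circleMap 0 1).comp continuous_subtype_val
  have hei : IsEmbedding e := (hec.isClosedEmbedding fun s t hst =>
    Subtype.ext (hinj s.2 t.2 hst)).isEmbedding
  let F : Icc α β → Icc α β := fun t => ⟨(hm (mem_image_of_mem _ t.2)).choose,
    (hm (mem_image_of_mem _ t.2)).choose_spec.1⟩
  have hF : ∀ t : Icc α β, e (F t) = G (circleMap 0 1 t) := fun t =>
    (hm (mem_image_of_mem _ t.2)).choose_spec.2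
  have hFc : Continuous F := by
    rw [hei.continuous_iff]
    have : e ∘ F = fun t : Icc α β => G (circleMap 0 1 t) := funext hF
    rw [this]
    exact hG.comp_continuous hec fun t => mem_image_of_mem _ t.2
  have hle : α ≤ β := hαβ.le
  obtain ⟨c, hc, hfix⟩ := exists_mem_Icc_isFixedPt_of_mapsTo (f := fun t => (F (projIcc α β hle t) : ℝ))
    (continuous_subtype_val.comp (hFc.comp continuous_projIcc)).continuousOn hle fun t _ => (F _).2
  refine ⟨_, mem_image_of_mem _ hc, ?_⟩
  have h1 := hF ⟨c, hc⟩
  have h2 : F ⟨c, hc⟩ = ⟨c, hc⟩ := Subtype.ext (by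
    have : (F (projIcc α β hle c) : ℝ) = c := hfix
    rwa [projIcc_of_mem hle hc] at this)
  rw [h2] at h1
  exact h1.symm

theorem false_of_frontier_subset_arc {E : Set ℂ} (hE : IsOpen E) (hne : E.Nonempty)
    (hb : Bornology.IsBounded E) {q : ℝ → ℂ} (hq : ContinuousOn q (Icc 0 1)) (hi : InjOn q (Icc 0 1))
    (hd : Disjoint E (q '' Icc 0 1)) (hf : frontier E ⊆ q '' Icc 0 1) : False := by
  have h1 : (q '' Icc 0 1)ᶜ ⊆ E := by
    refine (isConnected_compl_arc zero_le_one hq hi).isPreconnected.subset_of_closure_inter_subset hE ?_ ?_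
    · obtain ⟨x, hx⟩ := hne
      exact ⟨x, fun h => hd.le_bot ⟨hx, h⟩, hx⟩
    · rintro y ⟨hy, hyq⟩
      by_contra hyE
      exact hyq (hf ⟨hy, by rwa [hE.interior_eq]⟩)
  have h2 := (hb.subset h1).union (isCompact_Icc.image_of_continuousOn hq).isBounded
  rw [compl_union_self] at h2
  exact NormedSpace.unbounded_univ ℝ ℂ h2

section disc

variable {A B : Set ℂ} {q : ℝ → ℂ} {G : ℂ → ℂ}

theorem disjoint_closure_interior_disc (hBs : B ⊆ Metric.ball 0 1) (hAB : Disjoint A B) :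
    Disjoint (closure B) (interior (A ∪ (Metric.ball (0 : ℂ) 1)ᶜ)) :=
  Disjoint.closure_left (Set.disjoint_left.2 fun _ hx hx' =>
    (interior_subset hx').elim (fun h => hAB.le_bot ⟨h, hx⟩) fun h => h (hBs hx)) isOpen_interior

theorem mem_closure_of_mem_interior_disc {ζ : ℂ} (hζ : ‖ζ‖ = 1)
    (h : ζ ∈ interior (A ∪ (Metric.ball (0 : ℂ) 1)ᶜ)) : ζ ∈ closure A := by
  have h1 : ζ ∈ closure (Metric.ball (0 : ℂ) 1) := by
    rw [closure_ball _ one_ne_zero, mem_closedBall_zero_iff, hζ]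
  refine closure_mono ?_ (isOpen_interior.inter_closure ⟨h, h1⟩)
  rintro y ⟨hy, hyb⟩
  exact (interior_subset hy).resolve_right fun hc => hc hyb

theorem mem_interior_disc_or (hA : IsOpen A) (hB : IsOpen B) (hAB : Disjoint A B)
    (hq : ContinuousOn q (Icc 0 1)) (hqb : ∀ t ∈ Ioo (0 : ℝ) 1, ‖q t‖ < 1)
    (hun : Metric.ball (0 : ℂ) 1 = A ∪ B ∪ q '' Ioo 0 1) {ζ : ℂ} (hζ : ‖ζ‖ = 1) (h0 : ζ ≠ q 0)
    (h1 : ζ ≠ q 1) :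
    ζ ∈ interior (A ∪ (Metric.ball (0 : ℂ) 1)ᶜ) ∨ ζ ∈ interior (B ∪ (Metric.ball (0 : ℂ) 1)ᶜ) := by
  have hζq : ζ ∉ q '' Icc 0 1 := by
    grind
  obtain ⟨r, hr, hball⟩ := Metric.isOpen_iff.1
    (isCompact_Icc.image_of_continuousOn hq).isClosed.isOpen_compl ζ hζq
  have hsub : Metric.ball (0 : ℂ) 1 ∩ Metric.ball ζ r ⊆ A ∪ B := fun w hw =>
    (hun ▸ hw.1 : w ∈ A ∪ B ∪ q '' Ioo 0 1).resolve_right fun h =>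
      hball hw.2 (image_mono Ioo_subset_Icc_self h)
  have key : ∀ C : Set ℂ, Metric.ball (0 : ℂ) 1 ∩ Metric.ball ζ r ⊆ C →
      ζ ∈ interior (C ∪ (Metric.ball (0 : ℂ) 1)ᶜ) := fun C hC =>
    mem_interior.2 ⟨Metric.ball ζ r, fun w hw => by
      grind, Metric.isOpen_ball, Metric.mem_ball_self hr⟩
  exact (IsPreconnected.subset_or_subset hA hB hAB hsub
    ((convex_ball _ _).inter (convex_ball _ _)).isPreconnected).imp (key A) (key B)

theorem false_of_arc_interval (hAs : A ⊆ Metric.ball 0 1) (hAB : Disjoint B A)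
    (hG : ContinuousOn G (Metric.closedBall 0 1)) (hGs : ∀ ζ, ‖ζ‖ = 1 → ‖G ζ‖ = 1)
    (hGA : MapsTo G A A) (hfix : ∀ ζ, ‖ζ‖ = 1 → G ζ ≠ ζ) {α β : ℝ} (hαβ : α < β)
    (hβ : β < α + 2 * Real.pi)
    (h1 : ∀ t ∈ Ioo α β, circleMap 0 1 t ∈ interior (A ∪ (Metric.ball (0 : ℂ) 1)ᶜ))
    (h2 : ∀ ζ, ‖ζ‖ = 1 → ζ ∉ circleMap 0 1 '' Icc α β → ζ ∈ interior (B ∪ (Metric.ball (0 : ℂ) 1)ᶜ)) :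
    False := by
  have hn : ∀ t, ‖circleMap 0 1 t‖ = 1 := fun t => by simp
  have hcl : closure A ⊆ Metric.closedBall 0 1 :=
    closure_minimal (hAs.trans Metric.ball_subset_closedBall) Metric.isClosed_closedBall
  have hm : MapsTo (fun t => G (circleMap 0 1 t)) (Ioo α β) (circleMap 0 1 '' Icc α β) := fun t ht => by
    have h3 : G (circleMap 0 1 t) ∈ closure A :=
      hGA.closure_of_continuousOn (hG.mono hcl) (mem_closure_of_mem_interior_disc (hn t) (h1 t ht))
    by_contra hcon
    exact (disjoint_closure_interior_disc hAs hAB).le_bot ⟨h3, h2 _ (hGs _ (hn t)) hcon⟩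
  have hcc : ContinuousOn (fun t => G (circleMap 0 1 t)) univ :=
    hG.comp (continuous_circleMap 0 1).continuousOn fun t _ => by
      rw [mem_closedBall_zero_iff, hn]
  have hclosed : IsClosed (circleMap 0 1 '' Icc α β) :=
    (isCompact_Icc.image (continuous_circleMap 0 1)).isClosed
  have hm2 := hm.closure_of_continuousOn (hcc.mono (subset_univ _))
  rw [closure_Ioo hαβ.ne, hclosed.closure_eq] at hm2
  obtain ⟨ζ, ⟨t, ht, rfl⟩, hζ⟩ := exists_fixed_on_circle_arc hαβ hβ (G := G)
    (hG.mono (by rintro _ ⟨t, _, rfl⟩; rw [mem_closedBall_zero_iff, hn])) (by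
      rintro _ ⟨t, ht, rfl⟩
      exact hm2 ht)
  exact hfix _ (hn t) hζ

theorem false_of_closed_curve (hBs : B ⊆ Metric.ball 0 1) (hAB : Disjoint A B)
    (hG : ContinuousOn G (Metric.closedBall 0 1)) (hGs : ∀ ζ, ‖ζ‖ = 1 → ‖G ζ‖ = 1)
    (hGB : MapsTo G B B) (hfix : ∀ ζ, ‖ζ‖ = 1 → G ζ ≠ ζ) {a : ℂ} (ha : ‖a‖ = 1) (haB : a ∈ closure B)
    (h : ∀ ζ, ‖ζ‖ = 1 → ζ ≠ a → ζ ∈ interior (A ∪ (Metric.ball (0 : ℂ) 1)ᶜ)) : False := by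
  have hcl : closure B ⊆ Metric.closedBall 0 1 :=
    closure_minimal (hBs.trans Metric.ball_subset_closedBall) Metric.isClosed_closedBall
  exact (disjoint_closure_interior_disc hBs hAB).le_bot
    ⟨hGB.closure_of_continuousOn (hG.mono hcl) haB, h _ (hGs a ha) (hfix a ha)⟩

theorem false_of_one_side (hA : IsOpen A) (hB : IsOpen B) (hAB : Disjoint A B) (hBne : B.Nonempty)
    (hq : ContinuousOn q (Icc 0 1)) (hi : InjOn q (Icc 0 1))
    (hun : Metric.ball (0 : ℂ) 1 = A ∪ B ∪ q '' Ioo 0 1) (hBq : Disjoint B (q '' Icc 0 1))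
    (h : ∀ ζ, ‖ζ‖ = 1 → ζ ≠ q 0 → ζ ≠ q 1 → ζ ∈ interior (A ∪ (Metric.ball (0 : ℂ) 1)ᶜ)) : False := by
  have hBs : B ⊆ Metric.ball 0 1 := fun x hx => hun ▸ Or.inl (Or.inr hx)
  refine false_of_frontier_subset_arc hB hBne (Metric.isBounded_ball.subset hBs) hq hi hBq fun ζ hζ => ?_
  rw [hB.frontier_eq] at hζ
  have h1 : ζ ∈ Metric.closedBall (0 : ℂ) 1 :=
    closure_minimal (hBs.trans Metric.ball_subset_closedBall) Metric.isClosed_closedBall hζ.1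
  rcases (mem_closedBall_zero_iff.1 h1).lt_or_eq with h2 | h2
  · rcases (hun ▸ mem_ball_zero_iff.2 h2 : ζ ∈ A ∪ B ∪ q '' Ioo 0 1) with (h3 | h3) | h3
    · exact ((hAB.symm.closure_left hA).le_bot ⟨hζ.1, h3⟩).elim
    · exact absurd h3 hζ.2
    · exact image_mono Ioo_subset_Icc_self h3
  · by_contra hcon
    refine (disjoint_closure_interior_disc hBs hAB).le_bot ⟨hζ.1, h ζ h2 ?_ ?_⟩
    · grind
    · grind

/-- A homeomorphism of the closed disc without fixed points on the circle cannot map one side of a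
cross-cut strictly into itself. -/
theorem disc_crossCut_false {G' : ℂ → ℂ} (hA : IsOpen A) (hB : IsOpen B) (hAB : Disjoint A B)
    (hAne : A.Nonempty) (hBne : B.Nonempty) (hq : ContinuousOn q (Icc 0 1)) (hi : InjOn q (Ioo 0 1))
    (hqb : ∀ t ∈ Ioo (0 : ℝ) 1, ‖q t‖ < 1) (h0 : ‖q 0‖ = 1) (h1 : ‖q 1‖ = 1)
    (hun : Metric.ball (0 : ℂ) 1 = A ∪ B ∪ q '' Ioo 0 1) (hAq : Disjoint A (q '' Ioo 0 1))
    (hBq : Disjoint B (q '' Ioo 0 1)) (hqA : q '' Ioo 0 1 ⊆ closure A) (hqB : q '' Ioo 0 1 ⊆ closure B)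
    (hG : ContinuousOn G (Metric.closedBall 0 1)) (hGs : ∀ ζ, ‖ζ‖ = 1 → ‖G ζ‖ = 1)
    (hGA : MapsTo G A A) (hfix : ∀ ζ, ‖ζ‖ = 1 → G ζ ≠ ζ)
    (hG' : ContinuousOn G' (Metric.closedBall 0 1)) (hGs' : ∀ ζ, ‖ζ‖ = 1 → ‖G' ζ‖ = 1)
    (hGB' : MapsTo G' B B) (hfix' : ∀ ζ, ‖ζ‖ = 1 → G' ζ ≠ ζ) : False := by
  have hpi := Real.pi_pos
  have hAs : A ⊆ Metric.ball 0 1 := fun x hx => hun ▸ Or.inl (Or.inl hx)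
  have hBs : B ⊆ Metric.ball 0 1 := fun x hx => hun ▸ Or.inl (Or.inr hx)
  have hor : ∀ ζ, ‖ζ‖ = 1 → ζ ≠ q 0 → ζ ≠ q 1 → _ := fun ζ => mem_interior_disc_or hA hB hAB hq hqb hun
  have hn : ∀ t, ‖circleMap 0 1 t‖ = 1 := fun t => by simp
  have hunBA : Metric.ball (0 : ℂ) 1 = B ∪ A ∪ q '' Ioo 0 1 := by rw [hun, union_comm A B]
  have hIA := disjoint_closure_interior_disc hBs hAB
  have hIB := disjoint_closure_interior_disc hAs hAB.symm
  set OA := interior (A ∪ (Metric.ball (0 : ℂ) 1)ᶜ) with hOA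
  set OB := interior (B ∪ (Metric.ball (0 : ℂ) 1)ᶜ) with hOB
  have hside : ∀ J : Set ℝ, IsPreconnected J → (∀ t ∈ J, circleMap 0 1 t ≠ q 0 ∧ circleMap 0 1 t ≠ q 1) →
      (∀ t ∈ J, circleMap 0 1 t ∈ OA) ∨ ∀ t ∈ J, circleMap 0 1 t ∈ OB := fun J hJ hne => by
    have := isPreconnected_iff_subset_of_disjoint.1
      (hJ.image _ (continuous_circleMap 0 1).continuousOn) OA OB isOpen_interior isOpen_interior (by
        rintro _ ⟨t, ht, rfl⟩
        exact hor _ (hn t) (hne t ht).1 (hne t ht).2) (by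
        rw [Set.eq_empty_iff_forall_notMem]
        rintro _ ⟨⟨t, ht, rfl⟩, h2, h3⟩
        exact hIB.le_bot ⟨mem_closure_of_mem_interior_disc (hn t) h2, h3⟩)
    exact this.imp (fun h t ht => h (mem_image_of_mem _ ht)) fun h t ht => h (mem_image_of_mem _ ht)
  obtain ⟨α, -, hα⟩ := exists_circleMap_eq_Ico one_pos (mem_sphere_zero_iff_norm.2 h0) 0
  have hpar : ∀ ζ, ‖ζ‖ = 1 → ∃ t ∈ Ico α (α + 2 * Real.pi), circleMap 0 1 t = ζ := fun ζ hζ =>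
    exists_circleMap_eq_Ico one_pos (mem_sphere_zero_iff_norm.2 hζ) α
  have hinj : ∀ s ∈ Ico α (α + 2 * Real.pi), ∀ t ∈ Ico α (α + 2 * Real.pi),
      circleMap 0 1 s = circleMap 0 1 t → s = t := fun s hs t ht =>
    circleMap_inj_of_lt one_ne_zero (by grind)
  obtain ⟨β, hβ, hβ1⟩ := hpar (q 1) h1
  have hαm : α ∈ Ico α (α + 2 * Real.pi) := ⟨le_rfl, by linarith⟩
  rcases hβ.1.eq_or_lt with hαβ | hαβ
  · have h01 : q 1 = q 0 := by rw [← hβ1, ← hα, hαβ]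
    have hcl : q 0 ∈ closure (q '' Ioo 0 1) :=
      (mapsTo_image q (Ioo 0 1)).closure_of_continuousOn (by rwa [closure_Ioo zero_ne_one])
        (by rw [closure_Ioo zero_ne_one]; exact left_mem_Icc.2 zero_le_one)
    have key : ∀ O : Set ℂ, (∀ t ∈ Ioo α (α + 2 * Real.pi), circleMap 0 1 t ∈ O) →
        ∀ ζ, ‖ζ‖ = 1 → ζ ≠ q 0 → ζ ∈ O := fun O hO ζ hζ hζ0 => by
      obtain ⟨t, ht, rfl⟩ := hpar ζ hζ
      grind
    rcases hside (Ioo α (α + 2 * Real.pi)) isPreconnected_Ioo fun t ht => by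
      grind with h | h
    · exact false_of_closed_curve hBs hAB hG' hGs' hGB' hfix' h0
        (closure_minimal hqB isClosed_closure hcl) (key OA h)
    · exact false_of_closed_curve hAs hAB.symm hG hGs hGA hfix h0
        (closure_minimal hqA isClosed_closure hcl) (key OB h)
  · have hq01 : q 0 ≠ q 1 := fun e => hαβ.ne (hinj α hαm β hβ (by rw [hα, hβ1, e]))
    have hi' : InjOn q (Icc 0 1) := by
      have hnot : ∀ t ∈ Ioo (0 : ℝ) 1, q t ≠ q 0 ∧ q t ≠ q 1 := fun t ht =>
        ⟨fun e => (hqb t ht).ne (e ▸ h0), fun e => (hqb t ht).ne (e ▸ h1)⟩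
      have hcase : ∀ t ∈ Icc (0 : ℝ) 1, t = 0 ∨ t = 1 ∨ t ∈ Ioo (0 : ℝ) 1 := fun t ht => by
        grind
      intro s hs t ht hst
      rcases hcase s hs with rfl | rfl | hs' <;> rcases hcase t ht with rfl | rfl | ht'
      · rfl
      · exact absurd hst hq01
      · exact absurd hst.symm (hnot t ht').1
      · exact absurd hst.symm hq01
      · rfl
      · exact absurd hst.symm (hnot t ht').2
      · exact absurd hst (hnot s hs').1
      · exact absurd hst (hnot s hs').2
      · exact hi hs' ht' hst
    have hdisj : ∀ C : Set ℂ, C ⊆ Metric.ball 0 1 → Disjoint C (q '' Ioo 0 1) → Disjoint C (q '' Icc 0 1) :=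
      fun C hC hd => by
        rw [Set.disjoint_left]
        rintro _ hx ⟨t, ht, rfl⟩
        rcases ht.1.eq_or_lt with h | h
        · exact (mem_ball_zero_iff.1 (hC hx)).ne (h ▸ h0)
        rcases ht.2.eq_or_lt with h' | h'
        · exact (mem_ball_zero_iff.1 (hC hx)).ne (h' ▸ h1)
        grind
    have hJ1 := hside (Ioo α β) isPreconnected_Ioo fun t ht => by
      grind
    have hJ2 := hside (Ioo β (α + 2 * Real.pi)) isPreconnected_Ioo fun t ht => by
      grind
    have hboth : ∀ O : Set ℂ, (∀ t ∈ Ioo α β, circleMap 0 1 t ∈ O) →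
        (∀ t ∈ Ioo β (α + 2 * Real.pi), circleMap 0 1 t ∈ O) →
        ∀ ζ, ‖ζ‖ = 1 → ζ ≠ q 0 → ζ ≠ q 1 → ζ ∈ O := fun O ho1 ho2 ζ hζ hζ0 hζ1 => by
      obtain ⟨t, ht, rfl⟩ := hpar ζ hζ
      grind
    rcases hJ1 with k1 | k1 <;> rcases hJ2 with k2 | k2
    · exact false_of_one_side hA hB hAB hBne hq hi' hun (hdisj B hBs hBq) (hboth OA k1 k2)
    · refine false_of_arc_interval hAs hAB.symm hG hGs hGA hfix hαβ hβ.2 k1 fun ζ hζ hζn => ?_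
      obtain ⟨t, ht, rfl⟩ := hpar ζ hζ
      grind
    · refine false_of_arc_interval hAs hAB.symm hG hGs hGA hfix hβ.2 (by linarith) k2 fun ζ hζ hζn => ?_
      obtain ⟨t, ht, rfl⟩ := hpar ζ hζ
      refine k1 t ⟨ht.1.lt_of_ne fun e => hζn ?_, lt_of_not_ge fun hle => hζn ⟨t, ⟨hle, ht.2.le⟩, rfl⟩⟩
      exact ⟨α + 2 * Real.pi, ⟨hβ.2.le, le_rfl⟩, by rw [← e, (periodic_circleMap 0 1) α]⟩
    · exact false_of_one_side hB hA hAB.symm hAne hq hi' hunBA (hdisj A hAs hAq) (hboth OB k1 k2)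

end disc

theorem mem_iff_of_image_eq {f : X ≃ₜ X} {U : Set X} (hfU : f '' U = U) (z : X) : f z ∈ U ↔ z ∈ U := by
  conv_lhs => rw [← hfU]
  exact f.injective.mem_set_image

theorem symm_image_eq {f : X ≃ₜ X} {U : Set X} (hfU : f '' U = U) : f.symm '' U = U := by
  conv_lhs => rw [← hfU]
  exact f.symm_image_image U

namespace RMap

variable {U : Set ℂ} {ψ φ : ℂ → ℂ} (h : RMap U ψ φ)
include h

theorem exists_small_image {f : ℂ ≃ₜ ℂ} (hUo : IsOpen U) (hUs : IsSimplyConnected U) {a : ℂ} (ha : a ∉ U)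
    (hfU : f '' U = U) {l : Filter ℂ} (hl : l = cocompact ℂ ∨ ∃ z ∉ U, l = 𝓝 z) {η : ℝ} (hη : 0 < η) :
    ∃ V ∈ l, (∀ κ ⊆ U ∩ V, IsPreconnected κ → ∀ u ∈ κ, ∀ v ∈ κ, ‖ψ (f u) - ψ (f v)‖ ≤ η) ∧
      ∀ u ∈ U ∩ V, 1 - η < ‖ψ (f u)‖ := by
  have key : ∃ l', Tendsto f l l' ∧ (∃ V ∈ l', ∀ κ ⊆ U ∩ V, IsPreconnected κ → ∀ u ∈ κ, ∀ v ∈ κ, ‖ψ u - ψ v‖ ≤ η) ∧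
      ∀ᶠ w in l', w ∈ U → 1 - η < ‖ψ w‖ := by
    rcases hl with rfl | ⟨z, hz, rfl⟩
    · exact ⟨_, f.isClosedEmbedding.tendsto_cocompact, h.small_of_cocompact hUo hUs ha hη,
        h.norm_lt_cocompact (by linarith)⟩
    · have hz' : f z ∉ U := (mem_iff_of_image_eq hfU z).not.2 hz
      exact ⟨_, f.continuous.continuousAt, h.small_of_nhds hUo hUs hz' hη,
        h.norm_lt_of_mem_nhds hz' (by linarith)⟩
  obtain ⟨l', hlim, ⟨V, hV, hosc⟩, hfar⟩ := key
  refine ⟨f ⁻¹' V ∩ {w | f w ∈ U → 1 - η < ‖ψ (f w)‖}, inter_mem (hlim hV) (hlim.eventually hfar),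
    fun κ hκ hκc u hu v hv => hosc (f '' κ) ?_ (hκc.image _ f.continuous.continuousOn) _
      (mem_image_of_mem _ hu) _ (mem_image_of_mem _ hv), fun u hu => hu.2.2 ((mem_iff_of_image_eq hfU u).2 hu.1)⟩
  rintro _ ⟨y, hy, rfl⟩
  grind

theorem exists_small_cap {f : ℂ ≃ₜ ℂ} (hUo : IsOpen U) (hUs : IsSimplyConnected U) {a : ℂ} (ha : a ∉ U)
    (hfU : f '' U = U) {ζ : ℂ} (hζ : ‖ζ‖ = 1) {η : ℝ} (hη : 0 < η) :
    ∃ r > 0, ∀ w ∈ Metric.ball (0 : ℂ) 1 ∩ Metric.ball ζ r, 1 - 3 * η ≤ ‖ψ (f (φ w))‖ ∧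
      ∀ w' ∈ Metric.ball (0 : ℂ) 1 ∩ Metric.ball ζ r, ‖ψ (f (φ w)) - ψ (f (φ w'))‖ ≤ 4 * η := by
  obtain ⟨H, r, l, hr, -, hS, hl, hlV⟩ := h.exists_caps hUo hUs ha hζ
  obtain ⟨V, hV, hosc, hfar⟩ := h.exists_small_image hUo hUs ha hfU hl hη
  obtain ⟨N₁, hN₁⟩ := hlV V hV
  have hy0 : f.symm (φ 0) ∈ U := (mem_iff_of_image_eq hfU _).1 (by simpa using h.zero_mem)
  obtain ⟨N₂, hN₂⟩ := hS.escape _ hy0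
  set n := max N₁ N₂
  have hδU : φ '' (Metric.ball 0 1 ∩ Metric.sphere ζ (r n)) ⊆ U ∩ V :=
    subset_inter (subset_union_right.trans (hS.subset n)) (hN₁ n (le_max_left _ _))
  have hδc : IsPreconnected (φ '' (Metric.ball 0 1 ∩ Metric.sphere ζ (r n))) :=
    (isPreconnected_edge hζ).image _ (h.diff_inv.continuousOn.mono inter_subset_left)
  have key : ∀ w ∈ Metric.ball (0 : ℂ) 1 ∩ Metric.ball ζ (r n),
      ∀ v ∈ φ '' (Metric.ball 0 1 ∩ Metric.sphere ζ (r n)), ‖ψ (f (φ w)) - ψ (f v)‖ ≤ 2 * η := by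
    intro w hw v hv
    have hgw : ψ (f (φ w)) ∈ Metric.ball (0 : ℂ) 1 :=
      h.mapsTo ((mem_iff_of_image_eq hfU _).2 (h.mapsTo_inv hw.1))
    have hseg : segment ℝ 0 (ψ (f (φ w))) ⊆ Metric.ball 0 1 :=
      (convex_ball _ _).segment_subset (Metric.mem_ball_self one_pos) hgw
    refine norm_sub_le_of_shadow (κ := (fun v => ψ (f v)) '' (φ '' (Metric.ball 0 1 ∩ Metric.sphere ζ (r n)))) ?_ ?_
      (mem_ball_zero_iff.1 hgw) ?_ (mem_image_of_mem _ hv)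
    · rintro _ ⟨u, hu, rfl⟩ _ ⟨v, hv, rfl⟩
      exact hosc _ hδU hδc u hu v hv
    · rintro _ ⟨u, hu, rfl⟩
      exact (hfar u (hδU hu)).le
    · have := hS.cross n (f.symm '' (φ '' segment ℝ 0 (ψ (f (φ w)))))
        (((convex_segment _ _).isPreconnected.image _ (h.diff_inv.continuousOn.mono hseg)).image _
          f.symm.continuous.continuousOn) ?_ ?_ ?_
      · obtain ⟨_, ⟨_, ⟨s, hs, rfl⟩, rfl⟩, hδ⟩ := this
        exact ⟨s, hs, _, hδ, by simp [h.right_inv s (hseg hs)]⟩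
      · rintro _ ⟨_, ⟨s, hs, rfl⟩, rfl⟩
        exact (mem_iff_of_image_eq hfU _).1 (by simpa using h.mapsTo_inv (hseg hs))
      · refine ⟨φ w, ⟨_, ⟨_, right_mem_segment _ _ _, rfl⟩, ?_⟩, mem_image_of_mem _ hw⟩
        rw [h.left_inv _ ((mem_iff_of_image_eq hfU _).2 (h.mapsTo_inv hw.1))]
        simp
      · intro hc
        exact hN₂ n (le_max_right _ _) (Or.inl (hc ⟨_, ⟨_, left_mem_segment _ _ _, rfl⟩, rfl⟩))
  obtain ⟨v, hv⟩ := hS.edge_nonempty n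
  refine ⟨r n, hr n, fun w hw => ⟨?_, fun w' hw' => ?_⟩⟩
  · have h1 := key w hw v hv
    have h2 := hfar v (hδU hv)
    have h3 := norm_sub_norm_le (ψ (f v)) (ψ (f (φ w)))
    rw [norm_sub_rev] at h3
    linarith
  · have h1 := key w hw v hv
    have h2 := key w' hw' v hv
    rw [norm_sub_rev] at h2
    have h3 := norm_add_le (ψ (f (φ w)) - ψ (f v)) (ψ (f v) - ψ (f (φ w')))
    rw [sub_add_sub_cancel] at h3
    linarith

theorem exists_disc_extension {f : ℂ ≃ₜ ℂ} (hUo : IsOpen U) (hUs : IsSimplyConnected U) {a : ℂ} (ha : a ∉ U)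
    (hfU : f '' U = U) : ∃ G : ℂ → ℂ, ContinuousOn G (Metric.closedBall 0 1) ∧
      (∀ w ∈ Metric.ball (0 : ℂ) 1, G w = ψ (f (φ w))) ∧ ∀ ζ, ‖ζ‖ = 1 → ‖G ζ‖ = 1 := by
  have hm : MapsTo (fun w => ψ (f (φ w))) (Metric.ball 0 1) (Metric.ball 0 1) := fun w hw =>
    h.mapsTo ((mem_iff_of_image_eq hfU _).2 (h.mapsTo_inv hw))
  have hgc : ContinuousOn (fun w => ψ (f (φ w))) (Metric.ball 0 1) :=
    h.diff.continuousOn.comp (f.continuous.comp_continuousOn h.diff_inv.continuousOn)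
      fun w hw => (mem_iff_of_image_eq hfU _).2 (h.mapsTo_inv hw)
  have hcl : closure (Metric.ball (0 : ℂ) 1) = Metric.closedBall 0 1 := closure_ball _ one_ne_zero
  have hlim : ∀ ζ ∈ Metric.closedBall (0 : ℂ) 1,
      ∃ y, Tendsto (fun w => ψ (f (φ w))) (𝓝[Metric.ball 0 1] ζ) (𝓝 y) ∧ (‖ζ‖ = 1 → ‖y‖ = 1) := by
    intro ζ hζ
    rcases (mem_closedBall_zero_iff.1 hζ).lt_or_eq with h1 | h1
    · exact ⟨_, hgc ζ (mem_ball_zero_iff.2 h1), fun e => absurd e h1.ne⟩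
    have hne : (𝓝[Metric.ball (0 : ℂ) 1] ζ).NeBot := mem_closure_iff_nhdsWithin_neBot.1 (hcl ▸ hζ)
    have hcap : ∀ η > 0, ∃ t ∈ 𝓝[Metric.ball (0 : ℂ) 1] ζ, ∀ w ∈ t, 1 - 3 * η ≤ ‖ψ (f (φ w))‖ ∧
        ∀ w' ∈ t, ‖ψ (f (φ w)) - ψ (f (φ w'))‖ ≤ 4 * η := fun η hη => by
      obtain ⟨r, hr, hr'⟩ := h.exists_small_cap hUo hUs ha hfU h1 hη
      exact ⟨_, inter_mem_nhdsWithin _ (Metric.ball_mem_nhds _ hr), hr'⟩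
    have hcau : Cauchy (map (fun w => ψ (f (φ w))) (𝓝[Metric.ball 0 1] ζ)) := by
      refine Metric.cauchy_iff.2 ⟨hne.map _, fun ε hε => ?_⟩
      obtain ⟨t, ht, ht'⟩ := hcap (ε / 8) (by positivity)
      refine ⟨_, image_mem_map ht, ?_⟩
      rintro _ ⟨w, hw, rfl⟩ _ ⟨w', hw', rfl⟩
      have := (ht' w hw).2 w' hw'
      rw [dist_eq_norm]
      linarith
    obtain ⟨y, hy⟩ := CompleteSpace.complete hcau
    refine ⟨y, hy, fun _ => le_antisymm ?_ (le_of_forall_pos_le_add fun ε hε => ?_)⟩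
    · exact le_of_tendsto (Tendsto.norm hy) (by
        filter_upwards [self_mem_nhdsWithin] with w hw using (mem_ball_zero_iff.1 (hm hw)).le)
    · obtain ⟨t, ht, ht'⟩ := hcap (ε / 3) (by positivity)
      have : 1 - ε ≤ ‖y‖ := ge_of_tendsto (Tendsto.norm hy) (by
        filter_upwards [ht] with w hw
        have := (ht' w hw).1
        linarith)
      linarith
  refine ⟨extendFrom (Metric.ball 0 1) fun w => ψ (f (φ w)), continuousOn_extendFrom hcl.ge
    fun ζ hζ => ?_, fun w hw => extendFrom_eq (subset_closure hw) (hgc w hw), fun ζ hζ => ?_⟩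
  · obtain ⟨y, hy, -⟩ := hlim ζ hζ
    exact ⟨y, hy⟩
  · have hζ' := mem_closedBall_zero_iff.2 hζ.le
    obtain ⟨y, hy, hy1⟩ := hlim ζ hζ'
    rw [extendFrom_eq (hcl ▸ hζ') hy]
    exact hy1 hζ

theorem disc_extension_ne {f : ℂ ≃ₜ ℂ} (hUo : IsOpen U) (hUs : IsSimplyConnected U) {a : ℂ} (ha : a ∉ U)
    (hfU : f '' U = U) (hf : NoFixedPrimeEnd f U) {G : ℂ → ℂ} (hG : ContinuousOn G (Metric.closedBall 0 1))
    (hGf : ∀ w ∈ Metric.ball (0 : ℂ) 1, G w = ψ (f (φ w))) {ζ : ℂ} (hζ : ‖ζ‖ = 1) : G ζ ≠ ζ := by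
  intro hfix
  obtain ⟨H, r, l, hr, -, hS, -⟩ := h.exists_caps hUo hUs ha hζ
  refine hS.false_of_noFixedPrimeEnd hUo hUs hfU hf fun m k => ?_
  have hζ' : ζ ∈ closure (Metric.ball (0 : ℂ) 1) := by
    rw [closure_ball _ one_ne_zero]
    exact mem_closedBall_zero_iff.2 hζ.le
  have hne : (𝓝[Metric.ball (0 : ℂ) 1] ζ).NeBot := mem_closure_iff_nhdsWithin_neBot.1 hζ'
  have hlim : Tendsto G (𝓝[Metric.ball (0 : ℂ) 1] ζ) (𝓝 ζ) := by
    have := (hG ζ (mem_closedBall_zero_iff.2 hζ.le)).mono Metric.ball_subset_closedBall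
    rwa [ContinuousWithinAt, hfix] at this
  obtain ⟨w, hw1, hw2, hw3⟩ := Filter.nonempty_of_mem (inter_mem (self_mem_nhdsWithin (s := Metric.ball (0 : ℂ) 1) (a := ζ))
    (inter_mem (mem_nhdsWithin_of_mem_nhds (Metric.ball_mem_nhds ζ (hr m))) (hlim (Metric.ball_mem_nhds ζ (hr k)))))
  rw [mem_preimage, hGf w hw1] at hw3
  have hfw := (mem_iff_of_image_eq hfU _).2 (h.mapsTo_inv hw1)
  exact ⟨f (φ w), mem_image_of_mem _ ⟨w, ⟨hw1, hw2⟩, rfl⟩, _, ⟨h.mapsTo hfw, hw3⟩, h.left_inv _ hfw⟩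

theorem disc_extension_symm_ne {f : ℂ ≃ₜ ℂ} (hfU : f '' U = U) {G G' : ℂ → ℂ}
    (hG : ContinuousOn G (Metric.closedBall 0 1)) (hGf : ∀ w ∈ Metric.ball (0 : ℂ) 1, G w = ψ (f (φ w)))
    (hfix : ∀ ζ, ‖ζ‖ = 1 → G ζ ≠ ζ) (hG' : ContinuousOn G' (Metric.closedBall 0 1))
    (hGf' : ∀ w ∈ Metric.ball (0 : ℂ) 1, G' w = ψ (f.symm (φ w))) {ζ : ℂ} (hζ : ‖ζ‖ = 1) : G' ζ ≠ ζ := by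
  intro hfix'
  have hcl : closure (Metric.ball (0 : ℂ) 1) = Metric.closedBall 0 1 := closure_ball _ one_ne_zero
  have hmb : ∀ w ∈ Metric.ball (0 : ℂ) 1, f.symm (φ w) ∈ U := fun w hw =>
    (mem_iff_of_image_eq (symm_image_eq hfU) _).2 (h.mapsTo_inv hw)
  have hm : MapsTo G' (Metric.closedBall 0 1) (Metric.closedBall 0 1) := by
    have := MapsTo.closure_of_continuousOn (f := G') (s := Metric.ball 0 1) (t := Metric.ball 0 1)
      (fun w hw => by rw [hGf' w hw]; exact h.mapsTo (hmb w hw)) (hcl.symm ▸ hG')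
    rwa [hcl] at this
  have heq : EqOn (G ∘ G') id (Metric.closedBall 0 1) := by
    refine Set.EqOn.of_subset_closure (s := Metric.ball 0 1) (fun w hw => ?_) (hG.comp hG' hm) continuousOn_id
      Metric.ball_subset_closedBall hcl.ge
    have h1 := hmb w hw
    rw [Function.comp_apply, hGf' w hw, hGf _ (h.mapsTo h1), h.left_inv _ h1, f.apply_symm_apply,
      h.right_inv w hw, id]
  refine hfix ζ hζ ?_
  have := heq (mem_closedBall_zero_iff.2 hζ.le)
  rwa [Function.comp_apply, hfix', id] at this

end RMap

theorem HasTwoComps.eq_union {Y A B : Set X} (h : HasTwoComps Y A B) : Y = A ∪ B := by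
  refine Subset.antisymm (fun x hx => ?_) (union_subset h.1.subset h.2.1.subset)
  rcases h.2.2.2 x hx with e | e
  · exact Or.inl (e ▸ mem_connectedComponentIn hx)
  · exact Or.inr (e ▸ mem_connectedComponentIn hx)

theorem HasTwoComps.symm {Y A B : Set X} (h : HasTwoComps Y A B) : HasTwoComps Y B A :=
  ⟨h.2.1, h.1, h.2.2.1.symm, fun x hx => (h.2.2.2 x hx).symm⟩

theorem HasTwoComps.disjoint {Y A B : Set X} (h : HasTwoComps Y A B) : Disjoint A B :=
  h.1.disjoint h.2.1 h.2.2.1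

theorem RMap.exists_lift_arc {U : Set ℂ} {ψ φ : ℂ → ℂ} (h : RMap U ψ φ) (hUo : IsOpen U)
    (hUs : IsSimplyConnected U) {p : ℝ → ℂ} (hp : ContinuousOn p (Icc 0 1))
    (hpU : ∀ t ∈ Ioo (0 : ℝ) 1, p t ∈ U) (h0 : p 0 ∉ U) (h1 : p 1 ∉ U) :
    ∃ q : ℝ → ℂ, ContinuousOn q (Icc 0 1) ∧ (∀ t ∈ Ioo (0 : ℝ) 1, q t = ψ (p t)) ∧ ‖q 0‖ = 1 ∧ ‖q 1‖ = 1 := by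
  have hgc : ContinuousOn (fun t => ψ (p t)) (Ioo 0 1) :=
    h.diff.continuousOn.comp (hp.mono Ioo_subset_Icc_self) hpU
  have hcl : closure (Ioo (0 : ℝ) 1) = Icc 0 1 := closure_Ioo zero_ne_one
  have hlim : ∀ e ∈ Icc (0 : ℝ) 1,
      ∃ y, Tendsto (fun t => ψ (p t)) (𝓝[Ioo 0 1] e) (𝓝 y) ∧ (p e ∉ U → ‖y‖ = 1) := by
    intro e he
    by_cases heU : p e ∈ U
    · exact ⟨_, (h.diff.continuousOn.continuousAt (hUo.mem_nhds heU)).tendsto.comp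
        ((hp e he).mono Ioo_subset_Icc_self), fun hc => absurd heU hc⟩
    have hne : (𝓝[Ioo (0 : ℝ) 1] e).NeBot := mem_closure_iff_nhdsWithin_neBot.1 (hcl ▸ he)
    have hpe : Tendsto p (𝓝[Ioo 0 1] e) (𝓝 (p e)) := (hp e he).mono Ioo_subset_Icc_self
    have hcau : Cauchy (map (fun t => ψ (p t)) (𝓝[Ioo 0 1] e)) := by
      refine Metric.cauchy_iff.2 ⟨hne.map _, fun ε hε => ?_⟩
      obtain ⟨V, hV, hosc⟩ := h.small_of_nhds hUo hUs heU (half_pos hε)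
      obtain ⟨r, hr, hrV⟩ := Metric.mem_nhdsWithin_iff.1 (hpe hV)
      refine ⟨_, image_mem_map (inter_mem (mem_nhdsWithin_of_mem_nhds (Metric.ball_mem_nhds e hr))
        self_mem_nhdsWithin), ?_⟩
      have hκ : IsPreconnected (p '' (Metric.ball e r ∩ Ioo 0 1)) :=
        ((convex_ball e r).inter (convex_Ioo 0 1)).isPreconnected.image _
          (hp.mono (inter_subset_right.trans Ioo_subset_Icc_self))
      rintro _ ⟨s, hs, rfl⟩ _ ⟨t, ht, rfl⟩
      have := hosc _ (by grind) hκ _ (mem_image_of_mem _ hs) _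
        (mem_image_of_mem _ ht)
      rw [dist_eq_norm]
      linarith
    obtain ⟨y, hy⟩ := CompleteSpace.complete hcau
    refine ⟨y, hy, fun _ => le_antisymm ?_ (le_of_forall_lt fun c hc => ?_)⟩
    · exact le_of_tendsto (Tendsto.norm hy) (by
        filter_upwards [self_mem_nhdsWithin] with t ht using (mem_ball_zero_iff.1 (h.mapsTo (hpU t ht))).le)
    · obtain ⟨d, hcd, hd⟩ := exists_between hc
      refine hcd.trans_le (ge_of_tendsto (Tendsto.norm hy) ?_)
      filter_upwards [self_mem_nhdsWithin, hpe.eventually (h.norm_lt_of_mem_nhds heU hd)] with t ht ht'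
        using (ht' (hpU t ht)).le
  have hend : ∀ e ∈ Icc (0 : ℝ) 1, p e ∉ U → ‖extendFrom (Ioo 0 1) (fun t => ψ (p t)) e‖ = 1 := fun e he heU => by
    obtain ⟨y, hy, hy1⟩ := hlim e he
    rw [extendFrom_eq (hcl ▸ he) hy]
    exact hy1 heU
  refine ⟨extendFrom (Ioo 0 1) fun t => ψ (p t), continuousOn_extendFrom hcl.ge fun e he => ?_,
    fun t ht => extendFrom_eq (subset_closure ht) (hgc t ht), hend 0 (left_mem_Icc.2 zero_le_one) h0,
    hend 1 (right_mem_Icc.2 zero_le_one) h1⟩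
  grind

/-- A cross-cut cannot be mapped strictly into one of its two sides when there are no fixed prime ends. -/
theorem IsCrossCut.not_image_union_subset {U : Set ℂ} (hUo : IsOpen U) (hUs : IsSimplyConnected U)
    (hU : U ≠ univ) {f : ℂ ≃ₜ ℂ} (hfU : f '' U = U) (hf : NoFixedPrimeEnd f U) {σ A B : Set ℂ}
    (hσ : IsCrossCut U σ) (hAB : HasTwoComps (U \ σ) A B) (hfA : f '' (A ∪ σ) ⊆ A) : False := by
  obtain ⟨a, ha⟩ := (ne_univ_iff_exists_notMem U).1 hU
  obtain ⟨ψ, φ, h⟩ := exists_rMap hUo hUs ha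
  obtain ⟨G, hG, hGf, hGs⟩ := h.exists_disc_extension hUo hUs ha hfU
  obtain ⟨G', hG', hGf', hGs'⟩ := h.exists_disc_extension hUo hUs ha (symm_image_eq hfU)
  have hfix : ∀ ζ, ‖ζ‖ = 1 → G ζ ≠ ζ := fun ζ => h.disc_extension_ne hUo hUs ha hfU hf hG hGf
  have hclA := hσ.subset_closure hUo hUs hAB.1
  have hclB := hσ.subset_closure hUo hUs hAB.2.1
  have hAo := hAB.1.isOpen (hσ.isOpen_diff hUo)
  have hBo := hAB.2.1.isOpen (hσ.isOpen_diff hUo)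
  have hσU := hσ.subset
  have hAU : A ⊆ U := hAB.1.subset.trans sdiff_subset
  have hBU : B ⊆ U := hAB.2.1.subset.trans sdiff_subset
  have hUeq : ∀ z ∈ U, z ∈ A ∨ z ∈ B ∨ z ∈ σ := fun z hz => by
    by_cases hzσ : z ∈ σ
    · exact Or.inr (Or.inr hzσ)
    · rcases hAB.eq_union.subset ⟨hz, hzσ⟩ with hz | hz
      exacts [Or.inl hz, Or.inr (Or.inl hz)]
  obtain ⟨p, hp, hpi, hpU, h0, h1, rfl, -⟩ := hσ
  obtain ⟨q, hq, hqp, hq0, hq1⟩ := h.exists_lift_arc hUo hUs hp hpU (not_mem_of_frontier hUo h0)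
    (not_mem_of_frontier hUo h1)
  have hqφ : ∀ t ∈ Ioo (0 : ℝ) 1, φ (q t) = p t := fun t ht => by rw [hqp t ht, h.left_inv _ (hpU t ht)]
  have hqb : ∀ t ∈ Ioo (0 : ℝ) 1, q t ∈ Metric.ball (0 : ℂ) 1 := fun t ht => by
    rw [hqp t ht]
    exact h.mapsTo (hpU t ht)
  have hcl : ∀ {D : Set ℂ}, D ⊆ U → p '' Ioo 0 1 ⊆ closure D →
      q '' Ioo 0 1 ⊆ closure (Metric.ball 0 1 ∩ φ ⁻¹' D) := by
    rintro D hDU hD _ ⟨t, ht, rfl⟩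
    rw [hqp t ht]
    refine ((h.diff.continuousOn.continuousAt (hUo.mem_nhds (hpU t ht))).continuousWithinAt (s := D)).mem_closure
      (hD (mem_image_of_mem _ ht)) fun z hz => ⟨h.mapsTo (hDU hz), ?_⟩
    rw [mem_preimage, h.left_inv z (hDU hz)]
    exact hz
  have hdisj : ∀ {D : Set ℂ}, D ⊆ U \ p '' Ioo 0 1 → Disjoint (Metric.ball 0 1 ∩ φ ⁻¹' D) (q '' Ioo 0 1) := by
    intro D hD
    refine disjoint_left.2 ?_
    rintro _ hz ⟨t, ht, rfl⟩
    grind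
  have hne : ∀ {D : Set ℂ}, D ⊆ U → D.Nonempty → (Metric.ball 0 1 ∩ φ ⁻¹' D).Nonempty := by
    rintro D hDU ⟨z, hz⟩
    refine ⟨ψ z, h.mapsTo (hDU hz), ?_⟩
    rw [mem_preimage, h.left_inv z (hDU hz)]
    exact hz
  have hφo : ∀ {D : Set ℂ}, IsOpen D → IsOpen (Metric.ball 0 1 ∩ φ ⁻¹' D) := fun hD =>
    h.diff_inv.continuousOn.isOpen_inter_preimage Metric.isOpen_ball hD
  refine disc_crossCut_false (hφo hAo) (hφo hBo) ?_ (hne hAU hAB.1.nonempty) (hne hBU hAB.2.1.nonempty) hq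
    (fun s hs t ht hst => hpi hs ht (by rw [← hqφ s hs, ← hqφ t ht, hst]))
    (fun t ht => mem_ball_zero_iff.1 (hqb t ht)) hq0 hq1 ?_ (hdisj hAB.1.subset) (hdisj hAB.2.1.subset)
    (hcl hAU hclA) (hcl hBU hclB) hG hGs ?_ hfix hG' hGs' ?_
    fun ζ => h.disc_extension_symm_ne hfU hG hGf hfix hG' hGf'
  · exact disjoint_left.2 fun z hz hz' => disjoint_left.1 hAB.disjoint hz.2 hz'.2
  · refine Subset.antisymm (fun w hw => ?_) (union_subset (union_subset inter_subset_left inter_subset_left) ?_)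
    · rcases hUeq _ (h.mapsTo_inv hw) with h2 | h2 | ⟨t, ht, h2⟩
      · exact Or.inl (Or.inl ⟨hw, h2⟩)
      · exact Or.inl (Or.inr ⟨hw, h2⟩)
      · refine Or.inr ⟨t, ht, ?_⟩
        rw [hqp t ht, h2, h.right_inv w hw]
    · rintro _ ⟨t, ht, rfl⟩
      exact hqb t ht
  · intro w hw
    have := hfA (mem_image_of_mem f (Or.inl hw.2))
    rw [hGf w hw.1]
    refine ⟨h.mapsTo (hAU this), ?_⟩
    rw [mem_preimage, h.left_inv _ (hAU this)]
    exact this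
  · intro w hw
    rw [hGf' w hw.1]
    have h3 := (mem_iff_of_image_eq (symm_image_eq hfU) _).2 (h.mapsTo_inv hw.1)
    refine ⟨h.mapsTo h3, ?_⟩
    rw [mem_preimage, h.left_inv _ h3]
    have h4 : ¬ (f.symm (φ w) ∈ A ∪ p '' Ioo 0 1) := fun hc => by
      have := hfA (mem_image_of_mem f hc)
      rw [f.apply_symm_apply] at this
      exact disjoint_left.1 hAB.disjoint this hw.2
    rcases hUeq _ h3 with h5 | h5 | h5
    · exact absurd (Or.inl h5) h4
    · exact h5
    · exact absurd (Or.inr h5) h4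

/-- The closed rectangle with opposite integer corners `x` and `y`. -/
def gridBox (x y : ℤ × ℤ) : Set ℂ :=
  {z | z.re ∈ uIcc (x.1 : ℝ) y.1 ∧ z.im ∈ uIcc (x.2 : ℝ) y.2}

/-- An integer point as a complex number. -/
def gridPoint (x : ℤ × ℤ) : ℂ := ⟨x.1, x.2⟩

theorem left_mem_gridBox (x y : ℤ × ℤ) : gridPoint x ∈ gridBox x y := ⟨left_mem_uIcc, left_mem_uIcc⟩

theorem right_mem_gridBox (x y : ℤ × ℤ) : gridPoint y ∈ gridBox x y := ⟨right_mem_uIcc, right_mem_uIcc⟩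

theorem gridBox_comm (x y : ℤ × ℤ) : gridBox x y = gridBox y x := by
  simp only [gridBox, uIcc_comm]

theorem convex_gridBox (x y : ℤ × ℤ) : Convex ℝ (gridBox x y) :=
  ((convex_uIcc _ _).is_linear_preimage Complex.reLm.isLinear).inter
    ((convex_uIcc _ _).is_linear_preimage Complex.imLm.isLinear)

/-- The unit grid graph, restricted to the edges lying in `O`. -/
def gridGraph (O : Set ℂ) : SimpleGraph (ℤ × ℤ) where
  Adj x y := ((x.2 = y.2 ∧ (y.1 = x.1 + 1 ∨ x.1 = y.1 + 1)) ∨ (x.1 = y.1 ∧ (y.2 = x.2 + 1 ∨ x.2 = y.2 + 1))) ∧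
    gridBox x y ⊆ O
  symm := ⟨fun x y h => by
    refine ⟨?_, gridBox_comm x y ▸ h.2⟩
    have := h.1
    omega⟩
  loopless := ⟨fun x h => by have := h.1; omega⟩

theorem eq_of_ray_of_adj {O : Set ℂ} {x y : ℤ × ℤ} (h : (gridGraph O).Adj x y) {i j : ℤ} {a z : ℂ}
    (ha : a ∈ gridBox (i - 1, j - 1) (i, j)) (hx : x.1 + x.2 ≤ i + j) (hy : y.1 + y.2 ≤ i + j)
    (hxv : x ≠ (i, j)) (hyv : y ≠ (i, j)) (hz : z ∈ gridBox x y) (hza : z.re - a.re = z.im - a.im)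
    (h0 : 0 ≤ z.re - a.re) : z = a := by
  suffices z.re = a.re from Complex.ext this (by linarith)
  obtain ⟨x1, x2⟩ := x
  obtain ⟨y1, y2⟩ := y
  obtain ⟨h, -⟩ := h
  simp only [gridBox, mem_ofPred_eq, ne_eq, Prod.mk.injEq, Int.cast_sub, Int.cast_one] at *
  rw [uIcc_of_le (by linarith), uIcc_of_le (by linarith)] at ha
  obtain ⟨⟨ha1, ha2⟩, ha3, ha4⟩ := ha
  have key : ∀ P Q : ℤ, P + 1 + Q ≤ i + j → ¬ (P + 1 = i ∧ Q = j) → z.re ≤ P + 1 → z.im = Q → z.re = a.re := by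
    intro P Q h1 h2 h3 h4
    by_cases hQ : Q ≤ j - 1
    · have : (Q : ℝ) ≤ j - 1 := by exact_mod_cast hQ
      linarith
    · have : (P : ℝ) + 1 ≤ i - 1 := by
        have : P + 1 ≤ i - 1 := by omega
        exact_mod_cast this
      linarith
  have key' : ∀ P Q : ℤ, P + Q + 1 ≤ i + j → ¬ (P = i ∧ Q + 1 = j) → z.re = P → z.im ≤ Q + 1 → z.re = a.re := by
    intro P Q h1 h2 h3 h4
    by_cases hP : P ≤ i - 1
    · have : (P : ℝ) ≤ i - 1 := by exact_mod_cast hP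
      linarith
    · have : (Q : ℝ) + 1 ≤ j - 1 := by
        have : Q + 1 ≤ j - 1 := by omega
        exact_mod_cast this
      linarith
  rcases h with ⟨rfl, rfl | rfl⟩ | ⟨rfl, rfl | rfl⟩
  · rw [Int.cast_add, Int.cast_one, uIcc_of_le (by linarith), uIcc_self, mem_singleton_iff] at hz
    grind
  · rw [Int.cast_add, Int.cast_one, uIcc_of_ge (by linarith), uIcc_self, mem_singleton_iff] at hz
    grind
  · rw [Int.cast_add, Int.cast_one, uIcc_of_le (by linarith : (x2 : ℝ) ≤ _), uIcc_self, mem_singleton_iff] at hz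
    grind
  · rw [Int.cast_add, Int.cast_one, uIcc_of_ge (by linarith : (y2 : ℝ) ≤ _), uIcc_self, mem_singleton_iff] at hz
    grind

theorem sub_log_eq {T : Set ℂ} {L : ℂ → ℂ} {a m : ℂ} (hT : IsPreconnected T) (hL : ContinuousOn L T)
    (he : ∀ z ∈ T, Complex.exp (L z) = z - a) (hm : m ≠ 0) (hs : ∀ z ∈ T, m * (z - a) ∈ Complex.slitPlane)
    {z w : ℂ} (hz : z ∈ T) (hw : w ∈ T) :
    L z - Complex.log (m * (z - a)) = L w - Complex.log (m * (w - a)) := by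
  have := exp_one_const (h := fun z => L z - Complex.log (m * (z - a)) + Complex.log m) hT
    ((hL.sub ((by fun_prop : Continuous fun z : ℂ => m * (z - a)).continuousOn.clog hs)).add continuousOn_const)
    (fun z hz => ?_) hz hw
  · simpa using this
  · have h0 := Complex.slitPlane_ne_zero (hs z hz)
    rw [Complex.exp_add, Complex.exp_sub, he z hz, Complex.exp_log h0, Complex.exp_log hm]
    grind

/-- A grid walk joining the two neighbours of a top corner without going above it forces the
square below the corner to lie in the domain. -/
theorem gridBox_subset_of_walk {O : Set ℂ} (H : ∀ a ∉ O, HasLog O fun z => z - a) {i j : ℤ}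
    (hl : gridBox (i, j) (i - 1, j) ⊆ O) (hd : gridBox (i, j) (i, j - 1) ⊆ O)
    (p : (gridGraph O).Walk (i - 1, j) (i, j - 1))
    (hp : ∀ x ∈ p.support, x.1 + x.2 ≤ i + j ∧ x ≠ (i, j)) : gridBox (i - 1, j - 1) (i, j) ⊆ O := by
  intro a ha
  by_contra haO
  obtain ⟨L, hL, he⟩ := H a haO
  have hm : (1 - Complex.I) ≠ 0 := fun h => by simpa using congrArg Complex.re h
  have hm' : -(1 - Complex.I) ≠ 0 := neg_ne_zero.2 hm
  have hslit : ∀ z, ¬ (z.re - a.re = z.im - a.im ∧ 0 ≤ z.re - a.re) →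
      -(1 - Complex.I) * (z - a) ∈ Complex.slitPlane := fun z hz => by
    rw [Complex.mem_slitPlane_iff]
    simp only [Complex.mul_re, Complex.mul_im, Complex.neg_re, Complex.neg_im, Complex.sub_re, Complex.sub_im,
      Complex.one_re, Complex.one_im, Complex.I_re, Complex.I_im]
    grind
  have hslit' : ∀ z, ¬ (z.re - a.re = z.im - a.im ∧ z.re - a.re ≤ 0) →
      (1 - Complex.I) * (z - a) ∈ Complex.slitPlane := fun z hz => by
    rw [Complex.mem_slitPlane_iff]
    simp only [Complex.mul_re, Complex.mul_im, Complex.sub_re, Complex.sub_im,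
      Complex.one_re, Complex.one_im, Complex.I_re, Complex.I_im]
    grind
  have hwalk : ∀ {x y : ℤ × ℤ} (p : (gridGraph O).Walk x y),
      (∀ x ∈ p.support, x.1 + x.2 ≤ i + j ∧ x ≠ (i, j)) →
      L (gridPoint x) - Complex.log (-(1 - Complex.I) * (gridPoint x - a)) =
        L (gridPoint y) - Complex.log (-(1 - Complex.I) * (gridPoint y - a)) := by
    intro x y p hp
    induction p with
    | nil => rfl
    | @cons x y z h p ih =>
      rw [← ih fun x hx => hp x (by simp [hx])]
      obtain ⟨hx1, hx2⟩ := hp x (by simp)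
      obtain ⟨hy1, hy2⟩ := hp y (by simp)
      refine sub_log_eq (convex_gridBox x y).isPreconnected (hL.mono h.2) (fun z hz => he z (h.2 hz)) hm'
        (fun z hz => hslit z fun hc => haO ?_) (left_mem_gridBox x y) (right_mem_gridBox x y)
      exact eq_of_ray_of_adj h ha hx1 hy1 hx2 hy2 hz hc.1 hc.2 ▸ h.2 hz
  simp only [gridBox, mem_ofPred_eq, Int.cast_sub, Int.cast_one] at ha
  rw [uIcc_of_le (by linarith), uIcc_of_le (by linarith)] at ha
  obtain ⟨⟨ha1, ha2⟩, ha3, ha4⟩ := ha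
  have h1 := hwalk p hp
  have h2 := sub_log_eq (convex_gridBox (i, j) (i - 1, j)).isPreconnected (hL.mono hl) (fun z hz => he z (hl hz)) hm
    (fun z hz => hslit' z fun hc => haO ?_) (left_mem_gridBox (i, j) (i - 1, j)) (right_mem_gridBox (i, j) (i - 1, j))
  have h3 := sub_log_eq (convex_gridBox (i, j) (i, j - 1)).isPreconnected (hL.mono hd) (fun z hz => he z (hd hz)) hm
    (fun z hz => hslit' z fun hc => haO ?_) (left_mem_gridBox (i, j) (i, j - 1)) (right_mem_gridBox (i, j) (i, j - 1))
  · rw [h2] at h3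
    have him : 0 < ((1 - Complex.I) * (gridPoint (i - 1, j) - a)).im := by
      simp only [gridPoint, Complex.mul_im, Complex.sub_re, Complex.sub_im,
        Complex.one_re, Complex.one_im, Complex.I_re, Complex.I_im, Int.cast_sub, Int.cast_one]
      by_contra hcon
      have e : a = gridPoint (i - 1, j) := Complex.ext (by simp [gridPoint]; linarith) (by simp [gridPoint]; linarith)
      exact haO (e ▸ hl (right_mem_gridBox (i, j) (i - 1, j)))
    have him' : ((1 - Complex.I) * (gridPoint (i, j - 1) - a)).im < 0 := by
      simp only [gridPoint, Complex.mul_im, Complex.sub_re, Complex.sub_im,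
        Complex.one_re, Complex.one_im, Complex.I_re, Complex.I_im, Int.cast_sub, Int.cast_one]
      by_contra hcon
      have e : a = gridPoint (i, j - 1) := Complex.ext (by simp [gridPoint]; linarith) (by simp [gridPoint]; linarith)
      exact haO (e ▸ hd (right_mem_gridBox (i, j) (i, j - 1)))
    have h4 := congrArg Complex.im h1
    have h5 := congrArg Complex.im h3
    simp only [Complex.sub_im, Complex.log_im, neg_mul (1 - Complex.I),
      Complex.arg_neg_eq_arg_sub_pi_of_im_pos him, Complex.arg_neg_eq_arg_add_pi_of_im_neg him'] at h4 h5
    linarith [Real.pi_pos]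
  · have : z = a := by
      simp only [gridBox, mem_ofPred_eq, Int.cast_sub, Int.cast_one, uIcc_self, mem_singleton_iff] at hz
      rw [uIcc_of_ge (by linarith)] at hz
      exact Complex.ext (by linarith [hz.2.2, hc.1, hc.2, hz.1]) (by linarith [hz.2.2, hc.1, hc.2, hz.1])
    exact this ▸ hd hz
  · have : z = a := by
      simp only [gridBox, mem_ofPred_eq, Int.cast_sub, Int.cast_one, uIcc_self, mem_singleton_iff] at hz
      rw [uIcc_of_ge (by linarith)] at hz
      exact Complex.ext (by linarith [hz.1.2, hc.1, hc.2, hz.2]) (by linarith [hz.1.2, hc.1, hc.2, hz.2])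
    exact this ▸ hl hz

/-- A transport rule with values in a group which is path independent on convex subsets of `O`. -/
def FlatOn {G : Type*} [Group G] (O : Set ℂ) (S : ℂ → ℂ → G) : Prop :=
  ∀ C ⊆ O, Convex ℝ C → ∀ a ∈ C, ∀ b ∈ C, ∀ c ∈ C, S a c = S b c * S a b

theorem FlatOn.self {G : Type*} [Group G] {O : Set ℂ} {S : ℂ → ℂ → G} (hS : FlatOn O S) {a : ℂ}
    (ha : a ∈ O) : S a a = 1 :=
  mul_eq_left.1 (hS {a} (by simpa) (convex_singleton a) a rfl a rfl a rfl).symm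

/-- The transport along a walk in the grid. -/
def walkVal {G : Type*} [Group G] {O : Set ℂ} (S : ℂ → ℂ → G) {u v : ℤ × ℤ} : (gridGraph O).Walk u v → G
  | .nil => 1
  | .cons (v := w) _ p => walkVal S p * S (gridPoint u) (gridPoint w)

theorem walkVal_append {G : Type*} [Group G] {O : Set ℂ} (S : ℂ → ℂ → G) {u v w : ℤ × ℤ}
    (p : (gridGraph O).Walk u v) (q : (gridGraph O).Walk v w) :
    walkVal S (p.append q) = walkVal S q * walkVal S p := by
  induction p with
  | nil => simp [walkVal]
  | cons h p ih => simp [walkVal, ih, mul_assoc]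

theorem walkVal_closed_aux {G : Type*} [Group G] {O : Set ℂ} (H : ∀ a ∉ O, HasLog O fun z => z - a)
    {S : ℂ → ℂ → G} (hS : FlatOn O S) (a b : ℤ) (n : ℕ) : ∀ (v : ℤ × ℤ) (p : (gridGraph O).Walk v v),
      (∀ x ∈ p.support, a ≤ x.1 ∧ b ≤ x.2) →
      (p.support.tail.map fun x => (x.1 + x.2 - a - b).toNat + 1).sum ≤ n → walkVal S p = 1 := by
  induction n with
  | zero =>
    rintro v (_ | ⟨h, p⟩) hp hn
    · rfl
    · cases p <;> simp at hn
  | succ n ih =>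
    set wt : ℤ × ℤ → ℕ := fun x => (x.1 + x.2 - a - b).toNat + 1 with hwt
    suffices main : ∀ (v : ℤ × ℤ) (p : (gridGraph O).Walk v v),
      (∀ x ∈ p.support, a ≤ x.1 ∧ b ≤ x.2) → (∀ x ∈ p.support, x.1 + x.2 ≤ v.1 + v.2) →
      (p.support.tail.map wt).sum ≤ n + 1 → walkVal S p = 1 by
      intro v p hp hn
      obtain ⟨u, hu, hmax⟩ := Finset.exists_max_image p.support.toFinset (fun x => x.1 + x.2) ⟨v, by simp⟩
      rw [List.mem_toFinset] at hu
      have hperm := (p.support_rotate u hu).perm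
      have hmem : ∀ x ∈ (p.rotate u hu).support, x ∈ p.support := fun x hx => by
        rw [← SimpleGraph.Walk.cons_tail_support, List.mem_cons] at hx
        rcases hx with rfl | hx
        · exact hu
        · exact List.mem_of_mem_tail (hperm.subset hx)
      have h1 := main u (p.rotate u hu) (fun x hx => hp x (hmem x hx))
        (fun x hx => hmax x (List.mem_toFinset.2 (hmem x hx))) ((hperm.map wt).sum_eq ▸ hn)
      rw [SimpleGraph.Walk.rotate, walkVal_append] at h1
      rw [← p.take_spec hu, walkVal_append]
      exact mul_eq_one_comm.1 h1
    intro v p hp hmax hn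
    cases p with
    | nil => rfl
    | @cons _ n₁ _ h₁ q =>
    cases q with
    | nil => exact absurd h₁ ((gridGraph O).irrefl)
    | cons h r =>
    obtain ⟨n₂, q, h₂, hq⟩ := SimpleGraph.Walk.exists_cons_eq_concat h r
    rw [hq] at hp hmax hn ⊢
    have hval : walkVal S ((q.concat h₂).cons h₁) =
        S (gridPoint n₂) (gridPoint v) * walkVal S q * S (gridPoint v) (gridPoint n₁) := by
      simp [walkVal, SimpleGraph.Walk.concat_eq_append, walkVal_append]
    rw [hval]
    simp only [SimpleGraph.Walk.support_cons, SimpleGraph.Walk.support_concat, List.tail_cons, List.map_append,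
      List.sum_append, List.map_cons, List.map_nil, List.sum_cons, List.sum_nil, List.mem_cons, List.mem_append, List.not_mem_nil, or_false] at hp hmax hn
    have hwpos : ∀ x, 1 ≤ wt x := fun x => by simp [hwt]
    have hinv : S (gridPoint n₂) (gridPoint v) * S (gridPoint v) (gridPoint n₂) = 1 := by
      rw [← hS _ h₂.2 (convex_gridBox _ _) _ (right_mem_gridBox _ _) _ (left_mem_gridBox _ _) _ (right_mem_gridBox _ _)]
      exact hS.self (h₂.2 (right_mem_gridBox _ _))
    have hq0 : ∀ {x y : ℤ × ℤ} (q : (gridGraph O).Walk x y),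
      (q.support.map wt).sum = wt x + (q.support.tail.map wt).sum := fun q => by
        conv_lhs => rw [← SimpleGraph.Walk.cons_tail_support]
        rw [List.map_cons, List.sum_cons]
    by_cases hv : v ∈ q.support
    · have hqs := congrArg (fun q : (gridGraph O).Walk n₁ n₂ => (q.support.map wt).sum) (q.take_spec hv)
      simp only [SimpleGraph.Walk.support_append, List.map_append, List.sum_append] at hqs
      have e1 := ih v ((q.takeUntil v hv).cons h₁) (fun x hx => by
          rw [SimpleGraph.Walk.support_cons, List.mem_cons] at hx
          exact hp x (hx.imp_right fun h => Or.inl (q.support_takeUntil_subset_support hv h))) (by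
          grind)
      have e2 := ih v ((q.dropUntil v hv).concat h₂) (fun x hx => by
          rw [SimpleGraph.Walk.support_concat, List.mem_append] at hx
          exact hp x (Or.inr (hx.imp (fun h => q.support_dropUntil_subset_support hv h) List.eq_of_mem_singleton))) (by
          rw [SimpleGraph.Walk.concat_eq_append, SimpleGraph.Walk.tail_support_append]
          simp only [SimpleGraph.Walk.support_cons, List.tail_cons, SimpleGraph.Walk.support_nil, List.map_append,
            List.sum_append, List.map_cons, List.map_nil, List.sum_cons, List.sum_nil]
          grind)
      rw [← q.take_spec hv, walkVal_append]
      simp only [walkVal, SimpleGraph.Walk.concat_eq_append, walkVal_append] at e1 e2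
      grind
    have hs1 := hmax n₁ (Or.inr (Or.inl q.start_mem_support))
    have hs2 := hmax n₂ (Or.inr (Or.inl q.end_mem_support))
    have hb1 := hp n₁ (Or.inr (Or.inl q.start_mem_support))
    have hb2 := hp n₂ (Or.inr (Or.inl q.end_mem_support))
    obtain ⟨i, j⟩ := v
    have hn1 : n₁ = (i - 1, j) ∨ n₁ = (i, j - 1) := by
      obtain ⟨x, y⟩ := n₁
      have := h₁.1
      simp only [Prod.mk.injEq] at *
      omega
    have hn2 : n₂ = (i - 1, j) ∨ n₂ = (i, j - 1) := by
      obtain ⟨x, y⟩ := n₂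
      have := h₂.1
      simp only [Prod.mk.injEq] at *
      omega
    have hqm : ∀ x ∈ q.support, x.1 + x.2 ≤ i + j ∧ x ≠ (i, j) := fun x hx =>
      ⟨hmax x (Or.inr (Or.inl hx)), fun e => hv (e ▸ hx)⟩
    have key : gridBox (i - 1, j - 1) (i, j) ⊆ O → i - 1 ≥ a → j - 1 ≥ b →
        (gridGraph O).Adj n₂ (i - 1, j - 1) → (gridGraph O).Adj (i - 1, j - 1) n₁ → 
        gridPoint n₁ ∈ gridBox (i - 1, j - 1) (i, j) → gridPoint n₂ ∈ gridBox (i - 1, j - 1) (i, j) →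
        S (gridPoint n₂) (gridPoint (i, j)) * walkVal S q * S (gridPoint (i, j)) (gridPoint n₁) = 1 := by
      intro hsq ha hb g1 g2 m1 m2
      have e := ih n₁ (q.append (.cons g1 (.cons g2 .nil))) (fun x hx => by
        rw [SimpleGraph.Walk.mem_support_append_iff] at hx
        rcases hx with hx | hx
        · exact hp x (Or.inr (Or.inl hx))
        · simp only [SimpleGraph.Walk.support_cons, SimpleGraph.Walk.support_nil, List.mem_cons, List.not_mem_nil, or_false] at hx
          grind) (by
        rw [SimpleGraph.Walk.tail_support_append]
        simp only [SimpleGraph.Walk.support_cons, List.tail_cons, SimpleGraph.Walk.support_nil, List.map_append,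
            List.sum_append, List.map_cons, List.map_nil, List.sum_cons, List.sum_nil]
        grind)
      have hc := convex_gridBox (i - 1, j - 1) (i, j)
      have md := left_mem_gridBox (i - 1, j - 1) (i, j)
      have mv := right_mem_gridBox (i - 1, j - 1) (i, j)
      rw [walkVal_append] at e
      simp only [walkVal, one_mul] at e
      rw [← hS _ hsq hc _ m2 _ md _ m1] at e
      have e3 : S (gridPoint n₂) (gridPoint (i, j)) = S (gridPoint n₁) (gridPoint (i, j)) * S (gridPoint n₂) (gridPoint n₁) :=
        hS _ hsq hc _ m2 _ m1 _ mv
      rw [e3, mul_assoc (S (gridPoint n₁) _), e, mul_one, ← hS _ hsq hc _ mv _ m1 _ mv]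
      exact hS.self (hsq mv)
    have hbox : ∀ x y : ℤ × ℤ, gridPoint x ∈ gridBox (i - 1, j - 1) (i, j) →
        gridPoint y ∈ gridBox (i - 1, j - 1) (i, j) → gridBox x y ⊆ gridBox (i - 1, j - 1) (i, j) :=
      fun x y hx hy z hz => ⟨uIcc_subset_uIcc hx.1 hy.1 hz.1, uIcc_subset_uIcc hx.2 hy.2 hz.2⟩
    have ml : gridPoint (i - 1, j) ∈ gridBox (i - 1, j - 1) (i, j) := ⟨left_mem_uIcc, right_mem_uIcc⟩
    have mr : gridPoint (i, j - 1) ∈ gridBox (i - 1, j - 1) (i, j) := ⟨right_mem_uIcc, left_mem_uIcc⟩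
    have md := left_mem_gridBox (i - 1, j - 1) (i, j)
    have hsame : n₁ = n₂ →
        S (gridPoint n₂) (gridPoint (i, j)) * walkVal S q * S (gridPoint (i, j)) (gridPoint n₁) = 1 := by
      rintro rfl
      have := hq0 q
      have := hwpos n₁
      rw [ih n₁ q (fun x hx => hp x (Or.inr (Or.inl hx))) (show (q.support.tail.map wt).sum ≤ n by omega),
        mul_one, hinv]
    rcases hn1 with rfl | rfl <;> rcases hn2 with rfl | rfl
    · exact hsame rfl
    · have hsq := gridBox_subset_of_walk H h₁.2 h₂.symm.2 q hqm
      exact key hsq hb1.1 hb2.2 ⟨Or.inl ⟨rfl, Or.inr (by simp)⟩, (hbox _ _ mr md).trans hsq⟩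
        ⟨Or.inr ⟨rfl, Or.inl (by simp)⟩, (hbox _ _ md ml).trans hsq⟩ ml mr
    · have hsq := gridBox_subset_of_walk H h₂.symm.2 h₁.2 q.reverse
        (fun x hx => hqm x (by simpa using hx))
      exact key hsq hb2.1 hb1.2 ⟨Or.inr ⟨rfl, Or.inr (by simp)⟩, (hbox _ _ ml md).trans hsq⟩
        ⟨Or.inl ⟨rfl, Or.inl (by simp)⟩, (hbox _ _ md mr).trans hsq⟩ mr ml
    · exact hsame rfl

theorem walkVal_closed {G : Type*} [Group G] {O : Set ℂ} (H : ∀ a ∉ O, HasLog O fun z => z - a)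
    {S : ℂ → ℂ → G} (hS : FlatOn O S) {v : ℤ × ℤ} (p : (gridGraph O).Walk v v) : walkVal S p = 1 := by
  obtain ⟨u, -, hu⟩ := Finset.exists_min_image p.support.toFinset (fun x => x.1) ⟨v, by simp⟩
  obtain ⟨w, -, hw⟩ := Finset.exists_min_image p.support.toFinset (fun x => x.2) ⟨v, by simp⟩
  exact walkVal_closed_aux H hS u.1 w.2 _ v p
    (fun x hx => ⟨hu x (List.mem_toFinset.2 hx), hw x (List.mem_toFinset.2 hx)⟩) le_rfl

/-- The closed square with centre `z` and half side `r`. -/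
def cSquare (r : ℝ) (z : ℂ) : Set ℂ := {w | w.re ∈ Icc (z.re - r) (z.re + r) ∧ w.im ∈ Icc (z.im - r) (z.im + r)}

theorem convex_cSquare (r : ℝ) (z : ℂ) : Convex ℝ (cSquare r z) :=
  ((convex_Icc _ _).is_linear_preimage Complex.reLm.isLinear).inter
    ((convex_Icc _ _).is_linear_preimage Complex.imLm.isLinear)

theorem gridBox_subset_cSquare {r : ℝ} {z : ℂ} {x y : ℤ × ℤ} (hx : gridPoint x ∈ cSquare r z)
    (hy : gridPoint y ∈ cSquare r z) : gridBox x y ⊆ cSquare r z := fun _ hw =>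
  ⟨uIcc_subset_Icc hx.1 hy.1 hw.1, uIcc_subset_Icc hx.2 hy.2 hw.2⟩

theorem exists_walk_step {G : Type*} [Group G] {O : Set ℂ} {S : ℂ → ℂ → G} (hS : FlatOn O S) {z : ℂ}
    (hz : cSquare 2 z ⊆ O) {x y : ℤ × ℤ} (hx : gridPoint x ∈ cSquare 2 z) (hy : gridPoint y ∈ cSquare 2 z)
    (hxy : (x.2 = y.2 ∧ (y.1 = x.1 + 1 ∨ x.1 = y.1 + 1 ∨ x.1 = y.1)) ∨
      (x.1 = y.1 ∧ (y.2 = x.2 + 1 ∨ x.2 = y.2 + 1 ∨ x.2 = y.2))) :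
    ∃ p : (gridGraph O).Walk x y, walkVal S p = S (gridPoint x) (gridPoint y) := by
  by_cases h : x = y
  · subst h
    exact ⟨.nil, (hS.self (hz hx)).symm⟩
  · rw [Prod.ext_iff] at h
    have hadj : (gridGraph O).Adj x y := ⟨by omega, (gridBox_subset_cSquare hx hy).trans hz⟩
    exact ⟨.cons hadj .nil, by simp [walkVal]⟩

theorem exists_walk_near {G : Type*} [Group G] {O : Set ℂ} {S : ℂ → ℂ → G} (hS : FlatOn O S) {z : ℂ}
    (hz : cSquare 2 z ⊆ O) {x y : ℤ × ℤ} (hx : gridPoint x ∈ cSquare 2 z) (hy : gridPoint y ∈ cSquare 2 z)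
    (h1 : |x.1 - y.1| ≤ 1) (h2 : |x.2 - y.2| ≤ 1) :
    ∃ p : (gridGraph O).Walk x y, walkVal S p = S (gridPoint x) (gridPoint y) := by
  rw [abs_le] at h1 h2
  have hm : gridPoint (y.1, x.2) ∈ cSquare 2 z := ⟨hy.1, hx.2⟩
  obtain ⟨p, hp⟩ := exists_walk_step hS hz hx hm (Or.inl ⟨rfl, by omega⟩)
  obtain ⟨q, hq⟩ := exists_walk_step hS hz hm hy (Or.inr ⟨rfl, by omega⟩)
  exact ⟨p.append q, by rw [walkVal_append, hp, hq, hS _ hz (convex_cSquare _ _) _ hx _ hm _ hy]⟩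

/-- The transport along a polygonal chain. -/
def chainVal {G : Type*} [Group G] (S : ℂ → ℂ → G) (z : ℕ → ℂ) : ℕ → G
  | 0 => 1
  | k + 1 => S (z k) (z (k + 1)) * chainVal S z k

theorem chainVal_closed {G : Type*} [Group G] {O : Set ℂ} (H : ∀ a ∉ O, HasLog O fun z => z - a)
    {S : ℂ → ℂ → G} (hS : FlatOn O S) {z : ℕ → ℂ} (hz : ∀ k, cSquare 2 (z k) ⊆ O)
    (hzz : ∀ k, ‖z (k + 1) - z k‖ < 1) {n : ℕ} (hn : z n = z 0) : chainVal S z n = 1 := by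
  set g : ℕ → ℤ × ℤ := fun k => (⌊(z k).re⌋, ⌊(z k).im⌋) with hg
  have hfl : ∀ x y : ℝ, |y - x| < 1 → |⌊x⌋ - ⌊y⌋| ≤ 1 ∧ (⌊y⌋ : ℝ) ∈ Icc (x - 2) (x + 2) := fun x y h => by
    rw [abs_lt] at h
    have h1 := Int.floor_le x
    have h2 := Int.lt_floor_add_one x
    have h3 := Int.floor_le y
    have h4 := Int.lt_floor_add_one y
    refine ⟨?_, by linarith, by linarith⟩
    rw [abs_le]
    constructor
    · have : (⌊y⌋ : ℝ) < ⌊x⌋ + 2 := by linarith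
      have : ⌊y⌋ < ⌊x⌋ + 2 := by exact_mod_cast this
      omega
    · have : (⌊x⌋ : ℝ) < ⌊y⌋ + 2 := by linarith
      have : ⌊x⌋ < ⌊y⌋ + 2 := by exact_mod_cast this
      omega
  have hre : ∀ k, |(z (k + 1)).re - (z k).re| < 1 := fun k => (Complex.abs_re_le_norm (z (k + 1) - z k)).trans_lt (hzz k)
  have him : ∀ k, |(z (k + 1)).im - (z k).im| < 1 := fun k => (Complex.abs_im_le_norm (z (k + 1) - z k)).trans_lt (hzz k)
  have hself : ∀ k, z k ∈ cSquare 2 (z k) := fun k => ⟨⟨by linarith, by linarith⟩, by linarith, by linarith⟩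
  have hgk : ∀ k, gridPoint (g k) ∈ cSquare 2 (z k) := fun k =>
    ⟨(hfl _ _ (by simp)).2, (hfl _ _ (by simp)).2⟩
  have main : ∀ k, ∃ p : (gridGraph O).Walk (g 0) (g k),
      S (gridPoint (g k)) (z k) * walkVal S p = chainVal S z k * S (gridPoint (g 0)) (z 0) := by
    intro k
    induction k with
    | zero => exact ⟨.nil, by simp [walkVal, chainVal]⟩
    | succ k ih =>
      obtain ⟨p, hp⟩ := ih
      have hg' : gridPoint (g (k + 1)) ∈ cSquare 2 (z k) := ⟨(hfl _ _ (hre k)).2, (hfl _ _ (him k)).2⟩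
      have hz' : z (k + 1) ∈ cSquare 2 (z k) := by
        have h1 := abs_lt.1 (hre k)
        have h2 := abs_lt.1 (him k)
        exact ⟨⟨by linarith, by linarith⟩, by linarith, by linarith⟩
      obtain ⟨q, hq⟩ := exists_walk_near hS (hz k) (hgk k) hg' (hfl _ _ (hre k)).1 (hfl _ _ (him k)).1
      refine ⟨p.append q, ?_⟩
      have hc := convex_cSquare 2 (z k)
      rw [walkVal_append, hq, ← mul_assoc, ← hS _ (hz k) hc _ (hgk k) _ hg' _ hz',
        hS _ (hz k) hc _ (hgk k) _ (hself k) _ hz', mul_assoc, hp, chainVal, mul_assoc]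
  obtain ⟨p, hp⟩ := main n
  have hgn : g n = g 0 := by simp only [hg, hn]
  have : ∀ (u : ℤ × ℤ) (p : (gridGraph O).Walk (g 0) u), u = g 0 → walkVal S p = 1 := by
    rintro u p rfl
    exact walkVal_closed H hS p
  rw [this _ p hgn, hgn, hn, mul_one] at hp
  exact mul_eq_right.1 hp.symm

theorem homotopic_of_convex {O C : Set ℂ} (hC : C ⊆ O) (hc : Convex ℝ C) {a b : ↥O} (p q : Path a b)
    (hp : ∀ t, (p t : ℂ) ∈ C) (hq : ∀ t, (q t : ℂ) ∈ C) : p.Homotopic q := by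
  have ha : (a : ℂ) ∈ C := by simpa using hp 0
  have hb : (b : ℂ) ∈ C := by simpa using hp 1
  have : SimplyConnectedSpace ↥C := isSimplyConnected_of_convex hc ⟨a, ha⟩
  let res : ∀ p : Path a b, (∀ t, (p t : ℂ) ∈ C) → Path (⟨a, ha⟩ : ↥C) ⟨b, hb⟩ := fun p hp =>
    { toFun := fun t => ⟨p t, hp t⟩
      continuous_toFun := by fun_prop
      source' := by simp
      target' := by simp }
  have h := (SimplyConnectedSpace.paths_homotopic (res p hp) (res q hq)).map ⟨inclusion hC, continuous_inclusion hC⟩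
  exact h

/-- The segment from `a` to `b` as a path in `O`. -/
def segPath {O : Set ℂ} {a b : ℂ} (h : segment ℝ a b ⊆ O) :
    Path (⟨a, h (left_mem_segment ℝ a b)⟩ : ↥O) ⟨b, h (right_mem_segment ℝ a b)⟩ where
  toFun t := ⟨AffineMap.lineMap a b (t : ℝ), h (by
    rw [segment_eq_image_lineMap]; exact mem_image_of_mem _ t.2)⟩
  continuous_toFun := by
    refine Continuous.subtype_mk ?_ _
    exact (AffineMap.lineMap_continuous (R := ℝ)).comp continuous_subtype_val
  source' := by simp
  target' := by simp

theorem segPath_mem {O C : Set ℂ} {a b : ℂ} (h : segment ℝ a b ⊆ O) (hC : Convex ℝ C) (ha : a ∈ C) (hb : b ∈ C)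
    (t : unitInterval) : (segPath h t : ℂ) ∈ C :=
  hC.segment_subset ha hb (by
    rw [segment_eq_image_lineMap]; exact mem_image_of_mem _ t.2)

open CategoryTheory in
/-- The class of a path, closed up with the chosen paths `τ` from the base point. -/
def basedClass {Y : Type*} [TopologicalSpace Y] {x₀ : Y} (τ : ∀ y, Path x₀ y) {a b : Y} (p : Path a b) :
    FundamentalGroup Y x₀ :=
  (Path.Homotopic.Quotient.mk (τ a) : FundamentalGroupoid.mk x₀ ⟶ FundamentalGroupoid.mk a) ≫
    (Path.Homotopic.Quotient.mk p : FundamentalGroupoid.mk a ⟶ FundamentalGroupoid.mk b) ≫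
      Groupoid.inv (Path.Homotopic.Quotient.mk (τ b) : FundamentalGroupoid.mk x₀ ⟶ FundamentalGroupoid.mk b)

theorem basedClass_trans {Y : Type*} [TopologicalSpace Y] {x₀ : Y} (τ : ∀ y, Path x₀ y) {a b c : Y}
    (p : Path a b) (q : Path b c) : basedClass τ (p.trans q) = basedClass τ q * basedClass τ p := by
  rw [CategoryTheory.End.mul_def]
  simp only [basedClass, CategoryTheory.Category.assoc]
  rw [← CategoryTheory.Category.assoc (CategoryTheory.Groupoid.inv _), CategoryTheory.Groupoid.inv_comp,
    CategoryTheory.Category.id_comp, Path.Homotopic.Quotient.mk_trans, ← FundamentalGroupoid.comp_eq (FundamentalGroupoid.mk a)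
    (FundamentalGroupoid.mk b) (FundamentalGroupoid.mk c), CategoryTheory.Category.assoc]

theorem basedClass_congr {Y : Type*} [TopologicalSpace Y] {x₀ : Y} (τ : ∀ y, Path x₀ y) {a b : Y}
    {p q : Path a b} (h : p.Homotopic q) : basedClass τ p = basedClass τ q := by
  rw [basedClass, basedClass, Path.Homotopic.Quotient.eq.2 h]

theorem basedClass_cast {Y : Type*} [TopologicalSpace Y] {x₀ : Y} (τ : ∀ y, Path x₀ y) {a b a' b' : Y}
    (p : Path a b) (h : a' = a) (h' : b' = b) : basedClass τ (p.cast h h') = basedClass τ p := by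
  subst h h'
  rfl

theorem homotopic_refl_of_basedClass_eq_one {Y : Type*} [TopologicalSpace Y] {x₀ : Y} (τ : ∀ y, Path x₀ y)
    {a : Y} {p : Path a a} (h : basedClass τ p = 1) : p.Homotopic (Path.refl a) := by
  rw [basedClass, ← CategoryTheory.Category.assoc, CategoryTheory.Groupoid.inv_eq_inv,
    CategoryTheory.End.one_def, CategoryTheory.IsIso.comp_inv_eq, CategoryTheory.Category.id_comp] at h
  let t : FundamentalGroupoid.mk x₀ ⟶ FundamentalGroupoid.mk a := Path.Homotopic.Quotient.mk (τ a)
  let q : FundamentalGroupoid.mk a ⟶ FundamentalGroupoid.mk a := Path.Homotopic.Quotient.mk p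
  have h0 : CategoryTheory.CategoryStruct.comp t q = t := h
  have h1 : q = CategoryTheory.CategoryStruct.id _ :=
    (CategoryTheory.cancel_epi t).1 (h0.trans (CategoryTheory.Category.comp_id t).symm)
  exact Path.Homotopic.Quotient.eq.1 h1

open Classical in
/-- The transport rule given by classes of segments. -/
def segClass {O : Set ℂ} {x₀ : ↥O} (τ : ∀ y, Path x₀ y) (a b : ℂ) : FundamentalGroup ↥O x₀ :=
  if h : segment ℝ a b ⊆ O then basedClass τ (segPath h) else 1

theorem segClass_eq {O C : Set ℂ} {x₀ : ↥O} (τ : ∀ y, Path x₀ y) (hC : C ⊆ O) (hc : Convex ℝ C) {a b : ↥O}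
    (p : Path a b) (hp : ∀ t, (p t : ℂ) ∈ C) : segClass τ a b = basedClass τ p := by
  have ha : (a : ℂ) ∈ C := by simpa using hp 0
  have hb : (b : ℂ) ∈ C := by simpa using hp 1
  have h : segment ℝ (a : ℂ) b ⊆ O := (hc.segment_subset ha hb).trans hC
  rw [segClass, dif_pos h]
  exact basedClass_congr τ (homotopic_of_convex hC hc (segPath h) p (segPath_mem h hc ha hb) hp)

theorem flatOn_segClass {O : Set ℂ} {x₀ : ↥O} (τ : ∀ y, Path x₀ y) : FlatOn O (segClass τ) := by
  intro C hC hc a ha b hb c hc'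
  have h1 := (hc.segment_subset ha hb).trans hC
  have h2 := (hc.segment_subset hb hc').trans hC
  have := segClass_eq τ hC hc ((segPath h1).trans (segPath h2)) (fun t => by
    rw [Path.trans_apply]
    split_ifs
    · exact segPath_mem h1 hc ha hb _
    · exact segPath_mem h2 hc hb hc' _)
  rw [this, basedClass_trans, segClass, dif_pos h2, segClass, dif_pos h1]

theorem isSimplyConnected_of_hasLog {O : Set ℂ} (hO : IsOpen O) (hOc : IsConnected O)
    (H : ∀ a ∉ O, HasLog O fun z => z - a) : IsSimplyConnected O := by
  have hpc : PathConnectedSpace ↥O := isPathConnected_iff_pathConnectedSpace.1 ((hO.isConnected_iff_isPathConnected).1 hOc)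
  refine simply_connected_iff_loops_nullhomotopic.2 ⟨hpc, fun x p => ?_⟩
  have hcomp : IsCompact (range fun t => (p t : ℂ)) := isCompact_range (by fun_prop)
  obtain ⟨ε, hε, hεO⟩ := hcomp.exists_thickening_subset_open hO (by rintro _ ⟨t, rfl⟩; exact (p t).2)
  have hsq : ∀ t, cSquare (2 * (ε / 4)) (p t : ℂ) ⊆ O := fun t w hw => hεO <| by
    refine Metric.mem_thickening_iff.2 ⟨p t, mem_range_self t, ?_⟩
    rw [dist_eq_norm]
    refine (Complex.norm_le_sqrt_two_mul_max _).trans_lt ?_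
    have h1 : max |(w - p t).re| |(w - p t).im| ≤ ε / 2 := by
      refine max_le (abs_le.2 ?_) (abs_le.2 ?_)
      · rw [Complex.sub_re]; exact ⟨by linarith [hw.1.1], by linarith [hw.1.2]⟩
      · rw [Complex.sub_im]; exact ⟨by linarith [hw.2.1], by linarith [hw.2.2]⟩
    have h2 : √2 < 2 := by
      rw [Real.sqrt_lt' (by norm_num)]; norm_num
    nlinarith [Real.sqrt_nonneg 2]
  set δ := ε / 4 with hδ
  have hδ0 : 0 < δ := by positivity
  have hδc : (δ : ℂ) ≠ 0 := by exact_mod_cast hδ0.ne'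
  obtain ⟨η, hη, hηp⟩ := Metric.uniformContinuous_iff.1 (CompactSpace.uniformContinuous_of_continuous
    (show Continuous fun t => (p t : ℂ) by fun_prop)) δ hδ0
  obtain ⟨n, hn⟩ := exists_nat_one_div_lt hη
  let T : ℕ → unitInterval := fun k => projIcc 0 1 zero_le_one ((k : ℝ) / (n + 1))
  have hT : ∀ k s t, s ∈ uIcc (T k) (T (k + 1)) → t ∈ uIcc (T k) (T (k + 1)) → ‖(p s : ℂ) - p t‖ < δ := by
    intro k s t hs ht
    have hle : (k : ℝ) / (n + 1) ≤ ((k + 1 : ℕ) : ℝ) / (n + 1) := by push_cast; gcongr; linarith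
    have hk : ((k + 1 : ℕ) : ℝ) / (n + 1) = (k : ℝ) / (n + 1) + 1 / (n + 1) := by push_cast; ring
    have hTT : T k ≤ T (k + 1) := monotone_projIcc _ hle
    rw [uIcc_of_le hTT, mem_Icc] at hs ht
    have h1 : ((T (k + 1) : unitInterval) : ℝ) - T k ≤ 1 / (n + 1) := by
      simp only [T, coe_projIcc]
      grind
    rw [← dist_eq_norm]
    refine hηp (lt_of_le_of_lt ?_ hn)
    rw [Subtype.dist_eq, Real.dist_eq, abs_le]
    have hs1 := Subtype.coe_le_coe.2 hs.1
    have hs2 := Subtype.coe_le_coe.2 hs.2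
    have ht1 := Subtype.coe_le_coe.2 ht.1
    have ht2 := Subtype.coe_le_coe.2 ht.2
    constructor <;> linarith
  have hT0 : T 0 = 0 := by simp [T]
  have hT1 : T (n + 1) = 1 := by
    have : ((n + 1 : ℕ) : ℝ) / (n + 1) = 1 := by push_cast; exact div_self (by positivity)
    simp only [T, this, projIcc_right]
    rfl
  let τ : ∀ y, Path x y := fun y => PathConnectedSpace.somePath x y
  have hflat := flatOn_segClass τ
  let O' : Set ℂ := {z | δ * z ∈ O}
  have hlog' : ∀ a ∉ O', HasLog O' fun z => z - a := fun a ha => by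
    obtain ⟨L, hL, he⟩ := H _ ha
    refine HasLog.congr (HasLog.div (⟨fun z => L (δ * z), hL.comp (by fun_prop) fun z hz => hz, fun z hz => he _ hz⟩ :
      HasLog O' fun z => δ * z - δ * a) (hasLog_const O' hδc)) fun z _ => ?_
    grind
  have hflat' : FlatOn O' fun a b => segClass τ (δ * a) (δ * b) := fun C hC hc a ha b hb c hc' =>
    hflat ((fun z : ℂ => δ * z) '' C) (by rintro _ ⟨z, hz, rfl⟩; exact hC hz)
      (hc.is_linear_image ⟨fun x y => mul_add _ _ _, fun c x => by simp only [Complex.real_smul]; ring⟩)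
      _ (mem_image_of_mem _ ha) _ (mem_image_of_mem _ hb) _ (mem_image_of_mem _ hc')
  have hmul : ∀ t, (δ : ℂ) * (p t / δ) = p t := fun t => by field_simp
  have hchain := chainVal_closed hlog' hflat' (z := fun k => p (T k) / δ) (n := n + 1) (fun k w hw => by
      have h1 : ∀ r : ℝ, ((p (T k) : ℂ) / δ).re = (p (T k) : ℂ).re / δ ∧
        ((p (T k) : ℂ) / δ).im = (p (T k) : ℂ).im / δ := fun r =>
          ⟨Complex.div_ofReal_re _ _, Complex.div_ofReal_im _ _⟩
      refine hsq (T k) ?_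
      obtain ⟨⟨a1, a2⟩, a3, a4⟩ := hw
      rw [(h1 0).1] at a1 a2
      rw [(h1 0).2] at a3 a4
      have h2 : ∀ y : ℝ, δ * (y / δ - 2) = y - 2 * δ ∧ δ * (y / δ + 2) = y + 2 * δ := fun y => by
        constructor <;> field_simp
      have b1 := mul_le_mul_of_nonneg_left a1 hδ0.le
      have b2 := mul_le_mul_of_nonneg_left a2 hδ0.le
      have b3 := mul_le_mul_of_nonneg_left a3 hδ0.le
      have b4 := mul_le_mul_of_nonneg_left a4 hδ0.le
      rw [(h2 _).1] at b1 b3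
      rw [(h2 _).2] at b2 b4
      refine ⟨⟨?_, ?_⟩, ?_, ?_⟩
      · rw [Complex.re_ofReal_mul]; exact b1
      · rw [Complex.re_ofReal_mul]; exact b2
      · rw [Complex.im_ofReal_mul]; exact b3
      · rw [Complex.im_ofReal_mul]; exact b4) (fun k => by
      rw [← sub_div, norm_div, Complex.norm_real, Real.norm_of_nonneg hδ0.le, div_lt_one hδ0]
      exact hT k _ _ right_mem_uIcc left_mem_uIcc) (by simp only [hT0, hT1, p.source, p.target])
  have hsub : ∀ k, basedClass τ (p.subpath (T 0) (T k)) =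
      chainVal (fun a b => segClass τ (δ * a) (δ * b)) (fun k => p (T k) / δ) k := by
    intro k
    induction k with
    | zero =>
      rw [Path.subpath_self, chainVal]
      have := basedClass_trans τ (Path.refl (p (T 0))) (Path.refl (p (T 0)))
      rw [Path.refl_trans_refl] at this
      exact mul_eq_left.1 this.symm
    | succ k ih =>
      rw [chainVal, ← ih, hmul, hmul, segClass_eq τ (hsq (T k)) (convex_cSquare _ _) (p.subpath (T k) (T (k + 1))),
        ← basedClass_trans]
      · exact (basedClass_congr τ ⟨Path.Homotopy.subpathTransSubpath p _ _ _⟩).symm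
      · intro t
        have ht : p.subpath (T k) (T (k + 1)) t ∈ p '' uIcc (T k) (T (k + 1)) :=
          Path.range_subpath p _ _ ▸ mem_range_self t
        obtain ⟨s, hs, hst⟩ := ht
        rw [← hst]
        have h1 := hT k s _ hs left_mem_uIcc
        have h2 := abs_lt.1 ((Complex.abs_re_le_norm _).trans_lt h1)
        have h3 := abs_lt.1 ((Complex.abs_im_le_norm _).trans_lt h1)
        rw [Complex.sub_re] at h2
        rw [Complex.sub_im] at h3
        exact ⟨⟨by linarith, by linarith⟩, by linarith, by linarith⟩
  have h := (hsub (n + 1)).trans hchain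
  have hcast : ∀ s t, s = 0 → t = 1 → basedClass τ (p.subpath s t) = basedClass τ p := by
    rintro s t rfl rfl
    rw [Path.subpath_zero_one, basedClass_cast]
  exact homotopic_refl_of_basedClass_eq_one τ ((hcast _ _ hT0 hT1).symm.trans h)

/-- The broken line with vertices `v 0, v 1, …`, each edge being run through in unit time. -/
def brokenLine (v : ℕ → ℂ) (t : ℝ) : ℂ := v ⌊t⌋₊ + (t - ⌊t⌋₊) • (v (⌊t⌋₊ + 1) - v ⌊t⌋₊)

theorem brokenLine_eq (v : ℕ → ℂ) {k : ℕ} {t : ℝ} (h1 : k ≤ t) (h2 : t ≤ k + 1) :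
    brokenLine v t = v k + (t - k) • (v (k + 1) - v k) := by
  rcases h2.lt_or_eq with h | rfl
  · have : ⌊t⌋₊ = k := (Nat.floor_eq_iff ((Nat.cast_nonneg k).trans h1)).2 ⟨h1, h⟩
    rw [brokenLine, this]
  · have : ⌊(k : ℝ) + 1⌋₊ = k + 1 := by exact_mod_cast Nat.floor_natCast (R := ℝ) (k + 1)
    rw [brokenLine, this]
    simp

theorem brokenLine_natCast (v : ℕ → ℂ) (k : ℕ) : brokenLine v k = v k := by
  rw [brokenLine_eq v le_rfl (by linarith)]; simp

theorem brokenLine_mem_segment (v : ℕ → ℂ) {t : ℝ} (ht : 0 ≤ t) :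
    brokenLine v t ∈ segment ℝ (v ⌊t⌋₊) (v (⌊t⌋₊ + 1)) := by
  rw [segment_eq_image']
  exact ⟨t - ⌊t⌋₊, ⟨sub_nonneg.2 (Nat.floor_le ht), by linarith [(Nat.lt_floor_add_one t)]⟩, rfl⟩

theorem exists_brokenLine_eq (v : ℕ → ℂ) {k : ℕ} {t : ℝ} (h1 : k ≤ t) (h2 : t ≤ k + 1) {y : ℂ}
    (hy : y ∈ segment ℝ (brokenLine v t) (v (k + 1))) : ∃ s ∈ Icc t (k + 1), brokenLine v s = y := by
  rw [segment_eq_image'] at hy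
  obtain ⟨θ, ⟨h0, h1'⟩, rfl⟩ := hy
  have e1 : t ≤ t + θ * (k + 1 - t) := by nlinarith
  have e2 : t + θ * (k + 1 - t) ≤ k + 1 := by nlinarith
  refine ⟨t + θ * (k + 1 - t), ⟨e1, e2⟩, ?_⟩
  rw [brokenLine_eq v (h1.trans e1) e2, brokenLine_eq v h1 h2]
  simp only [Complex.real_smul]
  push_cast
  ring

theorem continuousOn_brokenLine (v : ℕ → ℂ) : ContinuousOn (brokenLine v) (Ici 0) := by
  have h : ∀ n : ℕ, ContinuousOn (brokenLine v) (Icc 0 n) := by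
    intro n
    induction n with
    | zero => simp
    | succ n ih =>
      have h1 : ContinuousOn (brokenLine v) (Icc n (n + 1)) :=
        ContinuousOn.congr (f := fun t : ℝ => v n + (t - n) • (v (n + 1) - v n)) (by fun_prop)
          fun t ht => brokenLine_eq v ht.1 ht.2
      have := ih.union_of_isClosed h1 isClosed_Icc isClosed_Icc
      rwa [Icc_union_Icc_eq_Icc (Nat.cast_nonneg n) (by linarith), ← Nat.cast_succ] at this
  intro t ht
  refine (h (⌊t⌋₊ + 1) t ⟨ht, by push_cast; exact (Nat.lt_floor_add_one t).le⟩).mono_of_mem_nhdsWithin ?_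
  refine mem_nhdsWithin.2 ⟨Iio ((⌊t⌋₊ + 1 : ℕ) : ℝ), isOpen_Iio, ?_, fun s hs => ⟨hs.2, le_of_lt hs.1⟩⟩
  push_cast
  exact Nat.lt_floor_add_one t

theorem tendsto_brokenLine {v : ℕ → ℂ} {z : ℂ} (hv : Tendsto v atTop (𝓝 z)) :
    Tendsto (brokenLine v) atTop (𝓝 z) := by
  refine Metric.tendsto_nhds.2 fun ε hε => ?_
  obtain ⟨M, hM⟩ := eventually_atTop.1 (Metric.tendsto_nhds.1 hv ε hε)
  filter_upwards [eventually_ge_atTop (M : ℝ)] with t ht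
  have ht0 : 0 ≤ t := (Nat.cast_nonneg M).trans ht
  have hf : M ≤ ⌊t⌋₊ := Nat.le_floor ht
  exact (convex_ball z ε).segment_subset (hM _ hf) (hM _ (hf.trans (Nat.le_succ _))) (brokenLine_mem_segment v ht0)

/-- Loop erasure: a broken line in `O` converging to a point outside of `O` can be shortened to an end-cut. -/
theorem exists_isEndCut_of_brokenLine {O : Set ℂ} {v : ℕ → ℂ} {z : ℂ} (hz : z ∉ O)
    (hv : Tendsto v atTop (𝓝 z)) (hO : ∀ k, segment ℝ (v k) (v (k + 1)) ⊆ O) :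
    ∃ η, IsEndCut O η ∧ Tendsto η (𝓝[<] (1:ℝ)) (𝓝 z) := by
  set κ := brokenLine v with hκ
  have hκc := continuousOn_brokenLine v
  have hκz := tendsto_brokenLine hv
  have hκO : ∀ t, 0 ≤ t → κ t ∈ O := fun t ht => hO _ (brokenLine_mem_segment v ht)
  have hfl : ∀ t : ℝ, 0 ≤ t → segment ℝ (κ t) (v (⌊t⌋₊ + 1)) ⊆ κ '' Icc t (⌊t⌋₊ + 1) := fun t ht y hy =>
    exists_brokenLine_eq v (Nat.floor_le ht) (Nat.lt_floor_add_one t).le hy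
  have hlast : ∀ t, ∃ T, 0 ≤ t → (⌊t⌋₊ : ℝ) + 1 ≤ T ∧ κ T ∈ segment ℝ (κ t) (v (⌊t⌋₊ + 1)) ∧
      ∀ s, T < s → κ s ∉ segment ℝ (κ t) (v (⌊t⌋₊ + 1)) := by
    intro t
    by_cases ht : 0 ≤ t
    swap
    · exact ⟨0, fun h => absurd h ht⟩
    set S := segment ℝ (κ t) (v (⌊t⌋₊ + 1)) with hS
    have hScl : IsClosed S := by
      rw [hS, segment_eq_image']
      exact (isCompact_Icc.image (by fun_prop)).isClosed
    have hSO : S ⊆ O := fun y hy => by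
      grind
    obtain ⟨R, hR⟩ := eventually_atTop.1 (hκz.eventually (hScl.isOpen_compl.mem_nhds fun h => hz (hSO h)))
    have hk : IsCompact (Icc ((⌊t⌋₊ : ℝ) + 1) R ∩ κ ⁻¹' S) :=
      isCompact_Icc.of_isClosed_subset ((hκc.mono fun s hs => (by positivity : (0:ℝ) ≤ ⌊t⌋₊ + 1).trans hs.1).preimage_isClosed_of_isClosed
        isClosed_Icc hScl) inter_subset_left
    have hmem : κ ((⌊t⌋₊ : ℝ) + 1) ∈ S := by
      rw [hκ, ← Nat.cast_succ, brokenLine_natCast]; exact right_mem_segment _ _ _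
    obtain ⟨T, ⟨⟨hT1, hT2⟩, hTS⟩, hTm⟩ := hk.exists_isGreatest
      ⟨(⌊t⌋₊ : ℝ) + 1, ⟨le_rfl, le_of_not_gt fun h => hR _ h.le hmem⟩, hmem⟩
    refine ⟨T, fun _ => ⟨hT1, hTS, fun s hs hsS => ?_⟩⟩
    exact absurd (hTm ⟨⟨hT1.trans hs.le, le_of_not_gt fun h => hR _ h.le hsS⟩, hsS⟩) (not_le.2 hs)
  choose T hT using hlast
  let τ : ℕ → ℝ := fun n => T^[n + 1] 0
  have hτs : ∀ n, τ (n + 1) = T (τ n) := fun n => Function.iterate_succ_apply' T (n + 1) 0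
  have hτn : ∀ n : ℕ, (n : ℝ) ≤ τ n := by
    intro n
    induction n with
    | zero => exact_mod_cast (by positivity : (0:ℝ) ≤ (⌊(0:ℝ)⌋₊ : ℝ) + 1).trans (hT 0 le_rfl).1
    | succ n ih =>
      rw [hτs]
      have h0 : 0 ≤ τ n := (Nat.cast_nonneg n).trans ih
      refine le_trans ?_ (hT _ h0).1
      push_cast
      have : (n : ℝ) ≤ ⌊τ n⌋₊ := by exact_mod_cast Nat.le_floor ih
      linarith
  have hτ0 : ∀ n, 0 ≤ τ n := fun n => (Nat.cast_nonneg n).trans (hτn n)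
  have hτm : StrictMono τ := strictMono_nat_of_lt_succ fun n => by
    rw [hτs]; exact (Nat.lt_floor_add_one _).trans_le (hT _ (hτ0 n)).1
  have hne : ∀ n s, τ n < s → κ s ≠ κ (τ n) := by
    intro n s hs he
    cases n with
    | zero => exact (hT 0 le_rfl).2.2 s hs (he ▸ (hT 0 le_rfl).2.1)
    | succ n =>
      grind
  let p : ℕ → ℂ := fun n => κ (τ n)
  have hpn : ∀ n, p (n + 1) - p n ≠ 0 := fun n => sub_ne_zero.2 (hne n _ (hτm n.lt_succ_self))
  have hpS : ∀ n, segment ℝ (p n) (p (n + 1)) ⊆ segment ℝ (κ (τ n)) (v (⌊τ n⌋₊ + 1)) := fun n =>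
    (convex_segment _ _).segment_subset (left_mem_segment _ _ _) (by
      grind)
  have hinj : InjOn (brokenLine p) (Ici 0) := by
    have key : ∀ s t : ℝ, 0 ≤ s → s < t → brokenLine p s ≠ brokenLine p t := by
      intro s t hs hst he
      have ht : 0 ≤ t := hs.trans hst.le
      have hsl := Nat.lt_floor_add_one s
      have htl := Nat.floor_le ht
      have h1 : brokenLine p t ∈ segment ℝ (κ (τ ⌊s⌋₊)) (v (⌊τ ⌊s⌋₊⌋₊ + 1)) :=
        he ▸ hpS _ (brokenLine_mem_segment p hs)
      rcases (Nat.floor_le_floor hst.le).eq_or_lt with h | h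
      · rw [brokenLine, brokenLine, ← h, add_right_inj] at he
        have := smul_left_injective ℝ (hpn ⌊s⌋₊) he
        linarith
      · obtain ⟨r, hr, hrt⟩ := hfl _ (hτ0 ⌊t⌋₊) (hpS _ (brokenLine_mem_segment p ht))
        have h2 : r ≤ τ (⌊s⌋₊ + 1) := by
          grind
        have h3 : ⌊t⌋₊ = ⌊s⌋₊ + 1 := le_antisymm (hτm.le_iff_le.1 (hr.1.trans h2)) h
        rw [← h3] at h2
        have h4 : brokenLine p t = p ⌊t⌋₊ := by rw [← hrt, le_antisymm h2 hr.1]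
        have h5 : brokenLine p s = p (⌊s⌋₊ + 1) := by rw [he, h4, h3]
        rw [brokenLine, ← sub_eq_zero] at h5
        have h6 : (s - ⌊s⌋₊ - 1) • (p (⌊s⌋₊ + 1) - p ⌊s⌋₊) = 0 := by
          rw [← h5, sub_smul, one_smul]; ring
        rcases smul_eq_zero.1 h6 with h7 | h7
        · linarith
        · exact hpn _ h7
    intro s hs t ht he
    grind
  have hpz : Tendsto (brokenLine p) atTop (𝓝 z) := tendsto_brokenLine
    (hκz.comp (tendsto_atTop_mono hτn tendsto_natCast_atTop_atTop))
  have hd : ∀ t ∈ Ico (0:ℝ) 1, (0:ℝ) ≤ t / (1 - t) := fun t ht => div_nonneg ht.1 (by linarith [ht.2])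
  have hlim : Tendsto (fun t : ℝ => brokenLine p (t / (1 - t))) (𝓝[<] (1:ℝ)) (𝓝 z) := by
    refine hpz.comp ?_
    have h1 : Tendsto (fun t : ℝ => (1 - t)⁻¹) (𝓝[<] (1:ℝ)) atTop := by
      refine tendsto_inv_nhdsGT_zero.comp (tendsto_nhdsWithin_iff.2 ⟨?_, ?_⟩)
      · exact ((continuous_const.sub continuous_id).tendsto' (1:ℝ) 0 (by simp)).mono_left nhdsWithin_le_nhds
      · filter_upwards [self_mem_nhdsWithin] with t ht using sub_pos.2 (show t < 1 from ht)
    exact Tendsto.pos_mul_atTop one_pos (tendsto_id.mono_left nhdsWithin_le_nhds) h1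
  refine ⟨fun t => brokenLine p (t / (1 - t)), ⟨?_, ?_, ?_, z, hlim⟩, hlim⟩
  · refine (continuousOn_brokenLine p).comp (ContinuousOn.div continuousOn_id (by fun_prop) fun t ht => ?_) hd
    exact (sub_pos.2 ht.2).ne'
  · intro s hs t ht he
    have := hinj (hd s hs) (hd t ht) he
    grind
  · intro t ht
    obtain ⟨r, hr, hrt⟩ := hfl _ (hτ0 ⌊t / (1 - t)⌋₊) (hpS _ (brokenLine_mem_segment p (hd t ht)))
    grind

/-- Points of an open connected set are joined by chains of segments. -/
theorem exists_chain_of_isPreconnected {W : Set ℂ} (hW : IsOpen W) (hc : IsPreconnected W) {x y : ℂ}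
    (hx : x ∈ W) (hy : y ∈ W) :
    ∃ (m : ℕ) (c : ℕ → ℂ), c 0 = x ∧ c m = y ∧ ∀ i < m, segment ℝ (c i) (c (i + 1)) ⊆ W := by
  let r : ℂ → ℂ → Prop := Relation.ReflTransGen fun a b => segment ℝ a b ⊆ W
  have hloc : ∀ a ∈ W, ∀ᶠ b in 𝓝 a, segment ℝ a b ⊆ W ∧ segment ℝ b a ⊆ W := by
    intro a ha
    obtain ⟨ε, hε, hb⟩ := Metric.isOpen_iff.1 hW a ha
    filter_upwards [Metric.ball_mem_nhds a hε] with b hbb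
    exact ⟨((convex_ball a ε).segment_subset (Metric.mem_ball_self hε) hbb).trans hb,
      ((convex_ball a ε).segment_subset hbb (Metric.mem_ball_self hε)).trans hb⟩
  have hr : r x y := by
    by_contra hcon
    have hA : IsOpen {a | a ∈ W ∧ r x a} := isOpen_iff_mem_nhds.2 fun a ha => by
      filter_upwards [hloc a ha.1, hW.mem_nhds ha.1] with b hb hbW
      exact ⟨hbW, ha.2.tail hb.1⟩
    have hB : IsOpen {a | a ∈ W ∧ ¬ r x a} := isOpen_iff_mem_nhds.2 fun a ha => by
      filter_upwards [hloc a ha.1, hW.mem_nhds ha.1] with b hb hbW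
      exact ⟨hbW, fun h => ha.2 (h.tail hb.2)⟩
    obtain ⟨b, -, h1, h2⟩ := hc _ _ hA hB (fun a ha => (em (r x a)).imp (fun h => ⟨ha, h⟩) fun h => ⟨ha, h⟩)
      ⟨x, hx, hx, Relation.ReflTransGen.refl⟩ ⟨y, hy, hy, hcon⟩
    exact h2.2 h1.2
  clear hloc
  induction hr with
  | refl => exact ⟨0, fun _ => x, rfl, rfl, by simp⟩
  | @tail b d hxb hbd ih =>
    obtain ⟨m, c, h0, hm, hcm⟩ := ih (hbd (left_mem_segment _ _ _))
    refine ⟨m + 1, fun i => if i ≤ m then c i else d, by simp [h0], by simp, fun i hi => ?_⟩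
    grind

/-- If points of `O` converging to `z ∉ O` are successively joined by chains in shrinking sets, then `z` is
the end-point of an end-cut of `O`. -/
theorem exists_isEndCut_of_chains {O : Set ℂ} {W : ℕ → Set ℂ} {x : ℕ → ℂ} {z : ℂ} (hz : z ∉ O)
    (hWO : ∀ n, W n ⊆ O) (hWz : ∀ ε > 0, ∀ᶠ n in atTop, W n ⊆ Metric.ball z ε) (hWo : ∀ n, IsOpen (W n))
    (hWc : ∀ n, IsPreconnected (W n)) (hx : ∀ n, x n ∈ W n) (hx' : ∀ n, x (n + 1) ∈ W n) :
    ∃ η, IsEndCut O η ∧ Tendsto η (𝓝[<] (1:ℝ)) (𝓝 z) := by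
  choose m c h0 hm hc using fun n => exists_chain_of_isPreconnected (hWo n) (hWc n) (hx n) (hx' n)
  let step : ℕ × ℕ → ℕ × ℕ := fun q => if q.2 < m q.1 then (q.1, q.2 + 1) else (q.1 + 1, 0)
  let Q : ℕ → ℕ × ℕ := fun k => step^[k] (0, 0)
  have hQs : ∀ k, Q (k + 1) = step (Q k) := fun k => Function.iterate_succ_apply' step k (0, 0)
  have hQm : ∀ k, (Q k).2 ≤ m (Q k).1 := by
    intro k
    induction k with
    | zero => exact Nat.zero_le _
    | succ k ih =>
      grind
  have hQmono : Monotone fun k => (Q k).1 := monotone_nat_of_le_succ fun k => by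
    grind
  have hadv : ∀ n, ∃ k, n ≤ (Q k).1 := by
    intro n
    induction n with
    | zero => exact ⟨0, Nat.zero_le _⟩
    | succ n ih =>
      obtain ⟨k, hk⟩ := ih
      by_contra! hcon
      have heq : ∀ j, (Q (k + j)).1 = n := fun j =>
        le_antisymm (Nat.lt_succ_iff.1 (hcon _)) (hk.trans (hQmono (Nat.le_add_right k j)))
      have hj : ∀ j, j ≤ (Q (k + j)).2 := by
        intro j
        induction j with
        | zero => exact Nat.zero_le _
        | succ j ihj =>
          grind
      have := (hj (m n + 1)).trans (hQm _)
      rw [heq] at this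
      omega
  let v : ℕ → ℂ := fun k => c (Q k).1 (Q k).2
  have hvW : ∀ k, v k ∈ W (Q k).1 := by
    intro k
    rcases (hQm k).lt_or_eq with h | h
    · exact hc _ _ h (left_mem_segment _ _ _)
    · simp only [v, h, hm]; exact hx' _
  have hseg : ∀ k, segment ℝ (v k) (v (k + 1)) ⊆ W (Q k).1 := by
    intro k
    simp only [v, hQs, step]
    split_ifs with h
    · exact hc _ _ h
    · rw [(hQm k).antisymm (not_lt.1 h), hm, h0, segment_same, singleton_subset_iff]
      exact hx' _
  refine exists_isEndCut_of_brokenLine hz (Metric.tendsto_nhds.2 fun ε hε => ?_) fun k => (hseg k).trans (hWO _)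
  obtain ⟨n, hn⟩ := eventually_atTop.1 (hWz ε hε)
  obtain ⟨k, hk⟩ := hadv n
  filter_upwards [eventually_ge_atTop k] with j hj
  exact hn _ (hk.trans (hQmono hj)) (hvW j)

theorem hasLog_sub_of_path {O U : Set ℂ} (hUo : IsOpen U) (hUs : IsSimplyConnected U) (hOU : O ⊆ U)
    {h : ℝ → ℂ} (hc : ContinuousOn h (Icc 0 1)) (hO : ∀ t ∈ Icc (0:ℝ) 1, h t ∉ O) (h1 : h 1 ∉ U) :
    HasLog O fun z => z - h 0 := by
  have k1 : HasLog O fun z => (z - h 0) / (z - h 1) := (hasLog_compl_path hc).mono fun z hz ⟨t, ht, e⟩ =>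
    hO t ht (e ▸ hz)
  have k2 : HasLog O fun z => z - h 1 := (hasLog_of_isSimplyConnected hUs hUo (u := fun z => z - h 1) (by fun_prop)
    fun z hz => sub_ne_zero.2 fun e => h1 (e ▸ hz)).mono hOU
  exact (k1.mul k2).congr fun z hz => div_mul_cancel₀ _ (sub_ne_zero.2 fun e => h1 (e ▸ hOU hz))

section Arc

variable {U : Set ℂ} (hUo : IsOpen U) (hUs : IsSimplyConnected U) {g : ℝ → ℂ}
  (hg : ContinuousOn g (Icc 0 1)) (hi : InjOn g (Ioo 0 1)) (hgU : ∀ t ∈ Ioo (0:ℝ) 1, g t ∈ U)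
  (h0 : g 0 ∉ U) (h1 : g 1 ∉ U)
include hUo hUs hg hi hgU h0 h1

theorem isSimplyConnected_diff_ends {t₁ t₂ : ℝ} (ht₁ : 0 < t₁) (h12 : t₁ < t₂) (ht₂ : t₂ < 1) :
    IsSimplyConnected (U \ (g '' Icc 0 t₁ ∪ g '' Icc t₂ 1)) := by
  have hcl : IsClosed (g '' Icc 0 t₁ ∪ g '' Icc t₂ 1) :=
    (isCompact_Icc.image_of_continuousOn (hg.mono (Icc_subset_Icc_right (h12.trans ht₂).le))).isClosed.union
    (isCompact_Icc.image_of_continuousOn (hg.mono (Icc_subset_Icc_left (ht₁.trans h12).le))).isClosed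
  have hne : (U \ (g '' Icc 0 t₁ ∪ g '' Icc t₂ 1)).Nonempty := by
    obtain ⟨t, ht1, ht2⟩ := exists_between h12
    have ht : t ∈ Ioo (0:ℝ) 1 := ⟨ht₁.trans ht1, ht2.trans ht₂⟩
    refine ⟨g t, hgU t ht, ?_⟩
    rintro (⟨s, hs, e⟩ | ⟨s, hs, e⟩)
    · rcases hs.1.eq_or_lt with h | h
      · exact h0 (h ▸ e ▸ hgU t ht)
      · have := hi ⟨h, hs.2.trans_lt (h12.trans ht₂)⟩ ht e
        linarith [hs.2]
    · rcases hs.2.eq_or_lt with h | h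
      · exact h1 (h ▸ e ▸ hgU t ht)
      · have := hi ⟨(ht₁.trans h12).trans_le hs.1, h⟩ ht e
        linarith [hs.1]
  refine isSimplyConnected_of_hasLog (hUo.sdiff hcl)
    ⟨hne, isPreconnected_diff_ends hUo hUs hg hi hgU h0 h1 ht₁ h12 ht₂⟩ fun a ha => ?_
  by_cases haU : a ∈ U
  swap
  · exact (hasLog_of_isSimplyConnected hUs hUo (u := fun z => z - a) (by fun_prop)
      fun z hz => sub_ne_zero.2 fun e => haU (e ▸ hz)).mono sdiff_subset
  have a1 : t₁ ≤ 1 := (h12.trans ht₂).le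
  have a2 : 0 ≤ t₂ := (ht₁.trans h12).le
  have hmem : a ∈ g '' Icc 0 t₁ ∪ g '' Icc t₂ 1 := by_contra fun h => ha ⟨haU, h⟩
  rcases hmem with ⟨s, hs, rfl⟩ | ⟨s, hs, rfl⟩
  · have hm : ∀ t ∈ Icc (0:ℝ) 1, s * (1 - t) ∈ Icc 0 t₁ := fun t ht =>
      ⟨mul_nonneg hs.1 (by linarith [ht.2]), by nlinarith [ht.1, hs.1, hs.2]⟩
    have := hasLog_sub_of_path (O := U \ (g '' Icc 0 t₁ ∪ g '' Icc t₂ 1)) (h := fun t => g (s * (1 - t))) hUo hUs sdiff_subset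
      (hg.comp (f := fun t => s * (1 - t)) (by fun_prop) fun t ht => Icc_subset_Icc_right a1 (hm t ht))
      (fun t ht h => h.2 (Or.inl ⟨s * (1 - t), hm t ht, rfl⟩)) (by simpa using h0)
    simpa using this
  · have hm : ∀ t ∈ Icc (0:ℝ) 1, s + t * (1 - s) ∈ Icc t₂ 1 := fun t ht =>
      ⟨by nlinarith [ht.1, hs.1, hs.2], by nlinarith [ht.1, ht.2, hs.1, hs.2]⟩
    have := hasLog_sub_of_path (O := U \ (g '' Icc 0 t₁ ∪ g '' Icc t₂ 1)) (h := fun t => g (s + t * (1 - s))) hUo hUs sdiff_subset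
      (hg.comp (f := fun t => s + t * (1 - s)) (by fun_prop) fun t ht => Icc_subset_Icc_left a2 (hm t ht))
      (fun t ht h => h.2 (Or.inr ⟨s + t * (1 - s), hm t ht, rfl⟩)) (by simpa using h1)
    simpa using this

/-- Complementary domains of a cross-cut are locally connected at the points of the cross-cut. -/
theorem exists_isPreconnected_nhd {D : Set ℂ} (hD : IsCompOf (U \ g '' Ioo 0 1) D) {t₀ : ℝ} (ht₀ : t₀ ∈ Ioo (0:ℝ) 1)
    {ε : ℝ} (hε : 0 < ε) : ∃ δ > 0, δ ≤ ε ∧ ∃ W : Set ℂ, IsOpen W ∧ IsPreconnected W ∧ W ⊆ D ∩ Metric.ball (g t₀) ε ∧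
      D ∩ Metric.ball (g t₀) δ ⊆ W := by
  obtain ⟨ε₁, hε₁, hb⟩ := Metric.isOpen_iff.1 hUo (g t₀) (hgU t₀ ht₀)
  set ε' := min ε ε₁ with hε'
  have hε'0 : 0 < ε' := lt_min hε hε₁
  have hca : ContinuousAt g t₀ := hg.continuousAt (Icc_mem_nhds ht₀.1 ht₀.2)
  obtain ⟨η, hη, hηb⟩ := Metric.nhds_basis_ball.mem_iff.1 ((hca.eventually (Metric.ball_mem_nhds _ hε'0)).and
    (Ioo_mem_nhds ht₀.1 ht₀.2))
  have hη' : ∀ t, |t - t₀| < η → g t ∈ Metric.ball (g t₀) ε' ∧ t ∈ Ioo (0:ℝ) 1 := fun t ht =>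
    hηb (by rwa [Metric.mem_ball, Real.dist_eq])
  set t₁ := t₀ - η / 2 with ht₁
  set t₂ := t₀ + η / 2 with ht₂
  have a1 : t₁ ∈ Ioo (0:ℝ) 1 := (hη' t₁ (by rw [ht₁, abs_lt]; constructor <;> linarith)).2
  have a2 : t₂ ∈ Ioo (0:ℝ) 1 := (hη' t₂ (by rw [ht₂, abs_lt]; constructor <;> linarith)).2
  have a12 : t₁ < t₂ := by linarith
  set L := g '' Icc 0 t₁ ∪ g '' Icc t₂ 1 with hL
  have hsc := isSimplyConnected_diff_ends hUo hUs hg hi hgU h0 h1 a1.1 a12 a2.2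
  rw [← hL] at hsc
  have hLc : IsClosed L :=
    (isCompact_Icc.image_of_continuousOn (hg.mono (Icc_subset_Icc_right a1.2.le))).isClosed.union
    (isCompact_Icc.image_of_continuousOn (hg.mono (Icc_subset_Icc_left a2.1.le))).isClosed
  have hLU : ∀ y ∈ U, y ∈ L → y ∈ g '' Ioo 0 1 := by
    grind
  have hzL : g t₀ ∉ L := by
    rintro (⟨s, hs, e⟩ | ⟨s, hs, e⟩)
    · rcases hs.1.eq_or_lt with h | h
      · exact h0 (h ▸ e ▸ hgU _ ht₀)
      · have := hi ⟨h, hs.2.trans_lt a1.2⟩ ht₀ e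
        linarith [hs.2]
    · rcases hs.2.eq_or_lt with h | h
      · exact h1 (h ▸ e ▸ hgU _ ht₀)
      · have := hi ⟨a2.1.trans_le hs.1, h⟩ ht₀ e
        linarith [hs.1]
  obtain ⟨δ₁, hδ₁, hδb⟩ := Metric.isOpen_iff.1 hLc.isOpen_compl _ hzL
  set δ := min ε' δ₁ with hδ
  have hδ0 : 0 < δ := lt_min hε'0 hδ₁
  refine ⟨δ, hδ0, (min_le_left _ _).trans (min_le_left _ _), ?_⟩
  rcases (D ∩ Metric.ball (g t₀) δ).eq_empty_or_nonempty with hem | ⟨x, hxD, hxb⟩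
  · exact ⟨∅, isOpen_empty, isPreconnected_empty, empty_subset _, hem.subset⟩
  have hDo := isOpen_diff_arc hUo hg h0 h1
  have hO2 : IsOpen (Metric.ball (g t₀) ε' \ L) := Metric.isOpen_ball.sdiff hLc
  have hun : (U \ g '' Ioo 0 1) ∪ (Metric.ball (g t₀) ε' \ L) = U \ L := by
    ext y
    constructor
    · rintro (⟨hyU, hy⟩ | ⟨hyb, hy⟩)
      · exact ⟨hyU, fun h => hy (hLU y hyU h)⟩
      · exact ⟨hb (Metric.ball_subset_ball (min_le_right _ _) hyb), hy⟩
    · rintro ⟨hyU, hy⟩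
      by_cases hys : y ∈ g '' Ioo 0 1
      · right
        obtain ⟨s, hs, rfl⟩ := hys
        refine ⟨(hη' s ?_).1, hy⟩
        grind
      · exact Or.inl ⟨hyU, hys⟩
  have hbO2 : Metric.ball (g t₀) δ ⊆ Metric.ball (g t₀) ε' \ L := fun y hy =>
    ⟨Metric.ball_subset_ball (min_le_left _ _) hy, hδb (Metric.ball_subset_ball (min_le_right _ _) hy)⟩
  set W := connectedComponentIn ((U \ g '' Ioo 0 1) ∩ (Metric.ball (g t₀) ε' \ L)) x with hW
  have hxW : x ∈ (U \ g '' Ioo 0 1) ∩ (Metric.ball (g t₀) ε' \ L) := ⟨hD.subset hxD, hbO2 hxb⟩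
  have hWs := connectedComponentIn_subset ((U \ g '' Ioo 0 1) ∩ (Metric.ball (g t₀) ε' \ L)) x
  refine ⟨W, (hDo.inter hO2).connectedComponentIn, isPreconnected_connectedComponentIn,
    subset_inter (hD.subset_of_isPreconnected isPreconnected_connectedComponentIn (hWs.trans inter_subset_left)
      ⟨x, hxD, mem_connectedComponentIn hxW⟩)
      fun y hy => Metric.ball_subset_ball (min_le_left _ _) (hWs hy).2.1, fun y hy => ?_⟩
  refine joined_inter hDo hO2 (fun u hu hu0 _ _ => ?_) hxW
    (mem_ccIn_of_isPreconnected hD.isPreconnected hD.subset hxD hy.1)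
    (mem_ccIn_of_isPreconnected (convex_ball _ _).isPreconnected hbO2 hxb hy.2)
  rw [hun] at hu hu0 ⊢
  exact hasLog_of_isSimplyConnected hsc (hUo.sdiff hLc) hu hu0

/-- Points of a cross-cut are accessible from its complementary domains. -/
theorem exists_isEndCut_of_mem_arc {D : Set ℂ} (hD : IsCompOf (U \ g '' Ioo 0 1) D) {t₀ : ℝ}
    (ht₀ : t₀ ∈ Ioo (0:ℝ) 1) (hcl : g t₀ ∈ closure D) {ε : ℝ} (hε : 0 < ε) :
    ∃ η, IsEndCut (D ∩ Metric.ball (g t₀) ε) η ∧ Tendsto η (𝓝[<] (1:ℝ)) (𝓝 (g t₀)) := by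
  choose! δ hδ0 hδ W hWo hWc hWs hW using fun ε hε =>
    exists_isPreconnected_nhd hUo hUs hg hi hgU h0 h1 hD ht₀ (ε := ε) hε
  let e : ℕ → ℝ := fun n => (fun r => δ r / 2)^[n] ε
  have hes : ∀ n, e (n + 1) = δ (e n) / 2 := fun n => Function.iterate_succ_apply' _ n ε
  have he0 : ∀ n, 0 < e n := by
    intro n
    induction n with
    | zero => exact hε
    | succ n ih => rw [hes]; exact half_pos (hδ0 _ ih)
  have hen : ∀ n, e n ≤ ε * (1 / 2) ^ n := by
    intro n
    induction n with
    | zero => simp [e]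
    | succ n ih => rw [hes, pow_succ]; linarith [hδ _ (he0 n)]
  have hex : ∀ n, ∃ x, x ∈ D ∩ Metric.ball (g t₀) (δ (e n)) := fun n => by
    obtain ⟨x, hx, hxd⟩ := Metric.mem_closure_iff.1 hcl _ (hδ0 _ (he0 n))
    exact ⟨x, hx, by rwa [Metric.mem_ball, dist_comm]⟩
  choose x hx using hex
  have hlim : Tendsto (fun n => ε * (1 / 2 : ℝ) ^ n) atTop (𝓝 0) := by
    simpa using (tendsto_pow_atTop_nhds_zero_of_lt_one (by norm_num : (0:ℝ) ≤ 1 / 2) (by norm_num)).const_mul ε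
  refine exists_isEndCut_of_chains (W := fun n => W (e n)) (x := x)
    (fun h => (hD.subset h.1).2 ⟨t₀, ht₀, rfl⟩) (fun n y hy => ?_) (fun r hr => ?_) (fun n => hWo _ (he0 n))
    (fun n => hWc _ (he0 n)) (fun n => hW _ (he0 n) (hx n)) fun n => hW _ (he0 n) ⟨(hx _).1, ?_⟩
  · have := hWs _ (he0 n) hy
    refine ⟨this.1, Metric.ball_subset_ball ((hen n).trans ?_) this.2⟩
    exact mul_le_of_le_one_right hε.le (pow_le_one₀ (by norm_num) (by norm_num))
  · filter_upwards [hlim.eventually (gt_mem_nhds hr)] with n hn y hy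
    exact Metric.ball_subset_ball ((hen n).trans hn.le) (hWs _ (he0 n) hy).2
  · refine Metric.ball_subset_ball ?_ (hx (n + 1)).2
    grind

end Arc

theorem HasTwoComps.eq_or_eq {Y A B D : Set X} (h : HasTwoComps Y A B) (hD : IsCompOf Y D) :
    D = A ∨ D = B := by
  obtain ⟨x, hx, rfl⟩ := hD
  exact h.2.2.2 x hx

theorem HasTwoComps.subset_or_subset {Y A B T : Set X} (h : HasTwoComps Y A B) (hT : IsPreconnected T)
    (hTY : T ⊆ Y) : T ⊆ A ∨ T ⊆ B := by
  rcases T.eq_empty_or_nonempty with rfl | ⟨x, hx⟩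
  · exact Or.inl (empty_subset _)
  rcases h.2.2.2 x (hTY hx) with h' | h'
  · exact Or.inl (h' ▸ hT.subset_connectedComponentIn hx hTY)
  · exact Or.inr (h' ▸ hT.subset_connectedComponentIn hx hTY)

theorem IsCrossCut.exists_hasTwoComps {U σ : Set X} (h : IsCrossCut U σ) : ∃ A B, HasTwoComps (U \ σ) A B := by
  obtain ⟨g, _, _, _, _, _, _, A, B, h, _⟩ := h
  exact ⟨A, B, h⟩

/-- The side `B` of the cross-cut `σ` is moved off itself, together with `σ`, into the other
side `A`, which meets its image. -/
structure Sides (f : X ≃ₜ X) (U σ A B : Set X) : Prop where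
  cut : IsCrossCut U σ
  two : HasTwoComps (U \ σ) A B
  push : f '' (B ∪ σ) ⊆ A
  meet : (f '' A ∩ A).Nonempty

namespace Sides

variable {f : X ≃ₜ X} {U σ A B : Set X} (h : Sides f U σ A B)
include h

theorem mem_cases {y : X} (hy : y ∈ U) : y ∈ A ∨ y ∈ B ∨ y ∈ σ := by
  by_cases hσ : y ∈ σ
  · exact Or.inr (Or.inr hσ)
  · have : y ∈ A ∪ B := h.two.eq_union ▸ (⟨hy, hσ⟩ : y ∈ U \ σ)
    grind

theorem left_subset : A ⊆ U := h.two.1.subset.trans sdiff_subset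
theorem right_subset : B ⊆ U := h.two.2.1.subset.trans sdiff_subset
theorem cut_subset : σ ⊆ U := h.cut.subset
theorem union_subset : B ∪ σ ⊆ U := Set.union_subset h.right_subset h.cut_subset
theorem disjoint : Disjoint A B := h.two.disjoint
theorem disjoint_left : Disjoint A σ := Set.disjoint_left.2 fun _ hy hs => (h.two.1.subset hy).2 hs
theorem disjoint_right : Disjoint B σ := Set.disjoint_left.2 fun _ hy hs => (h.two.2.1.subset hy).2 hs
theorem left_eq : A = U \ (B ∪ σ) := by
  ext y
  refine ⟨fun hy => ⟨h.left_subset hy, ?_⟩, fun hy => ?_⟩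
  · rintro (hB | hs)
    exacts [Set.disjoint_left.1 h.disjoint hy hB, Set.disjoint_left.1 h.disjoint_left hy hs]
  · rcases h.mem_cases hy.1 with h' | h' | h'
    exacts [h', (hy.2 (Or.inl h')).elim, (hy.2 (Or.inr h')).elim]
theorem image_disjoint : f '' (B ∪ σ) ∩ (B ∪ σ) = ∅ := by
  rw [eq_empty_iff_forall_notMem]
  rintro y ⟨hy, hy'⟩
  have := h.push hy
  rw [h.left_eq] at this
  exact this.2 hy'
theorem image_right_disjoint : f '' B ∩ B = ∅ := by
  have := h.image_disjoint
  grind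
theorem eq_right {D : Set X} (hD : IsCompOf (U \ σ) D) (hfD : f '' D ∩ D = ∅) : D = B := by
  rcases h.two.eq_or_eq hD with rfl | rfl
  · exact (h.meet.ne_empty hfD).elim
  · rfl
theorem existsUnique : ∃! D, IsCompOf (U \ σ) D ∧ f '' D ∩ D = ∅ :=
  ⟨B, ⟨h.two.2.1, h.image_right_disjoint⟩, fun _ hD => h.eq_right hD.1 hD.2⟩

theorem right_unique {A' B' : Set X} (h' : Sides f U σ A' B') : B' = B :=
  h.eq_right h'.two.2.1 h'.image_right_disjoint

theorem image {e : X ≃ₜ X} (heU : e '' U = U) (hef : ∀ z, e (f z) = f (e z)) :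
    Sides f U (e '' σ) (e '' A) (e '' B) := by
  have hc : ∀ S : Set X, f '' (e '' S) = e '' (f '' S) := fun S => by
    simp only [image_image, hef]
  refine ⟨?_, ?_, ?_, ?_⟩
  · have := h.cut.image e; rwa [heU] at this
  · have := h.two.image e; rwa [image_sdiff e.injective, heU] at this
  · rw [← image_union, hc]; exact image_mono h.push
  · rw [hc, ← image_inter e.injective]; exact h.meet.image _

end Sides

theorem Sides.isPreconnected_right {f : ℂ ≃ₜ ℂ} {U σ A B : Set ℂ} (hUo : IsOpen U)
    (hUs : IsSimplyConnected U) (h : Sides f U σ A B) : IsPreconnected (B ∪ σ) :=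
  h.two.2.1.isPreconnected.subset_closure subset_union_left
    (Set.union_subset subset_closure (IsCrossCut.subset_closure hUo hUs h.cut h.two.2.1))

theorem Sides.isPreconnected_left {f : ℂ ≃ₜ ℂ} {U σ A B : Set ℂ} (hUo : IsOpen U)
    (hUs : IsSimplyConnected U) (h : Sides f U σ A B) : IsPreconnected (A ∪ σ) :=
  h.two.1.isPreconnected.subset_closure subset_union_left
    (Set.union_subset subset_closure (IsCrossCut.subset_closure hUo hUs h.cut h.two.1))

theorem exists_sides {f : ℂ ≃ₜ ℂ} {U σ : Set ℂ} (hUo : IsOpen U) (hUs : IsSimplyConnected U) (hU : U ≠ univ)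
    (hfU : f '' U = U) (hf : NoFixedPrimeEnd f U) (hσ : IsCrossCut U σ) (hfσ : f '' σ ∩ σ = ∅) :
    ∃ A B, Sides f U σ A B := by
  have hfσU : f '' σ ⊆ U \ σ := fun y hy =>
    ⟨hfU ▸ image_mono hσ.subset hy, fun hs => (hfσ.subset ⟨hy, hs⟩ : _)⟩
  obtain ⟨A, B, h2, hA⟩ : ∃ A B, HasTwoComps (U \ σ) A B ∧ f '' σ ⊆ A := by
    obtain ⟨A, B, h2⟩ := hσ.exists_hasTwoComps
    rcases h2.subset_or_subset (hσ.isConnected.isPreconnected.image f f.continuous.continuousOn) hfσU with h | h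
    exacts [⟨A, B, h2, h⟩, ⟨B, A, h2.symm, h⟩]
  have hAU : A ⊆ U := h2.1.subset.trans sdiff_subset
  have hBU : B ⊆ U := h2.2.1.subset.trans sdiff_subset
  have hun : ∀ y ∈ U, y ∉ B ∪ σ → y ∈ A := fun y hy hn => by
    have : y ∈ A ∪ B := h2.eq_union ▸ (⟨hy, fun h => hn (Or.inr h)⟩ : y ∈ U \ σ)
    grind
  have hdis : ∀ y ∈ A, y ∉ B ∪ σ := fun y hy hn =>
    hn.elim (fun h => Set.disjoint_left.1 h2.disjoint hy h) (fun h => (h2.1.subset hy).2 h)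
  have hpre : IsPreconnected (B ∪ σ) := h2.2.1.isPreconnected.subset_closure subset_union_left
    (Set.union_subset subset_closure (IsCrossCut.subset_closure hUo hUs hσ h2.2.1))
  have h2f : HasTwoComps (U \ f '' σ) (f '' A) (f '' B) := by
    have := h2.image f; rwa [image_sdiff f.injective, hfU] at this
  have hsub : B ∪ σ ⊆ U \ f '' σ := fun y hy =>
    ⟨Set.union_subset hBU hσ.subset hy, fun h => hdis y (hA h) hy⟩
  have hfdis : ∀ S T : Set ℂ, Disjoint S T → ∀ y ∈ f '' S, y ∉ f '' T := by
    rintro S T hST _ ⟨z, hz, rfl⟩ ⟨w, hw, hwz⟩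
    exact Set.disjoint_left.1 hST hz (f.injective hwz ▸ hw)
  have dA : Disjoint A (B ∪ σ) := Set.disjoint_left.2 hdis
  have dB : Disjoint (A ∪ σ) B := Set.disjoint_left.2 fun y hy hB => hy.elim
    (fun h => Set.disjoint_left.1 h2.disjoint h hB) (fun h => (h2.2.1.subset hB).2 h)
  have hfU' : ∀ S ⊆ U, f '' S ⊆ U := fun S hS => hfU ▸ image_mono hS
  rcases h2f.subset_or_subset hpre hsub with hc | hc
  · refine ⟨A, B, hσ, h2, fun y hy => hun y (hfU' _ (Set.union_subset hBU hσ.subset) hy) fun hn =>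
      hfdis _ _ dA y (hc hn) hy, ?_⟩
    by_contra hne
    have hfA : f '' A = B ∪ σ := by
      refine subset_antisymm (fun y hy => ?_) hc
      by_contra hn
      exact hne ⟨y, hy, hun y (hfU' A hAU hy) hn⟩
    have hAo : IsOpen A := h2.1.isOpen (hσ.isOpen_diff hUo)
    obtain ⟨z, hz, hzA, hzB⟩ := hUs.isPathConnected.isConnected.isPreconnected A (f '' A) hAo (f.isOpenMap _ hAo)
      (fun y hy => by
        by_cases h : y ∈ B ∪ σ
        exacts [Or.inr (hfA ▸ h), Or.inl (hun y hy h)])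
      (h2.1.nonempty.mono fun y hy => ⟨hAU hy, hy⟩)
      ((h2.1.nonempty.image f).mono fun y hy => ⟨hfU' A hAU hy, hy⟩)
    exact hdis z hzA (hfA ▸ hzB)
  · exact (IsCrossCut.not_image_union_subset hUo hUs hU hfU hf hσ h2 fun y hy =>
      hun y (hfU' _ (Set.union_subset hAU hσ.subset) hy) fun hn => hfdis _ _ dB y hy (hc hn)).elim

/-- Free sides of disjoint cross-cuts are disjoint or nested. -/
theorem Sides.trichotomy {f : ℂ ≃ₜ ℂ} {U σ A B τ A' B' : Set ℂ} (hUo : IsOpen U)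
    (hUs : IsSimplyConnected U) (h : Sides f U σ A B) (h' : Sides f U τ A' B') (hd : Disjoint σ τ) :
    Disjoint (B ∪ σ) (B' ∪ τ) ∨ B ∪ σ ⊆ B' ∨ B' ∪ τ ⊆ B := by
  have hσ : σ ⊆ U \ τ := fun y hy => ⟨h.cut_subset hy, fun h => Set.disjoint_left.1 hd hy h⟩
  have hτ : τ ⊆ U \ σ := fun y hy => ⟨h'.cut_subset hy, fun h => Set.disjoint_left.1 hd h hy⟩
  have d1 : ∀ y ∈ A, y ∉ B ∪ σ := fun y hy => by rw [h.left_eq] at hy; exact hy.2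
  have d2 : ∀ y ∈ A', y ∉ B' ∪ τ := fun y hy => by rw [h'.left_eq] at hy; exact hy.2
  rcases h'.two.subset_or_subset h.cut.isConnected.isPreconnected hσ with hs | hs <;>
    rcases h.two.subset_or_subset h'.cut.isConnected.isPreconnected hτ with ht | ht
  · -- `B ∪ σ` avoids `τ`
    have hx : B ∪ σ ⊆ U \ τ := fun y hy => ⟨h.union_subset hy, fun hyt => d1 y (ht hyt) hy⟩
    rcases h'.two.subset_or_subset (h.isPreconnected_right hUo hUs) hx with hh | hh
    · exact Or.inl (Set.disjoint_left.2 fun y hy => d2 y (hh hy))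
    · obtain ⟨z, hz⟩ := h.cut.isConnected.nonempty
      exact (d2 z (hs hz) (Or.inl (hh (Or.inr hz)))).elim
  · have hx : B' ∪ τ ⊆ U \ σ := fun y hy => ⟨h'.union_subset hy, fun hyt => d2 y (hs hyt) hy⟩
    rcases h.two.subset_or_subset (h'.isPreconnected_right hUo hUs) hx with hh | hh
    · obtain ⟨z, hz⟩ := h'.cut.isConnected.nonempty
      exact (d1 z (hh (Or.inr hz)) (Or.inl (ht hz))).elim
    · exact Or.inr (Or.inr hh)
  · have hx : B ∪ σ ⊆ U \ τ := fun y hy => ⟨h.union_subset hy, fun hyt => d1 y (ht hyt) hy⟩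
    rcases h'.two.subset_or_subset (h.isPreconnected_right hUo hUs) hx with hh | hh
    · obtain ⟨z, hz⟩ := h.cut.isConnected.nonempty
      exact (d2 z (hh (Or.inr hz)) (Or.inl (hs hz))).elim
    · exact Or.inr (Or.inl hh)
  · exfalso
    have hx : A ∪ σ ⊆ U \ τ := fun y hy => ⟨Set.union_subset h.left_subset h.cut_subset hy, fun hyt =>
      hy.elim (fun h0 => d1 y h0 (Or.inl (ht hyt))) (fun h0 => (hσ h0).2 hyt)⟩
    have hx' : A' ∪ τ ⊆ U \ σ := fun y hy => ⟨Set.union_subset h'.left_subset h'.cut_subset hy, fun hyt =>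
      hy.elim (fun h0 => d2 y h0 (Or.inl (hs hyt))) (fun h0 => (hτ h0).2 hyt)⟩
    have k1 : A ∪ σ ⊆ B' := by
      rcases h'.two.subset_or_subset (h.isPreconnected_left hUo hUs) hx with hh | hh
      · obtain ⟨z, hz⟩ := h.cut.isConnected.nonempty
        exact (d2 z (hh (Or.inr hz)) (Or.inl (hs hz))).elim
      · exact hh
    have k2 : A' ∪ τ ⊆ B := by
      rcases h.two.subset_or_subset (h'.isPreconnected_left hUo hUs) hx' with hh | hh
      · obtain ⟨z, hz⟩ := h'.cut.isConnected.nonempty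
        exact (d1 z (hh (Or.inr hz)) (Or.inl (ht hz))).elim
      · exact hh
    obtain ⟨z, hz, hz'⟩ := h'.meet
    have : z ∈ A := h.push (image_mono ((subset_union_left.trans k2).trans subset_union_left) hz)
    exact d2 z hz' (Or.inl (k1 (Or.inl this)))

/-- The components of `Y` are cross-cuts of `U`, each with a side moved off itself, and they
form a locally finite family in `U`. -/
structure FreeFamily (f : ℂ ≃ₜ ℂ) (U Y : Set ℂ) (L R : Set ℂ → Set ℂ) : Prop where
  isOpen : IsOpen U
  sc : IsSimplyConnected U
  inv : f '' U = U
  ne : U ≠ univ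
  sub : Y ⊆ U
  sides : ∀ σ, IsCompOf Y σ → Sides f U σ (L σ) (R σ)
  loc : ∀ y ∈ U, ∃ ε > 0, Metric.ball y ε ⊆ U ∧ ∀ σ, IsCompOf Y σ → (σ ∩ Metric.ball y ε).Nonempty → y ∈ σ

/-- The cross-cuts of the family contained in no free side. -/
def maximalCuts (Y : Set ℂ) (R : Set ℂ → Set ℂ) : Set (Set ℂ) :=
  {σ | IsCompOf Y σ ∧ ∀ τ, IsCompOf Y τ → ¬ σ ⊆ R τ}

/-- The complement in `U` of all free sides and all cuts. -/
def coreSet (U Y : Set ℂ) (R : Set ℂ → Set ℂ) : Set ℂ :=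
  {y | y ∈ U ∧ ∀ σ, IsCompOf Y σ → y ∉ R σ ∪ σ}

namespace FreeFamily

variable {f : ℂ ≃ₜ ℂ} {U Y : Set ℂ} {L R : Set ℂ → Set ℂ} (H : FreeFamily f U Y L R)
include H

theorem isOpen_right {σ : Set ℂ} (hσ : IsCompOf Y σ) : IsOpen (R σ) :=
  (H.sides σ hσ).two.2.1.isOpen ((H.sides σ hσ).cut.isOpen_diff H.isOpen)

theorem isOpen_left {σ : Set ℂ} (hσ : IsCompOf Y σ) : IsOpen (L σ) :=
  (H.sides σ hσ).two.1.isOpen ((H.sides σ hσ).cut.isOpen_diff H.isOpen)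

theorem cut_diff {σ : Set ℂ} (hσ : IsCompOf Y σ) {T : Set ℂ} (hT : IsPreconnected T) (hTU : T ⊆ U)
    (hTσ : Disjoint T σ) (h : (R σ ∩ T).Nonempty) : T ⊆ R σ :=
  (H.sides σ hσ).two.2.1.subset_of_isPreconnected hT
    (fun _ hy => ⟨hTU hy, fun hs => Set.disjoint_left.1 hTσ hy hs⟩) h

theorem finite_containing {w : ℂ} (hw : w ∈ U) : {τ | IsCompOf Y τ ∧ w ∈ R τ ∪ τ}.Finite := by
  have hfw : f w ∈ U := (mem_iff_of_image_eq H.inv w).2 hw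
  obtain ⟨K, hKU, hK, hKc, hwK, hfwK⟩ := H.sc.isPathConnected.exists_compact_connected hw hfw
  have hloc : ∀ y, ∃ V : Set ℂ, IsOpen V ∧ y ∈ V ∧ (y ∈ U → ∀ σ, IsCompOf Y σ → (σ ∩ V).Nonempty → y ∈ σ) := by
    intro y
    by_cases hy : y ∈ U
    · obtain ⟨ε, hε, _, h⟩ := H.loc y hy
      exact ⟨_, Metric.isOpen_ball, Metric.mem_ball_self hε, fun _ => h⟩
    · exact ⟨univ, isOpen_univ, mem_univ _, fun h => (hy h).elim⟩
  choose V hVo hVm hV using hloc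
  obtain ⟨t, htK, ht⟩ := hK.elim_nhds_subcover V fun y _ => (hVo y).mem_nhds (hVm y)
  refine (t.finite_toSet.biUnion (t := fun y => {τ | IsCompOf Y τ ∧ y ∈ τ}) fun y _ =>
    Set.Subsingleton.finite fun σ hσ τ hτ => hσ.1.eq_of_mem hτ.1 hσ.2 hτ.2).subset ?_
  rintro τ ⟨hτ, hwτ⟩
  have hS := H.sides τ hτ
  have hmeet : ¬ Disjoint K τ := fun hd => by
    have hwR : w ∈ R τ := hwτ.resolve_right fun h => Set.disjoint_left.1 hd hwK h
    have := H.cut_diff hτ hKc.isPreconnected hKU hd ⟨w, hwR, hwK⟩ hfwK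
    exact hS.image_right_disjoint.subset ⟨mem_image_of_mem f hwR, this⟩
  obtain ⟨y, hyK, hyτ⟩ := Set.not_disjoint_iff.1 hmeet
  obtain ⟨x, hx, hyx⟩ := mem_iUnion₂.1 (ht hyK)
  exact mem_iUnion₂.2 ⟨x, hx, hτ, hV x (hKU (htK x hx)) τ hτ ⟨y, hyτ, hyx⟩⟩

theorem ne_of_subset {σ τ : Set ℂ} (hσ : IsCompOf Y σ) (h : σ ⊆ R τ) : σ ≠ τ := by
  rintro rfl
  obtain ⟨z, hz⟩ := hσ.nonempty
  exact Set.disjoint_left.1 (H.sides σ hσ).disjoint_right (h hz) hz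

theorem trichotomy {σ τ : Set ℂ} (hσ : IsCompOf Y σ) (hτ : IsCompOf Y τ) (hne : σ ≠ τ) :
    Disjoint (R σ ∪ σ) (R τ ∪ τ) ∨ R σ ∪ σ ⊆ R τ ∨ R τ ∪ τ ⊆ R σ :=
  (H.sides σ hσ).trichotomy H.isOpen H.sc (H.sides τ hτ) (hσ.disjoint hτ hne)

theorem union_subset_right {σ τ : Set ℂ} (hσ : IsCompOf Y σ) (hτ : IsCompOf Y τ) (h : σ ⊆ R τ) :
    R σ ∪ σ ⊆ R τ := by
  obtain ⟨z, hz⟩ := hσ.nonempty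
  rcases H.trichotomy hσ hτ (H.ne_of_subset hσ h) with h' | h' | h'
  · grind
  · exact h'
  · exact (Set.disjoint_left.1 (H.sides σ hσ).disjoint_right (h' (Or.inl (h hz))) hz).elim

theorem subset_of_meet {σ τ : Set ℂ} (hσ : σ ∈ maximalCuts Y R) (hτ : IsCompOf Y τ)
    (h : ¬ Disjoint (R σ ∪ σ) (R τ ∪ τ)) : τ = σ ∨ R τ ∪ τ ⊆ R σ := by
  by_cases hne : τ = σ
  · exact Or.inl hne
  rcases H.trichotomy hσ.1 hτ (Ne.symm hne) with h' | h' | h'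
  exacts [(h h').elim, (hσ.2 τ hτ (subset_union_right.trans h')).elim, Or.inr h']

theorem exists_maximal {σ : Set ℂ} (hσ : IsCompOf Y σ) :
    ∃ τ ∈ maximalCuts Y R, R σ ∪ σ ⊆ R τ ∪ τ := by
  obtain ⟨w, hw⟩ := hσ.nonempty
  obtain ⟨τ, ⟨hτ, hwτ⟩, hmax⟩ := (H.finite_containing (H.sub (hσ.subset hw))).exists_maximalFor
    (fun τ => R τ ∪ τ) _ ⟨σ, hσ, Or.inr hw⟩
  refine ⟨τ, ⟨hτ, fun τ' hτ' hs => ?_⟩, ?_⟩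
  · have h1 := H.union_subset_right hτ hτ' hs
    have h2 := hmax ⟨hτ', Or.inl (h1 hwτ)⟩ (h1.trans subset_union_left)
    obtain ⟨z, hz⟩ := hτ'.nonempty
    exact Set.disjoint_left.1 (H.sides τ' hτ').disjoint_right (h1 (h2 (Or.inr hz))) hz
  · by_cases hne : σ = τ
    · rw [hne]
    rcases H.trichotomy hσ hτ hne with h' | h' | h'
    · grind
    · exact h'.trans subset_union_left
    · grind

theorem exists_ball {σ : Set ℂ} (hσ : σ ∈ maximalCuts Y R) {y : ℂ} (hy : y ∈ σ) :
    ∃ ε > 0, L σ ∩ Metric.ball y ε ⊆ coreSet U Y R := by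
  obtain ⟨ε, hε, hεU, h⟩ := H.loc y (H.sub (hσ.1.subset hy))
  refine ⟨ε, hε, fun z hz => ⟨hεU hz.2, fun τ hτ hzτ => ?_⟩⟩
  have hzσ : z ∉ R σ ∪ σ := by
    have := hz.1
    rw [(H.sides σ hσ.1).left_eq] at this
    exact this.2
  obtain ⟨τ', hτ', hsub⟩ := H.exists_maximal hτ
  have hne : τ' ≠ σ := by rintro rfl; exact hzσ (hsub hzτ)
  have hdis : Disjoint (Metric.ball y ε) τ' := by
    by_contra hd
    obtain ⟨v, hv, hv'⟩ := Set.not_disjoint_iff.1 hd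
    exact hne (hτ'.1.eq_of_mem hσ.1 (h τ' hτ'.1 ⟨v, hv', hv⟩) hy)
  have hzR : z ∈ R τ' := (hsub hzτ).resolve_right fun h' => Set.disjoint_left.1 hdis hz.2 h'
  have := H.cut_diff hτ'.1 (convex_ball y ε).isPreconnected hεU hdis ⟨z, hzR, hz.2⟩ (Metric.mem_ball_self hε)
  rcases H.subset_of_meet hσ hτ'.1 (Set.not_disjoint_iff.2 ⟨y, Or.inr hy, Or.inl this⟩) with h' | h'
  · exact hne h'
  · grind

theorem isOpen_core : IsOpen (coreSet U Y R) := by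
  rw [Metric.isOpen_iff]
  rintro y ⟨hyU, hy⟩
  obtain ⟨ε, hε, hεU, h⟩ := H.loc y hyU
  refine ⟨ε, hε, fun z hz => ⟨hεU hz, fun τ hτ hzτ => ?_⟩⟩
  have hdis : Disjoint (Metric.ball y ε) τ := by
    by_contra hd
    obtain ⟨v, hv, hv'⟩ := Set.not_disjoint_iff.1 hd
    exact hy τ hτ (Or.inr (h τ hτ ⟨v, hv', hv⟩))
  have hzR : z ∈ R τ := hzτ.resolve_right fun h' => Set.disjoint_left.1 hdis hz h'
  exact hy τ hτ (Or.inl (H.cut_diff hτ (convex_ball y ε).isPreconnected hεU hdis ⟨z, hzR, hz⟩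
    (Metric.mem_ball_self hε)))

theorem cut_subset_closure {σ : Set ℂ} (hσ : σ ∈ maximalCuts Y R) : σ ⊆ closure (coreSet U Y R) := by
  intro y hy
  obtain ⟨ε, hε, h⟩ := H.exists_ball hσ hy
  have hS := H.sides σ hσ.1
  have hyL : y ∈ closure (L σ) := IsCrossCut.subset_closure H.isOpen H.sc hS.cut hS.two.1 hy
  rw [Metric.mem_closure_iff] at hyL ⊢
  intro δ hδ
  obtain ⟨b, hb, hbd⟩ := hyL (min ε δ) (lt_min hε hδ)
  exact ⟨b, h ⟨hb, by rw [Metric.mem_ball, dist_comm]; exact hbd.trans_le (min_le_left _ _)⟩,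
    hbd.trans_le (min_le_right _ _)⟩

theorem exists_of_notMem_core {y : ℂ} (hy : y ∈ U) (hn : y ∉ coreSet U Y R) :
    ∃ σ ∈ maximalCuts Y R, y ∈ R σ ∪ σ := by
  simp only [coreSet, mem_ofPred_eq, not_and, not_forall, not_not] at hn
  obtain ⟨σ, hσ, hyσ⟩ := hn hy
  obtain ⟨τ, hτ, h⟩ := H.exists_maximal hσ
  exact ⟨τ, hτ, h hyσ⟩

theorem bdIn_core : bdIn U (coreSet U Y R) = ⋃₀ maximalCuts Y R := by
  ext y
  constructor
  · rintro ⟨⟨hcl, hn⟩, hyU⟩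
    obtain ⟨σ, hσ, hy | hy⟩ := H.exists_of_notMem_core hyU hn
    · obtain ⟨z, hz, hz'⟩ := mem_closure_iff.1 hcl _ (H.isOpen_right hσ.1) hy
      exact (hz'.2 σ hσ.1 (Or.inl hz)).elim
    · exact ⟨σ, hσ, hy⟩
  · rintro ⟨σ, hσ, hy⟩
    exact ⟨⟨H.cut_subset_closure hσ hy, fun h => h.2 σ hσ.1 (Or.inr hy)⟩, H.sub (hσ.1.subset hy)⟩

theorem isOpen_diff : IsOpen (U \ Y) := by
  rw [Metric.isOpen_iff]
  rintro y ⟨hyU, hy⟩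
  obtain ⟨ε, hε, hεU, h⟩ := H.loc y hyU
  refine ⟨ε, hε, fun z hz => ⟨hεU hz, fun hzY => hy ?_⟩⟩
  exact (isCompOf_cc hzY).subset (h _ (isCompOf_cc hzY) ⟨z, mem_connectedComponentIn hzY, hz⟩)

omit H in
theorem core_subset : coreSet U Y R ⊆ U \ Y := fun _ hy =>
  ⟨hy.1, fun hY => hy.2 _ (isCompOf_cc hY) (Or.inr (mem_connectedComponentIn hY))⟩

theorem mem_left_of_core {y σ} (hy : y ∈ coreSet U Y R) (hσ : IsCompOf Y σ) : y ∈ L σ := by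
  rw [(H.sides σ hσ).left_eq]
  exact ⟨hy.1, hy.2 σ hσ⟩

theorem isCompOf_core (hY : Y.Nonempty) : IsCompOf (U \ Y) (coreSet U Y R) := by
  have hne : (coreSet U Y R).Nonempty := by
    obtain ⟨y, hy⟩ := hY
    obtain ⟨τ, hτ, _⟩ := H.exists_maximal (isCompOf_cc hy)
    obtain ⟨z, hz⟩ := hτ.1.nonempty
    exact closure_nonempty_iff.1 ⟨z, H.cut_subset_closure hτ hz⟩
  obtain ⟨w, hw⟩ := hne
  have hwY := core_subset hw
  refine ⟨w, hwY, subset_antisymm (fun z hz => ?_) fun v hv => ?_⟩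
  · by_contra hn
    obtain ⟨c, hc, hcn⟩ := exists_isCompOf_separating H.isOpen H.sc H.isOpen_diff hwY (core_subset hz) hn
    have hS := H.sides c hc
    exact hcn (hS.two.1.isPreconnected.subset_connectedComponentIn (H.mem_left_of_core hw hc)
      hS.two.1.subset (H.mem_left_of_core hz hc))
  · have hvY := connectedComponentIn_subset _ _ hv
    refine ⟨hvY.1, fun σ hσ hvσ => ?_⟩
    have hvR : v ∈ R σ := hvσ.resolve_right fun h => hvY.2 (hσ.subset h)
    have := H.cut_diff hσ (T := connectedComponentIn (U \ Y) w) isPreconnected_connectedComponentIn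
      ((connectedComponentIn_subset _ _).trans sdiff_subset)
      (Set.disjoint_left.2 fun y hy hyσ => (connectedComponentIn_subset _ _ hy).2 (hσ.subset hyσ))
      ⟨v, hvR, hv⟩ (mem_connectedComponentIn hwY)
    exact hw.2 σ hσ (Or.inl this)

theorem image_core_meet (hY : Y.Nonempty) : (f '' coreSet U Y R ∩ coreSet U Y R).Nonempty := by
  by_contra hcon
  have hO := H.isOpen_core
  have hfO := f.isOpenMap _ hO
  have hc := H.isCompOf_core hY
  have hfU : f '' coreSet U Y R ⊆ U := fun y hy => H.inv ▸ image_mono (fun z hz => hz.1) hy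
  have hav : ∀ σ ∈ maximalCuts Y R, Disjoint (f '' coreSet U Y R) σ := fun σ hσ =>
    Set.disjoint_left.2 fun y hy hyσ => hcon (mem_closure_iff.1 (H.cut_subset_closure hσ hyσ) _ hfO hy)
  obtain ⟨w, hw⟩ := hc.nonempty.image f
  obtain ⟨σ, hσ, hwσ⟩ := H.exists_of_notMem_core (hfU hw) fun h => hcon ⟨w, hw, h⟩
  have hwR := hwσ.resolve_right fun h => Set.disjoint_left.1 (hav σ hσ) hw h
  have hsub := H.cut_diff hσ.1 (hc.isPreconnected.image f f.continuous.continuousOn) hfU (hav σ hσ) ⟨w, hwR, hw⟩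
  obtain ⟨y, hy⟩ := hσ.1.nonempty
  have hS := H.sides σ hσ.1
  obtain ⟨z, hz, hz'⟩ := mem_closure_iff.1 (H.cut_subset_closure hσ hy) _
    ((H.isOpen_left hσ.1).preimage f.continuous) (hS.push (mem_image_of_mem f (Or.inr hy)))
  exact Set.disjoint_left.1 hS.disjoint hz (hsub (mem_image_of_mem f hz'))

theorem subset_core {T : Set ℂ} (hT : IsPreconnected T) (hTY : T ⊆ U \ Y) (h : (f '' T ∩ T).Nonempty)
    (hY : Y.Nonempty) : T ⊆ coreSet U Y R := by
  obtain ⟨_, ⟨w, hw, rfl⟩, hfw⟩ := h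
  have hwc : w ∈ coreSet U Y R := by
    refine ⟨(hTY hw).1, fun σ hσ hwσ => ?_⟩
    have hwR : w ∈ R σ := hwσ.resolve_right fun h => (hTY hw).2 (hσ.subset h)
    have hsub := H.cut_diff hσ hT (hTY.trans sdiff_subset)
      (Set.disjoint_left.2 fun y hy hyσ => (hTY hy).2 (hσ.subset hyσ)) ⟨w, hwR, hw⟩
    exact (H.sides σ hσ).image_right_disjoint.subset ⟨mem_image_of_mem f hwR, hsub hfw⟩
  exact (H.isCompOf_core hY).subset_of_isPreconnected hT hTY ⟨w, hwc, hw⟩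

theorem eq_core {W : Set ℂ} (hW : IsCompOf (U \ Y) W) (h : (f '' W ∩ W).Nonempty) (hY : Y.Nonempty) :
    W = coreSet U Y R := by
  obtain ⟨w, hw⟩ := hW.nonempty
  exact hW.eq_of_mem (H.isCompOf_core hY) hw (H.subset_core hW.isPreconnected hW.subset h hY hw)

theorem isSimplyConnected_core (hY : Y.Nonempty) : IsSimplyConnected (coreSet U Y R) := by
  refine isSimplyConnected_of_hasLog H.isOpen_core (H.isCompOf_core hY).isConnected ?_
  have hOU : coreSet U Y R ⊆ U := fun y hy => hy.1
  have out : ∀ a ∉ U, HasLog (coreSet U Y R) fun z => z - a := fun a ha =>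
    (hasLog_of_isSimplyConnected (u := fun z => z - a) H.sc H.isOpen (by fun_prop) fun z hz =>
      sub_ne_zero.2 fun h => ha (h ▸ hz)).mono hOU
  have cut : ∀ σ, IsCompOf Y σ → ∀ a ∈ σ, HasLog (coreSet U Y R) fun z => z - a := by
    intro σ hσ a ha
    obtain ⟨g, hg, _, hgU, h0, _, hσe, _⟩ := (H.sides σ hσ).cut
    have h0U := not_mem_of_frontier H.isOpen h0
    obtain ⟨t, ht, rfl⟩ := hσe ▸ ha
    have := hasLog_sub_of_path (O := coreSet U Y R) (h := fun s => g (t * (1 - s))) H.isOpen H.sc hOU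
      (hg.comp (by fun_prop) fun s hs => ⟨mul_nonneg ht.1.le (by linarith [hs.2]), by nlinarith [hs.1, hs.2, ht.1, ht.2]⟩)
      (fun s hs => ?_) (by simpa using h0U)
    · simpa using this
    · rcases eq_or_lt_of_le hs.2 with h | h
      · grind
      · intro h'
        refine h'.2 σ hσ (Or.inr (hσe ▸ ⟨_, ⟨mul_pos ht.1 (by linarith), ?_⟩, rfl⟩))
        nlinarith [hs.1, ht.1, ht.2]
  intro a ha
  by_cases haU : a ∈ U
  swap
  · exact out a haU
  obtain ⟨σ, hσ, haσ⟩ := H.exists_of_notMem_core haU ha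
  rcases haσ with haR | haσ
  swap
  · exact cut σ hσ.1 a haσ
  obtain ⟨p, hp⟩ := (ne_univ_iff_exists_notMem _).1 H.ne
  have hS := H.sides σ hσ.1
  set h : ℝ → ℂ := fun s => a + s * (p - a) with hh
  have hhc : Continuous h := by fun_prop
  have hScl : IsCompact (Icc (0:ℝ) 1 ∩ h ⁻¹' (R σ)ᶜ) :=
    isCompact_Icc.inter_right ((H.isOpen_right hσ.1).isClosed_compl.preimage hhc)
  have hSne : (Icc (0:ℝ) 1 ∩ h ⁻¹' (R σ)ᶜ).Nonempty := ⟨1, by simp, by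
    simpa [hh] using fun h' => hp (hS.right_subset h')⟩
  obtain ⟨s₀, ⟨hs₀, hs₀R⟩, hmin⟩ := hScl.exists_isLeast hSne
  have hlt : ∀ s, 0 ≤ s → s < s₀ → h s ∈ R σ := fun s hs hs' => by
    by_contra hn
    exact absurd (hmin ⟨⟨hs, by linarith [hs₀.2]⟩, hn⟩) (not_le.2 hs')
  have hs₀pos : 0 < s₀ := by
    rcases eq_or_lt_of_le hs₀.1 with h' | h'
    · exact (hs₀R (by rw [← h']; simpa [hh] using haR)).elim
    · exact h'
  have hqc : h s₀ ∉ U ∨ h s₀ ∈ σ := by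
    refine or_iff_not_imp_left.2 fun hqU => ?_
    rw [← IsCrossCut.bdIn_eq H.isOpen H.sc hS.cut hS.two.2.1]
    refine ⟨⟨?_, hs₀R⟩, not_not.1 hqU⟩
    have : s₀ ∈ closure (Ico 0 s₀) := by rw [closure_Ico hs₀pos.ne]; exact ⟨hs₀pos.le, le_rfl⟩
    exact map_mem_closure hhc this fun s hs => hlt s hs.1 hs.2
  have hq : HasLog (coreSet U Y R) fun z => z - h s₀ := hqc.elim (out _) (cut σ hσ.1 _)
  have hqn : h s₀ ∉ coreSet U Y R := fun h' =>
    hqc.elim (fun h => h h'.1) fun h => h'.2 σ hσ.1 (Or.inr h)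
  have hlog := hasLog_compl_path (g := fun s => h (s * s₀)) (by fun_prop)
  have hlog' := (hlog.mono (O' := coreSet U Y R) ?_).mul hq
  · refine hlog'.congr fun z hz => ?_
    have : z - h s₀ ≠ 0 := sub_ne_zero.2 fun h' => hqn (h' ▸ hz)
    simp only [one_mul, zero_mul]
    rw [div_mul_cancel₀ _ this]
    simp [hh]
  · rintro z hz ⟨s, hs, rfl⟩
    rcases eq_or_lt_of_le hs.2 with h' | h'
    · subst h'; exact hqn (by simpa using hz)
    · exact hz.2 σ hσ.1 (Or.inl (hlt _ (mul_nonneg hs.1 hs₀pos.le) (by nlinarith [hs.1])))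

theorem exists_isEndCut {y : ℂ} (hy : y ∈ bdIn U (coreSet U Y R)) :
    ∃ η : ℝ → ℂ, IsEndCut (coreSet U Y R) η ∧ Tendsto η (𝓝[<] (1:ℝ)) (𝓝 y) := by
  rw [H.bdIn_core] at hy
  obtain ⟨σ, hσ, hyσ⟩ := hy
  obtain ⟨ε, hε, hsub⟩ := H.exists_ball hσ hyσ
  have hS := H.sides σ hσ.1
  have hyL : y ∈ closure (L σ) := IsCrossCut.subset_closure H.isOpen H.sc hS.cut hS.two.1 hyσ
  have hL := hS.two.1
  obtain ⟨g, hg, hi, hgU, h0, h1, hσe, _⟩ := hS.cut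
  rw [hσe] at hyσ hL
  obtain ⟨t, ht, rfl⟩ := hyσ
  rw [← hσe] at hL
  obtain ⟨η, ⟨h1, h2, h3, h4⟩, h5⟩ := exists_isEndCut_of_mem_arc H.isOpen H.sc hg hi hgU
    (not_mem_of_frontier H.isOpen h0) (not_mem_of_frontier H.isOpen h1) (D := L σ) (hσe ▸ hL) ht hyL hε
  exact ⟨η, ⟨h1, h2, fun t ht => hsub (h3 t ht), h4⟩, h5⟩

theorem right_subset_of_disjoint {σ : Set ℂ} (hσ : IsCompOf Y σ) {V : Set ℂ} (hV : U \ V ⊆ coreSet U Y R) :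
    R σ ⊆ V := fun y hy => by
  by_contra hn
  exact (hV ⟨(H.sides σ hσ).right_subset hy, hn⟩).2 σ hσ (Or.inl hy)

end FreeFamily

theorem iterate_eq_pow (f : X ≃ₜ X) (k : ℕ) : ⇑(f ^ k) = (⇑f)^[k] := by
  induction k with
  | zero => rfl
  | succ k ih => rw [pow_succ', Function.iterate_succ', ← ih]; rfl

theorem iterate_image_eq {f : X ≃ₜ X} {U : Set X} (hfU : f '' U = U) (k : ℕ) : (⇑f)^[k] '' U = U := by
  induction k with
  | zero => simp
  | succ k ih => rw [Function.iterate_succ', image_comp, ih, hfU]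

/-- A simple arc `g` with endpoints on the boundary of the invariant set `U`, meeting `U`, whose
first `N` images meet it in at most one point, outside `U`. -/
structure TransArc (f : X ≃ₜ X) (U : Set X) (N : ℕ) (g : ℝ → X) : Prop where
  cont : ContinuousOn g (Icc 0 1)
  inj : InjOn g (Icc 0 1)
  inv : f '' U = U
  zero : g 0 ∈ frontier U
  one : g 1 ∈ frontier U
  meet : ∃ t ∈ Icc (0:ℝ) 1, g t ∈ U
  pos : 1 ≤ N
  inter : ∀ d, 1 ≤ d → d ≤ N → ∃ m ∉ U, (⇑f)^[d] '' (g '' Icc 0 1) ∩ (g '' Icc 0 1) ⊆ {m}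

theorem IsNTranslationArc.exists_transArc {f : X ≃ₜ X} {U : Set X} (hUo : IsOpen U) {N : ℕ} {γ : Set X} {x : X}
    (h : IsNTranslationArc f N γ x) (hN : 2 ≤ N) (hfU : f '' U = U) (hx : x ∈ frontier U)
    (hfx : f x ∈ frontier U) (hγ : (γ ∩ U).Nonempty) :
    ∃ g, TransArc f U N g ∧ γ = g '' Icc 0 1 := by
  obtain ⟨⟨hne, g, hg, hi, h0, h1, rfl, htr⟩, hN'⟩ := h
  obtain ⟨h2, h3⟩ := hN' hN
  have hxm : x ∈ g '' Icc 0 1 := ⟨0, by simp, h0⟩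
  have hfxm : f x ∈ g '' Icc 0 1 := ⟨1, by simp, h1⟩
  obtain ⟨_, ⟨t, ht, rfl⟩, htU⟩ := hγ
  refine ⟨g, ⟨hg, hi, hfU, h0 ▸ hx, h1 ▸ hfx, ⟨t, ht, htU⟩, by omega, fun d hd hdN => ?_⟩, rfl⟩
  rcases hd.eq_or_lt with rfl | hd
  · refine ⟨f x, not_mem_of_frontier hUo hfx, ?_⟩
    rcases htr with h | ⟨_, hxx⟩
    · exact h.subset
    exfalso
    have k1 : x ∈ (⇑f)^[2] '' (g '' Icc 0 1) ∩ g '' Icc 0 1 := ⟨⟨x, hxm, hxx⟩, hxm⟩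
    have k2 : f x ∈ (⇑f)^[2] '' (g '' Icc 0 1) ∩ g '' Icc 0 1 := ⟨⟨f x, hfxm, congrArg f hxx⟩, hfxm⟩
    by_cases h23 : 2 ≤ N - 1
    · exact (h2 2 le_rfl h23).subset k1
    obtain rfl : N = 2 := by omega
    rcases h3 with h3 | ⟨h3, _⟩
    · exact h3.subset k1
    · exact hne (h3.subset k2)
  rcases hdN.eq_or_lt with rfl | hdN
  · refine ⟨x, not_mem_of_frontier hUo hx, ?_⟩
    rcases h3 with h3 | ⟨h3, _⟩
    · rw [h3]; exact empty_subset _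
    · exact h3.subset
  · refine ⟨x, not_mem_of_frontier hUo hx, ?_⟩
    rw [h2 d hd (by omega)]; exact empty_subset _

/-- The images of `g` under the first `N` iterates. -/
def orbitArc (f : X ≃ₜ X) (N : ℕ) (g : ℝ → X) : Set X := ⋃ k ∈ Iic N, (⇑f)^[k] '' (g '' Icc 0 1)

/-- `c` is a maximal open sub-arc of `g` in `U`. -/
def IsBase (U : Set X) (g : ℝ → X) (c : Set X) : Prop :=
  ∃ s t : ℝ, 0 ≤ s ∧ s < t ∧ t ≤ 1 ∧ (∀ u ∈ Ioo s t, g u ∈ U) ∧ g s ∈ frontier U ∧ g t ∈ frontier U ∧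
    c = g '' Ioo s t

namespace TransArc

section Gen

variable [T2Space X] {f : X ≃ₜ X} {U : Set X} {N : ℕ} {g : ℝ → X} (T : TransArc f U N g) (hUo : IsOpen U)
include T

omit [T2Space X] in
theorem iter_mem {k : ℕ} {z : X} : (⇑f)^[k] z ∈ U ↔ z ∈ U := by
  rw [← iterate_eq_pow]
  exact mem_iff_of_image_eq (by rw [iterate_eq_pow]; exact iterate_image_eq T.inv k) z

omit [T2Space X] in
theorem inter_of_lt {a b : ℕ} (hab : a < b) (hb : b ≤ a + N) :
    ∃ m ∉ U, (⇑f)^[b] '' (g '' Icc 0 1) ∩ (⇑f)^[a] '' (g '' Icc 0 1) ⊆ {m} := by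
  obtain ⟨m, hm, h⟩ := T.inter (b - a) (by omega) (by omega)
  refine ⟨(⇑f)^[a] m, fun h' => hm (T.iter_mem.1 h'), ?_⟩
  have : (⇑f)^[b] = (⇑f)^[a] ∘ (⇑f)^[b - a] := by rw [← Function.iterate_add]; congr 1; omega
  rw [this, image_comp, ← image_inter (f.injective.iterate a), ← image_singleton]
  exact image_mono h

omit [T2Space X] in
theorem inter_of_ne {a b : ℕ} (hab : a ≠ b) (ha : a ≤ N) (hb : b ≤ N) :
    ∃ m ∉ U, (⇑f)^[b] '' (g '' Icc 0 1) ∩ (⇑f)^[a] '' (g '' Icc 0 1) ⊆ {m} := by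
  rcases hab.lt_or_gt with h | h
  · exact T.inter_of_lt h (by omega)
  · rw [inter_comm]; exact T.inter_of_lt h (by omega)

omit [T2Space X] in
theorem isCompact_iter (k : ℕ) {s : Set ℝ} (hs : IsCompact s) (hsub : s ⊆ Icc 0 1) :
    IsCompact ((⇑f)^[k] '' (g '' s)) :=
  (hs.image_of_continuousOn (T.cont.mono hsub)).image (f.continuous.iterate k)

theorem isClosed_orbitArc : IsClosed (orbitArc f N g) :=
  (finite_Iic N).isClosed_biUnion fun k _ => (T.isCompact_iter k isCompact_Icc Subset.rfl).isClosed

include hUo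

theorem comp_of_isBase {c : Set X} (hc : IsBase U g c) {k : ℕ} (hk : k ≤ N) :
    IsCompOf (U ∩ orbitArc f N g) ((⇑f)^[k] '' c) ∧
      ∃ V, IsOpen V ∧ (⇑f)^[k] '' c = (U ∩ orbitArc f N g) ∩ V := by
  obtain ⟨s, t, hs, hst, ht, hU, hsf, htf, rfl⟩ := hc
  have hIs : Icc 0 s ⊆ Icc (0:ℝ) 1 := Icc_subset_Icc_right (by linarith)
  have hIt : Icc t 1 ⊆ Icc (0:ℝ) 1 := Icc_subset_Icc_left (by linarith)
  have hIst : Icc s t ⊆ Icc (0:ℝ) 1 := Icc_subset_Icc hs ht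
  set V : Set X := ((⋃ j ∈ Iic N \ {k}, (⇑f)^[j] '' (g '' Icc 0 1)) ∪
    ((⇑f)^[k] '' (g '' Icc 0 s) ∪ (⇑f)^[k] '' (g '' Icc t 1)))ᶜ with hV
  have hVo : IsOpen V := by
    refine (IsClosed.union ?_ (IsClosed.union ?_ ?_)).isOpen_compl
    · exact ((finite_Iic N).subset sdiff_subset).isClosed_biUnion fun k _ =>
        (T.isCompact_iter k isCompact_Icc Subset.rfl).isClosed
    · exact (T.isCompact_iter k isCompact_Icc hIs).isClosed
    · exact (T.isCompact_iter k isCompact_Icc hIt).isClosed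
  have hΓ : ∀ u ∈ Icc (0:ℝ) 1, (⇑f)^[k] (g u) ∈ orbitArc f N g := fun u hu =>
    mem_iUnion₂.2 ⟨k, hk, mem_image_of_mem _ ⟨u, hu, rfl⟩⟩
  have hCV : (⇑f)^[k] '' (g '' Ioo s t) = (U ∩ orbitArc f N g) ∩ V := by
    ext y
    constructor
    · rintro ⟨_, ⟨u, hu, rfl⟩, rfl⟩
      have huI : u ∈ Icc (0:ℝ) 1 := hIst (Ioo_subset_Icc_self hu)
      have hyU : (⇑f)^[k] (g u) ∈ U := T.iter_mem.2 (hU u hu)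
      refine ⟨⟨hyU, hΓ u huI⟩, ?_⟩
      rintro (h | h | h)
      · obtain ⟨j, ⟨hjN, hjk⟩, hj⟩ := mem_iUnion₂.1 h
        obtain ⟨m, hm, hsub⟩ := T.inter_of_ne (Ne.symm hjk) hk hjN
        exact hm (hsub ⟨hj, mem_image_of_mem _ ⟨u, huI, rfl⟩⟩ ▸ hyU)
      · obtain ⟨_, ⟨v, hv, rfl⟩, hvu⟩ := h
        have := T.inj (hIs hv) huI (f.injective.iterate k hvu)
        linarith [hv.2, hu.1]
      · obtain ⟨_, ⟨v, hv, rfl⟩, hvu⟩ := h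
        have := T.inj (hIt hv) huI (f.injective.iterate k hvu)
        linarith [hv.1, hu.2]
    · rintro ⟨⟨hyU, hyΓ⟩, hyV⟩
      obtain ⟨j, hj, hyj⟩ := mem_iUnion₂.1 hyΓ
      have hjk : j = k := by
        by_contra hne
        exact hyV (Or.inl (mem_iUnion₂.2 ⟨j, ⟨hj, hne⟩, hyj⟩))
      subst hjk
      obtain ⟨_, ⟨u, hu, rfl⟩, rfl⟩ := hyj
      refine ⟨_, ⟨u, ⟨not_le.1 fun h => ?_, not_le.1 fun h => ?_⟩, rfl⟩, rfl⟩
      · exact hyV (Or.inr (Or.inl ⟨_, ⟨u, ⟨hu.1, h⟩, rfl⟩, rfl⟩))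
      · exact hyV (Or.inr (Or.inr ⟨_, ⟨u, ⟨h, hu.2⟩, rfl⟩, rfl⟩))
  refine ⟨isCompOf_of_clopen ?_ (T.isCompact_iter k isCompact_Icc hIst).isClosed hVo ?_ hCV, V, hVo, hCV⟩
  · exact ((isConnected_Ioo hst).image g (T.cont.mono (Ioo_subset_Icc_self.trans hIst))).image _
      (f.continuous.iterate k).continuousOn
  · ext y
    constructor
    · rintro ⟨_, ⟨u, hu, rfl⟩, rfl⟩
      exact ⟨⟨T.iter_mem.2 (hU u hu), hΓ u (hIst (Ioo_subset_Icc_self hu))⟩,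
        ⟨_, ⟨u, Ioo_subset_Icc_self hu, rfl⟩, rfl⟩⟩
    · rintro ⟨⟨hyU, -⟩, ⟨_, ⟨u, hu, rfl⟩, rfl⟩⟩
      have hgU := T.iter_mem.1 hyU
      refine ⟨_, ⟨u, ⟨hu.1.lt_of_ne ?_, hu.2.lt_of_ne ?_⟩, rfl⟩, rfl⟩
      · rintro rfl; exact not_mem_of_frontier hUo hsf hgU
      · rintro rfl; exact not_mem_of_frontier hUo htf hgU

omit [T2Space X] in
theorem exists_isBase_of_mem {u : ℝ} (hu : u ∈ Icc (0:ℝ) 1) (hgu : g u ∈ U) : ∃ c, IsBase U g c ∧ g u ∈ c := by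
  have h0 := not_mem_of_frontier hUo T.zero
  have h1 := not_mem_of_frontier hUo T.one
  have hu0 : 0 < u := hu.1.lt_of_ne (by rintro rfl; exact h0 hgu)
  have hu1 : u < 1 := hu.2.lt_of_ne (by rintro rfl; exact h1 hgu)
  set e : ℝ → X := fun t => g (projIcc (0:ℝ) 1 zero_le_one t) with he
  have heq : ∀ t ∈ Icc (0:ℝ) 1, e t = g t := fun t ht => by simp [he, projIcc_of_mem _ ht]
  have hec : Continuous e := T.cont.comp_continuous (continuous_subtype_val.comp continuous_projIcc) fun t => Subtype.prop _
  obtain ⟨s, t, hs, hsu, hut, ht, hin, hsf, htf⟩ := exists_maximal_interval hUo hec hu0 hu1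
    (by rwa [heq 0 (by simp)]) (by rwa [heq u hu]) (by rwa [heq 1 (by simp)])
  have hI : ∀ v ∈ Icc s t, v ∈ Icc (0:ℝ) 1 := fun v hv => ⟨hs.trans hv.1, hv.2.trans ht⟩
  refine ⟨g '' Ioo s t, ⟨s, t, hs, hsu.trans hut, ht, fun v hv => ?_, ?_, ?_, rfl⟩, ⟨u, ⟨hsu, hut⟩, rfl⟩⟩
  · rw [← heq v (hI v (Ioo_subset_Icc_self hv))]; exact hin v hv
  · rwa [← heq s (hI s ⟨le_rfl, (hsu.trans hut).le⟩)]
  · rwa [← heq t (hI t ⟨(hsu.trans hut).le, le_rfl⟩)]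

omit [T2Space X] in
theorem exists_isBase : ∃ c, IsBase U g c := by
  obtain ⟨t, ht, htU⟩ := T.meet
  exact (T.exists_isBase_of_mem hUo ht htU).imp fun _ h => h.1

theorem exists_isBase_of_comp {σ : Set X} (hσ : IsCompOf (U ∩ orbitArc f N g) σ) :
    ∃ k ≤ N, ∃ c, IsBase U g c ∧ σ = (⇑f)^[k] '' c := by
  obtain ⟨y, hy⟩ := hσ.nonempty
  obtain ⟨hyU, hyΓ⟩ := hσ.subset hy
  obtain ⟨k, hk, _, ⟨u, hu, rfl⟩, rfl⟩ := mem_iUnion₂.1 hyΓ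
  obtain ⟨c, hc, huc⟩ := T.exists_isBase_of_mem hUo hu (T.iter_mem.1 hyU)
  exact ⟨k, hk, c, hc, hσ.eq_of_mem (T.comp_of_isBase hUo hc hk).1 hy (mem_image_of_mem _ huc)⟩

omit [T2Space X] T hUo in
theorem base_subset {c : Set X} (hc : IsBase U g c) : c ⊆ g '' Icc 0 1 ∧ c ⊆ U := by
  obtain ⟨s, t, hs, hst, ht, hU, hsf, htf, rfl⟩ := hc
  exact ⟨image_mono (Ioo_subset_Icc_self.trans (Icc_subset_Icc hs ht)), by rintro _ ⟨u, hu, rfl⟩; exact hU u hu⟩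

omit [T2Space X] hUo in
theorem image_inter_isBase {c : Set X} (hc : IsBase U g c) : f '' c ∩ c = ∅ := by
  rw [eq_empty_iff_forall_notMem]
  rintro y ⟨h1, h2⟩
  obtain ⟨m, hm, h⟩ := T.inter 1 le_rfl T.pos
  obtain ⟨hcg, hcU⟩ := base_subset hc
  exact hm (h ⟨image_mono hcg h1, hcg h2⟩ ▸ hcU h2)

end Gen

section Plane

variable {f : ℂ ≃ₜ ℂ} {U : Set ℂ} {N : ℕ} {g : ℝ → ℂ} (T : TransArc f U N g) (hUo : IsOpen U)
  (hUs : IsSimplyConnected U)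
include T hUo hUs

theorem isCrossCut_base {c : Set ℂ} (hc : IsBase U g c) : IsCrossCut U c := by
  obtain ⟨s, t, hs, hst, ht, hU, hsf, htf, rfl⟩ := hc
  have := Icc_subset_Icc hs ht
  exact isCrossCut_of_arc_Icc hUo hUs hst (T.cont.mono this) (T.inj.mono this) hU hsf htf

variable (hU : U ≠ univ) (hf : NoFixedPrimeEnd f U)
include hU hf

theorem sides_comp {σ : Set ℂ} (hσ : IsCompOf (U ∩ orbitArc f N g) σ) : ∃ A B, Sides f U σ A B := by
  obtain ⟨k, hk, c, hc, rfl⟩ := T.exists_isBase_of_comp hUo hσ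
  obtain ⟨A, B, h⟩ := exists_sides hUo hUs hU T.inv hf (T.isCrossCut_base hUo hUs hc) (T.image_inter_isBase hc)
  have := h.image (e := f ^ k) (by rw [iterate_eq_pow, iterate_image_eq T.inv])
    (fun z => by
      rw [iterate_eq_pow]
      exact (Function.iterate_succ_apply f k z).symm.trans (Function.iterate_succ_apply' f k z))
  rw [iterate_eq_pow] at this
  exact ⟨_, _, this⟩

theorem exists_freeFamily : ∃ L R : Set ℂ → Set ℂ, FreeFamily f U (U ∩ orbitArc f N g) L R := by
  have : ∀ σ, ∃ A B, IsCompOf (U ∩ orbitArc f N g) σ → Sides f U σ A B := fun σ => by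
    by_cases hc : IsCompOf (U ∩ orbitArc f N g) σ
    · obtain ⟨A, B, h⟩ := T.sides_comp hUo hUs hU hf hc
      exact ⟨A, B, fun _ => h⟩
    · exact ⟨∅, ∅, fun h => (hc h).elim⟩
  choose L R h using this
  refine ⟨L, R, hUo, hUs, T.inv, hU, inter_subset_left, h, fun y hy => ?_⟩
  by_cases hyΓ : y ∈ orbitArc f N g
  · have hyY : y ∈ U ∩ orbitArc f N g := ⟨hy, hyΓ⟩
    have hσ := isCompOf_cc hyY
    obtain ⟨k, hk, c, hc, hck⟩ := T.exists_isBase_of_comp hUo hσ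
    obtain ⟨V, hV, hVe⟩ := (T.comp_of_isBase hUo hc hk).2
    have hyc := mem_connectedComponentIn hyY
    have hyV : y ∈ V := by rw [hck, hVe] at hyc; exact hyc.2
    obtain ⟨ε, hε, hb⟩ := Metric.isOpen_iff.1 (hUo.inter hV) y ⟨hy, hyV⟩
    refine ⟨ε, hε, hb.trans inter_subset_left, fun σ hσ' ⟨z, hz, hzb⟩ => ?_⟩
    have hzc : z ∈ (⇑f)^[k] '' c := hVe ▸ ⟨hσ'.subset hz, (hb hzb).2⟩
    rw [hσ'.eq_of_mem hσ hz (hck ▸ hzc)]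
    exact hyc
  · obtain ⟨ε, hε, hb⟩ := Metric.isOpen_iff.1 (hUo.inter T.isClosed_orbitArc.isOpen_compl) y ⟨hy, hyΓ⟩
    exact ⟨ε, hε, hb.trans inter_subset_left, fun σ hσ ⟨z, hz, hzb⟩ => ((hb hzb).2 (hσ.subset hz).2).elim⟩

end Plane

end TransArc

/-- `σ` is the part in `U` of the compact set `Λ`, whose complement is connected. -/
def IsTrace (U σ Λ : Set ℂ) : Prop :=
  IsCompact Λ ∧ IsPreconnected Λᶜ ∧ σ ⊆ Λ ∧ Λ ∩ U ⊆ σ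

/-- Between two nested free sides whose cuts have closures sharing at most one point there is a
cross-section. -/
theorem exists_crossSection_between {f : ℂ ≃ₜ ℂ} {U τ A B τ' A' B' Λ Λ' : Set ℂ} (hUo : IsOpen U)
    (hUs : IsSimplyConnected U) (h : Sides f U τ A B) (h' : Sides f U τ' A' B') (hsub : B ∪ τ ⊆ B')
    (hΛ : IsTrace U τ Λ) (hΛ' : IsTrace U τ' Λ') {m : ℂ} (hm : Λ ∩ Λ' ⊆ {m}) :
    ∃ D, IsCrossSection U D ∧ D ⊆ B' \ B := by
  obtain ⟨hΛc, hΛp, hτΛ, hΛτ⟩ := hΛ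
  obtain ⟨hΛc', hΛp', hτΛ', hΛτ'⟩ := hΛ'
  have hAo : IsOpen A := h.two.1.isOpen (h.cut.isOpen_diff hUo)
  have hB'o : IsOpen B' := h'.two.2.1.isOpen (h'.cut.isOpen_diff hUo)
  have hQo : IsOpen (B' ∩ A) := hB'o.inter hAo
  have hQU : B' ∩ A ⊆ U := inter_subset_right.trans h.left_subset
  have hQne : (B' ∩ A).Nonempty := by
    obtain ⟨y, hy⟩ := h.cut.isConnected.nonempty
    exact mem_closure_iff.1 (IsCrossCut.subset_closure hUo hUs h.cut h.two.1 hy) _ hB'o (hsub (Or.inr hy))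
  have hfr : ∀ z ∈ closure (B' ∩ A), z ∈ U → z ∈ B' ∩ A ∨ z ∈ τ ∨ z ∈ τ' := by
    intro z hz hzU
    by_cases h1 : z ∈ A
    · by_cases h2 : z ∈ B'
      · exact Or.inl ⟨h2, h1⟩
      · refine Or.inr (Or.inr ?_)
        rw [← IsCrossCut.bdIn_eq hUo hUs h'.cut h'.two.2.1]
        exact ⟨⟨closure_mono inter_subset_left hz, h2⟩, hzU⟩
    · refine Or.inr (Or.inl ?_)
      rw [← IsCrossCut.bdIn_eq hUo hUs h.cut h.two.1]
      exact ⟨⟨closure_mono inter_subset_right hz, h1⟩, hzU⟩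
  have hb : ∃ b ∈ closure (B' ∩ A), b ∉ U ∧ b ∉ Λ ∪ Λ' := by
    by_contra hcon
    push Not at hcon
    have hQM : B' ∩ A ⊆ (Λ ∪ Λ')ᶜ := by
      rintro z hz (hzΛ | hzΛ)
      · exact Set.disjoint_left.1 h.disjoint_left hz.2 (hΛτ ⟨hzΛ, hQU hz⟩)
      · exact Set.disjoint_left.1 h'.disjoint_right hz.1 (hΛτ' ⟨hzΛ, hQU hz⟩)
    obtain ⟨w, hw⟩ := hQne
    have hMp : IsPreconnected (Λ ∪ Λ')ᶜ := by
      have : (Λ ∪ Λ')ᶜ = connectedComponentIn (Λ ∪ Λ')ᶜ w := by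
        refine subset_antisymm (fun z hz => ?_) (connectedComponentIn_subset _ _)
        have hwM := hQM hw
        refine joined_compl_union hΛc hΛc' hm hwM ?_ ?_
        · exact hΛp.subset_connectedComponentIn (fun h => hwM (Or.inl h)) Subset.rfl fun h => hz (Or.inl h)
        · exact hΛp'.subset_connectedComponentIn (fun h => hwM (Or.inr h)) Subset.rfl fun h => hz (Or.inr h)
      rw [this]; exact isPreconnected_connectedComponentIn
    have hMQ : (Λ ∪ Λ')ᶜ ⊆ B' ∩ A := by
      refine hMp.subset_of_closure_inter_subset hQo ⟨w, hQM hw, hw⟩ ?_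
      grind
    obtain ⟨v, hv⟩ := h.two.2.1.nonempty
    have hvM : v ∈ (Λ ∪ Λ')ᶜ := by
      rintro (hh | hh)
      · exact Set.disjoint_left.1 h.disjoint_right hv (hΛτ ⟨hh, h.right_subset hv⟩)
      · exact Set.disjoint_left.1 h'.disjoint_right (hsub (Or.inl hv)) (hΛτ' ⟨hh, h.right_subset hv⟩)
    exact Set.disjoint_left.1 h.disjoint (hMQ hvM).2 hv
  obtain ⟨b, hbQ, hbU, hbΛ⟩ := hb
  obtain ⟨y, hy⟩ := h.cut.isConnected.nonempty
  obtain ⟨y', hy'⟩ := h'.cut.isConnected.nonempty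
  obtain ⟨K, hKU, hK, hKc, hyK, hy'K⟩ := hUs.isPathConnected.exists_compact_connected (h.cut_subset hy) (h'.cut_subset hy')
  have hTc : IsPreconnected ((K ∪ τ) ∪ τ') :=
    (hKc.isPreconnected.union y hyK hy h.cut.isConnected.isPreconnected).union y' (Or.inl hy'K) hy'
      h'.cut.isConnected.isPreconnected
  have hcl : IsClosed (K ∪ (Λ ∪ Λ')) := hK.isClosed.union (hΛc.isClosed.union hΛc'.isClosed)
  obtain ⟨r, hr, hball⟩ := Metric.isOpen_iff.1 hcl.isOpen_compl b
    (by grind)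
  have hTr : ∀ z ∈ (K ∪ τ) ∪ τ', r ≤ dist z b := by
    intro z hz
    by_contra hlt
    refine hball (Metric.mem_ball.2 (not_le.1 hlt)) ?_
    grind
  obtain ⟨w, hw, hwb⟩ := Metric.mem_closure_iff.1 hbQ (r / 2) (by positivity)
  rw [dist_comm] at hwb
  obtain ⟨c, hc, hcut, hyc⟩ := exists_circular_crossCut hUo hUs hbU (R := r / 2) (by positivity) (hQU hw)
    (h.cut_subset hy) (Or.inl ⟨hwb, by linarith [hTr y (Or.inl (Or.inr hy))]⟩)
  have hcs : ∀ z ∈ c, dist z b = r / 2 := fun z hz => (hc.subset hz).1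
  have hwc : w ∈ U \ c := ⟨hQU hw, fun hh => hwb.ne (hcs w hh)⟩
  have hD := isCompOf_cc hwc
  have hTU : (K ∪ τ) ∪ τ' ⊆ U \ c := by
    intro z hz
    refine ⟨?_, fun hh => by linarith [hcs z hh, hTr z hz]⟩
    rcases hz with (hz | hz) | hz
    exacts [hKU hz, h.cut_subset hz, h'.cut_subset hz]
  have hDT : ∀ z ∈ connectedComponentIn (U \ c) w, z ∉ (K ∪ τ) ∪ τ' := fun z hz hzT =>
    hyc (hD.subset_of_isPreconnected hTc hTU ⟨z, hz, hzT⟩ (Or.inl (Or.inr hy)))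
  have hDU : connectedComponentIn (U \ c) w ⊆ U := hD.subset.trans sdiff_subset
  have hwD := mem_connectedComponentIn hwc
  have hDA : connectedComponentIn (U \ c) w ⊆ A := h.two.1.subset_of_isPreconnected hD.isPreconnected
    (fun z hz => ⟨hDU hz, fun hh => hDT z hz (Or.inl (Or.inr hh))⟩) ⟨w, hw.2, hwD⟩
  have hDB : connectedComponentIn (U \ c) w ⊆ B' := h'.two.2.1.subset_of_isPreconnected hD.isPreconnected
    (fun z hz => ⟨hDU hz, fun hh => hDT z hz (Or.inr hh)⟩) ⟨w, hw.1, hwD⟩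
  exact ⟨_, ⟨c, hcut, hD⟩, fun z hz => ⟨hDB hz, fun hzB => Set.disjoint_left.1 h.disjoint (hDA hz) hzB⟩⟩

theorem zpow_add_image (f : X ≃ₜ X) (a b : ℤ) (S : Set X) :
    ⇑(f ^ (a + b)) '' S = ⇑(f ^ a) '' (⇑(f ^ b) '' S) := by
  rw [zpow_add, ← image_comp]; rfl

theorem pow_add_image (f : X ≃ₜ X) (a b : ℕ) (S : Set X) :
    ⇑(f ^ (a + b)) '' S = ⇑(f ^ a) '' (⇑(f ^ b) '' S) := by
  rw [pow_add, ← image_comp]; rfl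

theorem iterZ_eq (f : X ≃ₜ X) (k : ℤ) (A : Set X) : iterZ f k A = ⇑(f ^ k) '' A := by
  have h1 : ∀ n : ℕ, (f ^ n).toEquiv = f.toEquiv ^ n := fun n => by
    induction n with
    | zero => rfl
    | succ n ih => rw [pow_succ, pow_succ, ← ih]; rfl
  have : (f ^ k).toEquiv = f.toEquiv ^ k := by
    cases k with
    | ofNat n => simpa using h1 n
    | negSucc n => rw [zpow_negSucc, zpow_negSucc, ← h1]; rfl
  rw [iterZ, ← this]; rfl

theorem zpow_image_eq {f : X ≃ₜ X} {U : Set X} (hfU : f '' U = U) (k : ℤ) : ⇑(f ^ k) '' U = U := by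
  cases k with
  | ofNat n => simp only [Int.ofNat_eq_natCast, zpow_natCast, iterate_eq_pow, iterate_image_eq hfU]
  | negSucc n =>
    rw [zpow_negSucc]
    refine symm_image_eq (f := f ^ (n + 1)) ?_
    rw [iterate_eq_pow, iterate_image_eq hfU]

theorem homeomorph_zpow_comm (f : X ≃ₜ X) (k : ℤ) (z : X) : (f ^ k) (f z) = f ((f ^ k) z) := by
  have : f ^ k * f = f * f ^ k := (Commute.refl f).zpow_left k
  exact DFunLike.congr_fun this z

theorem zpow_disjoint_neg {f : X ≃ₜ X} {D : Set X} {k : ℤ} (h : ⇑(f ^ k) '' D ∩ D = ∅) :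
    ⇑(f ^ (-k)) '' D ∩ D = ∅ := by
  have : ⇑(f ^ (-k)) '' (⇑(f ^ k) '' D ∩ D) = D ∩ ⇑(f ^ (-k)) '' D := by
    rw [image_inter (f ^ (-k)).injective, ← zpow_add_image, neg_add_cancel, zpow_zero]
    congr 1
    exact image_id D
  rw [inter_comm, ← this, h, image_empty]

theorem iterZ_disjoint_of_pow {f : X ≃ₜ X} {D : Set X} {ε : ℤ} (hε : ε = 1 ∨ ε = -1)
    (h : ∀ k : ℕ, 1 ≤ k → ⇑((f ^ ε) ^ k) '' D ∩ D = ∅) (k : ℤ) (hk : k ≠ 0) :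
    iterZ f (((1 : ℕ) : ℤ) * k) D ∩ D = ∅ := by
  rw [iterZ_eq, Nat.cast_one, one_mul]
  have h' : ∀ k : ℕ, 1 ≤ k → ⇑(f ^ (ε * k)) '' D ∩ D = ∅ := fun k hk => by
    rw [zpow_mul, zpow_natCast]; exact h k hk
  have hp := h' k.natAbs (by omega)
  have hn := zpow_disjoint_neg hp
  grind

/-- A set trapped in the first return of `E` to itself is wandering off the return. -/
theorem pow_image_disjoint_of_trap {h : X ≃ₜ X} {E D : Set X} {k₀ : ℕ} (hk₀ : 1 ≤ k₀)
    (hmin : ∀ r, 1 ≤ r → r < k₀ → ⇑(h ^ r) '' E ∩ E = ∅) (hG : ⇑(h ^ k₀) '' E ⊆ E) (hDE : D ⊆ E)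
    (hD : Disjoint D (⇑(h ^ k₀) '' E)) (k : ℕ) (hk : 1 ≤ k) : ⇑(h ^ k) '' D ∩ D = ∅ := by
  have hq : ∀ q : ℕ, ⇑(h ^ (k₀ * q)) '' E ⊆ E := fun q => by
    induction q with
    | zero => rw [mul_zero, pow_zero]; exact (image_id E).subset
    | succ q ih => rw [mul_add, mul_one, pow_add_image]; exact (image_mono hG).trans ih
  rw [eq_empty_iff_forall_notMem]
  rintro y ⟨hy, hyD⟩
  have hkd : k = k % k₀ + k₀ * (k / k₀) := (Nat.mod_add_div k k₀).symm
  have hr : k % k₀ = 0 := by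
    by_contra hne
    have := hmin (k % k₀) (by omega) (Nat.mod_lt _ hk₀)
    refine this.subset ⟨?_, hDE hyD⟩
    rw [hkd, pow_add_image] at hy
    grind
  have hq0 : k / k₀ ≠ 0 := fun h0 => by rw [hr, h0] at hkd; omega
  obtain ⟨q, hq'⟩ := Nat.exists_eq_succ_of_ne_zero hq0
  have hk' : k = k₀ + k₀ * q := by rw [hr, hq', Nat.mul_succ] at hkd; omega
  rw [hk', pow_add_image] at hy
  grind

theorem IsTrace.image {U σ Λ : Set ℂ} (h : IsTrace U σ Λ) (e : ℂ ≃ₜ ℂ) (heU : e '' U = U) :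
    IsTrace U (e '' σ) (e '' Λ) := by
  obtain ⟨h1, h2, h3, h4⟩ := h
  refine ⟨h1.image e.continuous, ?_, image_mono h3, ?_⟩
  · rw [← image_compl_eq e.bijective]; exact h2.image e e.continuous.continuousOn
  · conv_lhs => rw [← heU]
    rw [← image_inter e.injective]; exact image_mono h4

/-- An injective integer sequence from `0` with steps at most `N` passes within `N` of every
integer on one side. -/
theorem exists_cover_of_injective {t : ℕ → ℤ} (ht : Function.Injective t) (h0 : t 0 = 0) {N : ℤ}
    (hs : ∀ n, |t (n + 1) - t n| ≤ N) :
    (∀ i : ℤ, 0 ≤ i → ∃ n, t n ≤ i ∧ i ≤ t n + N) ∨ ∀ i : ℤ, i ≤ N → ∃ n, t n ≤ i ∧ i ≤ t n + N := by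
  classical
  by_cases hb : ∃ B, ∀ n, t n ≤ B
  · right
    obtain ⟨B, hB⟩ := hb
    have hub : ∀ i, ∃ n, t n ≤ i := by
      by_contra hcon
      push Not at hcon
      obtain ⟨i, hi⟩ := hcon
      exact Set.infinite_of_injective_forall_mem ht (s := Icc i B) (fun n => ⟨(hi n).le, hB n⟩) (finite_Icc i B)
    intro i hi
    refine ⟨Nat.find (hub i), Nat.find_spec (hub i), ?_⟩
    rcases hn : Nat.find (hub i) with _ | n
    · rw [h0]; omega
    · have h1 := Nat.find_min (hub i) (m := n) (by omega)
      have := abs_le.1 (hs n)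
      omega
  · left
    push Not at hb
    intro i hi
    have h1 := Nat.find_spec (hb i)
    rcases hn : Nat.find (hb i) with _ | n
    · rw [hn] at h1; omega
    · have h2 := Nat.find_min (hb i) (m := n) (by omega)
      grind

namespace TransArc

variable {f : ℂ ≃ₜ ℂ} {U : Set ℂ} {N : ℕ} {g : ℝ → ℂ} (T : TransArc f U N g)
include T

theorem inter_zpow {a b : ℤ} (hab : a ≠ b) (h : |b - a| ≤ N) :
    ∃ m ∉ U, ⇑(f ^ a) '' (g '' Icc 0 1) ∩ ⇑(f ^ b) '' (g '' Icc 0 1) ⊆ {m} := by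
  wlog hlt : a < b generalizing a b
  · rw [inter_comm]
    exact this (Ne.symm hab) (by rwa [abs_sub_comm]) (lt_of_le_of_ne (not_lt.1 hlt) (Ne.symm hab))
  obtain ⟨d, hd⟩ := Int.eq_ofNat_of_zero_le (sub_nonneg.2 hlt.le)
  rw [hd, Nat.abs_cast] at h
  obtain ⟨m, hm, hsub⟩ := T.inter d (by omega) (by exact_mod_cast h)
  refine ⟨(f ^ a) m, fun h' => hm ((mem_iff_of_image_eq (zpow_image_eq T.inv a) m).1 h'), ?_⟩
  have hb : b = a + d := by omega
  rw [hb, zpow_add_image, inter_comm, ← image_inter (f ^ a).injective, ← image_singleton]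
  refine image_mono ?_
  rwa [zpow_natCast, iterate_eq_pow]

theorem isTrace_base (hUo : IsOpen U) {c : Set ℂ} (hc : IsBase U g c) :
    ∃ Λ ⊆ g '' Icc 0 1, IsTrace U c Λ := by
  obtain ⟨s, t, hs, hst, ht, hU, hsf, htf, rfl⟩ := hc
  have hsub := Icc_subset_Icc hs ht
  refine ⟨g '' Icc s t, image_mono hsub, isCompact_Icc.image_of_continuousOn (T.cont.mono hsub),
    (isConnected_compl_arc hst.le (T.cont.mono hsub) (T.inj.mono hsub)).isPreconnected,
    image_mono Ioo_subset_Icc_self, ?_⟩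
  rintro _ ⟨⟨u, hu, rfl⟩, huU⟩
  refine ⟨u, ⟨hu.1.lt_of_ne ?_, hu.2.lt_of_ne ?_⟩, rfl⟩
  · rintro rfl; exact not_mem_of_frontier hUo hsf huU
  · rintro rfl; exact not_mem_of_frontier hUo htf huU

variable {L R : Set ℂ → Set ℂ} (H : FreeFamily f U (U ∩ orbitArc f N g) L R)
include H

theorem comp_zpow {c : Set ℂ} (hc : IsBase U g c) {l : ℤ} (h0 : 0 ≤ l) (hl : l ≤ N) :
    IsCompOf (U ∩ orbitArc f N g) (⇑(f ^ l) '' c) := by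
  obtain ⟨n, rfl⟩ := Int.eq_ofNat_of_zero_le h0
  rw [zpow_natCast, iterate_eq_pow]
  exact (T.comp_of_isBase H.isOpen hc (by exact_mod_cast hl)).1

theorem comp_base {c : Set ℂ} (hc : IsBase U g c) : IsCompOf (U ∩ orbitArc f N g) c := by
  have := (T.comp_of_isBase H.isOpen hc (Nat.zero_le N)).1
  simpa using this

theorem sides_zpow {c : Set ℂ} (hc : IsBase U g c) (a : ℤ) :
    Sides f U (⇑(f ^ a) '' c) (⇑(f ^ a) '' L c) (⇑(f ^ a) '' R c) :=
  (H.sides c (T.comp_base H hc)).image (zpow_image_eq T.inv a) (homeomorph_zpow_comm f a)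

theorem right_zpow {c : Set ℂ} (hc : IsBase U g c) {l : ℤ} (h0 : 0 ≤ l) (hl : l ≤ N) :
    R (⇑(f ^ l) '' c) = ⇑(f ^ l) '' R c :=
  (T.sides_zpow H hc l).right_unique (H.sides _ (T.comp_zpow H hc h0 hl))

theorem exists_between {c c' : Set ℂ} (hc : IsBase U g c) (hc' : IsBase U g c') {a b : ℤ} (hab : a ≠ b)
    (h : |b - a| ≤ N) (hsub : ⇑(f ^ a) '' (R c ∪ c) ⊆ ⇑(f ^ b) '' R c') :
    ∃ D, IsCrossSection U D ∧ D ⊆ ⇑(f ^ b) '' R c' \ ⇑(f ^ a) '' R c := by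
  obtain ⟨Λ, hΛ, hΛt⟩ := T.isTrace_base H.isOpen hc
  obtain ⟨Λ', hΛ', hΛt'⟩ := T.isTrace_base H.isOpen hc'
  obtain ⟨m, _, hm⟩ := T.inter_zpow hab h
  rw [image_union] at hsub
  exact exists_crossSection_between H.isOpen H.sc (T.sides_zpow H hc a) (T.sides_zpow H hc' b) hsub
    (hΛt.image _ (zpow_image_eq T.inv a)) (hΛt'.image _ (zpow_image_eq T.inv b))
    ((inter_subset_inter (image_mono hΛ) (image_mono hΛ')).trans hm)

theorem exists_next {c : Set ℂ} (hc : IsBase U g c) (hcm : ∀ c', IsBase U g c' → ¬ c ⊆ R c') {k : ℕ} (hk : k ≤ N)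
    (hn : (⇑f)^[k] '' c ∉ maximalCuts (U ∩ orbitArc f N g) R) :
    ∃ c' d, IsBase U g c' ∧ (∃ j : ℤ, 0 ≤ j ∧ j ≤ N ∧ ⇑(f ^ j) '' c' ∈ maximalCuts (U ∩ orbitArc f N g) R) ∧
      d ≠ 0 ∧ |d| ≤ (N : ℤ) ∧ R c ∪ c ⊆ ⇑(f ^ d) '' R c' := by
  rw [← iterate_eq_pow, ← zpow_natCast] at hn
  have hk' : (k : ℤ) ≤ N := by exact_mod_cast hk
  have hcomp := T.comp_zpow H hc (Nat.cast_nonneg k) hk'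
  obtain ⟨τ, hτ, hsub⟩ := H.exists_maximal hcomp
  obtain ⟨j, hj, c', hc', rfl⟩ := T.exists_isBase_of_comp H.isOpen hτ.1
  rw [← iterate_eq_pow, ← zpow_natCast] at hτ hsub
  have hj' : (j : ℤ) ≤ N := by exact_mod_cast hj
  have hne : ⇑(f ^ (j : ℤ)) '' c' ≠ ⇑(f ^ (k : ℤ)) '' c := fun h => hn (h ▸ hτ)
  have hsub' : R (⇑(f ^ (k:ℤ)) '' c) ∪ ⇑(f ^ (k:ℤ)) '' c ⊆ R (⇑(f ^ (j:ℤ)) '' c') := by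
    obtain ⟨y, hy⟩ := hcomp.nonempty
    refine (H.subset_of_meet hτ hcomp (Set.not_disjoint_iff.2 ⟨y, hsub (Or.inr hy), Or.inr hy⟩)).resolve_left
      (Ne.symm hne)
  rw [T.right_zpow H hc (Nat.cast_nonneg k) hk', T.right_zpow H hc' (Nat.cast_nonneg j) hj', ← image_union] at hsub'
  have hd : R c ∪ c ⊆ ⇑(f ^ ((j:ℤ) - k)) '' R c' := by
    have := image_mono (f := ⇑(f ^ (-(k:ℤ)))) hsub'
    rw [← zpow_add_image, ← zpow_add_image, neg_add_cancel, zpow_zero] at this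
    rw [sub_eq_neg_add]
    exact (image_id (R c ∪ c)).symm.subset.trans this
  refine ⟨c', j - k, hc', ⟨j, Nat.cast_nonneg j, hj', hτ⟩, fun h0 => ?_, abs_le.2 ⟨by omega, by omega⟩, hd⟩
  rw [h0, zpow_zero] at hd
  exact hcm c' hc' (subset_union_right.trans (hd.trans (image_id (R c')).subset))

theorem base_maximal {c : Set ℂ} {j : ℤ} (h0 : 0 ≤ j) (hj : j ≤ N)
    (hm : ⇑(f ^ j) '' c ∈ maximalCuts (U ∩ orbitArc f N g) R) (c' : Set ℂ) (hc' : IsBase U g c') : ¬ c ⊆ R c' := by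
  intro h
  refine hm.2 _ (T.comp_zpow H hc' h0 hj) ?_
  rw [T.right_zpow H hc' h0 hj]
  exact image_mono h

end TransArc

namespace TransArc

variable {f : ℂ ≃ₜ ℂ} {U : Set ℂ} {N : ℕ} {g : ℝ → ℂ} (T : TransArc f U N g)
  {L R : Set ℂ → Set ℂ} (H : FreeFamily f U (U ∩ orbitArc f N g) L R)
include T H

theorem exists_chain (hY : (U ∩ orbitArc f N g).Nonempty)
    (hcon : ∀ c, IsBase U g c → ∃ k ≤ N, (⇑f)^[k] '' c ∉ maximalCuts (U ∩ orbitArc f N g) R) :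
    ∃ (σ : ℕ → Set ℂ) (s : ℕ → ℤ), s 0 = 0 ∧ (∀ n, IsBase U g (σ n)) ∧
      (∃ j : ℤ, 0 ≤ j ∧ j ≤ N ∧ ⇑(f ^ j) '' σ 0 ∈ maximalCuts (U ∩ orbitArc f N g) R) ∧
      Function.Injective s ∧ (∀ n, |s (n + 1) - s n| ≤ (N : ℤ)) ∧
      ∀ n m, n < m → ⇑(f ^ s n) '' (R (σ n) ∪ σ n) ⊆ ⇑(f ^ s m) '' R (σ m) := by
  let Q : Set ℂ → Prop := fun c => IsBase U g c ∧
    ∃ j : ℤ, 0 ≤ j ∧ j ≤ N ∧ ⇑(f ^ j) '' c ∈ maximalCuts (U ∩ orbitArc f N g) R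
  have hmax : ∀ c : {c // Q c}, ∀ c', IsBase U g c' → ¬ c.1 ⊆ R c' := by
    rintro ⟨c, hc, j, h0, hj, hm⟩
    exact T.base_maximal H h0 hj hm
  have next : ∀ c : {c // Q c}, ∃ (c' : {c // Q c}) (d : ℤ), d ≠ 0 ∧ |d| ≤ (N : ℤ) ∧
      R c.1 ∪ c.1 ⊆ ⇑(f ^ d) '' R c'.1 := by
    intro c
    obtain ⟨k, hk, hn⟩ := hcon c.1 c.2.1
    obtain ⟨c', d, h1, h2, h3⟩ := T.exists_next H c.2.1 (hmax c) hk hn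
    exact ⟨⟨c', h1, h2⟩, d, h3⟩
  choose F d hd0 hdN hdR using next
  obtain ⟨y, hy⟩ := hY
  obtain ⟨τ, hτ, -⟩ := H.exists_maximal (isCompOf_cc hy)
  obtain ⟨j, hj, c₀, hc₀, rfl⟩ := T.exists_isBase_of_comp H.isOpen hτ.1
  rw [← iterate_eq_pow, ← zpow_natCast] at hτ
  have hq₀ : Q c₀ := ⟨hc₀, j, Nat.cast_nonneg j, by exact_mod_cast hj, hτ⟩
  let σ : ℕ → {c // Q c} := fun n => F^[n] ⟨c₀, hq₀⟩
  have hσ : ∀ n, σ (n + 1) = F (σ n) := fun n => Function.iterate_succ_apply' F n _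
  let s : ℕ → ℤ := fun n => ∑ i ∈ Finset.range n, d (σ i)
  have hs : ∀ n, s (n + 1) = s n + d (σ n) := fun n => Finset.sum_range_succ _ n
  have hstep : ∀ n, ⇑(f ^ s n) '' (R (σ n).1 ∪ (σ n).1) ⊆ ⇑(f ^ s (n + 1)) '' R (σ (n + 1)).1 := fun n => by
    rw [hs, zpow_add_image, hσ]
    exact image_mono (hdR (σ n))
  have hlt : ∀ n m, n < m → ⇑(f ^ s n) '' (R (σ n).1 ∪ (σ n).1) ⊆ ⇑(f ^ s m) '' R (σ m).1 := fun n m h => by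
    induction m, h using Nat.le_induction with
    | base => exact hstep n
    | succ m _ ih => exact ih.trans ((image_mono subset_union_left).trans (hstep m))
  have hne : ∀ n m, n < m → s n ≠ s m := fun n m h he => by
    have := hlt n m h
    rw [he, image_subset_image_iff (f ^ s m).injective] at this
    grind
  refine ⟨fun n => (σ n).1, s, Finset.sum_range_zero _, fun n => (σ n).2.1, hq₀.2, fun n m h => ?_, fun n => ?_, hlt⟩
  · grind
  · rw [hs, add_sub_cancel_left]; exact hdN _

theorem exists_all_maximal (hY : (U ∩ orbitArc f N g).Nonempty) {V : Set ℂ}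
    (hV : ∀ σ, IsCompOf (U ∩ orbitArc f N g) σ → R σ ⊆ V)
    (nw : ∀ ε : ℤ, (ε = 1 ∨ ε = -1) → ∀ D, IsWanderingSection f U 1 D →
      ¬ ∀ k : ℤ, 0 ≤ k → ⇑(f ^ (ε * k)) '' D ⊆ V) :
    ∃ c, IsBase U g c ∧ ∀ k ≤ N, (⇑f)^[k] '' c ∈ maximalCuts (U ∩ orbitArc f N g) R := by
  classical
  by_contra hcon
  push Not at hcon
  obtain ⟨σ, s, hs0, hb, ⟨j, hj0, hjN, hjm⟩, hinj, hsN, hlt⟩ := T.exists_chain H hY hcon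
  have hcomp : ∀ n {l : ℤ}, 0 ≤ l → l ≤ N → IsCompOf (U ∩ orbitArc f N g) (⇑(f ^ l) '' σ n) :=
    fun n _ h0 hl => T.comp_zpow H (hb n) h0 hl
  have hright : ∀ n {l : ℤ}, 0 ≤ l → l ≤ N → R (⇑(f ^ l) '' σ n) = ⇑(f ^ l) '' R (σ n) :=
    fun n _ h0 hl => T.right_zpow H (hb n) h0 hl
  have hcov : ∀ {i n}, 0 < n → ⇑(f ^ i) '' (R (σ 0) ∪ σ 0) ⊆ ⇑(f ^ (i + s n)) '' R (σ n) := fun {i n} hn => by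
    have := image_mono (f := ⇑(f ^ i)) (hlt 0 n hn)
    rwa [hs0, ← zpow_add_image, ← zpow_add_image, add_zero] at this
  have hcov' : ∀ i n, ⇑(f ^ i) '' R (σ 0) ⊆ ⇑(f ^ (i + s n)) '' R (σ n) := fun i n => by
    rcases n.eq_zero_or_pos with rfl | hn
    · rw [hs0, add_zero]
    · grind
  have hE := hright 0 hj0 hjN
  set E := ⇑(f ^ j) '' R (σ 0) with hEdef
  obtain ⟨ε, hε, hc⟩ : ∃ ε : ℤ, (ε = 1 ∨ ε = -1) ∧ ∀ k : ℤ, 0 ≤ k → ∃ n, 0 ≤ j + ε * k + s n ∧ j + ε * k + s n ≤ N := by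
    rcases exists_cover_of_injective (t := fun n => - s n) (N := N) (neg_injective.comp hinj) (by simp [hs0])
        (fun n => by rw [neg_sub_neg, abs_sub_comm]; exact hsN n) with h | h
    · refine ⟨1, Or.inl rfl, fun k hk => ?_⟩
      obtain ⟨n, h1, h2⟩ := h (j + 1 * k) (by omega)
      exact ⟨n, by omega, by omega⟩
    · refine ⟨-1, Or.inr rfl, fun k hk => ?_⟩
      obtain ⟨n, h1, h2⟩ := h (j + -1 * k) (by omega)
      exact ⟨n, by omega, by omega⟩
  have himg : ∀ k : ℤ, ⇑(f ^ (ε * k)) '' E = ⇑(f ^ (j + ε * k)) '' R (σ 0) := fun k => by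
    rw [hEdef, ← zpow_add_image, add_comm]
  have hnw : ∀ D, IsCrossSection U D → D ⊆ E → ¬ ∀ k : ℕ, 1 ≤ k → ⇑((f ^ ε) ^ k) '' D ∩ D = ∅ := by
    intro D hD hDE hdis
    refine nw ε hε D ⟨hD, iterZ_disjoint_of_pow hε hdis⟩ fun k hk => ?_
    obtain ⟨n, h1, h2⟩ := hc k hk
    refine (image_mono hDE).trans ?_
    rw [himg]
    refine (hcov' _ n).trans ?_
    grind
  have hpow : ∀ k : ℕ, ⇑((f ^ ε) ^ k) '' E = ⇑(f ^ (j + ε * k)) '' R (σ 0) := fun k => by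
    rw [← himg, zpow_mul, zpow_natCast]
  have hex : ∃ k : ℕ, 1 ≤ k ∧ (⇑((f ^ ε) ^ k) '' E ∩ E).Nonempty := by
    by_contra hno
    push Not at hno
    have hS := T.sides_zpow H (hb 0) j
    exact hnw E ⟨_, hS.cut, hS.two.2.1⟩ Subset.rfl hno
  obtain ⟨hk1, hkE⟩ := Nat.find_spec hex
  have hmin : ∀ r, 1 ≤ r → r < Nat.find hex → ⇑((f ^ ε) ^ r) '' E ∩ E = ∅ := fun r h1 hr =>
    not_nonempty_iff_eq_empty.1 fun h => Nat.find_min hex hr ⟨h1, h⟩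
  generalize Nat.find hex = k₀ at hk1 hkE hmin
  obtain ⟨n, hn0, hnN⟩ := hc k₀ (Nat.cast_nonneg _)
  have hεk : ε * k₀ ≠ 0 := by
    rcases hε with rfl | rfl <;> omega
  -- the component of the orbit covering the return is the base one or lies behind it
  have hret : ⇑(f ^ (j + ε * k₀ + s n)) '' σ n = ⇑(f ^ j) '' σ 0 ∨
      ⇑(f ^ (j + ε * k₀ + s n)) '' (R (σ n) ∪ σ n) ⊆ E := by
    obtain ⟨y, hy, hyE⟩ := hkE
    rw [hpow] at hy
    rw [image_union, ← hright n hn0 hnN, ← hE]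
    refine H.subset_of_meet hjm (hcomp n hn0 hnN) (Set.not_disjoint_iff.2 ⟨y, Or.inl ?_, Or.inl ?_⟩)
    · rw [hE]; exact hyE
    · rw [hright n hn0 hnN]; exact hcov' _ n hy
  have hretE : ⇑(f ^ (j + ε * k₀ + s n)) '' R (σ n) ⊆ E := by
    rcases hret with h | h
    · rw [← hright n hn0 hnN, h, hE]
    · exact (image_mono subset_union_left).trans h
  have hGE : ⇑((f ^ ε) ^ k₀) '' E ⊆ E := by
    rw [hpow]; exact (hcov' _ n).trans hretE
  obtain ⟨D, hD, hDE, hDG⟩ : ∃ D, IsCrossSection U D ∧ D ⊆ E ∧ Disjoint D (⇑((f ^ ε) ^ k₀) '' E) := by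
    rw [hpow]
    rcases n.eq_zero_or_pos with rfl | hn
    · rw [hs0, add_zero] at hret hn0 hnN
      obtain ⟨y, hy⟩ := (hcomp 0 hj0 hjN).nonempty
      have hne : ⇑(f ^ (j + ε * k₀)) '' σ 0 ≠ ⇑(f ^ j) '' σ 0 := fun h => by
        obtain ⟨m, hm, hsub⟩ := T.inter_zpow (a := j + ε * k₀) (b := j) (by omega)
          (abs_le.2 ⟨by omega, by omega⟩)
        have hbs := (base_subset (hb 0)).1
        have := hsub ⟨image_mono hbs (h.symm.subset hy), image_mono hbs hy⟩
        exact hm (this ▸ H.sub ((hcomp 0 hj0 hjN).subset hy))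
      obtain ⟨D, hD, hsub⟩ := T.exists_between H (hb 0) (hb 0) (a := j + ε * k₀) (b := j) (by omega)
        (abs_le.2 ⟨by omega, by omega⟩) (hret.resolve_left hne)
      exact ⟨D, hD, fun z hz => (hsub hz).1, Set.disjoint_left.2 fun z hz => (hsub hz).2⟩
    · have h1 : ⇑(f ^ (j + ε * k₀ + s 1)) '' R (σ 1) ⊆ E := by
        refine Subset.trans ?_ hretE
        rcases (show 1 ≤ n from hn).eq_or_lt with rfl | h1
        · rfl
        · have := image_mono (f := ⇑(f ^ (j + ε * k₀))) (hlt 1 n h1)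
          rw [← zpow_add_image, ← zpow_add_image] at this
          exact (image_mono subset_union_left).trans this
      have hs1 : s 1 ≠ 0 := fun h => one_ne_zero (hinj (h.trans hs0.symm))
      have hsN1 := hsN 0
      rw [zero_add, hs0, sub_zero] at hsN1
      obtain ⟨D, hD, hsub⟩ := T.exists_between H (hb 0) (hb 1) (a := j + ε * k₀) (b := j + ε * k₀ + s 1) (by omega)
        (by rwa [add_sub_cancel_left]) (hcov one_pos)
      exact ⟨D, hD, fun z hz => h1 (hsub hz).1, Set.disjoint_left.2 fun z hz => (hsub hz).2⟩
  exact hnw D hD hDE fun k hk => pow_image_disjoint_of_trap hk1 hmin hGE hDE hDG k hk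

end TransArc

/-- The union of the first `N` iterates of `γ`. -/
def orbitSet (f : X ≃ₜ X) (N : ℕ) (γ : Set X) : Set X := ⋃ k ∈ Iic N, (⇑f)^[k] '' γ

/-- The conclusions of the maximal cross-cut lemma. -/
structure IsMaximalCore (f : X ≃ₜ X) (U γ : Set X) (N : ℕ) (U₀ : Set X) (F : Set (Set X)) : Prop where
  cuts : ∀ σ, IsCompOf (U ∩ orbitSet f N γ) σ → IsCrossCut U σ ∧ f '' σ ∩ σ = ∅ ∧
    ∃! D, IsCompOf (U \ σ) D ∧ f '' D ∩ D = ∅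
  comp : IsCompOf (U \ orbitSet f N γ) U₀
  meet : (f '' U₀ ∩ U₀).Nonempty
  unique : ∀ W, IsCompOf (U \ orbitSet f N γ) W → (f '' W ∩ W).Nonempty → W = U₀
  isOpen : IsOpen U₀
  sc : IsSimplyConnected U₀
  diff : U \ U₀ = {y | ∃ σ, IsCompOf (U ∩ orbitSet f N γ) σ ∧
    (y ∈ σ ∨ ∃ D, IsCompOf (U \ σ) D ∧ f '' D ∩ D = ∅ ∧ y ∈ D)}
  family : ∀ σ ∈ F, IsCompOf (U ∩ orbitSet f N γ) σ
  bd : bdIn U U₀ = ⋃₀ F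
  accessible : ∀ y ∈ bdIn U U₀, ∃ η : ℝ → X, IsEndCut U₀ η ∧ Tendsto η (𝓝[<] (1:ℝ)) (𝓝 y)
  orbit : ∀ V, IsOpen V → frontier U ⊆ V → orbitSet f N γ ⊆ V → IsConnected (U \ V) →
    (f '' (U \ V) ∩ (U \ V)).Nonempty →
    (¬∃ D, IsWanderingSection f U 1 D ∧ ∀ k : ℤ, 0 ≤ k → iterZ f k D ⊆ V) →
    (¬∃ D, IsWanderingSection f U 1 D ∧ ∀ k : ℤ, k ≤ 0 → iterZ f k D ⊆ V) →
    ∃ σ ⊆ γ, ∀ k ≤ N, (⇑f)^[k] '' σ ∈ F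

theorem exists_isMaximalCore {f : ℂ ≃ₜ ℂ} {U : Set ℂ} (hUo : IsOpen U) (hfU : f '' U = U)
    (hUs : IsSimplyConnected U) (hU : U ≠ univ) (hf : NoFixedPrimeEnd f U) {N : ℕ} (hN : 2 ≤ N) {γ : Set ℂ}
    {x : ℂ} (hγ : IsNTranslationArc f N γ x) (hx : x ∈ frontier U) (hfx : f x ∈ frontier U)
    (hγU : (γ ∩ U).Nonempty) : ∃ U₀ F, IsMaximalCore f U γ N U₀ F := by
  obtain ⟨g, T, rfl⟩ := hγ.exists_transArc hUo hN hfU hx hfx hγU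
  obtain ⟨L, R, H⟩ := T.exists_freeFamily hUo hUs hU hf
  obtain ⟨c, hc⟩ := T.exists_isBase hUo
  have hY : (U ∩ orbitArc f N g).Nonempty := (T.comp_base H hc).nonempty.mono (T.comp_base H hc).subset
  have hdiff : U \ (U ∩ orbitArc f N g) = U \ orbitArc f N g := sdiff_self_inter
  refine ⟨coreSet U (U ∩ orbitArc f N g) R, maximalCuts (U ∩ orbitArc f N g) R, ?_⟩
  refine ⟨fun σ hσ => ?_, ?_, H.image_core_meet hY, fun W hW hfW => ?_, H.isOpen_core, H.isSimplyConnected_core hY, ?_,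
    fun σ hσ => hσ.1, H.bdIn_core, fun y => H.exists_isEndCut, ?_⟩
  · have hS := H.sides σ hσ
    refine ⟨hS.cut, ?_, hS.existsUnique⟩
    exact subset_empty_iff.1 ((inter_subset_inter (image_mono subset_union_right) subset_union_right).trans
      hS.image_disjoint.subset)
  · exact hdiff ▸ H.isCompOf_core hY
  · exact H.eq_core (hdiff.symm ▸ hW) hfW hY
  · ext y
    constructor
    · rintro ⟨hy, hn⟩
      obtain ⟨σ, hσ, h | h⟩ := H.exists_of_notMem_core hy hn
      · have hS := H.sides σ hσ.1
        exact ⟨σ, hσ.1, Or.inr ⟨R σ, hS.two.2.1, hS.image_right_disjoint, h⟩⟩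
      · exact ⟨σ, hσ.1, Or.inl h⟩
    · rintro ⟨σ, hσ, h | ⟨D, hD, hfD, h⟩⟩
      · exact ⟨(hσ.subset h).1, fun hc => hc.2 σ hσ (Or.inr h)⟩
      · exact ⟨(hD.subset h).1, fun hc => hc.2 σ hσ (Or.inl ((H.sides σ hσ).eq_right hD hfD ▸ h))⟩
  · intro V _ _ hΓV hcon hmeet hpos hneg
    have hcore : U \ V ⊆ coreSet U (U ∩ orbitArc f N g) R :=
      H.subset_core hcon.isPreconnected (fun y hy => ⟨hy.1, fun h => hy.2 (hΓV h.2)⟩) hmeet hY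
    have nw : ∀ ε : ℤ, (ε = 1 ∨ ε = -1) → ∀ D, IsWanderingSection f U 1 D →
        ¬ ∀ k : ℤ, 0 ≤ k → ⇑(f ^ (ε * k)) '' D ⊆ V := by
      rintro ε (rfl | rfl) D hD h
      · exact hpos ⟨D, hD, fun k hk => by rw [iterZ_eq, ← one_mul k]; exact h k hk⟩
      · refine hneg ⟨D, hD, fun k hk => ?_⟩
        have := h (-k) (by omega)
        rwa [neg_one_mul, neg_neg, ← iterZ_eq] at this
    obtain ⟨c, hc, h⟩ := T.exists_all_maximal H hY (fun σ hσ => H.right_subset_of_disjoint hσ hcore) nw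
    exact ⟨c, (TransArc.base_subset hc).1, h⟩

section Transport

variable {Y : Type u} [TopologicalSpace Y] (e : X ≃ₜ Y) (f : X ≃ₜ X)

/-- The homeomorphism conjugate to `f` under `e`. -/
def conjHomeo : Y ≃ₜ Y := (e.symm.trans f).trans e

theorem conjHomeo_apply (z : X) : conjHomeo e f (e z) = e (f z) := by
  simp [conjHomeo]

theorem conjHomeo_symm : conjHomeo e.symm (conjHomeo e f) = f := by
  ext z
  simp [conjHomeo]

theorem conjHomeo_image (A : Set X) : conjHomeo e f '' (e '' A) = e '' (f '' A) := by
  simp only [image_image, conjHomeo_apply]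

theorem conjHomeo_pow (k : ℕ) : conjHomeo e f ^ k = conjHomeo e (f ^ k) := by
  induction k with
  | zero => ext z; simp [conjHomeo]
  | succ k ih =>
    ext z
    obtain ⟨z, rfl⟩ := e.surjective z
    rw [pow_succ, ih, conjHomeo_apply, pow_succ, Homeomorph.mul_apply, conjHomeo_apply,
      conjHomeo_apply, Homeomorph.mul_apply]

theorem conjHomeo_zpow (k : ℤ) : conjHomeo e f ^ k = conjHomeo e (f ^ k) := by
  cases k with
  | ofNat n => exact (zpow_natCast _ n).trans ((conjHomeo_pow e f n).trans (by rw [← zpow_natCast]; rfl))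
  | negSucc n => rw [zpow_negSucc, zpow_negSucc, conjHomeo_pow]; rfl

theorem iterate_conjHomeo_apply (k : ℕ) (z : X) : (⇑(conjHomeo e f))^[k] (e z) = e ((⇑f)^[k] z) := by
  rw [← iterate_eq_pow, ← iterate_eq_pow, conjHomeo_pow, conjHomeo_apply]

theorem iterate_conjHomeo_image (k : ℕ) (A : Set X) :
    (⇑(conjHomeo e f))^[k] '' (e '' A) = e '' ((⇑f)^[k] '' A) := by
  simp only [image_image, iterate_conjHomeo_apply]

theorem iterZ_conjHomeo (k : ℤ) (A : Set X) : iterZ (conjHomeo e f) k (e '' A) = e '' iterZ f k A := by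
  rw [iterZ_eq, iterZ_eq, conjHomeo_zpow, conjHomeo_image]

theorem orbitSet_conjHomeo (N : ℕ) (γ : Set X) : orbitSet (conjHomeo e f) N (e '' γ) = e '' orbitSet f N γ := by
  simp only [orbitSet, image_iUnion, iterate_conjHomeo_image]

variable {f}

theorem isWanderingSection_image {U D : Set X} {n : ℕ} (h : IsWanderingSection f U n D) :
    IsWanderingSection (conjHomeo e f) (e '' U) n (e '' D) :=
  ⟨h.1.image e, fun k hk => by rw [iterZ_conjHomeo, ← image_inter e.injective, h.2 k hk, image_empty]⟩

theorem IsEndCut.image {U : Set X} {η : ℝ → X} (h : IsEndCut U η) : IsEndCut (e '' U) (e ∘ η) :=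
  ⟨e.continuous.comp_continuousOn h.1, e.injective.comp_injOn h.2.1,
    fun t ht => mem_image_of_mem e (h.2.2.1 t ht),
    h.2.2.2.imp' e fun z hz => (e.continuous.tendsto z).comp hz⟩

theorem IsNTranslationArc.image {N : ℕ} {γ : Set X} {x : X} (h : IsNTranslationArc f N γ x) :
    IsNTranslationArc (conjHomeo e f) N (e '' γ) (e x) := by
  obtain ⟨⟨hne, g, hg, hi, h0, h1, rfl, htr⟩, hN⟩ := h
  refine ⟨⟨?_, e ∘ g, e.continuous.comp_continuousOn hg, e.injective.comp_injOn hi, congrArg e h0, ?_,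
    (image_comp _ _ _).symm, ?_⟩, fun h2 => ⟨fun k hk hk' => ?_, ?_⟩⟩
  · rwa [conjHomeo_apply, e.injective.ne_iff]
  · rw [conjHomeo_apply, ← h1]; rfl
  · simp only [conjHomeo_apply, conjHomeo_image, ← image_inter e.injective]
    refine htr.imp (fun h => by rw [h, image_singleton]) fun h => ⟨by rw [h.1, image_pair], congrArg e h.2⟩
  · rw [iterate_conjHomeo_image, ← image_inter e.injective, (hN h2).1 k hk hk', image_empty]
  · rw [iterate_conjHomeo_image, ← image_inter e.injective, iterate_conjHomeo_apply]
    exact (hN h2).2.imp (fun h => by rw [h, image_empty]) fun h => ⟨by rw [h.1, image_singleton], congrArg e h.2⟩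

theorem image_inter_eq_empty_iff {D : Set X} : conjHomeo e f '' (e '' D) ∩ e '' D = ∅ ↔ f '' D ∩ D = ∅ := by
  rw [conjHomeo_image, ← image_inter e.injective, image_eq_empty]

theorem image_inter_nonempty_iff {D : Set X} :
    (conjHomeo e f '' (e '' D) ∩ e '' D).Nonempty ↔ (f '' D ∩ D).Nonempty := by
  rw [conjHomeo_image, ← image_inter e.injective, image_nonempty]

theorem isCompOf_diff_image_iff {U σ D : Set X} : IsCompOf (e '' U \ e '' σ) (e '' D) ↔ IsCompOf (U \ σ) D := by
  rw [← image_sdiff e.injective, isCompOf_image_iff]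

theorem isCompOf_inter_image_iff {U σ D : Set X} : IsCompOf (e '' U ∩ e '' σ) (e '' D) ↔ IsCompOf (U ∩ σ) D := by
  rw [← image_inter e.injective, isCompOf_image_iff]

theorem IsMaximalCore.image {U γ U₀ : Set X} {N : ℕ} {F : Set (Set X)} (h : IsMaximalCore f U γ N U₀ F) :
    IsMaximalCore (conjHomeo e f) (e '' U) (e '' γ) N (e '' U₀) (image e '' F) := by
  have surj : ∀ S : Set Y, ∃ S₀ : Set X, e '' S₀ = S := image_surjective.2 e.surjective
  refine ⟨?_, ?_, ?_, ?_, ?_, ?_, ?_, ?_, ?_, ?_, ?_⟩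
  · intro σ hσ
    obtain ⟨σ, rfl⟩ := surj σ
    rw [orbitSet_conjHomeo, isCompOf_inter_image_iff] at hσ
    obtain ⟨h1, h2, D, hD, huD⟩ := h.cuts σ hσ
    refine ⟨h1.image e, (image_inter_eq_empty_iff e).2 h2, e '' D,
      ⟨(isCompOf_diff_image_iff e).2 hD.1, (image_inter_eq_empty_iff e).2 hD.2⟩, fun D' hD' => ?_⟩
    obtain ⟨D', rfl⟩ := surj D'
    rw [huD D' ⟨(isCompOf_diff_image_iff e).1 hD'.1, (image_inter_eq_empty_iff e).1 hD'.2⟩]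
  · rw [orbitSet_conjHomeo, isCompOf_diff_image_iff]; exact h.comp
  · exact (image_inter_nonempty_iff e).2 h.meet
  · intro W hW hfW
    obtain ⟨W, rfl⟩ := surj W
    rw [orbitSet_conjHomeo, isCompOf_diff_image_iff] at hW
    rw [h.unique W hW ((image_inter_nonempty_iff e).1 hfW)]
  · exact e.isOpenMap _ h.isOpen
  · exact e.isSimplyConnected_image.2 h.sc
  · rw [← image_sdiff e.injective, h.diff, orbitSet_conjHomeo]
    ext y
    constructor
    · rintro ⟨y, ⟨σ, hσ, hy⟩, rfl⟩
      exact ⟨e '' σ, (isCompOf_inter_image_iff e).2 hσ, hy.imp (mem_image_of_mem e) fun ⟨D, h1, h2, h3⟩ =>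
        ⟨e '' D, (isCompOf_diff_image_iff e).2 h1, (image_inter_eq_empty_iff e).2 h2, mem_image_of_mem e h3⟩⟩
    · rintro ⟨σ, hσ, hy⟩
      obtain ⟨σ, rfl⟩ := surj σ
      obtain ⟨y, rfl⟩ := e.surjective y
      refine mem_image_of_mem e ⟨σ, (isCompOf_inter_image_iff e).1 hσ, hy.imp e.injective.mem_set_image.1 ?_⟩
      rintro ⟨D, h1, h2, h3⟩
      obtain ⟨D, rfl⟩ := surj D
      exact ⟨D, (isCompOf_diff_image_iff e).1 h1, (image_inter_eq_empty_iff e).1 h2, e.injective.mem_set_image.1 h3⟩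
  · rintro _ ⟨σ, hσ, rfl⟩
    rw [orbitSet_conjHomeo, isCompOf_inter_image_iff]
    exact h.family σ hσ
  · rw [bdIn_image, h.bd, sUnion_eq_biUnion, image_iUnion₂, sUnion_eq_biUnion, biUnion_image]
  · rw [bdIn_image]
    rintro _ ⟨y, hy, rfl⟩
    obtain ⟨η, hη, hlim⟩ := h.accessible y hy
    exact ⟨e ∘ η, hη.image e, (e.continuous.tendsto y).comp hlim⟩
  · intro V hV hUV hΓ hcon hmeet hpos hneg
    obtain ⟨V, rfl⟩ := surj V
    rw [orbitSet_conjHomeo, image_subset_image_iff e.injective] at hΓ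
    rw [← image_sdiff e.injective] at hcon hmeet
    rw [← e.image_frontier, image_subset_image_iff e.injective] at hUV
    obtain ⟨σ, hσ, hF⟩ := h.orbit V (e.isOpen_image.1 hV) hUV hΓ (e.isConnected_image.1 hcon)
      ((image_inter_nonempty_iff e).1 hmeet)
      (fun ⟨D, hD, hDV⟩ => hpos ⟨e '' D, isWanderingSection_image e hD, fun k hk => by
        rw [iterZ_conjHomeo]; exact image_mono (hDV k hk)⟩)
      (fun ⟨D, hD, hDV⟩ => hneg ⟨e '' D, isWanderingSection_image e hD, fun k hk => by
        rw [iterZ_conjHomeo]; exact image_mono (hDV k hk)⟩)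
    refine ⟨e '' σ, image_mono hσ, fun k hk => ?_⟩
    rw [iterate_conjHomeo_image]
    exact mem_image_of_mem _ (hF k hk)

end Transport

theorem exists_isMaximalCore_of_homeomorph {X : Type} [TopologicalSpace X] (e : X ≃ₜ ℂ) {f : X ≃ₜ X} {U : Set X} (hUo : IsOpen U)
    (hfU : f '' U = U) (hUs : IsSimplyConnected U) (hU : U ≠ univ) (hf : NoFixedPrimeEnd f U) {N : ℕ}
    (hN : 2 ≤ N) {γ : Set X} {x : X} (hγ : IsNTranslationArc f N γ x) (hx : x ∈ frontier U)
    (hfx : f x ∈ frontier U) (hγU : (γ ∩ U).Nonempty) : ∃ U₀ F, IsMaximalCore f U γ N U₀ F := by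
  obtain ⟨U₀, F, h⟩ := exists_isMaximalCore (f := conjHomeo e f) (U := e '' U) (γ := e '' γ) (x := e x)
    (e.isOpenMap _ hUo) (by rw [conjHomeo_image, hfU]) (e.isSimplyConnected_image.2 hUs)
    (fun h => hU (e.injective.image_injective (h.trans (image_univ_of_surjective e.surjective).symm)))
    (hf.image e) hN (hγ.image e) (e.image_frontier U ▸ mem_image_of_mem e hx)
    (by rw [conjHomeo_apply, ← e.image_frontier]; exact mem_image_of_mem e hfx)
    (by rw [← image_inter e.injective]; exact hγU.image e)
  have := h.image e.symm
  rw [conjHomeo_symm, e.symm_image_image', e.symm_image_image'] at this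
  exact ⟨_, _, this⟩

/-- The maximal cross-cut lemma in the plane. -/
theorem maximal_crosscut_lemma
    (f : (ℝ × ℝ) ≃ₜ (ℝ × ℝ))
    (U : Set (ℝ × ℝ)) (hUopen : IsOpen U) (hUinv : ⇑f '' U = U)
    (hUsc : SimplyConnectedSpace ↥U) (hUcompl : Set.Nontrivial Uᶜ)
    (hrot : ∃ F : PrimeEndComp U ≃ₜ PrimeEndComp U, IsPEExtension f U F ∧
      ∀ p : PrimeEnd U, F (peEnd U p) ≠ peEnd U p)
    (N : ℕ) (hN : 2 ≤ N)
    (γ : Set (ℝ × ℝ)) (x : ℝ × ℝ) (harc : IsNTranslationArc f N γ x)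
    (hx : x ∈ frontier U) (hfx : f x ∈ frontier U) (hγU : (γ ∩ U).Nonempty) :
    ∀ Γ : Set (ℝ × ℝ), Γ = (⋃ k ∈ Set.Iic N, (⇑f)^[k] '' γ) →
      -- (1)
      (∀ σ : Set (ℝ × ℝ), IsCompOf (U ∩ Γ) σ →
          IsCrossCut U σ ∧ ⇑f '' σ ∩ σ = ∅ ∧
            ∃! D : Set (ℝ × ℝ), IsCompOf (U \ σ) D ∧ ⇑f '' D ∩ D = ∅) ∧
      -- (2),(3),(4)
      ∃ U₀ : Set (ℝ × ℝ),
        (IsCompOf (U \ Γ) U₀ ∧ (⇑f '' U₀ ∩ U₀).Nonempty) ∧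
        (∀ W : Set (ℝ × ℝ), IsCompOf (U \ Γ) W → (⇑f '' W ∩ W).Nonempty → W = U₀) ∧
        IsOpen U₀ ∧ SimplyConnectedSpace ↥U₀ ∧
        U \ U₀ = {y | ∃ σ : Set (ℝ × ℝ), IsCompOf (U ∩ Γ) σ ∧
          (y ∈ σ ∨ ∃ D : Set (ℝ × ℝ), IsCompOf (U \ σ) D ∧ ⇑f '' D ∩ D = ∅ ∧ y ∈ D)} ∧
        ∃ Fstar : Set (Set (ℝ × ℝ)),
          (∀ σ ∈ Fstar, IsCompOf (U ∩ Γ) σ) ∧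
          bdIn U U₀ = ⋃₀ Fstar ∧
          (∀ y ∈ bdIn U U₀,
            ∃ η : ℝ → ℝ × ℝ, IsEndCut U₀ η ∧ Tendsto η (𝓝[<] (1:ℝ)) (𝓝 y)) ∧
          (∀ V : Set (ℝ × ℝ), IsOpen V → frontier U ⊆ V → Γ ⊆ V →
            IsConnected (U \ V) → (⇑f '' (U \ V) ∩ (U \ V)).Nonempty →
            (¬∃ D : Set (ℝ × ℝ), IsWanderingSection f U 1 D ∧
              ∀ k : ℤ, 0 ≤ k → iterZ f k D ⊆ V) →
            (¬∃ D : Set (ℝ × ℝ), IsWanderingSection f U 1 D ∧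
              ∀ k : ℤ, k ≤ 0 → iterZ f k D ⊆ V) →
            ∃ σ : Set (ℝ × ℝ), σ ⊆ γ ∧ ∀ k : ℕ, k ≤ N → (⇑f)^[k] '' σ ∈ Fstar) := by
  intro Γ hΓ
  subst hΓ
  obtain ⟨F, hF, hfix⟩ := hrot
  obtain ⟨U₀, Fstar, h⟩ := exists_isMaximalCore_of_homeomorph Complex.equivRealProdCLM.symm.toHomeomorph
    hUopen hUinv hUsc (nonempty_compl.1 hUcompl.nonempty) (noFixedPrimeEnd_of_extension hUinv hF hfix)
    hN harc hx hfx hγU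
  exact ⟨h.cuts, U₀, ⟨h.comp, h.meet⟩, h.unique, h.isOpen, h.sc, h.diff, Fstar, h.family, h.bd,
    h.accessible, h.orbit⟩

end
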